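/- Let k be a field and grade K̄_m^n = kQ̄_m^n / Ī_m^n by path length, with (K̄_m^n)_i the image of the span of the length-i paths. For all weights λ, μ of type (m,n): e_λ (K̄_m^n)_i e_μ = 0 whenever i > |λ| + |μ|, and e_λ (K̄_m^n)_i e_μ is one-dimensional when i = |λ| + |μ|. In particular (K̄_m^n)_i = 0 for i > 2mn, and (K̄_m^n)_{2mn} is one-dimensional. -/

import Mathlib

open scoped Classical

namespace Kh

abbrev Wt (N : ℕ) := Fin N → Bool

variable {N : ℕ}

/-- A weight of type `(m,n)`: `m` downs (`true`) and `n` ups (`false`). -/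
def IsWeight (m n : ℕ) (l : Wt N) : Prop :=
  {i : Fin N | l i = true}.ncard = m ∧ {i : Fin N | l i = false}.ncard = n

/-- The height of a weight: sum over downs of the number of ups to the left. -/
noncomputable def height (l : Wt N) : ℕ :=
  ∑ i : Fin N, if l i = true then {j : Fin N | j < i ∧ l j = false}.ncard else 0

/-- Number of positions `t` with `i < t ≤ j` and value `b`. -/
noncomputable def cnt (l : Wt N) (b : Bool) (i j : Fin N) : ℕ :=
  {t : Fin N | i < t ∧ t ≤ j ∧ l t = b}.ncard

/-- `(i,j)` is a matched pair ("circle") of the standard non-crossing bracket matching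
of `l` (reading `true` = ↓ as an opening bracket and `false` = ↑ as a closing bracket):
`l i = ↓`, `l j = ↑`, the segment strictly between `i` and `j` is balanced and every
prefix of it has at least as many ↓'s as ↑'s. -/
def IsCircle (l : Wt N) (i j : Fin N) : Prop :=
  i < j ∧ l i = true ∧ l j = false ∧
    cnt l true i j + 1 = cnt l false i j ∧
    ∀ k : Fin N, i < k → k < j → cnt l false i k ≤ cnt l true i k

/-- `s_C(λ)`: exchange the values of `l` at the two positions of the circle `C = (i,j)`. -/
def swapC (l : Wt N) (i j : Fin N) : Wt N :=
  fun t => if t = i then l j else if t = j then l i else l t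

/-- The circle `(i,j)` encloses the circle `(i',j')`. -/
def Encloses (i j i' j' : Fin N) : Prop := i < i' ∧ j' < j

/-- The circle `(i,j)` lies to the left of the circle `(i',j')`. -/
def LeftOf (i j i' j' : Fin N) : Prop := j < i'

/-- The position `p` is unmatched in `l`. -/
def Unmatched (l : Wt N) (p : Fin N) : Prop :=
  ∀ q : Fin N, ¬ IsCircle l p q ∧ ¬ IsCircle l q p

/-- `def(λ)`: the number of circles of `l`. -/
noncomputable def defect (l : Wt N) : ℕ :=
  {p : Fin N × Fin N | IsCircle l p.1 p.2}.ncard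

/-- One step up in the graph `Γ_m^n`: `m' = s_C(l)` for some circle `C` of `l`. -/
def GammaStep (l m' : Wt N) : Prop :=
  ∃ i j : Fin N, IsCircle l i j ∧ m' = swapC l i j

/-- Adjacency in the graph `Γ_m^n`. -/
def GammaAdj (l m' : Wt N) : Prop := GammaStep l m' ∨ GammaStep m' l

/-- The order embedding `Fin N → Fin (N+2)` skipping the two positions `i`, `i+1`;
composing a weight with it deletes these two positions. -/
def skip2 (i : ℕ) {N : ℕ} (t : Fin N) : Fin (N + 2) :=
  if (t : ℕ) < i then Fin.castLE (Nat.le_add_right N 2) t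
  else ⟨(t : ℕ) + 2, Nat.add_lt_add_right t.isLt 2⟩

end Kh

namespace Kh

variable {N : ℕ}

/-- Type (I) elements of `S_m^n`: an ascending arrow into a vertex followed by a
descending arrow out of it (as vertex lists of the corresponding paths in `Q̄_m^n`). -/
def SType1 (p : List (Wt N)) : Prop :=
  ∃ x y z : Wt N, p = [x, y, z] ∧ GammaStep x y ∧ GammaStep z y

/-- Ascending type (II) elements of `S_m^n`: `ȳ_λ^ν ȳ_ν^μ` with `ν = s_C(λ)`,
`μ = s_{C'}(ν)`, where `C'` is a circle of `λ` enclosed in `C` or lying to the right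
of `C`. -/
def SType2Asc (p : List (Wt N)) : Prop :=
  ∃ (la : Wt N) (i j i' j' : Fin N),
    IsCircle la i j ∧ IsCircle la i' j' ∧
    (Encloses i j i' j' ∨ LeftOf i j i' j') ∧
    IsCircle (swapC la i j) i' j' ∧
    p = [la, swapC la i j, swapC (swapC la i j) i' j']

/-- Ascending type (III) elements of `S_m^n` (length `k ≥ 3`), written with 0-based
vertices `v 0, …, v k` (so `λ_t = v (t-1)`) and 1-based circles `C_i = (a i, b i)`. -/
def SType3Asc (p : List (Wt N)) : Prop :=
  ∃ (k : ℕ) (v : ℕ → Wt N) (a b : ℕ → Fin N),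
    3 ≤ k ∧
    p = List.ofFn (fun t : Fin (k + 1) => v t.val) ∧
    (∀ i, 1 ≤ i → i ≤ k →
      IsCircle (v (i - 1)) (a i) (b i) ∧ v i = swapC (v (i - 1)) (a i) (b i)) ∧
    (∀ i, 2 ≤ i → i ≤ k - 1 → ¬ IsCircle (v (i - 2)) (a i) (b i)) ∧
    (∀ j, 1 ≤ j → j ≤ k → IsCircle (v (j - 1)) (a k) (b k)) ∧
    Encloses (a 1) (b 1) (a k) (b k) ∧
    (∀ i, 2 ≤ i → i ≤ k - 1 → LeftOf (a k) (b k) (a i) (b i))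

/-- Membership in the reduction set `S_m^n` (vertex-list model: the descending
elements are the reverses of the ascending ones). -/
def InS (p : List (Wt N)) : Prop :=
  SType1 p ∨ SType2Asc p ∨ SType2Asc p.reverse ∨ SType3Asc p ∨ SType3Asc p.reverse

/-- A path in `Q̄_m^n` (given by its vertex list) is irreducible if no contiguous
subpath of it belongs to `S_m^n`. -/
def Irreducible (p : List (Wt N)) : Prop :=
  ∀ s, s <:+: p → ¬ InS s

/-- The number of ascending irreducible paths of length `k` from `la` to `mu`. -/
noncomputable def ascCount (k : ℕ) (la mu : Wt N) : ℕ :=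
  {p : List (Wt N) | p.length = k + 1 ∧ p.head? = some la ∧ p.getLast? = some mu ∧
    p.Chain' GammaStep ∧ Irreducible p}.ncard

/-- The total number of irreducible paths from `la` to `mu`. -/
noncomputable def irrCount (la mu : Wt N) : ℕ :=
  {p : List (Wt N) | p ≠ [] ∧ p.head? = some la ∧ p.getLast? = some mu ∧
    p.Chain' GammaAdj ∧ Irreducible p}.ncard

end Kh

namespace Kh

/-- The vertex set of `Q̄_m^n`: weights of type `(m,n)`. -/
def V (m n N : ℕ) := {l : Wt N // IsWeight m n l}

/-- The arrow set of `Q̄_m^n`: for adjacent weights there is one arrow in each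
direction (the ascending arrow `ȳ` and the descending arrow `x̄`); an arrow is an
ordered adjacent pair (source, target). -/
def E (m n N : ℕ) := {p : V m n N × V m n N // GammaAdj p.1.1 p.2.1}

/-- The free algebra on the vertices and arrows of `Q̄_m^n`; the path algebra
`kQ̄_m^n` is its quotient by the path-algebra relations `PARel`. -/
abbrev FA (F : Type*) [Field F] (m n N : ℕ) := FreeAlgebra F (V m n N ⊕ E m n N)

noncomputable def eV (F : Type*) [Field F] (m n N : ℕ) (v : V m n N) : FA F m n N :=
  FreeAlgebra.ι F (Sum.inl v)

noncomputable def arE (F : Type*) [Field F] (m n N : ℕ) (a : E m n N) : FA F m n N :=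
  FreeAlgebra.ι F (Sum.inr a)

/-- The idempotent `e_λ` attached to an arbitrary `l : Wt N` (zero if `l` is not
a weight of type `(m,n)`). -/
noncomputable def eW (F : Type*) [Field F] (m n N : ℕ) (l : Wt N) : FA F m n N :=
  if h : IsWeight m n l then eV F m n N ⟨l, h⟩ else 0

/-- The arrow from `u` to `w` (zero if `u`, `w` are not adjacent weights). -/
noncomputable def arW (F : Type*) [Field F] (m n N : ℕ) (u w : Wt N) : FA F m n N :=
  if h : IsWeight m n u ∧ IsWeight m n w ∧ GammaAdj u w then
    arE F m n N ⟨(⟨u, h.1⟩, ⟨w, h.2.1⟩), h.2.2⟩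
  else 0

/-- The element of the (free algebra presenting the) path algebra corresponding to
the path with the given vertex list. -/
noncomputable def pathEl (F : Type*) [Field F] (m n N : ℕ) : List (Wt N) → FA F m n N
  | [] => 0
  | [u] => eW F m n N u
  | u :: w :: rest => arW F m n N u w * pathEl F m n N (w :: rest)

/-- The defining relations of the path algebra `kQ̄_m^n` as a quotient of the free
algebra on vertices and arrows: the vertices are orthogonal idempotents summing to
`1` and each arrow is supported at its source and target. -/
inductive PARel (F : Type*) [Field F] (m n N : ℕ) : FA F m n N → FA F m n N → Prop
  | idem (v : V m n N) : PARel F m n N (eV F m n N v * eV F m n N v) (eV F m n N v)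
  | orth (v w : V m n N) (h : v ≠ w) : PARel F m n N (eV F m n N v * eV F m n N w) 0
  | src (a : E m n N) :
      PARel F m n N (eV F m n N a.1.1 * arE F m n N a) (arE F m n N a)
  | tgt (a : E m n N) :
      PARel F m n N (arE F m n N a * eV F m n N a.1.2) (arE F m n N a)
  | srcZero (v : V m n N) (a : E m n N) (h : v ≠ a.1.1) :
      PARel F m n N (eV F m n N v * arE F m n N a) 0
  | tgtZero (a : E m n N) (v : V m n N) (h : v ≠ a.1.2) :
      PARel F m n N (arE F m n N a * eV F m n N v) 0
  | unit : PARel F m n N (∑ᶠ v : V m n N, eV F m n N v) 1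

/-- The coefficient `c_κ^μ(λ)` where `λ = s_D(κ)` with `D = (d1,d2)`, and
`μ = s_C(λ)` with `C = (i,j)` a circle of `λ`. -/
noncomputable def cCoef {N : ℕ} (ka : Wt N) (d1 d2 i j : Fin N) : ℤ :=
  if IsCircle ka i j then
    if Encloses i j d1 d2 then
      (-1) ^ ({p : Fin N × Fin N |
        IsCircle ka p.1 p.2 ∧ Encloses p.1 p.2 d1 d2 ∧ Encloses i j p.1 p.2}.ncard) * 2
    else 0
  else 1

/-- Generator of type (A): the sum of all length-2 paths from `la` to `mu`. -/
noncomputable def GenA (F : Type*) [Field F] (m n N : ℕ) (la mu : Wt N) : FA F m n N :=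
  ∑ᶠ nu : Wt N, arW F m n N la nu * arW F m n N nu mu

/-- Generator of type (D): `ȳ_λ^μ x̄_λ^μ + Σ_κ c_κ^μ(λ) x̄_κ^λ ȳ_κ^λ`, for `λ` a
weight with circle `C = (i,j)` and `μ = s_C(λ)`. -/
noncomputable def GenD (F : Type*) [Field F] (m n N : ℕ) (la : Wt N) (i j : Fin N) :
    FA F m n N :=
  arW F m n N la (swapC la i j) * arW F m n N (swapC la i j) la +
    ∑ᶠ ka : Wt N, ∑ᶠ d1 : Fin N, ∑ᶠ d2 : Fin N,
      if IsCircle ka d1 d2 ∧ la = swapC ka d1 d2 then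
        cCoef ka d1 d2 i j • (arW F m n N la ka * arW F m n N ka la)
      else 0

/-- The relations presenting `K̄_m^n = kQ̄_m^n / Ī_m^n`: the path-algebra relations
together with the quadratic generators (A)–(D) of the ideal `Ī_m^n`. -/
inductive KbarRel (F : Type*) [Field F] (m n N : ℕ) : FA F m n N → FA F m n N → Prop
  | pa {x y : FA F m n N} : PARel F m n N x y → KbarRel F m n N x y
  | genA (la mu : Wt N) (h1 : IsWeight m n la) (h2 : IsWeight m n mu) (hne : la ≠ mu)
      (htwo : 2 ≤ {nu : Wt N | GammaAdj la nu ∧ GammaAdj nu mu}.ncard) :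
      KbarRel F m n N (GenA F m n N la mu) 0
  | genB1 (la : Wt N) (h : IsWeight m n la) (i j i' j' : Fin N)
      (hC : IsCircle la i j) (hC' : IsCircle la i' j') (henc : Encloses i j i' j')
      (hno : ¬ ∃ a b : Fin N, IsCircle la a b ∧ Encloses a b i' j' ∧ Encloses i j a b) :
      KbarRel F m n N
        (arW F m n N la (swapC la i j) *
          arW F m n N (swapC la i j) (swapC (swapC la i j) i' j')) 0
  | genB2 (la : Wt N) (h : IsWeight m n la) (i j i' j' : Fin N)
      (hC : IsCircle la i j) (hC' : IsCircle la i' j') (henc : Encloses i j i' j')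
      (hno : ¬ ∃ a b : Fin N, IsCircle la a b ∧ Encloses a b i' j' ∧ Encloses i j a b) :
      KbarRel F m n N
        (arW F m n N (swapC (swapC la i j) i' j') (swapC la i j) *
          arW F m n N (swapC la i j) la) 0
  | genC (la mu : Wt N) (h1 : IsWeight m n la) (h2 : IsWeight m n mu) (hne : la ≠ mu)
      (c1 c2 d1 d2 : Fin N) (hC : IsCircle la c1 c2) (hC'' : IsCircle mu d1 d2)
      (hsw : swapC la c1 c2 = swapC mu d1 d2)
      (hcross : (c1 < d1 ∧ d1 < c2 ∧ c2 < d2) ∨ (d1 < c1 ∧ c1 < d2 ∧ d2 < c2)) :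
      KbarRel F m n N
        (arW F m n N la (swapC la c1 c2) * arW F m n N (swapC la c1 c2) mu) 0
  | genD (la : Wt N) (h : IsWeight m n la) (i j : Fin N) (hC : IsCircle la i j) :
      KbarRel F m n N (GenD F m n N la i j) 0

/-- The Koszul dual `K̄_m^n` of the extended Khovanov arc algebra, presented as a
quotient of the free algebra on the vertices and arrows of `Q̄_m^n`. -/
abbrev Kbar (F : Type*) [Field F] (m n N : ℕ) := RingQuot (KbarRel F m n N)

/-- The canonical projection; an element of the path algebra lies in the ideal
`Ī_m^n` if and only if its image under this map is zero. -/
noncomputable def toKbar (F : Type*) [Field F] (m n N : ℕ) :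
    FA F m n N →ₐ[F] Kbar F m n N :=
  RingQuot.mkAlgHom F (KbarRel F m n N)

/-- The degree-`i` component of `K̄_m^n` (image of the span of the length-`i` paths). -/
noncomputable def degComp (F : Type*) [Field F] (m n N : ℕ) (i : ℕ) :
    Submodule F (Kbar F m n N) :=
  Submodule.span F {x : Kbar F m n N | ∃ p : List (Wt N),
    p.length = i + 1 ∧ (∀ v ∈ p, IsWeight m n v) ∧ p.Chain' GammaAdj ∧
    x = toKbar F m n N (pathEl F m n N p)}

/-- The linear map `x ↦ e_λ x e_μ` on `K̄_m^n`. -/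
noncomputable def sandwich (F : Type*) [Field F] (m n N : ℕ) (la mu : Wt N) :
    Kbar F m n N →ₗ[F] Kbar F m n N :=
  (LinearMap.mulLeft F (toKbar F m n N (eW F m n N la))).comp
    (LinearMap.mulRight F (toKbar F m n N (eW F m n N mu)))

end Kh

namespace Kh

end Kh

namespace Kh

/-- Abstract combinatorial system used to build the representation. -/
structure Sys (V : Type) (Arc : Type) where
  Nb : V → V → Prop
  ht : V → ℕ
  has : V → Arc → Prop
  upArc : V → V → Arc
  eta : V → V → ℤ
  symm : ∀ {u v}, Nb u v → Nb v u
  hne : ∀ {u v}, Nb u v → ht u ≠ ht v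
  ua1 : ∀ {l m}, Nb l m → ht l < ht m → has l (upArc l m)
  ua2 : ∀ {l m}, Nb l m → ht l < ht m → ¬ has m (upArc l m)
  ua3 : ∀ {l m r}, Nb l m → ht l < ht m → Nb l r → ¬ has r (upArc l m) → r ≠ m → ht r < ht m
  lemK : ∀ {k v r C}, Nb k v → Nb v r → k ≠ r → has k C → has r C → has v C
  top1 : ∀ {k l m w}, Nb k m → Nb l m → ht k < ht m → ht l < ht m → k ≠ l →
    Nb k w → Nb w l → w ≠ m → ht w < ht m
  top2 : ∀ {k l m w w'}, Nb k m → Nb l m → ht k < ht m → ht l < ht m → k ≠ l →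
    Nb k w → Nb w l → w ≠ m → Nb k w' → Nb w' l → w' ≠ m → w = w'
  eqht : ∀ {k m v}, k ≠ m → ht k = ht m → Nb k v → Nb v m → ht v < ht k →
    ∃ t, Nb k t ∧ Nb t m ∧ ht k < ht t
  cstar : ∀ {k m l}, ht k < ht m → (∀ r, Nb k r → Nb r m → ht r < ht m) →
    (∃ r, Nb k r ∧ Nb r m) → Nb m l → ht l < ht m → ¬ Nb k l →
    ∀ x y, Nb k x → Nb x y → Nb y l → ht x < ht m ∧ (y ≠ m → ht y < ht m)
  case1 : ∀ {k m l}, ht k < ht m → (∀ r, Nb k r → Nb r m → ht r < ht m) →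
    Nb k l → Nb l m → has k (upArc l m) →
    ∃ t, Nb k t ∧ ht k < ht t ∧ upArc k t = upArc l m ∧ ht t < ht m
  case3 : ∀ {k m l}, k ≠ m → ht k < ht m → (∀ r, Nb k r → Nb r m → ht r < ht m) →
    Nb k l → Nb l m → ¬ has k (upArc l m) →
    ht l < ht k ∧ has m (upArc l k) ∧ ∃ t1 t2, Nb k t1 ∧ ht k < ht t1 ∧ ht t1 < ht m ∧
      Nb k t2 ∧ ht k < ht t2 ∧ ht t2 < ht m ∧
      ¬ has l (upArc k t1) ∧ ¬ has l (upArc k t2) ∧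
      (∀ v, Nb k v → ¬ has v (upArc k t1) → ¬ has v (upArc k t2) → v = l) ∧
      (∀ r, Nb l r → ¬ has r (upArc l m) → ¬ has r (upArc l k) → r = k) ∧
      (∀ v r, Nb k v → Nb v r → Nb r l → v ≠ l → r ≠ k →
        ((has v (upArc k t1) ∧ has v (upArc k t2)) ↔ (has r (upArc l m) ∧ has r (upArc l k))))
  sgn : ∀ {k m}, ht k < ht m → k ≠ m → (∀ r, Nb k r → Nb r m → ht r < ht m) →
    ∀ [Fintype V], ∑ v : V, (if Nb k v ∧ Nb v m ∧ ht k < ht v then eta k v * eta v m else 0) = 0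
  sg0 : ∀ {k v m}, Nb k v → Nb v m → ht v < ht k → ht k < ht m → eta v m = 0

namespace Sys
variable {V Arc : Type} [Fintype V] (S : Sys V Arc)

/-- The replacement of the path `v → m → l`. -/
noncomputable def T {A : Type*} [Ring A] (a : V → V → A) (m v l : V) : A :=
  if v = l then - ∑ r : V, (if S.Nb l r ∧ ¬ S.has r (S.upArc l m) ∧ r ≠ m then a l r * a r l else 0)
  else - ∑ r : V, (if S.Nb v r ∧ S.Nb r l ∧ r ≠ m then a v r * a r l else 0)

variable {A : Type*} [Ring A] (a : V → V → A) (h : ℕ)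

def HA : Prop := ∀ k m, k ≠ m → S.ht k < h → S.ht m < h →
  (∀ v, S.Nb k v → S.Nb v m → S.ht v < h) →
  ∑ v : V, (if S.Nb k v ∧ S.Nb v m then a k v * a v m else 0) = 0

def HD : Prop := ∀ l t, S.Nb l t → S.ht l < S.ht t → S.ht t < h →
  ∑ v : V, (if S.Nb l v ∧ ¬ S.has v (S.upArc l t) then a l v * a v l else 0) = 0

theorem cubic_far (hA : S.HA a h) {m k l : V} (hm : S.ht m = h) (hk : S.ht k < h)
    (hR : ∀ r, S.Nb k r → S.Nb r m → S.ht r < h) (hml : S.Nb m l) (hl : S.ht l < h)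
    (hkl : ¬ S.Nb k l) :
    ∑ v : V, (if S.Nb k v ∧ S.Nb v m then a k v * S.T a m v l else 0) = 0 := by
  by_cases hne : ∃ r, S.Nb k r ∧ S.Nb r m
  swap
  · apply Finset.sum_eq_zero
    intro v _
    rw [if_neg]
    rintro ⟨h1, h2⟩
    exact hne ⟨v, h1, h2⟩
  have hc := S.cstar (k := k) (m := m) (l := l) (by omega) (by simpa [hm] using hR) hne hml (by omega) hkl
  have hkey : ∀ v, (if S.Nb k v ∧ S.Nb v m then a k v * S.T a m v l else 0)
      = - ∑ r : V, (if S.Nb k v ∧ S.Nb v r ∧ S.Nb r l ∧ r ≠ m then a k v * (a v r * a r l) else 0) := by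
    intro v
    by_cases hv : S.Nb k v
    swap
    · simp [hv]
    have hvl : v ≠ l := by rintro rfl; exact hkl hv
    by_cases hvm : S.Nb v m
    · simp only [hv, hvm, and_self, if_true, T, if_neg hvl, true_and, mul_neg, Finset.mul_sum, mul_ite, mul_zero]
    · simp only [hv, hvm, and_false, if_false, true_and]
      symm
      rw [neg_eq_zero]
      have : ∑ r : V, (if S.Nb v r ∧ S.Nb r l ∧ r ≠ m then a k v * (a v r * a r l) else 0)
        = a k v * ∑ r : V, (if S.Nb v r ∧ S.Nb r l then a v r * a r l else 0) := by
        rw [Finset.mul_sum]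
        apply Finset.sum_congr rfl
        intro r _
        by_cases h1 : S.Nb v r ∧ S.Nb r l
        · have : r ≠ m := by rintro rfl; exact hvm h1.1
          simp [h1, this]
        · rw [if_neg h1, if_neg (fun hh => h1 ⟨hh.1, hh.2.1⟩)]; simp
      rw [this]
      by_cases hex : ∃ r, S.Nb v r ∧ S.Nb r l
      · obtain ⟨r, hr1, hr2⟩ := hex
        rw [hA v l hvl (by have := (hc v r hv hr1 hr2).1; omega) hl, mul_zero]
        intro w h1 h2
        have := (hc v w hv h1 h2).2 (by rintro rfl; exact hvm h1)
        omega
      · rw [Finset.sum_eq_zero, mul_zero]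
        intro r _
        rw [if_neg]
        rintro ⟨h1, h2⟩
        exact hex ⟨r, h1, h2⟩
  simp only [hkey]
  rw [Finset.sum_neg_distrib, Finset.sum_comm, neg_eq_zero]
  apply Finset.sum_eq_zero
  intro r _
  by_cases hr : S.Nb r l ∧ r ≠ m
  swap
  · apply Finset.sum_eq_zero
    intro v _
    rw [if_neg]
    tauto
  have : ∑ v : V, (if S.Nb k v ∧ S.Nb v r ∧ S.Nb r l ∧ r ≠ m then a k v * (a v r * a r l) else 0)
    = (∑ v : V, (if S.Nb k v ∧ S.Nb v r then a k v * a v r else 0)) * a r l := by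
    rw [Finset.sum_mul]
    apply Finset.sum_congr rfl
    intro v _
    simp [hr, mul_assoc]
  rw [this]
  by_cases hex : ∃ v, S.Nb k v ∧ S.Nb v r
  · obtain ⟨v, hv1, hv2⟩ := hex
    rw [hA k r (by rintro rfl; exact hkl hr.1) hk (by have := (hc v r hv1 hv2 hr.1).2 hr.2; omega), zero_mul]
    intro w h1 h2
    have := (hc w r h1 h2 hr.1).1
    omega
  · rw [Finset.sum_eq_zero, zero_mul]
    intro v _
    rw [if_neg]
    rintro ⟨h1, h2⟩
    exact hex ⟨v, h1, h2⟩

end Sys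
end Kh

namespace Kh
namespace Sys
variable {V Arc : Type} [Fintype V] (S : Sys V Arc)
variable {A : Type*} [Ring A] (a : V → V → A) (h : ℕ)

theorem cubic_core (hA : S.HA a h) {m k l : V} (hm : S.ht m = h) (hk : S.ht k < h)
    (hR : ∀ r, S.Nb k r → S.Nb r m → S.ht r < h) (hml : S.Nb l m) (hl : S.ht l < h)
    (hkl : S.Nb k l) (w w' : V → ℤ)
    (p0 : ∑ v : V, (if S.Nb k v then w v • (a k v * a v k) else 0) = 0)
    (p1 : ∑ r : V, (if S.Nb l r ∧ ¬ S.has r (S.upArc l m) ∧ r ≠ m then a l r * a r l else 0)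
      = ∑ r : V, (if S.Nb l r ∧ r ≠ m then w' r • (a l r * a r l) else 0))
    (p2 : ∀ v, S.Nb k v → S.Nb v m → v ≠ l → w v = 1)
    (p3 : w l = w' k)
    (p4 : ∀ v r, S.Nb k v → S.Nb v r → S.Nb r l → v ≠ l → r ≠ k → w v = w' r)
    (p5 : ∀ v, S.Nb k v → v ≠ l → w v ≠ 0 → S.ht v < h)
    (p6 : ∀ r, S.Nb l r → r ≠ m → w' r ≠ 0 → S.ht r < h) :
    ∑ v : V, (if S.Nb k v ∧ S.Nb v m then a k v * S.T a m v l else 0) = 0 := by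
  have hkm : k ≠ m := by rintro rfl; omega
  have hlk := S.symm hkl
  -- top2 consequence
  have htop : ∀ v r, S.Nb k v → S.Nb v m → v ≠ l → S.Nb v r → S.Nb r l → r ≠ m → r = k := by
    intro v r h1 h2 h3 h4 h5 h6
    exact S.top2 (m := m) h2 hml (by have := hR v h1 h2; omega) (by omega) h3 h4 h5 h6 (S.symm h1) hkl hkm
  -- termwise rewriting
  have e1 : ∀ v : V, (if S.Nb k v ∧ S.Nb v m then a k v * S.T a m v l else 0)
      = - (if S.Nb k v ∧ S.Nb v m ∧ v ≠ l then a k v * a v k * a k l else 0)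
        - (if v = l then a k l * ∑ r : V, (if S.Nb l r ∧ r ≠ m then w' r • (a l r * a r l) else 0) else 0) := by
    intro v
    by_cases hv : v = l
    · subst hv
      simp [hkl, hml, T, p1]
    · by_cases hv2 : S.Nb k v ∧ S.Nb v m
      · rw [if_pos hv2, T, if_neg hv, if_pos ⟨hv2.1, hv2.2, hv⟩, if_neg hv, sub_zero]
        rw [Finset.sum_eq_single k]
        · rw [if_pos ⟨S.symm hv2.1, hkl, hkm⟩]; simp [mul_assoc]
        · intro r _ hr
          rw [if_neg]
          rintro ⟨h1, h2, h3⟩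
          exact hr (htop v r hv2.1 hv2.2 hv h1 h2 h3)
        · simp
      · rw [if_neg hv2, if_neg (fun hh => hv2 ⟨hh.1, hh.2.1⟩)]; simp [hv]
  -- multiply p0 by a k l
  have e2 : ∑ v : V, (if S.Nb k v ∧ S.Nb v m ∧ v ≠ l then a k v * a v k * a k l else 0)
      = - w l • (a k l * a l k * a k l)
        - ∑ v : V, (if S.Nb k v ∧ ¬ S.Nb v m then w v • (a k v * a v k * a k l) else 0) := by
    have h0 : ∑ v : V, (if S.Nb k v then w v • (a k v * a v k * a k l) else 0) = 0 := by
      have := congrArg (· * a k l) p0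
      simp only [Finset.sum_mul, zero_mul] at this
      refine Eq.trans ?_ this
      apply Finset.sum_congr rfl
      intro v _
      split_ifs
      · rw [smul_mul_assoc]
      · simp
    have h1 : ∀ v : V, (if S.Nb k v then w v • (a k v * a v k * a k l) else 0)
       = (if S.Nb k v ∧ S.Nb v m ∧ v ≠ l then a k v * a v k * a k l else 0)
        + (if v = l then w l • (a k l * a l k * a k l) else 0)
        + (if S.Nb k v ∧ ¬ S.Nb v m then w v • (a k v * a v k * a k l) else 0) := by
      intro v
      by_cases hv : v = l
      · subst hv; simp [hkl, hml]
      · by_cases h2 : S.Nb k v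
        · by_cases h3 : S.Nb v m
          · simp [h2, h3, hv, p2 v h2 h3 hv]
          · simp [h2, h3, hv]
        · simp [h2, hv]
    simp only [h1] at h0
    rw [Finset.sum_add_distrib, Finset.sum_add_distrib] at h0
    simp only [Finset.sum_ite_eq', Finset.mem_univ, if_true] at h0
    have key : ∀ x y z : A, x + y + z = 0 → x = -y - z := by
      intro x y z hh
      rw [eq_sub_iff_add_eq, eq_neg_iff_add_eq_zero, ← hh]; abel
    rw [neg_smul]
    exact key _ _ _ h0
  -- replace v k l
  have e3 : ∀ v : V, (if S.Nb k v ∧ ¬ S.Nb v m then w v • (a k v * a v k * a k l) else 0)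
      = - ∑ r : V, (if S.Nb k v ∧ v ≠ l ∧ S.Nb v r ∧ S.Nb r l ∧ r ≠ k ∧ r ≠ m then
            w' r • (a k v * a v r * a r l) else 0) := by
    intro v
    by_cases hv : S.Nb k v ∧ ¬ S.Nb v m
    · have hvl : v ≠ l := by rintro rfl; exact hv.2 hml
      rw [if_pos hv]
      have h1 : ∑ r : V, (if S.Nb k v ∧ v ≠ l ∧ S.Nb v r ∧ S.Nb r l ∧ r ≠ k ∧ r ≠ m then
            w' r • (a k v * a v r * a r l) else 0)
          = w v • (a k v * ∑ r : V, (if S.Nb v r ∧ S.Nb r l ∧ r ≠ k then a v r * a r l else 0)) := by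
        rw [Finset.mul_sum, Finset.smul_sum]
        apply Finset.sum_congr rfl
        intro r _
        by_cases h2 : S.Nb v r ∧ S.Nb r l ∧ r ≠ k
        · have h3 : r ≠ m := by rintro rfl; exact hv.2 h2.1
          rw [if_pos ⟨hv.1, hvl, h2.1, h2.2.1, h2.2.2, h3⟩, if_pos h2,
            p4 v r hv.1 h2.1 h2.2.1 hvl h2.2.2, mul_assoc]
        · rw [if_neg h2, if_neg (fun hh => h2 ⟨hh.2.2.1, hh.2.2.2.1, hh.2.2.2.2.1⟩)]; simp
      rw [h1]
      by_cases hw : w v = 0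
      · simp [hw]
      have h4 := hA v l hvl (p5 v hv.1 hvl hw) hl (by
        intro r h5 h6
        by_cases h7 : r = k
        · subst h7; exact hk
        · have := p4 v r hv.1 h5 h6 hvl h7
          exact p6 r (S.symm h6) (by rintro rfl; exact hv.2 h5) (by rw [← this]; exact hw))
      have h5 : ∀ r : V, (if S.Nb v r ∧ S.Nb r l then a v r * a r l else 0)
        = (if r = k then a v k * a k l else 0) +
          (if S.Nb v r ∧ S.Nb r l ∧ r ≠ k then a v r * a r l else 0) := by
        intro r
        by_cases hr : r = k
        · subst hr; simp [S.symm hv.1, hkl]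
        · simp [hr]
      simp only [h5] at h4
      rw [Finset.sum_add_distrib] at h4
      simp only [Finset.sum_ite_eq', Finset.mem_univ, if_true] at h4
      rw [mul_assoc, eq_neg_of_add_eq_zero_left h4]
      simp
    · rw [if_neg hv, eq_comm, neg_eq_zero]
      apply Finset.sum_eq_zero
      intro r _
      rw [if_neg]
      rintro ⟨h1, h2, h3, h4, h5, h6⟩
      have h7 : S.Nb v m := by by_contra h7; exact hv ⟨h1, h7⟩
      exact h5 (htop v r h1 h7 h2 h3 h4 h6)
  simp only [e1]
  rw [Finset.sum_sub_distrib, Finset.sum_neg_distrib, e2]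
  simp only [e3, Finset.sum_ite_eq', Finset.mem_univ, if_true]
  rw [Finset.sum_neg_distrib, Finset.sum_comm]
  -- the final regroup
  have e4 : ∀ r : V, ∑ v : V, (if S.Nb k v ∧ v ≠ l ∧ S.Nb v r ∧ S.Nb r l ∧ r ≠ k ∧ r ≠ m then
            w' r • (a k v * a v r * a r l) else 0)
      = - (if S.Nb l r ∧ r ≠ m ∧ r ≠ k then w' r • (a k l * (a l r * a r l)) else 0) := by
    intro r
    by_cases hr : S.Nb l r ∧ r ≠ m ∧ r ≠ k
    swap
    · rw [if_neg hr, neg_zero]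
      apply Finset.sum_eq_zero
      intro v _
      rw [if_neg]
      rintro ⟨h1, h2, h3, h4, h5, h6⟩
      exact hr ⟨S.symm h4, h6, h5⟩
    rw [if_pos hr]
    by_cases hw : w' r = 0
    · simp [hw]
    have h4 := hA k r (Ne.symm hr.2.2) hk (p6 r hr.1 hr.2.1 hw) (by
      intro v h1 h2
      by_cases hv : v = l
      · subst hv; exact hl
      · exact p5 v h1 hv (by rw [p4 v r h1 h2 (S.symm hr.1) hv hr.2.2]; exact hw))
    have h5 : ∀ v : V, (if S.Nb k v ∧ S.Nb v r then a k v * a v r else 0)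
        = (if v = l then a k l * a l r else 0) +
          (if S.Nb k v ∧ v ≠ l ∧ S.Nb v r then a k v * a v r else 0) := by
      intro v
      by_cases hv : v = l
      · subst hv; simp [hkl, hr.1]
      · simp [hv]
    simp only [h5] at h4
    rw [Finset.sum_add_distrib] at h4
    simp only [Finset.sum_ite_eq', Finset.mem_univ, if_true] at h4
    have h6 : ∑ v : V, (if S.Nb k v ∧ v ≠ l ∧ S.Nb v r ∧ S.Nb r l ∧ r ≠ k ∧ r ≠ m then
            w' r • (a k v * a v r * a r l) else 0)
        = w' r • ((∑ v : V, (if S.Nb k v ∧ v ≠ l ∧ S.Nb v r then a k v * a v r else 0)) * a r l) := by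
      rw [Finset.sum_mul, Finset.smul_sum]
      apply Finset.sum_congr rfl
      intro v _
      simp [S.symm hr.1, hr.2]
    rw [h6, eq_neg_of_add_eq_zero_right h4]
    simp [mul_assoc]
  simp only [e4]
  have e5 : ∀ r : V, (if S.Nb l r ∧ r ≠ m then w' r • (a l r * a r l) else 0)
      = (if r = k then w' k • (a l k * a k l) else 0)
       + (if S.Nb l r ∧ r ≠ m ∧ r ≠ k then w' r • (a l r * a r l) else 0) := by
    intro r
    by_cases hr : r = k
    · subst hr; simp [hlk, hkm]
    · simp [hr]
  simp only [e5]
  rw [Finset.sum_add_distrib, p3, mul_add, Finset.mul_sum, Finset.sum_neg_distrib]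
  simp only [Finset.sum_ite_eq', Finset.mem_univ, if_true, Finset.mul_sum, mul_ite, mul_zero, mul_smul_comm, neg_smul, mul_assoc]
  abel

theorem cubic_near (hA : S.HA a h) (hD : S.HD a h) {m k l : V} (hm : S.ht m = h) (hk : S.ht k < h)
    (hR : ∀ r, S.Nb k r → S.Nb r m → S.ht r < h) (hml : S.Nb l m) (hl : S.ht l < h)
    (hkl : S.Nb k l) :
    ∑ v : V, (if S.Nb k v ∧ S.Nb v m then a k v * S.T a m v l else 0) = 0 := by
  have hkm : k ≠ m := by rintro rfl; omega
  subst hm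
  have hu1 := S.ua1 hml hl
  have hu2 := S.ua2 hml hl
  have conv : ∀ (b : V) (C : Arc), ∑ v : V, (if S.Nb b v ∧ ¬ S.has v C then a b v * a v b else 0)
      = ∑ v : V, (if S.Nb b v then (if S.has v C then (0:ℤ) else 1) • (a b v * a v b) else 0) := by
    intro b C
    apply Finset.sum_congr rfl
    intro v _
    by_cases h1 : S.Nb b v <;> by_cases h2 : S.has v C <;> simp [h1, h2]
  by_cases hC : S.has k (S.upArc l m)
  · obtain ⟨t, ht1, ht2, ht3, ht4⟩ := S.case1 hk hR hkl hml hC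
    refine S.cubic_core a _ hA rfl hk hR hml hl hkl
      (fun v => if S.has v (S.upArc l m) then 0 else 1)
      (fun v => if S.has v (S.upArc l m) then 0 else 1) ?_ ?_ ?_ ?_ ?_ ?_ ?_
    · rw [← conv, ← ht3]; exact hD k t ht1 ht2 ht4
    · apply Finset.sum_congr rfl
      intro v _
      by_cases h1 : S.Nb l v <;> by_cases h2 : S.has v (S.upArc l m) <;> by_cases h3 : v = m <;> simp [h1, h2, h3]
    · intro v h1 h2 h3
      have : ¬ S.has v (S.upArc l m) := fun hh => hu2 (S.lemK hml (S.symm h2) (Ne.symm h3) hu1 hh)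
      simp [this]
    · simp [hC, hu1]
    · intro v r h1 h2 h3 h4 h5
      have : S.has v (S.upArc l m) ↔ S.has r (S.upArc l m) :=
        ⟨fun hh => S.lemK h2 h3 h4 hh hu1, fun hh => S.lemK h1 h2 (Ne.symm h5) hC hh⟩
      simp [this]
    · intro v h1 h2 h3
      have h4 : ¬ S.has v (S.upArc k t) := by rw [ht3]; intro hh; simp [hh] at h3
      by_cases h5 : v = t
      · subst h5; exact ht4
      · exact (S.ua3 ht1 ht2 h1 h4 h5).trans ht4
    · intro v h1 h2 h3
      have h4 : ¬ S.has v (S.upArc l m) := by intro hh; simp [hh] at h3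
      exact S.ua3 hml hl h1 h4 h2
  · obtain ⟨hlk, hmY, t1, t2, ha1, ha2, ha3, hb1, hb2, hb3, hc1, hc2, hd1, hd2, hsq⟩ :=
      S.case3 hkm hk hR hkl hml hC
    have hY2 := S.ua2 (S.symm hkl) hlk
    refine S.cubic_core a _ hA rfl hk hR hml hl hkl
      (fun v => (if S.has v (S.upArc k t1) then 0 else 1) + (if S.has v (S.upArc k t2) then 0 else 1))
      (fun v => (if S.has v (S.upArc l m) then 0 else 1) + (if S.has v (S.upArc l k) then 0 else 1))
      ?_ ?_ ?_ ?_ ?_ ?_ ?_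
    · have e1 := hD k t1 ha1 ha2 ha3
      have e2 := hD k t2 hb1 hb2 hb3
      rw [conv] at e1 e2
      have := congrArg₂ (· + ·) e1 e2
      simp only [← Finset.sum_add_distrib, add_zero] at this
      refine Eq.trans ?_ this
      apply Finset.sum_congr rfl
      intro v _
      by_cases h1 : S.Nb k v <;> simp [h1, add_smul]
    · have e1 := hD l k (S.symm hkl) hlk hk
      rw [conv] at e1
      refine Eq.trans (add_zero _).symm ?_
      refine Eq.trans (congrArg (fun z => _ + z) e1.symm) ?_
      rw [← Finset.sum_add_distrib]
      apply Finset.sum_congr rfl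
      intro v _
      by_cases h1 : S.Nb l v <;> by_cases h3 : v = m
      · subst h3; simp [hmY]
      · by_cases h2 : S.has v (S.upArc l m) <;> simp [h1, h2, h3, add_smul]
      · simp [h1]
      · simp [h1]
    · intro v h1 h2 h3
      have e1 := hsq v m h1 h2 (S.symm hml) h3 (Ne.symm hkm)
      have e2 := hd1 v h1
      have e3 : ¬ (S.has v (S.upArc k t1) ∧ S.has v (S.upArc k t2)) := fun hh => hu2 (e1.1 hh).1
      clear e1 hsq
      by_cases x1 : S.has v (S.upArc k t1) <;> by_cases x2 : S.has v (S.upArc k t2)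
      · exact absurd ⟨x1, x2⟩ e3
      · simp [x1, x2]
      · simp [x1, x2]
      · exact absurd (e2 x1 x2) h3
    · simp [hc1, hc2, hC, hY2]
    · intro v r h1 h2 h3 h4 h5
      have e1 := hsq v r h1 h2 h3 h4 h5
      have e2 := hd1 v h1
      have e3 := hd2 r (S.symm h3)
      have e4 : S.has v (S.upArc k t1) ∨ S.has v (S.upArc k t2) := by
        by_contra hh; push Not at hh; exact h4 (e2 hh.1 hh.2)
      have e5 : S.has r (S.upArc l m) ∨ S.has r (S.upArc l k) := by
        by_contra hh; push Not at hh; exact h5 (e3 hh.1 hh.2)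
      clear hsq hd1 hd2 hA hD e2 e3
      generalize S.has v (S.upArc k t1) = p1 at *
      generalize S.has v (S.upArc k t2) = p2 at *
      generalize S.has r (S.upArc l m) = p3 at *
      generalize S.has r (S.upArc l k) = p4 at *
      by_cases x1 : p1 <;> by_cases x2 : p2 <;> by_cases y1 : p3 <;> by_cases y2 : p4 <;>
        simp [x1, x2, y1, y2] at e1 e4 e5 ⊢
    · intro v h1 h2 h3
      by_cases x1 : S.has v (S.upArc k t1)
      · have x2 : ¬ S.has v (S.upArc k t2) := by intro hh; simp [x1, hh] at h3
        by_cases h5 : v = t2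
        · subst h5; exact hb3
        · exact (S.ua3 hb1 hb2 h1 x2 h5).trans hb3
      · by_cases h5 : v = t1
        · subst h5; exact ha3
        · exact (S.ua3 ha1 ha2 h1 x1 h5).trans ha3
    · intro v h1 h2 h3
      by_cases x1 : S.has v (S.upArc l m)
      · have x2 : ¬ S.has v (S.upArc l k) := by intro hh; simp [x1, hh] at h3
        by_cases h5 : v = k
        · subst h5; exact hk
        · exact (S.ua3 (S.symm hkl) hlk h1 x2 h5).trans hk
      · exact S.ua3 hml hl h1 x1 h2

theorem cubic (hA : S.HA a h) (hD : S.HD a h) {m k l : V} (hm : S.ht m = h) (hk : S.ht k < h)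
    (hR : ∀ r, S.Nb k r → S.Nb r m → S.ht r < h) (hml : S.Nb l m) (hl : S.ht l < h) :
    ∑ v : V, (if S.Nb k v ∧ S.Nb v m then a k v * S.T a m v l else 0) = 0 := by
  by_cases hkl : S.Nb k l
  · exact S.cubic_near a h hA hD hm hk hR hml hl hkl
  · exact S.cubic_far a h hA hm hk hR (S.symm hml) hl hkl

end Sys
end Kh

namespace Kh
namespace Sys
variable {V Arc : Type} [Fintype V] (S : Sys V Arc)

section op
variable {A : Type*} [Ring A] (a : V → V → A) (h : ℕ)
open MulOpposite

theorem T_op (m v l : V) : S.T (fun k v => op (a v k)) m v l = op (S.T a m l v) := by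
  unfold T
  by_cases hv : v = l
  · subst hv
    simp only [if_true, op_neg, Finset.op_sum]
    congr 1
    apply Finset.sum_congr rfl
    intro r _
    split_ifs <;> simp
  · rw [if_neg hv, if_neg (Ne.symm hv), op_neg, Finset.op_sum]
    congr 1
    apply Finset.sum_congr rfl
    intro r _
    have : (S.Nb v r ∧ S.Nb r l ∧ r ≠ m) ↔ (S.Nb l r ∧ S.Nb r v ∧ r ≠ m) :=
      ⟨fun hh => ⟨S.symm hh.2.1, S.symm hh.1, hh.2.2⟩, fun hh => ⟨S.symm hh.2.1, S.symm hh.1, hh.2.2⟩⟩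
    simp only [this]
    split_ifs <;> simp

theorem cubic_op (hA : S.HA a h) (hD : S.HD a h) {m k l : V} (hm : S.ht m = h) (hk : S.ht k < h)
    (hR : ∀ r, S.Nb k r → S.Nb r m → S.ht r < h) (hml : S.Nb l m) (hl : S.ht l < h) :
    ∑ v : V, (if S.Nb k v ∧ S.Nb v m then S.T a m l v * a v k else 0) = 0 := by
  have := S.cubic (fun k v => op (a v k)) h ?_ ?_ hm hk hR hml hl
  · simp only [T_op] at this
    apply op_injective
    rw [Finset.op_sum, op_zero, ← this]
    apply Finset.sum_congr rfl
    intro v _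
    split_ifs <;> simp
  · intro k m h1 h2 h3 h4
    have := hA m k (Ne.symm h1) h3 h2 (fun v x y => h4 v (S.symm y) (S.symm x))
    have h5 := congrArg op this
    rw [Finset.op_sum, op_zero] at h5
    refine Eq.trans ?_ h5
    apply Finset.sum_congr rfl
    intro v _
    have : (S.Nb k v ∧ S.Nb v m) ↔ (S.Nb m v ∧ S.Nb v k) :=
      ⟨fun hh => ⟨S.symm hh.2, S.symm hh.1⟩, fun hh => ⟨S.symm hh.2, S.symm hh.1⟩⟩
    simp only [this]
    split_ifs <;> simp
  · intro l t h1 h2 h3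
    have h5 := congrArg op (hD l t h1 h2 h3)
    rw [Finset.op_sum, op_zero] at h5
    refine Eq.trans ?_ h5
    apply Finset.sum_congr rfl
    intro v _
    split_ifs <;> simp
end op

variable {F : Type*} [Field F]

/-- deconcatenation operator -/
def Dop (F : Type*) [Field F] (v : V) : Module.End F (List V → F) where
  toFun x l := x (v :: l)
  map_add' _ _ := rfl
  map_smul' _ _ := rfl

noncomputable def wv (F : Type*) [Field F] (b : V) : V → List V → F
  | v, [] => if v = b then 1 else 0
  | v, (l :: r) => if S.Nb l v ∧ S.ht l < S.ht v then (S.eta l v : F) * wv F b l r else 0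

structure Good (b : V) (h : ℕ) (M : V → Submodule F (List V → F)) (a : V → V → Module.End F (List V → F)) :
    Prop where
  g1 : ∀ k v, S.Nb k v → S.ht k < h → S.ht v < h → ∀ x ∈ M v, a k v x ∈ M k
  g2 : ∀ k m, k ≠ m → S.ht k < h → S.ht m < h →
    (∀ v, S.Nb k v → S.Nb v m → S.ht v < h) → ∀ x ∈ M m,
    (∑ v : V, (if S.Nb k v ∧ S.Nb v m then a k v * a v m else 0)) x = 0
  g3 : ∀ l t, S.Nb l t → S.ht l < S.ht t → S.ht t < h → ∀ x ∈ M l,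
    (∑ v : V, (if S.Nb l v ∧ ¬ S.has v (S.upArc l t) then a l v * a v l else 0)) x = 0
  g4 : ∀ k v, S.Nb k v → S.ht k < S.ht v → S.ht v < h → a k v = Dop F k
  g5 : ∀ k v, S.Nb k v → S.ht v < S.ht k → S.ht k < h → ∀ x, a k v x [] = (S.eta v k : F) * x []
  g6 : ∀ v, S.ht v < h → S.wv F b v ∈ M v

section ring
variable {b : V} {h : ℕ} {M : V → Submodule F (List V → F)} {a : V → V → Module.End F (List V → F)}

/-- total space below height h -/
def Tot (h : ℕ) (M : V → Submodule F (List V → F)) : Submodule F (V → List V → F) where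
  carrier := {f | ∀ v, (S.ht v < h → f v ∈ M v) ∧ (h ≤ S.ht v → f v = 0)}
  add_mem' := by
    intro f g hf hg v
    refine ⟨fun hh => (M v).add_mem ((hf v).1 hh) ((hg v).1 hh), fun hh => ?_⟩
    simp [(hf v).2 hh, (hg v).2 hh]
  zero_mem' := by
    intro v
    exact ⟨fun _ => (M v).zero_mem, fun _ => rfl⟩
  smul_mem' := by
    intro c f hf v
    refine ⟨fun hh => (M v).smul_mem c ((hf v).1 hh), fun hh => ?_⟩
    simp [(hf v).2 hh]

theorem single_mem_Tot {k : V} (hk : S.ht k < h) {x : List V → F} (hx : x ∈ M k) :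
    Pi.single k x ∈ S.Tot h M := by
  intro v
  by_cases hv : v = k
  · subst hv; simp [hx]; omega
  · simp [Pi.single_eq_of_ne hv]

noncomputable def ah (G : S.Good b h M a) (k v : V) : Module.End F (S.Tot h M) :=
  if c : S.Nb k v ∧ S.ht k < h ∧ S.ht v < h then
    LinearMap.restrict ((LinearMap.single F (fun _ => List V → F) k) ∘ₗ (a k v) ∘ₗ (LinearMap.proj v))
      (p := S.Tot h M) (q := S.Tot h M)
      (fun f hf => S.single_mem_Tot c.2.1 (G.g1 k v c.1 c.2.1 c.2.2 _ ((hf v).1 c.2.2)))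
  else 0

theorem ah_apply (G : S.Good b h M a) {k v : V} (c1 : S.Nb k v) (c2 : S.ht k < h) (c3 : S.ht v < h)
    (f : S.Tot h M) : ((S.ah G k v f : S.Tot h M) : V → List V → F) = Pi.single k (a k v (f.1 v)) := by
  unfold ah
  rw [dif_pos ⟨c1, c2, c3⟩]
  rfl

theorem ah2_apply (G : S.Good b h M a) {k v m : V} (c1 : S.Nb k v) (c2 : S.ht k < h) (c3 : S.ht v < h)
    (c4 : S.Nb v m) (c5 : S.ht m < h)
    (f : S.Tot h M) : (((S.ah G k v * S.ah G v m) f : S.Tot h M) : V → List V → F)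
      = Pi.single k ((a k v * a v m) (f.1 m)) := by
  rw [Module.End.mul_apply, ah_apply S G c1 c2 c3, ah_apply S G c4 c3 c5]
  simp

theorem sum_apply' (G : S.Good b h M a) {k m : V} (P : V → Prop) [DecidablePred P] (hk : S.ht k < h) (hm : S.ht m < h)
    (hP : ∀ v, P v → S.Nb k v ∧ S.Nb v m ∧ S.ht v < h) (f : S.Tot h M) :
    (((∑ v : V, (if P v then S.ah G k v * S.ah G v m else 0)) f : S.Tot h M) : V → List V → F)
      = Pi.single k ((∑ v : V, (if P v then a k v * a v m else 0)) (f.1 m)) := by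
  rw [LinearMap.sum_apply, LinearMap.sum_apply, ← LinearMap.single_apply (R := F), map_sum,
    Submodule.coe_sum]
  apply Finset.sum_congr rfl
  intro v _
  by_cases hv : P v
  · obtain ⟨h1, h2, h3⟩ := hP v hv
    rw [if_pos hv, if_pos hv, ah2_apply S G h1 hk h3 h2 hm]
    rfl
  · simp [hv]

theorem ah_HA (G : S.Good b h M a) : S.HA (S.ah G) h := by
  intro k m h1 h2 h3 h4
  ext f : 2
  rw [sum_apply' S G (fun v => S.Nb k v ∧ S.Nb v m) h2 h3 (fun v hv => ⟨hv.1, hv.2, h4 v hv.1 hv.2⟩) f,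
    G.g2 k m h1 h2 h3 h4 _ ((f.2 m).1 h3)]
  simp

theorem ah_HD (G : S.Good b h M a) : S.HD (S.ah G) h := by
  intro l t h1 h2 h3
  ext f : 2
  rw [sum_apply' S G (fun v => S.Nb l v ∧ ¬ S.has v (S.upArc l t)) (h2.trans h3) (h2.trans h3)
    (fun v hv => ⟨hv.1, S.symm hv.1, ?_⟩) f,
    G.g3 l t h1 h2 h3 _ ((f.2 l).1 (h2.trans h3))]
  · simp
  · by_cases hvt : v = t
    · subst hvt; exact h3
    · exact (S.ua3 h1 h2 hv.1 hv.2 hvt).trans h3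

theorem T_apply (G : S.Good b h M a) {m v l : V} (hm : S.ht m = h) (hv : S.ht v < h) (hl : S.ht l < h)
    (hvm : S.Nb v m) (hlm : S.Nb l m) (f : S.Tot h M) :
    ((S.T (S.ah G) m v l f : S.Tot h M) : V → List V → F) = Pi.single v (S.T a m v l (f.1 l)) := by
  unfold T
  by_cases hvl : v = l
  · subst hvl
    simp only [if_true, LinearMap.neg_apply, Submodule.coe_neg]
    rw [sum_apply' S G (fun r => S.Nb v r ∧ ¬ S.has r (S.upArc v m) ∧ r ≠ m) hv hv
      (fun r hr => ⟨hr.1, S.symm hr.1, by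
        have := S.ua3 hlm (by omega) hr.1 hr.2.1 hr.2.2; omega⟩) f, ← Pi.single_neg]
  · simp only [if_neg hvl, LinearMap.neg_apply, Submodule.coe_neg]
    rw [sum_apply' S G (fun r => S.Nb v r ∧ S.Nb r l ∧ r ≠ m) hv hl
      (fun r hr => ⟨hr.1, hr.2.1, by
        have := S.top1 hvm hlm (by omega) (by omega) hvl hr.1 hr.2.1 hr.2.2; omega⟩) f, ← Pi.single_neg]

theorem T_mem (G : S.Good b h M a) {m v l : V} (hm : S.ht m = h) (hv : S.ht v < h) (hl : S.ht l < h)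
    (hvm : S.Nb v m) (hlm : S.Nb l m) {x : List V → F} (hx : x ∈ M l) : S.T a m v l x ∈ M v := by
  have h1 := T_apply S G hm hv hl hvm hlm ⟨Pi.single l x, S.single_mem_Tot hl hx⟩
  have h2 := ((S.T (S.ah G) m v l ⟨Pi.single l x, S.single_mem_Tot hl hx⟩).2 v).1 hv
  rw [h1] at h2
  simpa using h2

theorem cubicL (G : S.Good b h M a) {m k l : V} (hm : S.ht m = h) (hk : S.ht k < h)
    (hR : ∀ r, S.Nb k r → S.Nb r m → S.ht r < h) (hml : S.Nb l m) (hl : S.ht l < h)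
    {x : List V → F} (hx : x ∈ M l) :
    (∑ v : V, (if S.Nb k v ∧ S.Nb v m then a k v * S.T a m v l else 0)) x = 0 := by
  have h1 := S.cubic (S.ah G) h (S.ah_HA G) (S.ah_HD G) hm hk hR hml hl
  have h2 := congrArg (fun z => ((z ⟨Pi.single l x, S.single_mem_Tot hl hx⟩ : S.Tot h M) : V → List V → F) k) h1
  simp only [LinearMap.sum_apply, Submodule.coe_sum, Finset.sum_apply, LinearMap.zero_apply, Submodule.coe_zero, Pi.zero_apply] at h2 ⊢
  refine Eq.trans ?_ h2
  apply Finset.sum_congr rfl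
  intro v _
  by_cases hv : S.Nb k v ∧ S.Nb v m
  · have h3 := hR v hv.1 hv.2
    rw [if_pos hv, if_pos hv, Module.End.mul_apply, Module.End.mul_apply, ah_apply S G hv.1 hk h3,
      T_apply S G hm h3 hl hv.2 hml]
    simp
  · simp [hv]

theorem cubicR (G : S.Good b h M a) {m k l : V} (hm : S.ht m = h) (hk : S.ht k < h)
    (hR : ∀ r, S.Nb k r → S.Nb r m → S.ht r < h) (hml : S.Nb l m) (hl : S.ht l < h)
    {x : List V → F} (hx : x ∈ M k) :
    (∑ v : V, (if S.Nb k v ∧ S.Nb v m then S.T a m l v * a v k else 0)) x = 0 := by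
  have h1 := S.cubic_op (S.ah G) h (S.ah_HA G) (S.ah_HD G) hm hk hR hml hl
  have h2 := congrArg (fun z => ((z ⟨Pi.single k x, S.single_mem_Tot hk hx⟩ : S.Tot h M) : V → List V → F) l) h1
  simp only [LinearMap.sum_apply, Submodule.coe_sum, Finset.sum_apply, LinearMap.zero_apply, Submodule.coe_zero, Pi.zero_apply] at h2 ⊢
  refine Eq.trans ?_ h2
  apply Finset.sum_congr rfl
  intro v _
  by_cases hv : S.Nb k v ∧ S.Nb v m
  · have h3 := hR v hv.1 hv.2
    rw [if_pos hv, if_pos hv, Module.End.mul_apply, Module.End.mul_apply, T_apply S G hm hl h3 hml hv.2,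
      ah_apply S G (S.symm hv.1) h3 hk]
    simp
  · simp [hv]

end ring
end Sys
end Kh

set_option linter.unusedSectionVars false
namespace Kh
namespace Sys
variable {V Arc : Type} [Fintype V] (S : Sys V Arc)
variable {F : Type*} [Field F]

/-- the raising operator `M_v → M_m` -/
noncomputable def Uop (a : V → V → Module.End F (List V → F)) (m v : V) :
    Module.End F (List V → F) where
  toFun x l := match l with
    | [] => (S.eta v m : F) * x []
    | c :: r => if S.Nb c m ∧ S.ht c < S.ht m then (S.T a m c v x) r else 0
  map_add' x y := by
    ext l
    match l with
    | [] => simp [mul_add]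
    | c :: r => by_cases hc : S.Nb c m ∧ S.ht c < S.ht m <;> simp [hc]
  map_smul' t x := by
    ext l
    match l with
    | [] => simp only [Pi.smul_apply, smul_eq_mul, RingHom.id_apply]; ring
    | c :: r => by_cases hc : S.Nb c m ∧ S.ht c < S.ht m <;> simp [hc]

theorem D_Uop (a : V → V → Module.End F (List V → F)) {m v c : V} (hc : S.Nb c m) (hc' : S.ht c < S.ht m) :
    Dop F c * S.Uop a m v = S.T a m c v := by
  ext x r
  change (if S.Nb c m ∧ S.ht c < S.ht m then (S.T a m c v x) r else 0) = _
  rw [if_pos ⟨hc, hc'⟩]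

def Mtop (h : ℕ) (M : V → Submodule F (List V → F)) (a : V → V → Module.End F (List V → F)) (m : V) :
    Submodule F (List V → F) where
  carrier := {x | (∀ c, S.Nb c m → S.ht c < S.ht m → Dop F c x ∈ M c) ∧
    ∀ k, S.ht k < h → (∀ v, S.Nb k v → S.Nb v m → S.ht v < h) →
      (∑ v : V, (if S.Nb k v ∧ S.Nb v m then a k v * Dop F v else 0)) x = 0}
  add_mem' := by
    rintro x y ⟨h1, h2⟩ ⟨h3, h4⟩
    refine ⟨fun c hc hc' => ?_, fun k hk hk' => ?_⟩
    · rw [map_add]; exact (M c).add_mem (h1 c hc hc') (h3 c hc hc')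
    · rw [map_add, h2 k hk hk', h4 k hk hk', add_zero]
  zero_mem' := by
    refine ⟨fun c _ _ => ?_, fun k _ _ => ?_⟩
    · rw [map_zero]; exact (M c).zero_mem
    · rw [map_zero]
  smul_mem' := by
    rintro t x ⟨h1, h2⟩
    refine ⟨fun c hc hc' => ?_, fun k hk hk' => ?_⟩
    · rw [map_smul]; exact (M c).smul_mem _ (h1 c hc hc')
    · rw [map_smul, h2 k hk hk', smul_zero]

theorem Dop_wv {b k v : V} (h1 : S.Nb k v) (h2 : S.ht k < S.ht v) :
    Dop F k (S.wv F b v) = (S.eta k v : F) • S.wv F b k := by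
  ext l
  change S.wv F b v (k :: l) = _
  simp [wv, h1, h2]

theorem good_step {b : V} {h : ℕ} {M : V → Submodule F (List V → F)}
    {a : V → V → Module.End F (List V → F)} (G : S.Good b h M a) :
    ∃ M' a', S.Good b (h+1) (F := F) M' a' := by
  set M' : V → Submodule F (List V → F) := fun v => if S.ht v = h then S.Mtop h M a v else M v with hM'
  set a' : V → V → Module.End F (List V → F) := fun k v =>
    if S.ht k < h ∧ S.ht v < h then a k v else if S.ht k < S.ht v then Dop F k else S.Uop a k v with ha'
  have M1 : ∀ v, S.ht v < h → M' v = M v := fun v hv => by simp only [hM']; rw [if_neg (by omega)]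
  have M2 : ∀ v, S.ht v = h → M' v = S.Mtop h M a v := fun v hv => by simp only [hM']; rw [if_pos hv]
  have A1 : ∀ k v, S.ht k < h → S.ht v < h → a' k v = a k v := fun k v h1 h2 => by
    simp only [ha']; rw [if_pos ⟨h1, h2⟩]
  have A2 : ∀ k v, S.ht k < h → S.ht v = h → a' k v = Dop F k := fun k v h1 h2 => by
    simp only [ha']; rw [if_neg (by omega), if_pos (by omega)]
  have A3 : ∀ k v, S.ht k = h → S.ht v < h → a' k v = S.Uop a k v := fun k v h1 h2 => by
    simp only [ha']; rw [if_neg (by omega), if_neg (by omega)]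
  refine ⟨M', a', ?_, ?_, ?_, ?_, ?_, ?_⟩
  · -- g1
    intro k v hkv hk hv x hx
    have hne := S.hne hkv
    rcases Nat.lt_succ_iff_lt_or_eq.1 hk with hk | hk <;> rcases Nat.lt_succ_iff_lt_or_eq.1 hv with hv | hv
    · rw [A1 k v hk hv, M1 k hk]; rw [M1 v hv] at hx; exact G.g1 k v hkv hk hv x hx
    · rw [A2 k v hk hv, M1 k hk]; rw [M2 v hv] at hx; exact hx.1 k hkv (by omega)
    · rw [A3 k v hk hv, M2 k hk]; rw [M1 v hv] at hx
      constructor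
      · intro c hc hc'
        rw [← Module.End.mul_apply, D_Uop S a hc hc']
        exact S.T_mem G hk (by omega) hv hc (S.symm hkv) hx
      · intro κ hκ hR
        refine Eq.trans ?_ (S.cubicL G hk hκ hR (S.symm hkv) hv hx)
        rw [LinearMap.sum_apply, LinearMap.sum_apply]
        apply Finset.sum_congr rfl
        intro w _
        by_cases hw : S.Nb κ w ∧ S.Nb w k
        · rw [if_pos hw, if_pos hw, ← D_Uop S a hw.2 (by have := hR w hw.1 hw.2; omega)]
          rfl
        · simp [hw]
    · omega
  · -- g2
    intro k m hkm hk hm hR x hx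
    have hz : (∀ v, S.Nb k v → S.Nb v m → False) →
        (∑ v : V, (if S.Nb k v ∧ S.Nb v m then a' k v * a' v m else 0)) x = 0 := by
      intro hh
      rw [Finset.sum_eq_zero]
      · rfl
      · intro v _
        rw [if_neg]; rintro ⟨h1, h2⟩; exact hh v h1 h2
    rcases Nat.lt_succ_iff_lt_or_eq.1 hk with hk | hk <;> rcases Nat.lt_succ_iff_lt_or_eq.1 hm with hm | hm
    · rw [M1 m hm] at hx
      by_cases hall : ∀ v, S.Nb k v → S.Nb v m → S.ht v < h
      · refine Eq.trans ?_ (G.g2 k m hkm hk hm hall x hx)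
        congr 1
        apply Finset.sum_congr rfl
        intro v _
        by_cases hv : S.Nb k v ∧ S.Nb v m
        · have := hall v hv.1 hv.2
          rw [if_pos hv, if_pos hv, A1 k v hk this, A1 v m this hm]
        · simp [hv]
      · push Not at hall
        obtain ⟨t, ht1, ht2, ht3⟩ := hall
        have ht4 : S.ht t = h := by have := hR t ht1 ht2; omega
        have key : ∀ v, (if S.Nb k v ∧ S.Nb v m then a' k v * a' v m else 0)
          = (if v = t then S.T a t k m else 0) +
            (if S.Nb k v ∧ S.Nb v m ∧ v ≠ t then a k v * a v m else 0) := by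
          intro v
          by_cases hv : v = t
          · subst hv
            simp only [ht1, ht2, and_self, if_true, ne_eq, not_true, and_false, if_false, add_zero]
            rw [A2 k v hk ht4, A3 v m ht4 hm, D_Uop S a ht1 (by omega)]
          · by_cases hv2 : S.Nb k v ∧ S.Nb v m
            · have := S.top1 ht1 (S.symm ht2) (by omega) (by omega) hkm hv2.1 hv2.2 hv
              rw [if_pos hv2, if_neg hv, if_pos ⟨hv2.1, hv2.2, hv⟩, A1 k v hk (by omega), A1 v m (by omega) hm,
                zero_add]
            · rw [if_neg hv2, if_neg hv, if_neg (fun hh => hv2 ⟨hh.1, hh.2.1⟩), zero_add]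
        simp only [key]
        rw [Finset.sum_add_distrib, T, if_neg hkm]
        simp only [Finset.sum_ite_eq', Finset.mem_univ, if_true]
        rw [neg_add_cancel]; rfl
    · -- m at height h
      by_cases hv : ∀ v, S.Nb k v → S.Nb v m → False
      · exact hz hv
      · have hR' : ∀ v, S.Nb k v → S.Nb v m → S.ht v < h := by
          intro v h1 h2
          have := hR v h1 h2; have := S.hne h2; omega
        rw [M2 m hm] at hx
        refine Eq.trans ?_ (hx.2 k hk hR')
        congr 1
        apply Finset.sum_congr rfl
        intro v _
        by_cases hv : S.Nb k v ∧ S.Nb v m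
        · have := hR' v hv.1 hv.2
          rw [if_pos hv, if_pos hv, A1 k v hk this, A2 v m this hm]
        · simp [hv]
    · -- k at height h
      have hR' : ∀ v, S.Nb m v → S.Nb v k → S.ht v < h := by
        intro v h1 h2
        have := hR v (S.symm h2) (S.symm h1); have := S.hne h2; omega
      rw [M1 m hm] at hx
      have e0 : (∑ v : V, (if S.Nb k v ∧ S.Nb v m then a' k v * a' v m else 0)) x
        = ∑ v : V, (if S.Nb m v ∧ S.Nb v k then S.Uop a k v (a v m x) else 0) := by
        rw [LinearMap.sum_apply]
        apply Finset.sum_congr rfl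
        intro v _
        by_cases hv : S.Nb m v ∧ S.Nb v k
        · have := hR' v hv.1 hv.2
          rw [if_pos hv, if_pos ⟨S.symm hv.2, S.symm hv.1⟩, A3 k v hk this, A1 v m this hm]; rfl
        · rw [if_neg hv, if_neg (fun hh => hv ⟨S.symm hh.2, S.symm hh.1⟩)]; rfl
      rw [e0]
      ext l
      match l with
      | [] =>
        have s1 := S.sgn (k := m) (m := k) (by omega) (Ne.symm hkm) (by rw [hk]; exact hR')
        have s2 := congrArg (fun z : ℤ => (z : F) * x []) s1
        simp only [Int.cast_zero, zero_mul, Int.cast_sum, Finset.sum_mul] at s2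
        refine Eq.trans ?_ s2
        rw [Finset.sum_apply]
        apply Finset.sum_congr rfl
        intro v _
        by_cases hv : S.Nb m v ∧ S.Nb v k
        · have h3 := hR' v hv.1 hv.2
          rw [if_pos hv]
          change (S.eta v k : F) * (a v m x []) = _
          rcases lt_or_gt_of_ne (S.hne hv.1) with h4 | h4
          · rw [if_pos ⟨hv.1, hv.2, h4⟩, G.g5 v m (S.symm hv.1) h4 h3]
            push_cast; ring
          · rw [if_neg (fun hh => by omega), S.sg0 hv.1 hv.2 h4 (by omega)]
            simp
        · rw [if_neg hv, if_neg (fun hh => hv ⟨hh.1, hh.2.1⟩)]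
          simp
      | c :: r =>
        rw [Finset.sum_apply]
        by_cases hc : S.Nb c k ∧ S.ht c < S.ht k
        · have := congrFun (S.cubicR G hk hm hR' hc.1 (by omega) hx) r
          refine Eq.trans ?_ this
          rw [LinearMap.sum_apply, Finset.sum_apply]
          apply Finset.sum_congr rfl
          intro v _
          by_cases hv : S.Nb m v ∧ S.Nb v k
          · rw [if_pos hv, if_pos hv]
            change (if S.Nb c k ∧ S.ht c < S.ht k then (S.T a k c v (a v m x)) r else 0) = _
            rw [if_pos hc]; rfl
          · rw [if_neg hv, if_neg hv]; rfl
        · apply Finset.sum_eq_zero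
          intro v _
          by_cases hv : S.Nb m v ∧ S.Nb v k
          · rw [if_pos hv]
            change (if S.Nb c k ∧ S.ht c < S.ht k then (S.T a k c v (a v m x)) r else 0) = _
            rw [if_neg hc]
          · rw [if_neg hv]; rfl
    · apply hz
      intro v h1 h2
      have h3 := hR v h1 h2
      have h4 := S.hne h1
      obtain ⟨t, ht1, ht2, ht3⟩ := S.eqht hkm (by omega) h1 h2 (by omega)
      have := hR t ht1 ht2
      omega
  · -- g3
    intro l t hlt hl ht x hx
    have hw : ∀ v, S.Nb l v → ¬ S.has v (S.upArc l t) → v ≠ t → S.ht v < S.ht t :=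
      fun v h1 h2 h3 => S.ua3 hlt hl h1 h2 h3
    rcases Nat.lt_succ_iff_lt_or_eq.1 ht with ht | ht
    · rw [M1 l (by omega)] at hx
      refine Eq.trans ?_ (G.g3 l t hlt hl ht x hx)
      congr 1
      apply Finset.sum_congr rfl
      intro v _
      by_cases hv : S.Nb l v ∧ ¬ S.has v (S.upArc l t)
      · have : S.ht v < h := by
          by_cases h3 : v = t
          · subst h3; exact ht
          · exact (hw v hv.1 hv.2 h3).trans ht
        rw [if_pos hv, if_pos hv, A1 l v (by omega) this, A1 v l this (by omega)]
      · rw [if_neg hv, if_neg hv]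
    · have key : ∀ v, (if S.Nb l v ∧ ¬ S.has v (S.upArc l t) then a' l v * a' v l else 0)
          = (if v = t then S.T a t l l else 0) +
            (if S.Nb l v ∧ ¬ S.has v (S.upArc l t) ∧ v ≠ t then a l v * a v l else 0) := by
        intro v
        by_cases hv : v = t
        · subst hv
          rw [if_pos ⟨hlt, S.ua2 hlt hl⟩, if_pos rfl, if_neg (by tauto), add_zero,
            A2 l v (by omega) ht, A3 v l ht (by omega), D_Uop S a hlt hl]
        · by_cases hv2 : S.Nb l v ∧ ¬ S.has v (S.upArc l t)
          · have := hw v hv2.1 hv2.2 hv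
            rw [if_pos hv2, if_neg hv, if_pos ⟨hv2.1, hv2.2, hv⟩, A1 l v (by omega) (by omega), A1 v l (by omega) (by omega),
                zero_add]
          · rw [if_neg hv2, if_neg hv, if_neg (fun hh => hv2 ⟨hh.1, hh.2.1⟩), zero_add]
      simp only [key]
      rw [Finset.sum_add_distrib, T, if_pos rfl]
      simp only [Finset.sum_ite_eq', Finset.mem_univ, if_true]
      rw [neg_add_cancel]; rfl
  · intro k v hkv h1 h2
    rcases Nat.lt_succ_iff_lt_or_eq.1 h2 with h2 | h2
    · rw [A1 k v (by omega) h2]; exact G.g4 k v hkv h1 h2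
    · exact A2 k v (by omega) h2
  · intro k v hkv h1 h2 x
    rcases Nat.lt_succ_iff_lt_or_eq.1 h2 with h2 | h2
    · rw [A1 k v h2 (by omega)]; exact G.g5 k v hkv h1 h2 x
    · rw [A3 k v h2 (by omega)]; rfl
  · intro v hv
    rcases Nat.lt_succ_iff_lt_or_eq.1 hv with hv | hv
    · rw [M1 v hv]; exact G.g6 v hv
    · rw [M2 v hv]
      constructor
      · intro c hc hc'
        rw [Dop_wv S hc hc']
        exact (M c).smul_mem _ (G.g6 c (by omega))
      · intro k hk hR
        have s1 := S.sgn (k := k) (m := v) (by omega) (by rintro rfl; omega) (by rw [hv]; exact hR)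
        have s2 := congrArg (fun z : ℤ => (z : F) • S.wv F b k) s1
        simp only [Int.cast_zero, zero_smul, Int.cast_sum, Finset.sum_smul] at s2
        refine Eq.trans ?_ s2
        rw [LinearMap.sum_apply]
        apply Finset.sum_congr rfl
        intro w _
        by_cases hw : S.Nb k w ∧ S.Nb w v
        · have h3 := hR w hw.1 hw.2
          rw [if_pos hw, Module.End.mul_apply, Dop_wv S hw.2 (by omega), map_smul]
          rcases lt_or_gt_of_ne (S.hne hw.1) with h4 | h4
          · rw [if_pos ⟨hw.1, hw.2, h4⟩, G.g4 k w hw.1 h4 h3, Dop_wv S hw.1 h4, smul_smul]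
            push_cast; rw [mul_comm]
          · rw [if_neg (fun hh => by omega), S.sg0 hw.1 hw.2 h4 (by omega)]
            simp
        · rw [if_neg hw, if_neg (fun hh => hw ⟨hh.1, hh.2.1⟩)]
          simp

theorem good_exists (b : V) (h : ℕ) : ∃ M a, S.Good (F := F) b h M a := by
  induction h with
  | zero =>
    refine ⟨fun _ => ⊥, fun _ _ => 0, ?_, ?_, ?_, ?_, ?_, ?_⟩ <;> intros <;> omega
  | succ h ih =>
    obtain ⟨M, a, G⟩ := ih
    exact S.good_step G

end Sys
end Kh

namespace Kh

/-! ### Order patterns of finitely many distinct naturals -/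

def ltl {k : ℕ} (l : List ℕ) (i j : Fin k) : Bool := decide (l.getD i.val 0 < l.getD j.val 0)

theorem rankd (k : ℕ) (Q : (Fin k → Fin k → Bool) → Prop)
    (hQ : ∀ l ∈ (List.range k).permutations', Q (ltl l)) (p : Fin k → ℕ)
    (hp : Function.Injective p) : Q (fun i j => decide (p i < p j)) := by
  set rk : Fin k → ℕ := fun i => (Finset.univ.filter (fun j => p j < p i)).card with hrk
  have hlt : ∀ i j, p i < p j → rk i < rk j := by
    intro i j hij
    apply Finset.card_lt_card
    rw [Finset.ssubset_iff_of_subset]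
    · exact ⟨i, by simpa using hij, by simp⟩
    · intro t ht
      simp only [Finset.mem_filter, Finset.mem_univ, true_and] at ht ⊢
      omega
  have hiff : ∀ i j, p i < p j ↔ rk i < rk j := by
    intro i j
    refine ⟨hlt i j, fun h => ?_⟩
    by_contra hc
    rcases lt_or_eq_of_le (not_lt.mp hc) with h' | h'
    · have := hlt _ _ h'; omega
    · have : i = j := hp h'.symm
      subst this; omega
  have hinj : Function.Injective rk := by
    intro i j hij
    by_contra hne
    rcases lt_or_gt_of_ne (fun h => hne (hp h)) with h | h
    · have := hlt _ _ h; omega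
    · have := hlt _ _ h; omega
  have hb : ∀ i, rk i < k := by
    intro i
    have : rk i < (Finset.univ : Finset (Fin k)).card := by
      apply Finset.card_lt_card
      rw [Finset.ssubset_iff_of_subset (Finset.subset_univ _)]
      exact ⟨i, Finset.mem_univ _, by simp⟩
    simpa using this
  have hperm : (List.ofFn rk).Perm (List.range k) := by
    apply List.Subperm.perm_of_length_le
    · apply List.subperm_of_subset
      · exact List.nodup_ofFn.mpr hinj
      · intro t ht
        rw [List.mem_ofFn] at ht
        obtain ⟨i, rfl⟩ := ht
        exact List.mem_range.mpr (hb i)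
    · simp
  have := hQ (List.ofFn rk) (List.mem_permutations'.mpr hperm)
  convert this using 3 with i j
  unfold ltl
  congr 1
  rw [hiff]
  simp [List.getD]

def Sb {k : ℕ} (lt : Fin k → Fin k → Bool) (x y z : Fin k) : Bool := xor (lt x z) (lt y z)

def SS (x y z : ℕ) : Bool := xor (decide (x < z)) (decide (y < z))

variable {M : ℕ}
def px (a : Fin M) : ℕ := 2 * a.val
def py (a : Fin M) : ℕ := 2 * a.val + 1

theorem px_inj {a b : Fin M} : px a = px b ↔ a = b := by
  unfold px; constructor
  · intro h; ext; omega
  · rintro rfl; rfl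
theorem py_inj {a b : Fin M} : py a = py b ↔ a = b := by
  unfold py; constructor
  · intro h; ext; omega
  · rintro rfl; rfl
theorem px_ne_py (a b : Fin M) : px a ≠ py b := by unfold px py; omega

theorem inj4 {a b a' b' : Fin M} (h : a ≠ b) (h' : a' ≠ b') :
    Function.Injective ![px a, py a', px b, py b'] := by
  intro i j hij
  have e1 : px a ≠ px b := fun e => h (px_inj.mp e)
  have e2 : py a' ≠ py b' := fun e => h' (py_inj.mp e)
  have k1 := px_ne_py a a'
  have k2 := px_ne_py a b'
  have k3 := px_ne_py b a'
  have k4 := px_ne_py b b'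
  fin_cases i <;> fin_cases j <;> simp at hij ⊢ <;> omega

theorem inj6 {a b c a' b' c' : Fin M} (h : a ≠ b) (h2 : a ≠ c) (h3 : b ≠ c)
    (h' : a' ≠ b') (h2' : a' ≠ c') (h3' : b' ≠ c') :
    Function.Injective ![px a, py a', px b, py b', px c, py c'] := by
  intro i j hij
  have e1 : px a ≠ px b := fun e => h (px_inj.mp e)
  have e2 : py a' ≠ py b' := fun e => h' (py_inj.mp e)
  have e3 : px a ≠ px c := fun e => h2 (px_inj.mp e)
  have e4 : py a' ≠ py c' := fun e => h2' (py_inj.mp e)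
  have e5 : px b ≠ px c := fun e => h3 (px_inj.mp e)
  have e6 : py b' ≠ py c' := fun e => h3' (py_inj.mp e)
  have k1 := px_ne_py a a'
  have k2 := px_ne_py a b'
  have k3 := px_ne_py b a'
  have k4 := px_ne_py b b'
  have k5 := px_ne_py a c'
  have k6 := px_ne_py b c'
  have k7 := px_ne_py c a'
  have k8 := px_ne_py c b'
  have k9 := px_ne_py c c'
  fin_cases i <;> fin_cases j <;> simp at hij ⊢ <;> omega

section facts
variable {a b c a' b' c' : Fin M}

theorem f4_anti (h : a ≠ b) (h' : a' ≠ b') :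
    SS (px a) (py a') (px b) = SS (px a) (py a') (py b') →
    ¬ (SS (px a) (py a') (px b) = true ∧ SS (px b) (py b') (px a) = true) :=
  rankd 4 (fun lt => Sb lt 0 1 2 = Sb lt 0 1 3 → ¬ (Sb lt 0 1 2 = true ∧ Sb lt 2 3 0 = true))
    (by decide +kernel) _ (inj4 h h')

theorem f4_sep (h : a ≠ b) (h' : a' ≠ b') :
    SS (px a) (py a') (px b) = SS (px a) (py a') (py b') →
    SS (px a) (py a') (px b) = false → SS (px b) (py b') (px a) = false →
    (decide (px a < px b) = true ∧ decide (px a < py b') = true ∧ decide (py a' < px b) = true ∧ decide (py a' < py b') = true) ∨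
    (decide (px b < px a) = true ∧ decide (px b < py a') = true ∧ decide (py b' < px a) = true ∧ decide (py b' < py a') = true) :=
  rankd 4 (fun lt => Sb lt 0 1 2 = Sb lt 0 1 3 → Sb lt 0 1 2 = false → Sb lt 2 3 0 = false →
    (lt 0 2 = true ∧ lt 0 3 = true ∧ lt 1 2 = true ∧ lt 1 3 = true) ∨
    (lt 2 0 = true ∧ lt 2 1 = true ∧ lt 3 0 = true ∧ lt 3 1 = true))
    (by decide +kernel) _ (inj4 h h')

theorem f4_Q1 (h : a ≠ b) (h' : a' ≠ b') :
    SS (px a) (py a') (px b) = SS (px a) (py a') (py b') →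
    SS (px a) (py b') (px b) = SS (px a) (py b') (py a') →
    SS (px a) (py a') (px b) = true →
    (decide (px a < py b') = true ∧ decide (py b' < px b) = true ∧ decide (px b < py a') = true) ∨
    (decide (py a' < px b) = true ∧ decide (px b < py b') = true ∧ decide (py b' < px a) = true) :=
  rankd 4 (fun lt => Sb lt 0 1 2 = Sb lt 0 1 3 → Sb lt 0 3 2 = Sb lt 0 3 1 → Sb lt 0 1 2 = true →
    (lt 0 3 = true ∧ lt 3 2 = true ∧ lt 2 1 = true) ∨
    (lt 1 2 = true ∧ lt 2 3 = true ∧ lt 3 0 = true))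
    (by decide +kernel) _ (inj4 h h')

/-- exactly one of the two pairings is nested -/
theorem f4_Q (h : a ≠ b) (h' : a' ≠ b') :
    SS (px a) (py a') (px b) = SS (px a) (py a') (py b') →
    SS (px a) (py b') (px b) = SS (px a) (py b') (py a') →
    xor (xor (SS (px a) (py a') (px b)) (SS (px b) (py b') (px a)))
    (xor (SS (px a) (py b') (px b)) (SS (px b) (py a') (px a))) = true :=
  rankd 4 (fun lt => Sb lt 0 1 2 = Sb lt 0 1 3 → Sb lt 0 3 2 = Sb lt 0 3 1 →
    xor (xor (Sb lt 0 1 2) (Sb lt 2 3 0)) (xor (Sb lt 0 3 2) (Sb lt 2 1 0)) = true)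
    (by decide +kernel) _ (inj4 h h')

end facts
end Kh

namespace Kh
variable {M : ℕ}
open Equiv (swap Perm)

def sS (π : Perm (Fin M)) (a : Fin M) (z : ℕ) : Bool := SS (px a) (py (π a)) z
def NC (π : Perm (Fin M)) : Prop := ∀ a b, a ≠ b → sS π a (px b) = sS π a (py (π b))
def Ins (π : Perm (Fin M)) (a b : Fin M) : Prop := sS π a (px b) = true
def Un (π : Perm (Fin M)) (a b : Fin M) : Prop := ¬ Ins π a b ∧ ¬ Ins π b a

theorem Un.symm {π : Perm (Fin M)} {a b : Fin M} (h : Un π a b) : Un π b a := ⟨h.2, h.1⟩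

theorem SS_true {x y z : ℕ} : SS x y z = true ↔ (x < z ∧ z ≤ y) ∨ (y < z ∧ z ≤ x) := by
  unfold SS
  by_cases h1 : x < z <;> by_cases h2 : y < z <;> simp [h1, h2] <;> omega

theorem SS_false {x y z : ℕ} : SS x y z = false ↔ (x < z ∧ y < z) ∨ (z ≤ x ∧ z ≤ y) := by
  unfold SS
  by_cases h1 : x < z <;> by_cases h2 : y < z <;> simp [h1, h2] <;> omega

variable {π : Perm (Fin M)} {a b c : Fin M}

theorem ins_anti (h : NC π) (hab : a ≠ b) (h1 : Ins π a b) : ¬ Ins π b a := fun h2 =>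
  f4_anti hab (fun e => hab (π.injective e)) (h a b hab) ⟨h1, h2⟩

theorem not_ins {a b : Fin M} : ¬ Ins π a b ↔ sS π a (px b) = false := by
  unfold Ins; simp

theorem un_sep (h : NC π) (hab : a ≠ b) (hu : Un π a b) :
    (px a < px b ∧ px a < py (π b) ∧ py (π a) < px b ∧ py (π a) < py (π b)) ∨
    (px b < px a ∧ px b < py (π a) ∧ py (π b) < px a ∧ py (π b) < py (π a)) := by
  have := f4_sep hab (fun e => hab (π.injective e)) (h a b hab) (not_ins.mp hu.1) (not_ins.mp hu.2)
  simpa using this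

theorem un_disj (h : NC π) (hab : a ≠ b) (hu : Un π a b) {z : ℕ} (hz : sS π a z = true) :
    sS π b z = false := by
  have := un_sep h hab hu
  unfold sS at *
  rw [SS_true] at hz
  rw [SS_false]
  omega

theorem ins_bd (h : NC π) (hab : a ≠ b) (h1 : Ins π a b) :
    (px a < px b ∧ px b < py (π a) ∧ px a < py (π b) ∧ py (π b) < py (π a)) ∨
    (py (π a) < px b ∧ px b < px a ∧ py (π a) < py (π b) ∧ py (π b) < px a) := by
  have h2 := h a b hab
  have h1' : sS π a (px b) = true := h1
  rw [h1'] at h2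
  have h3 := h2.symm
  unfold sS at h1' h3
  rw [SS_true] at h1' h3
  have k1 : px a ≠ px b := fun e => hab (px_inj.mp e)
  have k2 : py (π a) ≠ py (π b) := fun e => hab (π.injective (py_inj.mp e))
  have k3 := px_ne_py a (π b)
  have k4 := px_ne_py b (π a)
  omega

theorem ins_z (h : NC π) (hab : a ≠ b) (h1 : Ins π a b) {z : ℕ} (hz : sS π b z = true) :
    sS π a z = true := by
  have := ins_bd h hab h1
  unfold sS at *
  rw [SS_true] at *
  omega

theorem ins_trans (h : NC π) (hab : a ≠ b) (h1 : Ins π a b) (h2 : Ins π b c) : Ins π a c :=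
  ins_z h hab h1 h2

theorem swap_mul_of_ne (u : Perm (Fin M)) {f : Fin M} (hf : u f = f) (z : ℕ) :
    sS (π * u) f z = sS π f z := by
  simp [sS, hf]

/-- the star lemma -/
theorem star (h : NC π) {u : Perm (Fin M)} (h' : NC (π * u)) {f i : Fin M} (hf : u f = f)
    (hi : i ≠ f) : sS π f (px i) = sS π f (px (u i)) := by
  have hui : u i ≠ f := fun e => hi (u.injective (e.trans hf.symm))
  have h1 := h f (u i) hui.symm
  have h2 := h' f i hi.symm
  rw [swap_mul_of_ne u hf, swap_mul_of_ne u hf] at h2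
  rw [h2, h1]; rfl

theorem star_ins (h : NC π) {u : Perm (Fin M)} (h' : NC (π * u)) {f i : Fin M} (hf : u f = f)
    (hi : i ≠ f) : Ins π f i ↔ Ins π f (u i) := by
  unfold Ins; rw [star h h' hf hi]

theorem sxor (a b : Fin M) (z : ℕ) :
    xor (sS (π * swap a b) a z) (sS (π * swap a b) b z) = xor (sS π a z) (sS π b z) := by
  simp only [sS, SS, Equiv.Perm.mul_apply, Equiv.swap_apply_left, Equiv.swap_apply_right]
  cases decide (px a < z) <;> cases decide (px b < z) <;> cases decide (py (π a) < z) <;>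
    cases decide (py (π b) < z) <;> rfl

/-! lengths -/
def LL (f : ℕ → ℕ) (π : Perm (Fin M)) : ℕ := ∑ a, Nat.dist (f (px a)) (f (py (π a)))
def len (π : Perm (Fin M)) (a : Fin M) : ℕ := Nat.dist (px a) (py (π a))

theorem len_pos : 0 < len π a := by
  have := px_ne_py a (π a)
  unfold len Nat.dist; omega

theorem LL_swap (f : ℕ → ℕ) (hab : a ≠ b) : LL f (π * swap a b) +
    (Nat.dist (f (px a)) (f (py (π a))) + Nat.dist (f (px b)) (f (py (π b)))) =
    LL f π + (Nat.dist (f (px a)) (f (py (π b))) + Nat.dist (f (px b)) (f (py (π a)))) := by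
  unfold LL
  have e : ∀ g : Fin M → ℕ, ∑ x, g x = g a + (g b + ∑ x ∈ (Finset.univ.erase a).erase b, g x) := by
    intro g
    rw [Finset.add_sum_erase _ _ (by simp [hab.symm]), Finset.add_sum_erase _ _ (Finset.mem_univ a)]
  rw [e, e (fun x => Nat.dist (f (px x)) (f (py (π x))))]
  have : ∑ x ∈ (Finset.univ.erase a).erase b, Nat.dist (f (px x)) (f (py ((π * swap a b) x))) =
    ∑ x ∈ (Finset.univ.erase a).erase b, Nat.dist (f (px x)) (f (py (π x))) := by
    apply Finset.sum_congr rfl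
    intro x hx
    simp only [Finset.mem_erase, Finset.mem_univ, and_true] at hx
    rw [Equiv.Perm.mul_apply, Equiv.swap_apply_of_ne_of_ne hx.2 hx.1]
  rw [this]
  simp only [Equiv.Perm.mul_apply, Equiv.swap_apply_left, Equiv.swap_apply_right]
  omega

theorem ins_order (hab : a ≠ b) (h : NC π) (h' : NC (π * swap a b)) (h1 : Ins π a b) :
    (px a < py (π b) ∧ py (π b) < px b ∧ px b < py (π a)) ∨
    (py (π a) < px b ∧ px b < py (π b) ∧ py (π b) < px a) := by
  have h2 := h' a b hab
  unfold sS at h2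
  simp only [Equiv.Perm.mul_apply, Equiv.swap_apply_left, Equiv.swap_apply_right] at h2
  have := f4_Q1 hab (fun e => hab (π.injective e)) (h a b hab) h2 h1
  simpa using this

theorem LL_ins (f : ℕ → ℕ) (hf : Monotone f) (hab : a ≠ b) (h : NC π) (h' : NC (π * swap a b))
    (h1 : Ins π a b) : LL f π = LL f (π * swap a b) + 2 * Nat.dist (f (px b)) (f (py (π b))) := by
  have h2 := LL_swap (π := π) f hab
  rcases ins_order hab h h' h1 with ⟨k1, k2, k3⟩ | ⟨k1, k2, k3⟩
  · have := hf k1.le; have := hf k2.le; have := hf k3.le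
    unfold Nat.dist at *; omega
  · have := hf k1.le; have := hf k2.le; have := hf k3.le
    unfold Nat.dist at *; omega

def L (π : Perm (Fin M)) : ℕ := LL id π

theorem L_ins (hab : a ≠ b) (h : NC π) (h' : NC (π * swap a b))
    (h1 : Ins π a b) : L π = L (π * swap a b) + 2 * len π b := LL_ins id monotone_id hab h h' h1

theorem len_lt (h : NC π) (hab : a ≠ b) (h1 : Ins π a b) : len π b < len π a := by
  have := ins_bd h hab h1
  unfold len Nat.dist; omega

theorem Qc (hab : a ≠ b) (h : NC π) (h' : NC (π * swap a b)) :
    ((Ins π a b ∨ Ins π b a) ∧ Un (π * swap a b) a b) ∨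
    (Un π a b ∧ (Ins (π * swap a b) a b ∨ Ins (π * swap a b) b a)) := by
  have h2 := h' a b hab
  unfold sS at h2
  simp only [Equiv.Perm.mul_apply, Equiv.swap_apply_left, Equiv.swap_apply_right] at h2
  have h3 := f4_Q hab (fun e => hab (π.injective e)) (h a b hab) h2
  have k1 := ins_anti h hab
  have k2 := ins_anti h' hab
  unfold Un Ins sS at *
  simp only [Equiv.Perm.mul_apply, Equiv.swap_apply_left, Equiv.swap_apply_right] at *
  revert h3 k1 k2
  generalize SS (px a) (py (π a)) (px b) = s1
  generalize SS (px b) (py (π b)) (px a) = s2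
  generalize SS (px a) (py (π b)) (px b) = s3
  generalize SS (px b) (py (π a)) (px a) = s4
  revert s1 s2 s3 s4
  decide

theorem swap_swap (π : Perm (Fin M)) (a b : Fin M) : π * swap a b * swap a b = π := by
  rw [mul_assoc, Equiv.swap_mul_self, mul_one]

theorem L_un (hab : a ≠ b) (h : NC π) (h' : NC (π * swap a b)) (hu : Un π a b) :
    L π < L (π * swap a b) := by
  rcases Qc hab h h' with h1 | ⟨_, h1 | h1⟩
  · exfalso; rcases h1.1 with h2 | h2
    · exact hu.1 h2
    · exact hu.2 h2
  · have := L_ins hab h' (by rwa [swap_swap]) h1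
    rw [swap_swap] at this
    have := len_pos (π := π * swap a b) (a := b)
    omega
  · rw [Equiv.swap_comm] at *
    have := L_ins hab.symm h' (by rwa [swap_swap]) h1
    rw [swap_swap] at this
    have := len_pos (π := π * swap b a) (a := a)
    omega

theorem un_of_L (hab : a ≠ b) (h : NC π) (h' : NC (π * swap a b)) (hL : L π < L (π * swap a b)) :
    Un π a b := by
  rcases Qc hab h h' with ⟨h1 | h1, _⟩ | h1
  · have := L_ins hab h h' h1; omega
  · rw [Equiv.swap_comm] at *
    have := L_ins hab.symm h h' h1; omega
  · exact h1.1

/-- for an edge going up, the outer and inner labels -/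
theorem ins_of_L (hab : a ≠ b) (h : NC π) (h' : NC (π * swap a b)) (hL : L (π * swap a b) < L π) :
    (Ins π a b ∨ Ins π b a) := by
  rcases Qc hab h h' with ⟨h1, _⟩ | h1
  · exact h1
  · have := L_un hab h h' h1.1; omega

theorem un_after (hab : a ≠ b) (h : NC π) (h' : NC (π * swap a b)) (h1 : Ins π a b) :
    Un (π * swap a b) a b := by
  rcases Qc hab h h' with h2 | h2
  · exact h2.2
  · exact absurd h1 h2.1.1

theorem nb_ne (hab : a ≠ b) (h : NC π) (h' : NC (π * swap a b)) : L π ≠ L (π * swap a b) := by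
  rcases Qc hab h h' with ⟨h1 | h1, _⟩ | h1
  · have := L_ins hab h h' h1
    have := len_pos (π := π) (a := b)
    omega
  · rw [Equiv.swap_comm] at *
    have := L_ins hab.symm h h' h1
    have := len_pos (π := π) (a := a)
    omega
  · exact (L_un hab h h' h1.1).ne

/-- uniqueness of the parent -/
theorem F1 {p q : Fin M} (h : NC π) (hpc : p ≠ c) (hqc : q ≠ c) (hp : NC (π * swap p c))
    (hq : NC (π * swap q c)) (h1 : Ins π p c) (h2 : Ins π q c) : p = q := by
  by_contra hne
  have k1 := (star_ins h hq (f := p) (i := c)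
    (Equiv.swap_apply_of_ne_of_ne hne hpc) hpc.symm).mp h1
  have k2 := (star_ins h hp (f := q) (i := c)
    (Equiv.swap_apply_of_ne_of_ne (Ne.symm hne) hqc) hqc.symm).mp h2
  rw [Equiv.swap_apply_right] at k1 k2
  exact ins_anti h hne k1 k2

end Kh

namespace Kh
variable {M : ℕ}
open Equiv (swap Perm)

/-! ### hexagon facts -/
@[reducible] def hNC {P : Type} (s : P → P → P → Bool) (x1 y1 x2 y2 x3 y3 : P) : Prop :=
  s x1 y1 x2 = s x1 y1 y2 ∧ s x1 y1 x3 = s x1 y1 y3 ∧ s x2 y2 x3 = s x2 y2 y3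
@[reducible] def hUn {P : Type} (s : P → P → P → Bool) (x y u v : P) : Prop :=
  s x y u = false ∧ s u v x = false
@[reducible] def hX {P : Type} (s : P → P → P → Bool) (x1 y1 x2 y2 x3 y3 : P) : Prop :=
  s x1 y2 x2 = true ∧ s x1 y2 x3 = true ∧ hUn s x2 y3 x3 y1 ∧ s x1 y3 x3 = true ∧
  s x3 y2 x2 = true ∧ s x2 y1 x3 = true

@[reducible] def H1P {P : Type} (s : P → P → P → Bool) (x1 y1 x2 y2 x3 y3 : P) : Prop :=
  hNC s x1 y1 x2 y2 x3 y3 → hNC s x1 y2 x2 y3 x3 y1 →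
  (hNC s x1 y2 x2 y1 x3 y3 ∨ hNC s x1 y3 x2 y2 x3 y1 ∨ hNC s x1 y1 x2 y3 x3 y2) →
  (hNC s x1 y2 x2 y1 x3 y3 → hUn s x1 y1 x2 y2) →
  (hNC s x1 y3 x2 y2 x3 y1 → hUn s x1 y1 x3 y3) →
  (hNC s x1 y1 x2 y3 x3 y2 → hUn s x2 y2 x3 y3) →
  hUn s x1 y1 x2 y2 ∧ hUn s x1 y1 x3 y3 ∧ hUn s x2 y2 x3 y3 ∧
  hNC s x1 y2 x2 y1 x3 y3 ∧ hNC s x1 y3 x2 y2 x3 y1 ∧ hNC s x1 y1 x2 y3 x3 y2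
@[reducible] def H4P {P : Type} (s : P → P → P → Bool) (x1 y1 x2 y2 x3 y3 : P) : Prop :=
  hNC s x1 y1 x2 y2 x3 y3 → hNC s x1 y2 x2 y3 x3 y1 →
  hUn s x1 y1 x2 y2 → hUn s x1 y1 x3 y3 → hUn s x2 y2 x3 y3 →
  hX s x1 y1 x2 y2 x3 y3 ∨ hX s x2 y2 x3 y3 x1 y1 ∨ hX s x3 y3 x1 y1 x2 y2
@[reducible] def H5P {P : Type} (s : P → P → P → Bool) (x1 y1 x2 y2 x3 y3 : P) : Prop :=
  hNC s x1 y1 x2 y2 x3 y3 → hNC s x1 y2 x2 y3 x3 y1 → hNC s x1 y3 x2 y1 x3 y2 →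
  hUn s x1 y1 x2 y2 → hUn s x1 y1 x3 y3 → hUn s x2 y2 x3 y3 → False

section
theorem H1f {a b c a' b' c' : Fin M} (h : a ≠ b) (h2 : a ≠ c) (h3 : b ≠ c)
    (h' : a' ≠ b') (h2' : a' ≠ c') (h3' : b' ≠ c') :
    H1P SS (px a) (py a') (px b) (py b') (px c) (py c') :=
  rankd 6 (fun lt => H1P (Sb lt) 0 1 2 3 4 5) (by decide +kernel) _ (inj6 h h2 h3 h' h2' h3')
theorem H4f {a b c a' b' c' : Fin M} (h : a ≠ b) (h2 : a ≠ c) (h3 : b ≠ c)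
    (h' : a' ≠ b') (h2' : a' ≠ c') (h3' : b' ≠ c') :
    H4P SS (px a) (py a') (px b) (py b') (px c) (py c') :=
  rankd 6 (fun lt => H4P (Sb lt) 0 1 2 3 4 5) (by decide +kernel) _ (inj6 h h2 h3 h' h2' h3')
theorem H5f {a b c a' b' c' : Fin M} (h : a ≠ b) (h2 : a ≠ c) (h3 : b ≠ c)
    (h' : a' ≠ b') (h2' : a' ≠ c') (h3' : b' ≠ c') :
    H5P SS (px a) (py a') (px b) (py b') (px c) (py c') :=
  rankd 6 (fun lt => H5P (Sb lt) 0 1 2 3 4 5) (by decide +kernel) _ (inj6 h h2 h3 h' h2' h3')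
end

theorem f4_symm {a b a' b' : Fin M} (h : a ≠ b) (h' : a' ≠ b') :
    SS (px a) (py a') (px b) = SS (px a) (py a') (py b') →
    SS (px b) (py b') (px a) = SS (px b) (py b') (py a') :=
  rankd 4 (fun lt => Sb lt 0 1 2 = Sb lt 0 1 3 → Sb lt 2 3 0 = Sb lt 2 3 1)
    (by decide +kernel) _ (inj4 h h')

theorem pnc_symm {π : Perm (Fin M)} {a b : Fin M} (h : a ≠ b)
    (h1 : sS π a (px b) = sS π a (py (π b))) : sS π b (px a) = sS π b (py (π a)) :=
  f4_symm h (fun e => h (π.injective e)) h1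

/-- locality of noncrossingness -/
theorem Loc {π u : Perm (Fin M)} (hp : NC π) (T : Fin M → Prop) (hu : ∀ i, ¬ T i → u i = i)
    (h1 : ∀ i j, ¬ T i → T j → sS π i (px j) = sS π i (px (u j)))
    (h2 : ∀ i j, T i → T j → i ≠ j → sS (π * u) i (px j) = sS (π * u) i (py ((π * u) j))) :
    NC (π * u) := by
  have key : ∀ i j, ¬ T i → i ≠ j → sS (π * u) i (px j) = sS (π * u) i (py ((π * u) j)) := by
    intro i j hi hij
    rw [swap_mul_of_ne u (hu i hi), swap_mul_of_ne u (hu i hi)]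
    have e : u j ≠ i := fun e => hij (u.injective ((hu i hi).trans e.symm))
    have := hp i (u j) e.symm
    by_cases hj : T j
    · rw [h1 i j hi hj, this]; rfl
    · rw [hu j hj] at this
      rw [this]; simp [hu j hj]
  intro i j hij
  by_cases hi : T i
  · by_cases hj : T j
    · exact h2 i j hi hj hij
    · exact pnc_symm hij.symm (key j i hj hij.symm)
  · exact key i j hi hij

/-- local version for three labels -/
theorem Loc3 {π g u : Perm (Fin M)} {a b c : Fin M} (hab : a ≠ b) (hac : a ≠ c) (hbc : b ≠ c)
    (hp : NC π) (hg : NC (π * g)) (ga : g a = b) (gb : g b = c)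
    (gf : ∀ i, i ≠ a → i ≠ b → i ≠ c → g i = i)
    (uf : ∀ i, i ≠ a → i ≠ b → i ≠ c → u i = i)
    (hl : hNC SS (px a) (py (π (u a))) (px b) (py (π (u b))) (px c) (py (π (u c)))) :
    NC (π * u) := by
  apply Loc hp (fun i => i = a ∨ i = b ∨ i = c)
  · intro i hi; push Not at hi; exact uf i hi.1 hi.2.1 hi.2.2
  · intro i j hi hj
    push Not at hi
    have e1 := star hp hg (gf i hi.1 hi.2.1 hi.2.2) hi.1.symm
    have e2 := star hp hg (gf i hi.1 hi.2.1 hi.2.2) hi.2.1.symm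
    rw [ga] at e1; rw [gb] at e2
    have huj : u j = a ∨ u j = b ∨ u j = c := by
      by_contra hcon
      push Not at hcon
      have := u.injective (uf (u j) hcon.1 hcon.2.1 hcon.2.2)
      rw [this] at hcon
      tauto
    rcases hj with rfl | rfl | rfl <;> rcases huj with h | h | h <;> rw [h] <;> simp [e1, e2]
  · intro i j hi hj hij
    obtain ⟨k1, k2, k3⟩ := hl
    rcases hi with rfl | rfl | rfl <;> rcases hj with rfl | rfl | rfl
    · exact absurd rfl hij
    · exact k1
    · exact k2
    · exact pnc_symm hab k1
    · exact absurd rfl hij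
    · exact k3
    · exact pnc_symm hac k2
    · exact pnc_symm hbc k3
    · exact absurd rfl hij

theorem NC.hNC {π : Perm (Fin M)} (h : NC π) {a b c : Fin M} (hab : a ≠ b) (hac : a ≠ c) (hbc : b ≠ c) :
    hNC SS (px a) (py (π a)) (px b) (py (π b)) (px c) (py (π c)) :=
  ⟨h a b hab, h a c hac, h b c hbc⟩

theorem hUn_iff {π : Perm (Fin M)} {a b : Fin M} :
    hUn SS (px a) (py (π a)) (px b) (py (π b)) ↔ Un π a b := by
  unfold Un; rw [not_ins, not_ins]; rfl

/-- the commuting lemma -/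
theorem Comm {ν : Perm (Fin M)} {a b e f : Fin M} (hab : a ≠ b) (hef : e ≠ f) (hae : a ≠ e)
    (haf : a ≠ f) (hbe : b ≠ e) (hbf : b ≠ f) (hn : NC ν) (hk : NC (ν * swap a b))
    (hm : NC (ν * swap e f))
    (hc : sS (ν * swap a b) a (px e) = sS (ν * swap a b) a (px f)) :
    NC (ν * swap a b * swap e f) := by
  have fa : swap e f a = a := Equiv.swap_apply_of_ne_of_ne hae haf
  have fb : swap e f b = b := Equiv.swap_apply_of_ne_of_ne hbe hbf
  have hb : sS (ν * swap a b) b (px e) = sS (ν * swap a b) b (px f) := by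
    have x1 := sxor (π := ν) a b (px e)
    have x2 := sxor (π := ν) a b (px f)
    have s1 := star hn hm fa hae.symm
    have s2 := star hn hm fb hbe.symm
    rw [Equiv.swap_apply_left] at s1 s2
    rw [← s1, ← s2, ← x1, hc] at x2
    simpa using x2.symm
  apply Loc hk (fun i => i = e ∨ i = f)
  · intro i hi
    push Not at hi
    exact Equiv.swap_apply_of_ne_of_ne hi.1 hi.2
  · intro i j hi hj
    push Not at hi
    have : sS (ν * swap a b) i (px e) = sS (ν * swap a b) i (px f) := by
      by_cases h1 : i = a
      · subst h1; exact hc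
      by_cases h2 : i = b
      · subst h2; exact hb
      rw [swap_mul_of_ne _ (Equiv.swap_apply_of_ne_of_ne h1 h2), swap_mul_of_ne _ (Equiv.swap_apply_of_ne_of_ne h1 h2)]
      have s1 := star hn hm (Equiv.swap_apply_of_ne_of_ne hi.1 hi.2) hi.1.symm
      rwa [Equiv.swap_apply_left] at s1
    rcases hj with rfl | rfl
    · rw [Equiv.swap_apply_left, this]
    · rw [Equiv.swap_apply_right, this]
  · have key : ∀ i, (i = e ∨ i = f) → (ν * swap a b * swap e f) i = (ν * swap e f) i := by
      intro i hi
      rcases hi with rfl | rfl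
      · simp [Equiv.swap_apply_of_ne_of_ne haf.symm hbf.symm]
      · simp [Equiv.swap_apply_of_ne_of_ne hae.symm hbe.symm]
    intro i j hi hj hij
    have := hm i j hij
    unfold sS at *
    rw [key i hi, key j hj]
    exact this

/-! ### Bruhat -/
theorem bruhat {μ : Perm (Fin M)} (hμ : NC μ) (r : Fin M → Fin M → Prop) (hr : Equivalence r)
    (hd : ∀ i j, i ≠ j → r i j → Un μ i j) :
    ∀ (k : ℕ) (u : Perm (Fin M)), u.support.card ≤ k → (∀ i, r (u i) i) → u ≠ 1 →
      L μ < L (μ * u) := by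
  intro k
  induction k with
  | zero =>
    intro u hu _ h1
    exact absurd (Equiv.Perm.support_eq_empty_iff.mp (Finset.card_eq_zero.mp (by omega))) h1
  | succ k ih =>
    intro u hu hri h1
    have hne : u.support.Nonempty := by
      rw [Finset.nonempty_iff_ne_empty]
      intro e; exact h1 (Equiv.Perm.support_eq_empty_iff.mp e)
    obtain ⟨a, ha, hmin⟩ := Finset.exists_min_image u.support (fun a => min (px a) (py (μ a))) hne
    rw [Equiv.Perm.mem_support] at ha
    set b := u a with hb
    set c := u⁻¹ a with hc
    have huc : u c = a := by simp [hc]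
    have hca : c ≠ a := by intro e; rw [e] at huc; exact ha huc
    have hbs : b ∈ u.support := by
      rw [Equiv.Perm.mem_support]; intro e; exact ha (u.injective e)
    have hcs : c ∈ u.support := by
      rw [Equiv.Perm.mem_support, huc]; exact hca.symm
    have hrab : r a b := hr.symm (hri a)
    have hrac : r a c := by have := hri c; rwa [huc] at this
    have m1 := hmin b hbs
    have m2 := hmin c hcs
    have s1 := un_sep hμ (Ne.symm ha) (hd a b (Ne.symm ha) hrab)
    have s2 := un_sep hμ hca.symm (hd a c hca.symm hrac)
    have hL := LL_swap (π := μ * u) id hca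
    simp only [Equiv.Perm.mul_apply, huc, ← hb, id] at hL
    have hu' : ∀ i, r ((u * swap c a) i) i := by
      intro i
      by_cases i1 : i = c
      · subst i1
        rw [Equiv.Perm.mul_apply, Equiv.swap_apply_left]
        exact hr.trans (hri a) hrac
      by_cases i2 : i = a
      · subst i2
        rw [Equiv.Perm.mul_apply, Equiv.swap_apply_right, huc]
        exact hr.refl _
      rw [Equiv.Perm.mul_apply, Equiv.swap_apply_of_ne_of_ne i1 i2]
      exact hri i
    have hcard : (u * swap c a).support.card ≤ k := by
      have : (u * swap c a).support ⊆ u.support.erase a := by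
        intro i hi
        rw [Equiv.Perm.mem_support] at hi
        rw [Finset.mem_erase, Equiv.Perm.mem_support]
        by_cases i2 : i = a
        · subst i2
          rw [Equiv.Perm.mul_apply, Equiv.swap_apply_right, huc] at hi
          exact absurd rfl hi
        refine ⟨i2, ?_⟩
        by_cases i1 : i = c
        · subst i1; rw [huc]; exact hca.symm
        · rwa [Equiv.Perm.mul_apply, Equiv.swap_apply_of_ne_of_ne i1 i2] at hi
      have h2 := Finset.card_le_card this
      rw [Finset.card_erase_of_mem (Equiv.Perm.mem_support.mpr ha)] at h2
      omega
    have hw : L μ ≤ L (μ * (u * swap c a)) := by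
      by_cases e : u * swap c a = 1
      · rw [e, mul_one]
      · exact (ih _ hcard hu' e).le
    have : L (μ * (u * swap c a)) < L (μ * u) := by
      unfold L
      rw [← mul_assoc]
      unfold Nat.dist at hL
      omega
    omega

end Kh

namespace Kh
variable {M : ℕ}
open Equiv (swap Perm)

/-! ### transposition group facts -/
theorem swap_eq_of {x y x' y' : Fin M} (hxy : x ≠ y) (h : swap x' y' x = y) : swap x' y' = swap x y := by
  rw [Equiv.swap_apply_def] at h
  split_ifs at h with h1 h2
  · rw [h1, h]
  · rw [h2, h, Equiv.swap_comm]
  · exact absurd h hxy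

theorem gsupp {x y x' y' : Fin M} {u : Perm (Fin M)} (hxy : x ≠ y)
    (h : swap x y * swap x' y' = u) (hu : u ≠ 1) : u x ≠ x ∧ u y ≠ y := by
  constructor
  · intro e
    rw [← h, Equiv.Perm.mul_apply, Equiv.swap_apply_eq_iff, Equiv.swap_apply_left] at e
    rw [swap_eq_of hxy e, Equiv.swap_mul_self] at h
    exact hu h.symm
  · intro e
    rw [← h, Equiv.Perm.mul_apply, Equiv.swap_apply_eq_iff, Equiv.swap_apply_right] at e
    rw [swap_eq_of hxy.symm e, Equiv.swap_comm y x, Equiv.swap_mul_self] at h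
    exact hu h.symm

theorem mem3 {a b d x : Fin M} (h : (swap a b * swap a d) x ≠ x) : x = a ∨ x = b ∨ x = d := by
  by_contra hc
  push Not at hc
  apply h
  rw [Equiv.Perm.mul_apply, Equiv.swap_apply_of_ne_of_ne hc.1 hc.2.2, Equiv.swap_apply_of_ne_of_ne hc.1 hc.2.1]

theorem mem4 {a b c d x : Fin M} (h : (swap a b * swap c d) x ≠ x) : x = a ∨ x = b ∨ x = c ∨ x = d := by
  by_contra hc
  push Not at hc
  apply h
  rw [Equiv.Perm.mul_apply, Equiv.swap_apply_of_ne_of_ne hc.2.2.1 hc.2.2.2, Equiv.swap_apply_of_ne_of_ne hc.1 hc.2.1]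

theorem ne1_3 {a b d : Fin M} (hab : a ≠ b) (had : a ≠ d) (hbd : b ≠ d) : swap a b * swap a d ≠ 1 := by
  intro h
  have := congrArg (fun p => p a) h
  simp only [Equiv.Perm.mul_apply, Equiv.swap_apply_left, Equiv.Perm.one_apply] at this
  rw [Equiv.swap_apply_of_ne_of_ne had.symm hbd.symm] at this
  exact had this.symm

theorem ne1_4 {a b c d : Fin M} (hab : a ≠ b) (hac : a ≠ c) (had : a ≠ d) :
    swap a b * swap c d ≠ 1 := by
  intro h
  have := congrArg (fun p => p a) h
  simp only [Equiv.Perm.mul_apply, Equiv.Perm.one_apply] at this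
  rw [Equiv.swap_apply_of_ne_of_ne hac had, Equiv.swap_apply_left] at this
  exact hab this.symm

theorem G3 {a b d x y x' y' : Fin M} (hab : a ≠ b) (had : a ≠ d) (hbd : b ≠ d) (hxy : x ≠ y)
    (h : swap x y * swap x' y' = swap a b * swap a d) :
    swap x y = swap a b ∨ swap x y = swap a d ∨ swap x y = swap b d := by
  obtain ⟨h1, h2⟩ := gsupp hxy h (ne1_3 hab had hbd)
  rcases mem3 h1 with rfl | rfl | rfl <;> rcases mem3 h2 with rfl | rfl | rfl <;>
    simp_all [Equiv.swap_comm]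

theorem G2core {a b c d x' y' : Fin M} (hab : a ≠ b) (hcd : c ≠ d) (hac : a ≠ c) (had : a ≠ d)
    (hbc : b ≠ c) (hbd : b ≠ d) (h : swap a c * swap x' y' = swap a b * swap c d) : False := by
  have h' : swap x' y' = swap a c * (swap a b * swap c d) := by
    rw [← h, ← mul_assoc, Equiv.swap_mul_self, one_mul]
  have e1 : swap x' y' a = b := by
    rw [h']; simp only [Equiv.Perm.mul_apply]
    rw [Equiv.swap_apply_of_ne_of_ne hac had, Equiv.swap_apply_left, Equiv.swap_apply_of_ne_of_ne hab.symm hbc]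
  have e2 : swap x' y' b = c := by
    rw [h']; simp only [Equiv.Perm.mul_apply]
    rw [Equiv.swap_apply_of_ne_of_ne hbc hbd, Equiv.swap_apply_right, Equiv.swap_apply_left]
  rw [swap_eq_of hab e1, Equiv.swap_apply_right] at e2
  exact hac e2

theorem swap_disj_comm {a b c d : Fin M} (hac : a ≠ c) (had : a ≠ d)
    (hbc : b ≠ c) (hbd : b ≠ d) : swap a b * swap c d = swap c d * swap a b := by
  apply (Equiv.Perm.Disjoint.commute _).eq
  intro x
  by_cases h1 : x = a
  · right; subst h1; exact Equiv.swap_apply_of_ne_of_ne hac had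
  by_cases h2 : x = b
  · right; subst h2; exact Equiv.swap_apply_of_ne_of_ne hbc hbd
  left; exact Equiv.swap_apply_of_ne_of_ne h1 h2

theorem G2 {a b c d x y x' y' : Fin M} (hab : a ≠ b) (hcd : c ≠ d) (hac : a ≠ c) (had : a ≠ d)
    (hbc : b ≠ c) (hbd : b ≠ d) (hxy : x ≠ y)
    (h : swap x y * swap x' y' = swap a b * swap c d) : swap x y = swap a b ∨ swap x y = swap c d := by
  obtain ⟨h1, h2⟩ := gsupp hxy h (ne1_4 hab hac had)
  have hd := swap_disj_comm hac had hbc hbd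
  rcases mem4 h1 with e1 | e1 | e1 | e1 <;> rcases mem4 h2 with e2 | e2 | e2 | e2 <;>
    rw [e1, e2] at h ⊢ <;> first
    | (left; rfl) | (right; rfl) | (left; exact Equiv.swap_comm _ _) | (right; exact Equiv.swap_comm _ _)
    | exact absurd (e1.trans e2.symm) hxy
    | exact (G2core hab hcd hac had hbc hbd h).elim
    | exact (G2core hab hcd.symm had hac hbd hbc (by rw [h, Equiv.swap_comm c d])).elim
    | exact (G2core hab.symm hcd hbc hbd hac had (by rw [h, Equiv.swap_comm a b])).elim
    | exact (G2core hab.symm hcd.symm hbd hbc had hac (by rw [h, Equiv.swap_comm a b, Equiv.swap_comm c d])).elim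
    | exact (G2core hcd hab hac.symm hbc.symm had.symm hbd.symm (by rw [h, hd])).elim
    | exact (G2core hcd hab.symm hbc.symm hac.symm hbd.symm had.symm (by rw [h, hd, Equiv.swap_comm a b])).elim
    | exact (G2core hcd.symm hab had.symm hbd.symm hac.symm hbc.symm (by rw [h, hd, Equiv.swap_comm c d])).elim
    | exact (G2core hcd.symm hab.symm hbd.symm had.symm hbc.symm hac.symm (by rw [h, hd, Equiv.swap_comm c d, Equiv.swap_comm a b])).elim

/-! ### Lemma S -/
theorem lemS {π : Perm (Fin M)} (h : NC π) {p c : Fin M} (hpc : p ≠ c) (h1 : Ins π p c)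
    (hin : ∀ q, q ≠ c → q ≠ p → Ins π q c → ¬ Ins π p q) : NC (π * swap p c) := by
  have hb := ins_bd h hpc h1
  -- the orientation
  have hio : ∀ i, i ≠ p → i ≠ c → Ins π p i → ¬ Ins π i c := fun i hp hc h2 h3 => hin i hc hp h3 h2
  have hori : (px p < py (π c) ∧ py (π c) < px c ∧ px c < py (π p)) ∨
    (py (π p) < px c ∧ px c < py (π c) ∧ py (π c) < px p) := by
    by_contra hcon
    have k1 := px_ne_py c (π c)
    rcases hb with hb | hb
    · have hlt : px c < py (π c) := by omega
      have hmap : ∀ j ∈ Finset.Ico p c, π⁻¹ j ∈ Finset.Ioo p c := by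
        intro j hj
        set i := π⁻¹ j with hi
        have hji : π i = j := by simp [hi]
        have hj1 : px p < py j ∧ py j < px c := by
          rw [Finset.mem_Ico, Fin.le_def, Fin.lt_def] at hj
          unfold px py; omega
        rw [Finset.mem_Ioo, Fin.lt_def, Fin.lt_def]
        have hip : i ≠ p := by rintro e; rw [e] at hji; rw [← hji] at hj1; omega
        have hic : i ≠ c := by rintro e; rw [e] at hji; rw [← hji] at hj1; omega
        have hpi : Ins π p i := by
          unfold Ins; rw [h p i hip.symm, hji]; unfold sS; rw [SS_true]; omega
        have hb2 := ins_bd h hip.symm hpi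
        have hic' := hio i hip hic hpi
        rw [not_ins] at hic'
        have hci : sS π c (px i) = sS π c (py (π i)) := h c i hic.symm
        rw [hji] at hci
        unfold sS at hic' hci
        rw [SS_false, hji] at hic'
        rw [hji] at hb2
        have e0 : SS (px c) (py (π c)) (py j) = false := by rw [SS_false]; omega
        rw [e0, SS_false] at hci
        have : px p < px i ∧ px i < px c := by
          have := px_inj.not.mpr hic
          omega
        unfold px at this; omega
      have := Finset.card_le_card_of_injOn (s := Finset.Ico p c) (t := Finset.Ioo p c) (fun j => π⁻¹ j) hmap (fun x _ y _ e => (π⁻¹).injective e)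
      rw [Fin.card_Ico, Fin.card_Ioo] at this
      have : px p < px c := by omega
      unfold px at this
      omega
    · have hlt : py (π c) < px c := by omega
      have hmap : ∀ i ∈ Finset.Ioc (π p) (π c), π i ∈ Finset.Ioo (π p) (π c) := by
        intro i hj
        have hj1 : py (π p) < px i ∧ px i < py (π c) := by
          rw [Finset.mem_Ioc, Fin.le_def, Fin.lt_def] at hj
          unfold px py; omega
        rw [Finset.mem_Ioo, Fin.lt_def, Fin.lt_def]
        have hip : i ≠ p := by rintro rfl; omega
        have hic : i ≠ c := by rintro rfl; omega
        have hpi : Ins π p i := by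
          unfold Ins sS; rw [SS_true]; omega
        have hb2 := ins_bd h hip.symm hpi
        have hic' := hio i hip hic hpi
        rw [not_ins, h i c hic] at hic'
        have hci : sS π c (px i) = sS π c (py (π i)) := h c i hic.symm
        unfold sS at hic' hci
        rw [SS_false] at hic'
        have e0 : SS (px c) (py (π c)) (px i) = false := by rw [SS_false]; omega
        have hci := hci.symm
        rw [e0, SS_false] at hci
        have : py (π p) < py (π i) ∧ py (π i) < py (π c) := by
          have := py_inj.not.mpr (fun e => hic (π.injective e))
          omega
        unfold py at this; omega
      have := Finset.card_le_card_of_injOn (s := Finset.Ioc (π p) (π c)) (t := Finset.Ioo (π p) (π c)) (fun j => π j) hmap (fun x _ y _ e => π.injective e)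
      rw [Fin.card_Ioc, Fin.card_Ioo] at this
      have : py (π p) < py (π c) := by omega
      unfold py at this
      omega
  have hst : ∀ i, i ≠ p → i ≠ c → sS π i (px p) = sS π i (px c) := by
    intro i hip hic
    by_cases h2 : Ins π i p
    · have := ins_trans h hip h2 h1
      unfold Ins at h2 this; rw [h2, this]
    · have h3 : ¬ Ins π i c := by
        intro h3
        by_cases h4 : Ins π p i
        · exact hio i hip hic h4 h3
        · have := un_disj h hip ⟨h2, h4⟩ h3
          unfold Ins at h1
          rw [h1] at this
          exact Bool.noConfusion this
      rw [not_ins] at h2 h3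
      rw [h2, h3]
  have hmain : sS (π * swap p c) p (px c) = sS (π * swap p c) p (py ((π * swap p c) c)) := by
    unfold sS
    simp only [Equiv.Perm.mul_apply, Equiv.swap_apply_left, Equiv.swap_apply_right]
    have e1 : SS (px p) (py (π c)) (px c) = false := by rw [SS_false]; omega
    have e2 : SS (px p) (py (π c)) (py (π p)) = false := by rw [SS_false]; omega
    rw [e1, e2]
  apply Loc h (fun i => i = p ∨ i = c)
  · intro i hi
    push Not at hi
    exact Equiv.swap_apply_of_ne_of_ne hi.1 hi.2
  · intro i j hi hj
    push Not at hi
    rcases hj with rfl | rfl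
    · rw [Equiv.swap_apply_left, hst i hi.1 hi.2]
    · rw [Equiv.swap_apply_right, hst i hi.1 hi.2]
  · intro i j hi hj hij
    rcases hi with rfl | rfl <;> rcases hj with rfl | rfl
    · exact absurd rfl hij
    · exact hmain
    · exact pnc_symm hpc hmain
    · exact absurd rfl hij

theorem lemS' {π : Perm (Fin M)} (h : NC π) {c : Fin M} (he : ∃ p, p ≠ c ∧ Ins π p c) :
    ∃ p, p ≠ c ∧ Ins π p c ∧ NC (π * swap p c) := by
  have hne : (Finset.univ.filter (fun p => p ≠ c ∧ Ins π p c)).Nonempty := by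
    obtain ⟨p, hp⟩ := he
    exact ⟨p, by simpa using hp⟩
  obtain ⟨p, hp, hmin⟩ := Finset.exists_min_image _ (len π) hne
  simp only [Finset.mem_filter, Finset.mem_univ, true_and] at hp hmin
  refine ⟨p, hp.1, hp.2, lemS h hp.1 hp.2 ?_⟩
  intro q hq1 hq2 hq3 hq4
  have := hmin q ⟨hq1, hq3⟩
  have := len_lt h hq2.symm hq4
  omega

end Kh

namespace Kh
variable {M : ℕ}
open Equiv (swap Perm)

def Nbp (κ μ : Perm (Fin M)) : Prop := ∃ a b, a ≠ b ∧ μ = κ * swap a b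

theorem Nbp.symm {κ μ : Perm (Fin M)} (h : Nbp κ μ) : Nbp μ κ := by
  obtain ⟨a, b, hab, rfl⟩ := h
  exact ⟨a, b, hab, by rw [swap_swap]⟩

theorem nbp_swap (κ : Perm (Fin M)) {a b : Fin M} (h : a ≠ b) : Nbp κ (κ * swap a b) := ⟨a, b, h, rfl⟩
theorem nbp_swap' (κ : Perm (Fin M)) {a b : Fin M} (h : a ≠ b) : Nbp (κ * swap a b) κ := (nbp_swap κ h).symm

theorem shareCases {a b c d : Fin M} (hab : a ≠ b) (hcd : c ≠ d) (hne : swap a b ≠ swap c d) :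
    (a ≠ c ∧ a ≠ d ∧ b ≠ c ∧ b ≠ d) ∨
    ∃ x y z, x ≠ y ∧ x ≠ z ∧ y ≠ z ∧ swap a b = swap x y ∧ swap c d = swap x z := by
  by_cases h1 : a = c
  · subst h1; right
    exact ⟨a, b, d, hab, hcd, fun e => hne (by rw [e]), rfl, rfl⟩
  by_cases h2 : a = d
  · subst h2; right
    exact ⟨a, b, c, hab, hcd.symm, fun e => hne (by rw [e, Equiv.swap_comm]), rfl, Equiv.swap_comm _ _⟩
  by_cases h3 : b = c
  · subst h3; right
    exact ⟨b, a, d, hab.symm, hcd, fun e => hne (by rw [e, Equiv.swap_comm]), Equiv.swap_comm _ _, rfl⟩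
  by_cases h4 : b = d
  · subst h4; right
    exact ⟨b, a, c, hab.symm, hcd.symm, fun e => hne (by rw [e]), Equiv.swap_comm _ _, Equiv.swap_comm _ _⟩
  exact Or.inl ⟨h1, h2, h3, h4⟩

/-- `(a b)(b e) = (a e)(a b)` -/
theorem cyc1 {a b e : Fin M} (hab : a ≠ b) (hae : a ≠ e) (hbe : b ≠ e) :
    swap a b * swap b e = swap a e * swap a b := by
  have h2 : swap a b * swap b e * swap a b = swap a e := by
    ext x
    simp only [Equiv.Perm.mul_apply, Equiv.swap_apply_def]
    split_ifs <;> simp_all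
  rw [← h2, mul_assoc (swap a b * swap b e), Equiv.swap_mul_self, mul_one]

/-- `(a b)(b e) = (b e)(a e)` -/
theorem cyc2 {a b e : Fin M} (hab : a ≠ b) (hae : a ≠ e) (hbe : b ≠ e) :
    swap a b * swap b e = swap b e * swap a e := by
  have := cyc1 hbe hab.symm hae.symm
  rw [Equiv.swap_comm e a, Equiv.swap_comm b a] at this
  exact this.symm

theorem cyc_a {a b e : Fin M} (hae : a ≠ e) (hab : a ≠ b) : (swap a b * swap b e) a = b := by
  rw [Equiv.Perm.mul_apply, Equiv.swap_apply_of_ne_of_ne hab hae, Equiv.swap_apply_left]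
theorem cyc_b {a b e : Fin M} (hae : a ≠ e) (hbe : b ≠ e) : (swap a b * swap b e) b = e := by
  rw [Equiv.Perm.mul_apply, Equiv.swap_apply_left, Equiv.swap_apply_of_ne_of_ne hae.symm hbe.symm]
theorem cyc_e {a b e : Fin M} : (swap a b * swap b e) e = a := by
  rw [Equiv.Perm.mul_apply, Equiv.swap_apply_right, Equiv.swap_apply_right]
theorem cyc_o {a b e i : Fin M} (h1 : i ≠ a) (h2 : i ≠ b) (h3 : i ≠ e) : (swap a b * swap b e) i = i := by
  rw [Equiv.Perm.mul_apply, Equiv.swap_apply_of_ne_of_ne h2 h3, Equiv.swap_apply_of_ne_of_ne h1 h2]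

theorem Loc3' {π u : Perm (Fin M)} {a b c : Fin M} (hab : a ≠ b) (hac : a ≠ c) (hbc : b ≠ c)
    (hp : NC π)
    (hst : ∀ i, i ≠ a → i ≠ b → i ≠ c → sS π i (px a) = sS π i (px b) ∧ sS π i (px b) = sS π i (px c))
    (uf : ∀ i, i ≠ a → i ≠ b → i ≠ c → u i = i)
    (hl : hNC SS (px a) (py (π (u a))) (px b) (py (π (u b))) (px c) (py (π (u c)))) :
    NC (π * u) := by
  apply Loc hp (fun i => i = a ∨ i = b ∨ i = c)
  · intro i hi; push Not at hi; exact uf i hi.1 hi.2.1 hi.2.2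
  · intro i j hi hj
    push Not at hi
    obtain ⟨e1, e2⟩ := hst i hi.1 hi.2.1 hi.2.2
    have huj : u j = a ∨ u j = b ∨ u j = c := by
      by_contra hcon
      push Not at hcon
      have := u.injective (uf (u j) hcon.1 hcon.2.1 hcon.2.2)
      rw [this] at hcon
      tauto
    rcases hj with rfl | rfl | rfl <;> rcases huj with h | h | h <;> rw [h] <;> simp [e1, e2]
  · intro i j hi hj hij
    obtain ⟨k1, k2, k3⟩ := hl
    rcases hi with rfl | rfl | rfl <;> rcases hj with rfl | rfl | rfl
    · exact absurd rfl hij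
    · exact k1
    · exact k2
    · exact pnc_symm hab k1
    · exact absurd rfl hij
    · exact k3
    · exact pnc_symm hac k2
    · exact pnc_symm hbc k3
    · exact absurd rfl hij

@[reducible] def H6P {P : Type} (s : P → P → P → Bool) (x1 y1 x2 y2 x3 y3 : P) : Prop :=
  hNC s x1 y1 x2 y2 x3 y3 → hNC s x1 y2 x2 y1 x3 y3 → hNC s x1 y3 x2 y2 x3 y1 →
  s x1 y1 x2 = true → s x1 y1 x3 = true →
  (hNC s x1 y2 x2 y3 x3 y1 ∧ hUn s x1 y2 x2 y3 ∧ hUn s x1 y2 x3 y1 ∧ hUn s x2 y3 x3 y1) ∨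
  (hNC s x1 y3 x2 y1 x3 y2 ∧ hUn s x1 y3 x2 y1 ∧ hUn s x1 y3 x3 y2 ∧ hUn s x2 y1 x3 y2)

theorem H6f {a b c a' b' c' : Fin M} (h : a ≠ b) (h2 : a ≠ c) (h3 : b ≠ c)
    (h' : a' ≠ b') (h2' : a' ≠ c') (h3' : b' ≠ c') : H6P SS (px a) (py a') (px b) (py b') (px c) (py c') :=
  rankd 6 (fun lt => H6P (Sb lt) 0 1 2 3 4 5) (by decide +kernel) _ (inj6 h h2 h3 h' h2' h3')

theorem L_un' {π : Perm (Fin M)} {a b : Fin M} (hab : a ≠ b) (h : NC π) {ρ : Perm (Fin M)}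
    (e : ρ = π * swap a b) (h' : NC ρ) (hu : Un π a b) : L π < L ρ := by
  subst e; exact L_un hab h h' hu

theorem UP {ν : Perm (Fin M)} {p c q d : Fin M} (hn : NC ν) (hpc : p ≠ c) (hqd : q ≠ d)
    (hk : NC (ν * swap p c)) (hm : NC (ν * swap q d)) (h1 : Ins ν p c) (h2 : Ins ν q d)
    (hcd : c ≠ d) (hpd : p ≠ d) (hcq : c ≠ q) :
    ∃ t, NC t ∧ Nbp (ν * swap p c) t ∧ Nbp t (ν * swap q d) ∧ L t < L (ν * swap p c) ∧
      L t < L (ν * swap q d) := by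
  by_cases hpq : p = q
  · subst hpq
    have e2 : (ν * swap p c) p = ν c := by simp
    have hNk : hNC SS (px p) (py (ν c)) (px c) (py (ν p)) (px d) (py (ν d)) := by
      have := hk.hNC hpc hpd hcd
      simpa [Equiv.swap_apply_of_ne_of_ne hpd.symm hcd.symm] using this
    have hNm : hNC SS (px p) (py (ν d)) (px c) (py (ν c)) (px d) (py (ν p)) := by
      have := hm.hNC hpc hpd hcd
      simpa [Equiv.swap_apply_of_ne_of_ne hpc.symm hcd] using this
    have hst : ∀ i, i ≠ p → i ≠ c → i ≠ d →
        sS ν i (px p) = sS ν i (px c) ∧ sS ν i (px c) = sS ν i (px d) := by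
      intro i i1 i2 i3
      have s1 := star hn hk (Equiv.swap_apply_of_ne_of_ne i1 i2) i1.symm
      have s2 := star hn hm (Equiv.swap_apply_of_ne_of_ne i1 i3) i1.symm
      rw [Equiv.swap_apply_left] at s1 s2
      exact ⟨s1, by rw [← s1, s2]⟩
    rcases H6f hpc hpd hcd (fun e => hpc (ν.injective e)) (fun e => hpd (ν.injective e))
      (fun e => hcd (ν.injective e)) (hn.hNC hpc hpd hcd) hNk hNm h1 h2 with ⟨k0, k1, k2, k3⟩ | ⟨k0, k1, k2, k3⟩
    · -- p→c→d→p
      have ht : NC (ν * (swap p c * swap c d)) := by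
        apply Loc3' hpc hpd hcd hn hst (fun i a b c => cyc_o a b c)
        rw [cyc_a hpd hpc, cyc_b hpd hcd, cyc_e]; exact k0
      refine ⟨_, ht, ?_, ?_, ?_, ?_⟩
      · rw [← mul_assoc]; exact nbp_swap _ hcd
      · rw [cyc1 hpc hpd hcd, ← mul_assoc]; exact nbp_swap' _ hpc
      · refine L_un' hcd ht ?_ hk ?_
        · rw [← mul_assoc, swap_swap]
        · rw [← hUn_iff]; simp only [Equiv.Perm.mul_apply (f := ν)]
          rw [cyc_b hpd hcd, cyc_e]; exact k3
      · refine L_un' hpc ht ?_ hm ?_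
        · rw [cyc1 hpc hpd hcd, ← mul_assoc, swap_swap]
        · rw [← hUn_iff]; simp only [Equiv.Perm.mul_apply (f := ν)]
          rw [cyc_b hpd hcd, cyc_a hpd hpc]; exact k1
    · -- p→d→c→p
      have ht : NC (ν * (swap p d * swap d c)) := by
        apply Loc3' hpc hpd hcd hn hst (fun i a b c => cyc_o a c b)
        rw [cyc_a hpc hpd, cyc_b hpc hcd.symm, cyc_e]; exact k0
      refine ⟨_, ht, ?_, ?_, ?_, ?_⟩
      · rw [cyc1 hpd hpc hcd.symm, ← mul_assoc]; exact nbp_swap _ hpd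
      · rw [← mul_assoc]; exact nbp_swap' _ hcd.symm
      · refine L_un' hpd ht ?_ hk ?_
        · rw [cyc1 hpd hpc hcd.symm, ← mul_assoc, swap_swap]
        · rw [← hUn_iff]; simp only [Equiv.Perm.mul_apply (f := ν)]
          rw [cyc_b hpc hcd.symm, cyc_a hpc hpd]; exact k2
      · refine L_un' hcd.symm ht ?_ hm ?_
        · rw [← mul_assoc, swap_swap]
        · rw [← hUn_iff]; simp only [Equiv.Perm.mul_apply (f := ν)]
          rw [cyc_b hpc hcd.symm, cyc_e]
          exact ⟨k3.2, k3.1⟩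
  · have fp : swap q d p = p := Equiv.swap_apply_of_ne_of_ne hpq hpd
    have fc : swap q d c = c := Equiv.swap_apply_of_ne_of_ne hcq hcd
    have fq : swap p c q = q := Equiv.swap_apply_of_ne_of_ne (Ne.symm hpq) (Ne.symm hcq)
    have hu := un_after hpc hn hk h1
    have h2' : Ins (ν * swap p c) q d := by
      unfold Ins; rw [swap_mul_of_ne _ fq]; exact h2
    have hcc : sS (ν * swap p c) p (px q) = sS (ν * swap p c) p (px d) := by
      have x1 := sxor (π := ν) p c (px q)
      have x2 := sxor (π := ν) p c (px d)
      have s1 := star hn hm fp (Ne.symm hpq)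
      have s2 := star hn hm fc (Ne.symm hcq)
      rw [Equiv.swap_apply_left] at s1 s2
      rw [← s1, ← s2, ← x1] at x2
      cases hA : sS (ν * swap p c) p (px q)
      · cases hB : sS (ν * swap p c) p (px d)
        · rfl
        · have := un_disj hk hpc hu hB
          rw [hA, hB, this] at x2
          have : sS (ν * swap p c) c (px q) = true := by simpa using x2.symm
          have := ins_trans hk hcq this h2'
          unfold Ins at this
          simp_all
      · exact (ins_trans hk hpq hA h2').symm
    have ht := Comm hpc hqd hpq hpd hcq hcd hn hk hm hcc
    refine ⟨_, ht, nbp_swap _ hqd, ?_, ?_, ?_⟩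
    · rw [mul_assoc, swap_disj_comm hpq hpd hcq hcd, ← mul_assoc]
      exact nbp_swap' _ hpc
    · have := L_ins hqd hk ht h2'
      have := len_pos (π := ν * swap p c) (a := d)
      omega
    · have h1' : Ins (ν * swap q d) p c := by
        unfold Ins; rw [swap_mul_of_ne _ fp]; exact h1
      rw [mul_assoc, swap_disj_comm hpq hpd hcq hcd, ← mul_assoc] at ht ⊢
      have := L_ins hpc hm ht h1'
      have := len_pos (π := ν * swap q d) (a := c)
      omega

/-- common neighbours of two lower neighbours -/
theorem topcases {μ κ l w : Perm (Fin M)} (hκ : Nbp μ κ) (hl : Nbp μ l) (hne : κ ≠ l)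
    (h1 : Nbp κ w) (h2 : Nbp w l) (hw : w ≠ μ) :
    (∃ a b c d, a ≠ b ∧ c ≠ d ∧ a ≠ c ∧ a ≠ d ∧ b ≠ c ∧ b ≠ d ∧ κ = μ * swap a b ∧ l = μ * swap c d ∧
      w = μ * swap a b * swap c d) ∨
    (∃ a b d, a ≠ b ∧ a ≠ d ∧ b ≠ d ∧ κ = μ * swap a b ∧ l = μ * swap a d ∧
      (w = μ * (swap a b * swap b d) ∨ w = μ * (swap a d * swap d b))) := by
  obtain ⟨a, b, hab, rfl⟩ := hκ
  obtain ⟨c, d, hcd, rfl⟩ := hl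
  obtain ⟨x, y, hxy, rfl⟩ := h1
  obtain ⟨x', y', hxy', h3⟩ := h2
  have hs : swap a b ≠ swap c d := fun e => hne (by rw [e])
  have h4 : swap x y * swap x' y' = swap a b * swap c d := by
    rw [mul_assoc, mul_assoc] at h3
    have := mul_left_cancel h3
    rw [this, ← mul_assoc, Equiv.swap_mul_self, one_mul]
  rcases shareCases hab hcd hs with ⟨k1, k2, k3, k4⟩ | ⟨a', b', d', k1, k2, k3, k4, k5⟩
  · left
    refine ⟨a, b, c, d, hab, hcd, k1, k2, k3, k4, rfl, rfl, ?_⟩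
    rcases G2 hab hcd k1 k2 k3 k4 hxy h4 with e | e
    · rw [e, swap_swap] at hw; exact absurd rfl hw
    · rw [e]
  · right
    rw [k4, k5] at h4
    refine ⟨a', b', d', k1, k2, k3, by rw [k4], by rw [k5], ?_⟩
    rcases G3 k1 k2 k3 hxy h4 with e | e | e
    · rw [k4, e, swap_swap] at hw; exact absurd rfl hw
    · right; rw [k4, e, cyc1 k2 k1 k3.symm, mul_assoc]
    · left; rw [k4, e, mul_assoc]

theorem un3_eq {a b d : Fin M} {r : Fin M → Fin M → Prop} {μ : Perm (Fin M)}
    (hr : ∀ i j, r i j ↔ i = j ∨ ((i = a ∨ i = b ∨ i = d) ∧ (j = a ∨ j = b ∨ j = d)))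
    (h1 : Un μ a b) (h2 : Un μ a d) (h3 : Un μ b d) : ∀ i j, i ≠ j → r i j → Un μ i j := by
  intro i j hij h
  rw [hr] at h
  rcases h with h | ⟨h, h'⟩
  · exact absurd h hij
  rcases h with rfl | rfl | rfl <;> rcases h' with rfl | rfl | rfl <;>
    first | exact absurd rfl hij | assumption | (apply Un.symm; assumption)

theorem un_third {μ : Perm (Fin M)} {a b d : Fin M} (hμ : NC μ) (hab : a ≠ b) (had : a ≠ d) (hbd : b ≠ d)
    (hκ : NC (μ * swap a b)) (hl : NC (μ * swap a d)) (u1 : Un μ a b) (u2 : Un μ a d) : Un μ b d := by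
  constructor
  · have s := star_ins hμ hl (f := b) (i := a) (Equiv.swap_apply_of_ne_of_ne hab.symm hbd) hab
    rw [Equiv.swap_apply_left] at s
    rw [← s]; exact u1.2
  · have s := star_ins hμ hκ (f := d) (i := a) (Equiv.swap_apply_of_ne_of_ne had.symm hbd.symm) had
    rw [Equiv.swap_apply_left] at s
    rw [← s]; exact u2.2

theorem bruhat3 {μ : Perm (Fin M)} {a b d : Fin M} (hμ : NC μ)
    (u1 : Un μ a b) (u2 : Un μ a d) (u3 : Un μ b d) {u : Perm (Fin M)}
    (hu : ∀ i, i ≠ a → i ≠ b → i ≠ d → u i = i) (hu1 : u ≠ 1) : L μ < L (μ * u) := by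
  refine bruhat hμ (fun i j => i = j ∨ ((i = a ∨ i = b ∨ i = d) ∧ (j = a ∨ j = b ∨ j = d)))
    ⟨fun _ => Or.inl rfl, ?_, ?_⟩ (un3_eq (fun _ _ => Iff.rfl) u1 u2 u3) _ u le_rfl ?_ hu1
  · intro x y; rintro (h | h)
    · exact Or.inl h.symm
    · exact Or.inr ⟨h.2, h.1⟩
  · rintro x y z (h | h) (h' | h')
    · exact Or.inl (h.trans h')
    · subst h; exact Or.inr h'
    · subst h'; exact Or.inr h
    · exact Or.inr ⟨h.1, h'.2⟩
  · intro i
    by_cases h : u i = i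
    · exact Or.inl h
    right
    constructor
    · by_contra hc; push Not at hc
      exact h (u.injective (hu _ hc.1 hc.2.1 hc.2.2))
    · by_contra hc; push Not at hc
      exact h (hu _ hc.1 hc.2.1 hc.2.2)

theorem top1p {μ κ l w : Perm (Fin M)} (hμ : NC μ) (nκ : NC κ) (nl : NC l) (nw : NC w)
    (hκ : Nbp μ κ) (hl : Nbp μ l) (L1 : L μ < L κ) (L2 : L μ < L l) (hne : κ ≠ l)
    (h1 : Nbp κ w) (h2 : Nbp w l) (hw : w ≠ μ) : L μ < L w := by
  rcases topcases hκ hl hne h1 h2 hw with ⟨a, b, c, d, hab, hcd, k1, k2, k3, k4, rfl, rfl, rfl⟩ |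
    ⟨a, b, d, hab, had, hbd, rfl, rfl, h⟩
  · have u1 := un_of_L hcd hμ nl L2
    have : Un (μ * swap a b) c d := by
      unfold Un Ins at *
      rwa [swap_mul_of_ne _ (Equiv.swap_apply_of_ne_of_ne k1.symm k3.symm),
        swap_mul_of_ne _ (Equiv.swap_apply_of_ne_of_ne k2.symm k4.symm)]
    have := L_un hcd nκ nw this
    omega
  · have u1 := un_of_L hab hμ nκ L1
    have u2 := un_of_L had hμ nl L2
    have u3 := un_third hμ hab had hbd nκ nl u1 u2
    rcases h with rfl | rfl
    · refine bruhat3 hμ u1 u2 u3 (fun i => cyc_o) ?_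
      intro e; apply hw; rw [e, mul_one]
    · refine bruhat3 hμ u1 u2 u3 (fun i a b c => cyc_o a c b) ?_
      intro e; apply hw; rw [e, mul_one]

theorem top2p {μ κ l w w' : Perm (Fin M)} (hμ : NC μ) (nκ : NC κ) (nl : NC l) (nw : NC w) (nw' : NC w')
    (hκ : Nbp μ κ) (hl : Nbp μ l) (L1 : L μ < L κ) (L2 : L μ < L l) (hne : κ ≠ l)
    (h1 : Nbp κ w) (h2 : Nbp w l) (hw : w ≠ μ) (h1' : Nbp κ w') (h2' : Nbp w' l) (hw' : w' ≠ μ) :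
    w = w' := by
  by_contra hww
  have key : ∀ a b d, a ≠ b → a ≠ d → b ≠ d → κ = μ * swap a b → l = μ * swap a d →
      NC (μ * (swap a b * swap b d)) → NC (μ * (swap a d * swap d b)) → False := by
    rintro a b d hab had hbd rfl rfl n1 n2
    have u1 := un_of_L hab hμ nκ L1
    have u2 := un_of_L had hμ nl L2
    have u3 := un_third hμ hab had hbd nκ nl u1 u2
    have m1 := n1.hNC hab had hbd
    have m2 := n2.hNC hab had hbd
    simp only [Equiv.Perm.mul_apply (f := μ)] at m1 m2
    rw [cyc_a had hab, cyc_b had hbd, cyc_e] at m1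
    rw [cyc_a hab had, cyc_b hab hbd.symm, cyc_e] at m2
    exact H5f hab had hbd (fun e => hab (μ.injective e)) (fun e => had (μ.injective e))
      (fun e => hbd (μ.injective e)) (hμ.hNC hab had hbd) m1 m2 (hUn_iff.mpr u1) (hUn_iff.mpr u2) (hUn_iff.mpr u3)
  rcases topcases hκ hl hne h1 h2 hw with ⟨a, b, c, d, hab, hcd, k1, k2, k3, k4, e1, e2, e3⟩ |
    ⟨a, b, d, hab, had, hbd, e1, e2, h⟩
  · rcases topcases hκ hl hne h1' h2' hw' with ⟨a', b', c', d', hab', hcd', k1', k2', k3', k4', e1', e2', e3'⟩ |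
      ⟨a', b', d', hab', had', hbd', e1', e2', h'⟩
    · rw [e1] at e1'; rw [e2] at e2'
      apply hww
      rw [e3, e3', mul_left_cancel e1', mul_left_cancel e2']
    · rw [e1] at e1'; rw [e2] at e2'
      have e1' := mul_left_cancel e1'
      have e2' := mul_left_cancel e2'
      have m1 : swap a b a' ≠ a' := by rw [e1', Equiv.swap_apply_left]; exact hab'.symm
      have m2 : swap c d a' ≠ a' := by rw [e2', Equiv.swap_apply_left]; exact had'.symm
      have n1 : a' = a ∨ a' = b := by
        by_contra hc; push Not at hc; exact m1 (Equiv.swap_apply_of_ne_of_ne hc.1 hc.2)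
      have n2 : a' = c ∨ a' = d := by
        by_contra hc; push Not at hc; exact m2 (Equiv.swap_apply_of_ne_of_ne hc.1 hc.2)
      rcases n1 with rfl | rfl <;> rcases n2 with rfl | rfl <;> simp_all
  · have key2 : ∀ w'', Nbp κ w'' → Nbp w'' l → w'' ≠ μ →
        (w'' = μ * (swap a b * swap b d) ∨ w'' = μ * (swap a d * swap d b)) := by
      intro w'' h1 h2 hw
      obtain ⟨x, y, hxy, e3⟩ := h1
      obtain ⟨x', y', hxy', e4⟩ := h2
      have h4 : swap x y * swap x' y' = swap a b * swap a d := by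
        rw [e3, e1, e2, mul_assoc, mul_assoc] at e4
        have := mul_left_cancel e4
        rw [this, ← mul_assoc, Equiv.swap_mul_self, one_mul]
      rcases G3 hab had hbd hxy h4 with e | e | e
      · rw [e3, e, e1, swap_swap] at hw; exact absurd rfl hw
      · right; rw [e3, e1, e, cyc1 had hab hbd.symm, mul_assoc]
      · left; rw [e3, e1, e, mul_assoc]
    rcases key2 w h1 h2 hw with r1 | r1 <;> rcases key2 w' h1' h2' hw' with r2 | r2
    · exact hww (r1.trans r2.symm)
    · exact key a b d hab had hbd e1 e2 (r1 ▸ nw) (r2 ▸ nw')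
    · exact key a b d hab had hbd e1 e2 (r2 ▸ nw') (r1 ▸ nw)
    · exact hww (r1.trans r2.symm)

end Kh

namespace Kh
variable {M : ℕ}
open Equiv (swap Perm)

def has' (π : Perm (Fin M)) (C : ℕ × ℕ) : Prop := ∃ a : Fin M, C = (a.val, (π a).val)

theorem has_mk {π : Perm (Fin M)} {c d : Fin M} : has' π (c.val, d.val) ↔ π c = d := by
  unfold has'
  constructor
  · rintro ⟨a, h⟩
    simp only [Prod.mk.injEq] at h
    have h1 : c = a := Fin.ext h.1
    subst h1; exact Fin.ext h.2.symm
  · rintro rfl; exact ⟨c, rfl⟩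

def UpB (l m : Perm (Fin M)) (p c : Fin M) : Prop := p ≠ c ∧ m = l * swap p c ∧ Ins l p c

theorem UpB.uniq {l m : Perm (Fin M)} (hl : NC l) {p c p' c' : Fin M} (h : UpB l m p c)
    (h' : UpB l m p' c') : c = c' ∧ p = p' := by
  obtain ⟨h1, h2, h3⟩ := h
  obtain ⟨k1, k2, k3⟩ := h'
  rw [h2] at k2
  have e := mul_left_cancel k2
  have e2 : swap p c c = p := Equiv.swap_apply_right _ _
  rw [e] at e2
  by_cases hc : c = c'
  · subst hc
    rw [Equiv.swap_apply_right] at e2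
    exact ⟨rfl, e2.symm⟩
  by_cases hp : c = p'
  · subst hp
    rw [Equiv.swap_apply_left] at e2
    subst e2
    exact absurd k3 (ins_anti hl h1 h3)
  · rw [Equiv.swap_apply_of_ne_of_ne hp hc] at e2
    exact absurd e2.symm h1

noncomputable def upArc' (l m : Perm (Fin M)) : ℕ × ℕ :=
  if h : ∃ c p, UpB l m p c then (h.choose.val, (l h.choose).val) else (0, 0)

theorem upArc_eq {l m : Perm (Fin M)} (hl : NC l) {p c : Fin M} (h : UpB l m p c) :
    upArc' l m = (c.val, (l c).val) := by
  have hh : ∃ c p, UpB l m p c := ⟨c, p, h⟩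
  unfold upArc'
  rw [dif_pos hh]
  obtain ⟨p', hp'⟩ := hh.choose_spec
  rw [(hp'.uniq hl h).1]

theorem upB_of {l m : Perm (Fin M)} (hl : NC l) (hm : NC m) (h : Nbp l m) (hL : L m < L l) :
    ∃ p c, UpB l m p c := by
  obtain ⟨a, b, hab, rfl⟩ := h
  rcases ins_of_L hab hl hm hL with h1 | h1
  · exact ⟨a, b, hab, rfl, h1⟩
  · exact ⟨b, a, hab.symm, by rw [Equiv.swap_comm], h1⟩

theorem UpB.L {l m : Perm (Fin M)} (hl : NC l) (hm : NC m) {p c : Fin M} (h : UpB l m p c) :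
    L l = L m + 2 * len l c := by
  obtain ⟨h1, rfl, h3⟩ := h
  exact L_ins h1 hl hm h3

theorem UpB.Llt {l m : Perm (Fin M)} (hl : NC l) (hm : NC m) {p c : Fin M} (h : UpB l m p c) :
    Kh.L m < Kh.L l := by
  have := h.L hl hm
  have := len_pos (π := l) (a := c)
  omega

theorem UpB.mc {l m : Perm (Fin M)} {p c : Fin M} (h : UpB l m p c) : m c = l p := by
  rw [h.2.1]; simp
theorem UpB.mp {l m : Perm (Fin M)} {p c : Fin M} (h : UpB l m p c) : m p = l c := by
  rw [h.2.1]; simp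

theorem moved {l r : Perm (Fin M)} (h : Nbp l r) {c : Fin M} (hc : r c ≠ l c) :
    ∃ q, q ≠ c ∧ r = l * swap q c := by
  obtain ⟨x, y, hxy, rfl⟩ := h
  by_cases h1 : c = x
  · subst h1; exact ⟨y, hxy.symm, by rw [Equiv.swap_comm]⟩
  by_cases h2 : c = y
  · subst h2; exact ⟨x, hxy, rfl⟩
  · exfalso; apply hc; simp [Equiv.swap_apply_of_ne_of_ne h1 h2]

theorem ua3p {l m r : Perm (Fin M)} (hl : NC l) (hm : NC m) (hr : NC r) {p c : Fin M}
    (h : UpB l m p c) (hlr : Nbp l r) (hc : r c ≠ l c) (hne : r ≠ m) : L m < L r := by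
  obtain ⟨q, hq, rfl⟩ := moved hlr hc
  obtain ⟨h1, rfl, h3⟩ := id h
  have hL := h.L hl hm
  have hpos := len_pos (π := l) (a := c)
  rcases Qc hq hl hr with ⟨h4 | h4, _⟩ | h4
  · exact absurd (by rw [F1 hl h1 hq hm hr h3 h4]) hne
  · rw [Equiv.swap_comm q c] at hr ⊢
    have := L_ins hq.symm hl hr h4
    have := len_lt hl hq.symm h4
    omega
  · have := L_un hq hl hr h4.1
    omega

theorem lemKp {k v r : Perm (Fin M)} (h1 : Nbp k v) (h2 : Nbp v r) (hne : k ≠ r) {C : ℕ × ℕ}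
    (hk : has' k C) (hr : has' r C) : has' v C := by
  obtain ⟨i, rfl⟩ := hk
  rw [has_mk] at hr ⊢
  obtain ⟨a, b, hab, rfl⟩ := h1
  obtain ⟨e, f, hef, rfl⟩ := h2
  simp only [Equiv.Perm.mul_apply, EmbeddingLike.apply_eq_iff_eq] at hr ⊢
  by_contra h
  apply hne
  have h3 : swap e f i = swap a b i := by
    rw [← Equiv.swap_apply_self a b (swap e f i), hr]
  have h4 : swap e f = swap i (swap a b i) := swap_eq_of (Ne.symm h) h3
  have h5 : swap a b = swap i (swap a b i) := swap_eq_of (Ne.symm h) rfl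
  rw [h4, ← h5, swap_swap]

theorem eqhtp {k m v : Perm (Fin M)} (hk : NC k) (hm : NC m) (hv : NC v) (hne : k ≠ m) (hL : L k = L m)
    (h1 : Nbp k v) (h2 : Nbp v m) (h3 : L k < L v) : ∃ t, NC t ∧ Nbp k t ∧ Nbp t m ∧ L t < L k := by
  obtain ⟨p, c, h4⟩ := upB_of hv hk h1.symm h3
  obtain ⟨q, d, h5⟩ := upB_of hv hm h2 (by omega)
  have e1 := h4.L hv hk
  have e2 := h5.L hv hm
  obtain ⟨a1, rfl, a3⟩ := h4
  obtain ⟨b1, rfl, b3⟩ := h5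
  have hcd : c ≠ d := by
    rintro rfl
    exact hne (by rw [F1 hv a1 b1 hk hm a3 b3])
  have hpd : p ≠ d := by
    rintro rfl
    have := len_lt hv a1 a3
    omega
  have hcq : c ≠ q := by
    rintro rfl
    have := len_lt hv b1 b3
    omega
  obtain ⟨t, t1, t2, t3, t4, t5⟩ := UP hv a1 b1 hk hm a3 b3 hcd hpd hcq
  exact ⟨t, t1, t2, t3, t4⟩
end Kh

namespace Kh
variable {M : ℕ}
open Equiv (swap Perm)

structure C2a (μ κ : Perm (Fin M)) (a b e : Fin M) : Prop where
  ab : a ≠ b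
  ae : a ≠ e
  be : b ≠ e
  k : κ = μ * (swap a b * swap b e)
  uab : Un μ a b
  uae : Un μ a e
  ube : Un μ b e
  nab : NC (μ * swap a b)
  nae : NC (μ * swap a e)
  nbe : NC (μ * swap b e)

structure C2b (μ κ : Perm (Fin M)) (a b e f : Fin M) : Prop where
  ab : a ≠ b
  ef : e ≠ f
  ae : a ≠ e
  af : a ≠ f
  be : b ≠ e
  bf : b ≠ f
  k : κ = μ * (swap a b * swap e f)
  uab : Un μ a b
  uef : Un μ e f
  nab : NC (μ * swap a b)
  alt : NC (μ * swap e f) ∨ (Ins μ a e ∧ Ins μ b f ∧ ¬ Ins μ a f ∧ ¬ Ins μ b e) ∨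
    (Ins μ a f ∧ Ins μ b e ∧ ¬ Ins μ a e ∧ ¬ Ins μ b f)

theorem un_of_L' {π ρ : Perm (Fin M)} {a b : Fin M} (hab : a ≠ b) (h : NC π) (e : ρ = π * swap a b)
    (h' : NC ρ) (hL : L π < L ρ) : Un π a b := by
  subst e; exact un_of_L hab h h' hL

theorem claim2 {μ κ : Perm (Fin M)} (hμ : NC μ) (hκ : NC κ) (hne : κ ≠ μ)
    (R : ∀ r, NC r → Nbp κ r → Nbp r μ → L μ < L r) {r1 : Perm (Fin M)} (n1 : NC r1)
    (h1 : Nbp κ r1) (h2 : Nbp r1 μ) :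
    (∃ a b e, C2a μ κ a b e ∧ r1 = μ * swap a b) ∨ (∃ a b e f, C2b μ κ a b e f ∧ r1 = μ * swap a b) := by
  obtain ⟨x, y, hxy, er⟩ := h2.symm
  obtain ⟨u, v, huv, ek⟩ := h1.symm
  have hs : swap x y ≠ swap u v := by
    intro h
    apply hne
    rw [ek, er, ← h, swap_swap]
  rcases shareCases hxy huv hs with ⟨a1, a2, a3, a4⟩ | ⟨b, a, e, hba, hbe, hae, e1, e2⟩
  · right
    refine ⟨x, y, u, v, ?_, er⟩
    have uxy := un_of_L' hxy hμ er n1 (R r1 n1 h1 h2)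
    subst er
    by_cases hc : sS μ x (px u) = sS μ x (px v)
    · have nn : NC (μ * swap u v) := by
        have := Comm hxy huv a1 a2 a3 a4 n1 (by rwa [swap_swap]) (by rwa [← ek])
          (by rwa [swap_swap])
        rwa [swap_swap] at this
      have k1 : Nbp κ (μ * swap u v) := by
        rw [ek, mul_assoc, swap_disj_comm a1 a2 a3 a4, ← mul_assoc]
        exact nbp_swap' _ hxy
      exact ⟨hxy, huv, a1, a2, a3, a4, by rw [ek, mul_assoc], uxy,
        un_of_L huv hμ nn (R _ nn k1 (nbp_swap' _ huv)), n1, Or.inl nn⟩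
    · have fx : swap u v x = x := Equiv.swap_apply_of_ne_of_ne a1 a2
      have fy : swap u v y = y := Equiv.swap_apply_of_ne_of_ne a3 a4
      have s1 := star n1 (u := swap u v) (by rwa [← ek]) (f := x) (i := u) fx a1.symm
      have s2 := star n1 (u := swap u v) (by rwa [← ek]) (f := y) (i := u) fy a3.symm
      rw [Equiv.swap_apply_left] at s1 s2
      have t1 := sxor (π := μ) x y (px u)
      have t2 := sxor (π := μ) x y (px v)
      rw [s1, s2, t2] at t1
      have d1 : sS μ x (px u) = true → sS μ y (px u) = false := un_disj hμ hxy uxy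
      have d2 : sS μ x (px v) = true → sS μ y (px v) = false := un_disj hμ hxy uxy
      have alt : (Ins μ x u ∧ Ins μ y v ∧ ¬ Ins μ x v ∧ ¬ Ins μ y u) ∨
          (Ins μ x v ∧ Ins μ y u ∧ ¬ Ins μ x u ∧ ¬ Ins μ y v) := by
        unfold Ins
        revert t1 d1 d2 hc
        cases sS μ x (px u) <;> cases sS μ x (px v) <;> cases sS μ y (px u) <;>
          cases sS μ y (px v) <;> simp
      have uuv : Un μ u v := by
        rcases alt with ⟨b1, b2, b3, b4⟩ | ⟨b1, b2, b3, b4⟩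
        · exact ⟨fun h => b3 (ins_trans hμ a1 b1 h), fun h => b4 (ins_trans hμ a4 b2 h)⟩
        · exact ⟨fun h => b4 (ins_trans hμ a3 b2 h), fun h => b3 (ins_trans hμ a2 b1 h)⟩
      exact ⟨hxy, huv, a1, a2, a3, a4, by rw [ek, mul_assoc], uxy, uuv, n1, Or.inr alt⟩
  · left
    rw [Equiv.swap_comm b a] at e1
    have hab := hba.symm
    rw [e1] at er
    rw [e2] at ek
    have ek' : κ = μ * (swap a b * swap b e) := by rw [ek, er, mul_assoc]
    have ga : (swap a b * swap b e) a = b := cyc_a hae hab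
    have gb : (swap a b * swap b e) b = e := cyc_b hae hbe
    have ge : (swap a b * swap b e) e = a := cyc_e
    have go : ∀ i, i ≠ a → i ≠ b → i ≠ e → (swap a b * swap b e) i = i := fun i => cyc_o
    have nκ : NC (μ * (swap a b * swap b e)) := ek' ▸ hκ
    have l12 : hNC SS (px a) (py (μ b)) (px b) (py (μ a)) (px e) (py (μ e)) → NC (μ * swap a b) := by
      intro h
      apply Loc3 hab hae hbe hμ nκ ga gb go
      · intro i i1 i2 i3; exact Equiv.swap_apply_of_ne_of_ne i1 i2
      · rw [Equiv.swap_apply_left, Equiv.swap_apply_right, Equiv.swap_apply_of_ne_of_ne hae.symm hbe.symm]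
        exact h
    have l13 : hNC SS (px a) (py (μ e)) (px b) (py (μ b)) (px e) (py (μ a)) → NC (μ * swap a e) := by
      intro h
      apply Loc3 hab hae hbe hμ nκ ga gb go
      · intro i i1 i2 i3; exact Equiv.swap_apply_of_ne_of_ne i1 i3
      · rw [Equiv.swap_apply_left, Equiv.swap_apply_right, Equiv.swap_apply_of_ne_of_ne hab.symm hbe]
        exact h
    have l23 : hNC SS (px a) (py (μ a)) (px b) (py (μ e)) (px e) (py (μ b)) → NC (μ * swap b e) := by
      intro h
      apply Loc3 hab hae hbe hμ nκ ga gb go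
      · intro i i1 i2 i3; exact Equiv.swap_apply_of_ne_of_ne i2 i3
      · rw [Equiv.swap_apply_left, Equiv.swap_apply_right, Equiv.swap_apply_of_ne_of_ne hab hae]
        exact h
    have k12 : Nbp κ (μ * swap a b) := by
      rw [ek', ← mul_assoc]; exact nbp_swap' _ hbe
    have k13 : Nbp κ (μ * swap a e) := by
      rw [ek', cyc1 hab hae hbe, ← mul_assoc]; exact nbp_swap' _ hab
    have k23 : Nbp κ (μ * swap b e) := by
      rw [ek', cyc2 hab hae hbe, ← mul_assoc]; exact nbp_swap' _ hae
    have inj := fun {i j : Fin M} (h : i ≠ j) (e : μ i = μ j) => h (μ.injective e)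
    have q12 := n1.hNC hab hae hbe
    rw [er] at q12
    simp only [Equiv.Perm.mul_apply, Equiv.swap_apply_left, Equiv.swap_apply_right,
      Equiv.swap_apply_of_ne_of_ne hae.symm hbe.symm] at q12
    have qk := nκ.hNC hab hae hbe
    rw [Equiv.Perm.mul_apply, Equiv.Perm.mul_apply _ _ b, Equiv.Perm.mul_apply _ _ e, ga, gb, ge] at qk
    obtain ⟨u1, u2, u3, v1, v2, v3⟩ := H1f hab hae hbe (inj hab) (inj hae) (inj hbe) (hμ.hNC hab hae hbe) qk
      (Or.inl q12)
      (fun h => hUn_iff.mpr (un_of_L hab hμ (l12 h) (R _ (l12 h) k12 (nbp_swap' _ hab))))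
      (fun h => hUn_iff.mpr (un_of_L hae hμ (l13 h) (R _ (l13 h) k13 (nbp_swap' _ hae))))
      (fun h => hUn_iff.mpr (un_of_L hbe hμ (l23 h) (R _ (l23 h) k23 (nbp_swap' _ hbe))))
    exact ⟨a, b, e, ⟨hab, hae, hbe, ek', hUn_iff.mp u1, hUn_iff.mp u2, hUn_iff.mp u3, l12 v1, l13 v2, l23 v3⟩, er⟩

/-- the down-neighbour of `mu` in `C2a` can be any one of the three. -/
theorem C2a.rot {μ κ : Perm (Fin M)} {a b e : Fin M} (h : C2a μ κ a b e) : C2a μ κ b e a :=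
  ⟨h.be, h.ab.symm, h.ae.symm, by
    rw [h.k, cyc2 h.ab h.ae h.be, Equiv.swap_comm e a], h.ube, h.uab.symm, h.uae.symm, h.nbe,
    by rw [Equiv.swap_comm]; exact h.nab, by rw [Equiv.swap_comm]; exact h.nae⟩
end Kh

namespace Kh
variable {M : ℕ}
open Equiv (swap Perm)

theorem case1p {κ μ l : Perm (Fin M)} (hκ : NC κ) (hμ : NC μ) (hl : NC l) (hL : L μ < L κ)
    (R : ∀ r, NC r → Nbp κ r → Nbp r μ → L μ < L r) (h1 : Nbp κ l) (h2 : Nbp l μ)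
    {p c : Fin M} (hu : UpB l μ p c) (hc : κ c = l c) :
    ∃ t p', NC t ∧ UpB κ t p' c ∧ L μ < L t := by
  obtain ⟨a, b, hab, e⟩ := h1.symm
  have hca : c ≠ a := by
    rintro rfl
    rw [e] at hc; simp at hc; exact hab hc.symm
  have hcb : c ≠ b := by
    rintro rfl
    rw [e] at hc; simp at hc; exact hab hc
  have e1 := hu.L hl hμ
  have lt : L l < L κ := by
    by_contra hcon
    have hne : L κ ≠ L l := by
      rw [e]; exact (nb_ne hab hl (e ▸ hκ)).symm
    obtain ⟨q, d, hq⟩ := upB_of hl hκ h1.symm (by omega)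
    have e2 := hq.L hl hκ
    have hqd : swap a b = swap q d := mul_left_cancel (e.symm.trans hq.2.1)
    have hcc : swap q d c = c := by rw [← hqd]; exact Equiv.swap_apply_of_ne_of_ne hca hcb
    have hcq : c ≠ q := by rintro rfl; rw [Equiv.swap_apply_left] at hcc; exact hq.1 hcc.symm
    have hcd : c ≠ d := by rintro rfl; rw [Equiv.swap_apply_right] at hcc; exact hq.1 hcc
    by_cases hpd : p = d
    · subst hpd
      have := len_lt hl hu.1 hu.2.2
      omega
    · obtain ⟨b1, rfl, b3⟩ := hq
      obtain ⟨a1, rfl, a3⟩ := hu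
      obtain ⟨t, t1, t2, t3, t4, t5⟩ := UP hl a1 b1 hμ hκ a3 b3 hcd hpd hcq
      have := R t t1 t3.symm t2.symm
      omega
  obtain ⟨q, d, hq⟩ := upB_of hκ hl h1 lt
  have hqd : swap a b = swap q d := by
    have h3 := hq.2.1
    rw [e, mul_assoc] at h3
    have h4 := mul_eq_one_iff_eq_inv.mp (mul_left_cancel (h3.symm.trans (mul_one l).symm))
    rw [Equiv.swap_inv] at h4; exact h4
  have hcc : swap q d c = c := by rw [← hqd]; exact Equiv.swap_apply_of_ne_of_ne hca hcb
  have hcq : c ≠ q := by rintro rfl; rw [Equiv.swap_apply_left] at hcc; exact hq.1 hcc.symm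
  have hcd : c ≠ d := by rintro rfl; rw [Equiv.swap_apply_right] at hcc; exact hq.1 hcc
  have par : ∃ p', p' ≠ c ∧ Ins κ p' c := by
    by_cases hp : p = q ∨ p = d
    · have sx := sxor (π := κ) q d (px c)
      rw [← hq.2.1] at sx
      have hun : Un l q d := by
        have := un_after hq.1 hκ (hq.2.1 ▸ hl) hq.2.2
        rwa [← hq.2.1] at this
      have d1 : sS l q (px c) = true → sS l d (px c) = false := un_disj hl hq.1 hun
      have d2 : sS l q (px c) = true ∨ sS l d (px c) = true := by
        rcases hp with rfl | rfl
        · exact Or.inl hu.2.2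
        · exact Or.inr hu.2.2
      have : sS κ q (px c) = true ∨ sS κ d (px c) = true := by
        revert sx d1 d2
        cases sS κ q (px c) <;> cases sS κ d (px c) <;> cases sS l q (px c) <;>
          cases sS l d (px c) <;> simp
      rcases this with h | h
      · exact ⟨q, hcq.symm, h⟩
      · exact ⟨d, hcd.symm, h⟩
    · push Not at hp
      refine ⟨p, hu.1, ?_⟩
      have := hu.2.2
      unfold Ins at this ⊢
      rwa [hq.2.1, swap_mul_of_ne _ (Equiv.swap_apply_of_ne_of_ne hp.1 hp.2)] at this
  obtain ⟨p', p1, p2, p3⟩ := lemS' hκ par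
  have hu' : UpB κ (κ * swap p' c) p' c := ⟨p1, rfl, p2⟩
  refine ⟨_, p', p3, hu', ?_⟩
  have e3 := hu'.L hκ p3
  have e4 : len κ c = len l c := by unfold len; rw [hc]
  omega

theorem two_moved {κ v : Perm (Fin M)} (h : Nbp κ v) {c q : Fin M} (hcq : c ≠ q) (h1 : v c ≠ κ c)
    (h2 : v q ≠ κ q) : v = κ * swap c q := by
  obtain ⟨x, hx, rfl⟩ := moved h h1
  by_cases hxq : q = x
  · subst hxq; rw [Equiv.swap_comm]
  · exfalso; apply h2
    simp [Equiv.swap_apply_of_ne_of_ne hxq hcq.symm]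

theorem sq1 {κ l v r : Perm (Fin M)} {c q : Fin M} (hcq : c ≠ q) (e : l = κ * swap c q)
    (h1 : Nbp κ v) (h2 : Nbp v r) (h3 : Nbp r l) (hr : r ≠ κ) (hc : v c = κ c) (hq : v q = κ q) :
    r c = l c ∧ r q = l q := by
  obtain ⟨x, y, hxy, rfl⟩ := h1
  obtain ⟨z, w, hzw, rfl⟩ := h2
  obtain ⟨z', w', hzw', e'⟩ := h3
  have n1 : c ≠ x := by rintro rfl; simp at hc; exact hxy hc.symm
  have n2 : c ≠ y := by rintro rfl; simp at hc; exact hxy hc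
  have n3 : q ≠ x := by rintro rfl; simp at hq; exact hxy hq.symm
  have n4 : q ≠ y := by rintro rfl; simp at hq; exact hxy hq
  have h4 : swap z w * swap z' w' = swap x y * swap c q := by
    rw [e, mul_assoc, mul_assoc] at e'
    have := mul_left_cancel e'
    rw [this, ← mul_assoc (swap x y), Equiv.swap_mul_self, one_mul]
  rcases G2 hxy hcq n1.symm n3.symm n2.symm n4.symm hzw h4 with h5 | h5
  · exact absurd (by rw [h5, swap_swap]) hr
  · rw [h5, e]
    constructor
    · simp [Equiv.swap_apply_of_ne_of_ne n3 n4]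
    · simp [Equiv.swap_apply_of_ne_of_ne n1 n2]

theorem case3p {κ μ l : Perm (Fin M)} (hκ : NC κ) (hμ : NC μ) (hl : NC l) (hne : κ ≠ μ)
    (R : ∀ r, NC r → Nbp κ r → Nbp r μ → L μ < L r) (h1 : Nbp κ l) (h2 : Nbp l μ)
    {p c : Fin M} (hu : UpB l μ p c) (hc : κ c ≠ l c) :
    ∃ q, C2a μ κ c q p ∧ l = μ * swap c p ∧ UpB l κ c q ∧ UpB κ (μ * swap q p) p c ∧
      UpB κ (μ * swap c q) p q := by
  rcases claim2 hμ hκ hne R hl h1 h2 with ⟨a, b, e, hh, el⟩ | ⟨a, b, e, f, hh, el⟩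
  · have hek : κ = l * swap b e := by rw [hh.k, el, mul_assoc]
    have em : μ = l * swap a b := by rw [el, swap_swap]
    have hs : swap a b = swap p c := mul_left_cancel (em.symm.trans hu.2.1)
    have hcb : c = b ∧ p = a := by
      have c1 : c = a ∨ c = b := by
        by_contra h
        push Not at h
        have : swap p c c = c := by rw [← hs]; exact Equiv.swap_apply_of_ne_of_ne h.1 h.2
        rw [Equiv.swap_apply_right] at this
        exact hu.1 this
      rcases c1 with rfl | rfl
      · exfalso; apply hc; rw [hek]; simp [Equiv.swap_apply_of_ne_of_ne hh.ab hh.ae]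
      · refine ⟨rfl, ?_⟩
        have : swap p c c = swap a c c := by rw [hs]
        simpa using this
    obtain ⟨rfl, rfl⟩ := hcb
    have hr := hh.rot
    have inj := fun {i j : Fin M} (h : i ≠ j) (e : μ i = μ j) => h (μ.injective e)
    have hpe : p ≠ e := hh.ae
    have hce : c ≠ e := hh.be
    have hpc : p ≠ c := hh.ab
    have kc : κ c = μ e := by rw [hr.k]; exact congrArg μ (cyc_a hr.ae hr.ab)
    have ke : κ e = μ p := by rw [hr.k]; exact congrArg μ (cyc_b hr.ae hr.be)
    have kp : κ p = μ c := by rw [hr.k]; exact congrArg μ cyc_e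
    have lc : l c = μ p := by rw [el]; simp
    have lp : l p = μ c := by rw [el]; simp
    have le : l e = μ e := by rw [el]; simp [Equiv.swap_apply_of_ne_of_ne hpe.symm hce.symm]
    have qk := hκ.hNC hr.ab hr.ae hr.be
    rw [kc, ke, kp] at qk
    have hlp : SS (px p) (py (μ c)) (px c) = true := by
      have := hu.2.2; unfold Ins sS at this; rwa [lp] at this
    have h4 := H4f hr.ab hr.ae hr.be (inj hr.ab) (inj hr.ae) (inj hr.be) (hμ.hNC hr.ab hr.ae hr.be) qk
      (hUn_iff.mpr hr.uab) (hUn_iff.mpr hr.uae) (hUn_iff.mpr hr.ube)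
    have h5 : hX SS (px p) (py (μ p)) (px c) (py (μ c)) (px e) (py (μ e)) := by
      rcases h4 with h | h | h
      · exfalso
        have h6 : Ins l c p := by unfold Ins sS; rw [lc]; exact h.2.2.2.1
        exact ins_anti hl hu.1 hu.2.2 h6
      · exfalso
        have := h.2.2.1.1
        rw [hlp] at this; exact Bool.noConfusion this
      · exact h
    refine ⟨e, hr, by rw [el, Equiv.swap_comm], ⟨hce, hek, ?_⟩, ⟨hpc, ?_, ?_⟩, ⟨hpe, ?_, ?_⟩⟩
    · unfold Ins sS; rw [lc]; exact h5.2.2.2.2.2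
    · rw [hr.k, cyc2 hr.ab hr.ae hr.be, ← mul_assoc, Equiv.swap_comm c p, swap_swap]
    · unfold Ins sS; rw [kp]; exact h5.1
    · rw [hr.k, ← mul_assoc, Equiv.swap_comm e p, swap_swap]
    · unfold Ins sS; rw [kp]; exact h5.2.1
  · exfalso
    have hek : κ = l * swap e f := by rw [hh.k, el, mul_assoc]
    have em : μ = l * swap a b := by rw [el, swap_swap]
    have hs : swap a b = swap p c := mul_left_cancel (em.symm.trans hu.2.1)
    have c1 : c = a ∨ c = b := by
      by_contra h
      push Not at h
      have : swap p c c = c := by rw [← hs]; exact Equiv.swap_apply_of_ne_of_ne h.1 h.2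
      rw [Equiv.swap_apply_right] at this
      exact hu.1 this
    apply hc
    rw [hek]
    rcases c1 with rfl | rfl
    · simp [Equiv.swap_apply_of_ne_of_ne hh.ae hh.af]
    · simp [Equiv.swap_apply_of_ne_of_ne hh.be hh.bf]
end Kh

namespace Kh
variable {M : ℕ}
open Equiv (swap Perm)

def lo (C : ℕ × ℕ) : ℕ := min (2 * C.1) (2 * C.2 + 1)

noncomputable def eta' (ν μ : Perm (Fin M)) : ℤ :=
  if Nbp ν μ ∧ L ν = L μ + 2 then (-1) ^ (LL (fun x => min (lo (upArc' ν μ)) x) ν / 2) else 0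

def plo (κ : Perm (Fin M)) (c : Fin M) : ℕ := min (px c) (py (κ c))

theorem UpB.nbp {l m : Perm (Fin M)} {p c : Fin M} (h : UpB l m p c) : Nbp l m := ⟨p, c, h.1, h.2.1⟩

theorem eta_eq {ν μ : Perm (Fin M)} (hn : NC ν) (hm : NC μ) {p c : Fin M} (h : UpB ν μ p c) :
    eta' ν μ = if len ν c = 1 then (-1) ^ (LL (fun x => min (plo ν c) x) ν / 2) else 0 := by
  have e := h.L hn hm
  have : (Nbp ν μ ∧ L ν = L μ + 2) ↔ len ν c = 1 :=
    ⟨fun h => by omega, fun hh => ⟨h.nbp, by omega⟩⟩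
  unfold eta'
  simp only [this]
  rw [upArc_eq hn h]
  rfl

theorem LL_up {ν μ : Perm (Fin M)} (hn : NC ν) (hm : NC μ) {p c : Fin M} (h : UpB ν μ p c) (P : ℕ)
    (h1 : len ν c = 1) : LL (fun x => min P x) ν =
      LL (fun x => min P x) μ + 2 * (if plo ν c < P then 1 else 0) := by
  obtain ⟨a1, rfl, a3⟩ := h
  have hmono : Monotone (fun x => min P x) := fun x y hxy => by simp; omega
  rw [LL_ins _ hmono a1 hn hm a3]
  congr 2
  unfold len Nat.dist at h1
  unfold Nat.dist plo
  split_ifs <;> omega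

theorem AC {κ μ v1 v2 : Perm (Fin M)} (hκ : NC κ) (hμ : NC μ) (h1 : NC v1) (h2 : NC v2)
    {i j p p' q q' : Fin M} (hij : i ≠ j) (a1 : UpB κ v1 p i) (a2 : UpB v1 μ p' j)
    (b1 : UpB κ v2 q j) (b2 : UpB v2 μ q' i) (e1 : v1 j = κ j) (e2 : v2 i = κ i) :
    eta' κ v1 * eta' v1 μ + eta' κ v2 * eta' v2 μ = 0 := by
  rw [eta_eq hκ h1 a1, eta_eq h1 hμ a2, eta_eq hκ h2 b1, eta_eq h2 hμ b2]
  have l1 : len v1 j = len κ j := by unfold len; rw [e1]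
  have l2 : len v2 i = len κ i := by unfold len; rw [e2]
  have p1 : plo v1 j = plo κ j := by unfold plo; rw [e1]
  have p2 : plo v2 i = plo κ i := by unfold plo; rw [e2]
  rw [l1, l2, p1, p2]
  by_cases c1 : len κ i = 1 <;> by_cases c2 : len κ j = 1 <;> simp only [c1, c2, if_true, if_false, mul_zero, zero_mul, add_zero]
  have q1 := LL_up hκ h1 a1 (plo κ j) c1
  have q2 := LL_up hκ h2 b1 (plo κ i) c2
  have hne : plo κ i ≠ plo κ j := by
    intro e
    have k1 : px i ≠ px j := fun e => hij (px_inj.mp e)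
    have k2 : py (κ i) ≠ py (κ j) := fun e => hij (κ.injective (py_inj.mp e))
    have k3 := px_ne_py i (κ j)
    have k4 := px_ne_py j (κ i)
    unfold plo at e
    unfold len Nat.dist at c1 c2
    omega
  generalize hA : LL (fun x => min (plo κ i) x) κ = A at *
  generalize hB : LL (fun x => min (plo κ j) x) κ = B at *
  rcases lt_or_gt_of_ne hne with h | h
  · rw [if_pos h] at q1
    rw [if_neg (by omega)] at q2
    rw [q1, q2]
    have : (LL (fun x => min (plo κ j) x) v1 + 2 * 1) / 2 = LL (fun x => min (plo κ j) x) v1 / 2 + 1 := by omega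
    rw [this, mul_zero, add_zero, pow_succ]; ring
  · rw [if_pos h] at q2
    rw [if_neg (by omega)] at q1
    rw [q1, q2]
    have : (LL (fun x => min (plo κ i) x) v2 + 2 * 1) / 2 = LL (fun x => min (plo κ i) x) v2 / 2 + 1 := by omega
    rw [this, mul_zero, add_zero, pow_succ]; ring

theorem sg0p {k v m : Perm (Fin M)} (hk : NC k) (hv : NC v) (h1 : Nbp k v) (h3 : L k < L v) (h4 : L m < L k) :
    eta' v m = 0 := by
  obtain ⟨p, c, hu⟩ := upB_of hv hk h1.symm h3
  have := hu.L hv hk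
  have := len_pos (π := v) (a := c)
  unfold eta'
  rw [if_neg]
  rintro ⟨_, h⟩
  omega

theorem C2a.hX {μ κ : Perm (Fin M)} {a b e : Fin M} (hμ : NC μ) (hκ : NC κ) (h : C2a μ κ a b e) :
    ∃ a b e, C2a μ κ a b e ∧ Kh.hX SS (px a) (py (μ a)) (px b) (py (μ b)) (px e) (py (μ e)) := by
  have kc : κ a = μ b := by rw [h.k]; exact congrArg μ (cyc_a h.ae h.ab)
  have ke : κ b = μ e := by rw [h.k]; exact congrArg μ (cyc_b h.ae h.be)
  have kp : κ e = μ a := by rw [h.k]; exact congrArg μ cyc_e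
  have inj := fun {i j : Fin M} (h : i ≠ j) (e : μ i = μ j) => h (μ.injective e)
  have qk := hκ.hNC h.ab h.ae h.be
  rw [kc, ke, kp] at qk
  have h4 := H4f h.ab h.ae h.be (inj h.ab) (inj h.ae) (inj h.be) (hμ.hNC h.ab h.ae h.be) qk
      (hUn_iff.mpr h.uab) (hUn_iff.mpr h.uae) (hUn_iff.mpr h.ube)
  rcases h4 with k | k | k
  · exact ⟨a, b, e, h, k⟩
  · exact ⟨b, e, a, h.rot, k⟩
  · exact ⟨e, a, b, h.rot.rot, k⟩

theorem common_fac {κ μ v g : Perm (Fin M)} (hk : κ = μ * g) (h1 : Nbp κ v) (h2 : Nbp v μ) :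
    ∃ x y x' y', x ≠ y ∧ v = μ * swap x y ∧ swap x y * swap x' y' = g := by
  obtain ⟨x, y, hxy, e⟩ := h2.symm
  obtain ⟨x', y', hxy', e'⟩ := h1.symm
  refine ⟨x, y, x', y', hxy, e, ?_⟩
  rw [e', e, mul_assoc] at hk
  exact mul_left_cancel hk

theorem C2a.common {μ κ v : Perm (Fin M)} {a b e : Fin M} (h : C2a μ κ a b e) (h1 : Nbp κ v)
    (h2 : Nbp v μ) : v = μ * swap a b ∨ v = μ * swap a e ∨ v = μ * swap b e := by
  obtain ⟨x, y, x', y', hxy, e1, e2⟩ := common_fac h.k h1 h2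
  rw [Equiv.swap_comm a b] at e2
  rcases G3 h.ab.symm h.be h.ae hxy e2 with k | k | k
  · left; rw [e1, k, Equiv.swap_comm]
  · right; right; rw [e1, k]
  · right; left; rw [e1, k]

theorem C2b.common {μ κ v : Perm (Fin M)} {a b e f : Fin M} (h : C2b μ κ a b e f) (h1 : Nbp κ v)
    (h2 : Nbp v μ) : v = μ * swap a b ∨ v = μ * swap e f := by
  obtain ⟨x, y, x', y', hxy, e1, e2⟩ := common_fac h.k h1 h2
  rcases G2 h.ab h.ef h.ae h.af h.be h.bf hxy e2 with k | k
  · left; rw [e1, k]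
  · right; rw [e1, k]

theorem upB_dn {μ : Perm (Fin M)} (hμ : NC μ) {a b : Fin M} (hab : a ≠ b) (hn : NC (μ * swap a b)) (hu : Un μ a b) :
    ∃ p c, swap a b = swap p c ∧ UpB (μ * swap a b) μ p c ∧ ((p = a ∧ c = b) ∨ (p = b ∧ c = a)) := by
  rcases Qc hab hμ hn with ⟨h1 | h1, _⟩ | ⟨_, h1 | h1⟩
  · exact absurd h1 hu.1
  · exact absurd h1 hu.2
  · exact ⟨a, b, rfl, ⟨hab, by rw [swap_swap], h1⟩, Or.inl ⟨rfl, rfl⟩⟩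
  · exact ⟨b, a, Equiv.swap_comm _ _, ⟨hab.symm, by rw [Equiv.swap_comm b a, swap_swap], h1⟩, Or.inr ⟨rfl, rfl⟩⟩

theorem sgnp {κ μ : Perm (Fin M)} (hκ : NC κ) (hμ : NC μ) (hne : κ ≠ μ)
    (R : ∀ r, NC r → Nbp κ r → Nbp r μ → L μ < L r) :
    (∀ v, NC v → Nbp κ v → Nbp v μ → L v < L κ → eta' κ v * eta' v μ = 0) ∨
    ∃ v1 v2, v1 ≠ v2 ∧ (NC v1 ∧ Nbp κ v1 ∧ Nbp v1 μ ∧ L v1 < L κ) ∧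
      (NC v2 ∧ Nbp κ v2 ∧ Nbp v2 μ ∧ L v2 < L κ) ∧
      (∀ v, NC v → Nbp κ v → Nbp v μ → L v < L κ → v = v1 ∨ v = v2) ∧
      eta' κ v1 * eta' v1 μ + eta' κ v2 * eta' v2 μ = 0 := by
  by_cases hex : ∃ v, NC v ∧ Nbp κ v ∧ Nbp v μ
  swap
  · left; intro v h1 h2 h3; exact absurd ⟨v, h1, h2, h3⟩ hex
  obtain ⟨v0, n0, k1, k2⟩ := hex
  rcases claim2 hμ hκ hne R n0 k1 k2 with ⟨a, b, e, hh, -⟩ | ⟨a, b, e, f, h, -⟩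
  · right
    obtain ⟨a, b, e, h, hx⟩ := hh.hX hμ hκ
    obtain ⟨x1, x2, x3, x4, x5, x6⟩ := hx
    have ka : κ a = μ b := by rw [h.k]; exact congrArg μ (cyc_a h.ae h.ab)
    have kb : κ b = μ e := by rw [h.k]; exact congrArg μ (cyc_b h.ae h.be)
    have ke : κ e = μ a := by rw [h.k]; exact congrArg μ cyc_e
    have A1 : UpB κ (μ * swap a e) a b := ⟨h.ab, by
      rw [h.k, cyc1 h.ab h.ae h.be, ← mul_assoc, swap_swap], by unfold Ins sS; rw [ka]; exact x1⟩
    have A2 : UpB (μ * swap a e) μ a e := ⟨h.ae, by rw [swap_swap], by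
      unfold Ins sS; simp only [Equiv.Perm.mul_apply, Equiv.swap_apply_left]; exact x4⟩
    have B1 : UpB κ (μ * swap b e) a e := ⟨h.ae, by
      rw [h.k, cyc2 h.ab h.ae h.be, ← mul_assoc, swap_swap], by unfold Ins sS; rw [ka]; exact x2⟩
    have B2 : UpB (μ * swap b e) μ e b := ⟨h.be.symm, by rw [Equiv.swap_comm e b, swap_swap], by
      unfold Ins sS; simp only [Equiv.Perm.mul_apply, Equiv.swap_apply_right]; exact x5⟩
    refine ⟨μ * swap a e, μ * swap b e, ?_, ⟨h.nae, A1.nbp, A2.nbp, A1.Llt hκ h.nae⟩,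
      ⟨h.nbe, B1.nbp, B2.nbp, B1.Llt hκ h.nbe⟩, ?_, ?_⟩
    · intro e1
      have e2 := congrArg (fun g : Perm (Fin M) => g a) (mul_left_cancel e1)
      simp only [Equiv.swap_apply_left, Equiv.swap_apply_of_ne_of_ne h.ab h.ae] at e2
      exact h.ae e2.symm
    · intro v nv v1 v2 v3
      rcases h.common v1 v2 with r | r | r
      · exfalso
        have e12 : v = κ * swap b e := by rw [r, h.k, ← mul_assoc, swap_swap]
        have : Un κ b e := by
          rw [← hUn_iff, kb, ke]; exact x3
        have := L_un' h.be hκ e12 nv this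
        omega
      · exact Or.inl r
      · exact Or.inr r
    · apply AC hκ hμ h.nae h.nbe h.be A1 A2 B1 B2
      · rw [ke]; simp
      · rw [kb]; simp
  · have ke : κ e = μ f := by
      rw [h.k]; simp [Equiv.swap_apply_of_ne_of_ne h.af.symm h.bf.symm]
    have kf : κ f = μ e := by
      rw [h.k]; simp [Equiv.swap_apply_of_ne_of_ne h.ae.symm h.be.symm]
    have ka : κ a = μ b := by
      rw [h.k]; simp [Equiv.swap_apply_of_ne_of_ne h.ae h.af]
    have kb : κ b = μ a := by
      rw [h.k]; simp [Equiv.swap_apply_of_ne_of_ne h.be h.bf]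
    have er1 : μ * swap a b = κ * swap e f := by rw [h.k, ← mul_assoc, swap_swap]
    have er2 : μ * swap e f = κ * swap a b := by
      rw [h.k, swap_disj_comm h.ae h.af h.be h.bf, ← mul_assoc, swap_swap]
    have hcom : ∀ v, Nbp κ v → Nbp v μ → v = μ * swap a b ∨ v = μ * swap e f := fun v => h.common
    by_cases nef : NC (μ * swap e f)
    · right
      obtain ⟨p, c, s1, u1, o1⟩ := upB_dn hμ h.ab h.nab h.uab
      obtain ⟨q, d, s2, u2, o2⟩ := upB_dn hμ h.ef nef h.uef
      have w1 : UpB κ (μ * swap a b) q d := by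
        refine ⟨u2.1, by rw [er1, s2], ?_⟩
        have := u2.2.2
        rcases o2 with ⟨rfl, rfl⟩ | ⟨rfl, rfl⟩
        · unfold Ins sS at *; rw [ke]; simpa using this
        · unfold Ins sS at *; rw [kf]; simpa using this
      have w2 : UpB κ (μ * swap e f) p c := by
        refine ⟨u1.1, by rw [er2, s1], ?_⟩
        have := u1.2.2
        rcases o1 with ⟨rfl, rfl⟩ | ⟨rfl, rfl⟩
        · unfold Ins sS at *; rw [ka]; simpa using this
        · unfold Ins sS at *; rw [kb]; simpa using this
      refine ⟨μ * swap a b, μ * swap e f, ?_, ⟨h.nab, w1.nbp, u1.nbp, w1.Llt hκ h.nab⟩,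
        ⟨nef, w2.nbp, u2.nbp, w2.Llt hκ nef⟩, fun v _ v1 v2 _ => hcom v v1 v2, ?_⟩
      · intro e1
        have e2 := congrArg (fun g : Perm (Fin M) => g a) (mul_left_cancel e1)
        simp only [Equiv.swap_apply_left, Equiv.swap_apply_of_ne_of_ne h.ae h.af] at e2
        exact h.ab e2.symm
      · apply AC hκ hμ h.nab nef (i := d) (j := c) _ w1 u1 w2 u2
        · rcases o1 with ⟨rfl, rfl⟩ | ⟨rfl, rfl⟩
          · rw [kb]; simp
          · rw [ka]; simp
        · rcases o2 with ⟨rfl, rfl⟩ | ⟨rfl, rfl⟩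
          · rw [kf]; simp
          · rw [ke]; simp
        · rcases o1 with ⟨rfl, rfl⟩ | ⟨rfl, rfl⟩ <;> rcases o2 with ⟨rfl, rfl⟩ | ⟨rfl, rfl⟩
          exacts [h.bf.symm, h.be.symm, h.af.symm, h.ae.symm]
    · left
      intro v nv v1 v2 v3
      rcases hcom v v1 v2 with rfl | rfl
      · have s1 := un_sep hμ h.ab h.uab
        have big : 3 ≤ len κ e ∧ 3 ≤ len κ f := by
          unfold len; rw [ke, kf]
          rcases h.alt with h3 | ⟨i1, i2, -, -⟩ | ⟨i1, i2, -, -⟩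
          · exact absurd h3 nef
          · have t1 := ins_bd hμ h.ae i1
            have t2 := ins_bd hμ h.bf i2
            generalize px a = A at *
            generalize px b = B at *
            generalize px e = E at *
            generalize px f = F at *
            generalize py (μ a) = A' at *
            generalize py (μ b) = B' at *
            generalize py (μ e) = E' at *
            generalize py (μ f) = F' at *
            clear * - s1 t1 t2
            unfold Nat.dist
            omega
          · have t1 := ins_bd hμ h.af i1
            have t2 := ins_bd hμ h.be i2
            generalize px a = A at *
            generalize px b = B at *
            generalize px e = E at *
            generalize px f = F at *
            generalize py (μ a) = A' at *
            generalize py (μ b) = B' at *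
            generalize py (μ e) = E' at *
            generalize py (μ f) = F' at *
            clear * - s1 t1 t2
            unfold Nat.dist
            omega
        obtain ⟨q, d, hq⟩ := upB_of hκ nv v1 v3
        rw [eta_eq hκ nv hq, if_neg, zero_mul]
        have hs : swap e f = swap q d := mul_left_cancel (er1.symm.trans hq.2.1)
        have : d = e ∨ d = f := by
          by_contra hd
          push Not at hd
          have : swap q d d = d := by rw [← hs]; exact Equiv.swap_apply_of_ne_of_ne hd.1 hd.2
          rw [Equiv.swap_apply_right] at this
          exact hq.1 this
        rcases this with rfl | rfl <;> omega
      · exact absurd nv nef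
end Kh

namespace Kh
variable {M : ℕ}
open Equiv (swap Perm)

theorem claimT {g : Perm (Fin M)} {r : Fin M → Fin M → Prop} (hr : Equivalence r)
    (hg : ∀ i, r (g i) i) (hns : ∀ p q, p ≠ q → g ≠ swap p q) {p q u v u' v' : Fin M} (hpq : p ≠ q)
    (huv : u ≠ v) (huv' : u' ≠ v') (e : g = swap p q * (swap u v * swap u' v')) :
    ∀ i, r (swap p q i) i := by
  suffices H : r p q by
    intro i
    by_cases h1 : i = p
    · subst h1; rw [Equiv.swap_apply_left]; exact hr.symm H
    by_cases h2 : i = q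
    · subst h2; rw [Equiv.swap_apply_right]; exact H
    · rw [Equiv.swap_apply_of_ne_of_ne h1 h2]; exact hr.refl _
  have hfix : ∀ p q : Fin M, g = swap p q * (swap u v * swap u' v') →
      (swap u v * swap u' v') p = p → r p q := by
    intro p q e hp
    have := hg p
    rw [e, Equiv.Perm.mul_apply, hp, Equiv.swap_apply_left] at this
    exact hr.symm this
  by_cases hp : (swap u v * swap u' v') p = p
  · exact hfix p q e hp
  by_cases hq : (swap u v * swap u' v') q = q
  · exact hr.symm (hfix q p (by rw [e, Equiv.swap_comm]) hq)
  by_cases heq : swap u v = swap u' v'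
  · exact absurd (by rw [heq, Equiv.swap_mul_self]; rfl) hp
  rcases shareCases huv huv' heq with ⟨n1, n2, n3, n4⟩ | ⟨x, y, z, hxy, hxz, hyz, e1, e2⟩
  · have key : ∀ (p q u v u' v' : Fin M), p ≠ q → u ≠ v → p = u → q = u' →
        u ≠ u' → u ≠ v' → v ≠ u' → v ≠ v' → g = swap p q * (swap u v * swap u' v') → r p q := by
      rintro p q u v u' v' hpq huv rfl rfl n1 n2 n3 n4 e
      have h1 := hg v
      have h2 := hg p
      rw [e] at h1 h2
      simp only [Equiv.Perm.mul_apply, Equiv.swap_apply_of_ne_of_ne n3 n4, Equiv.swap_apply_right,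
        Equiv.swap_apply_left, Equiv.swap_apply_of_ne_of_ne n1 n2,
        Equiv.swap_apply_of_ne_of_ne huv.symm n3] at h1 h2
      exact hr.symm (hr.trans h1 h2)
    have e' : g = swap p q * (swap u' v' * swap u v) := by
      rw [e, swap_disj_comm n1 n2 n3 n4]
    have e3 : ∀ x y, (x = u ∨ x = v) → (y = u' ∨ y = v') → x ≠ y →
        g = swap x y * (swap u v * swap u' v') → r x y := by
      rintro x y (rfl | rfl) (rfl | rfl) hxy e
      · exact key _ _ _ _ _ _ hxy huv rfl rfl n1 n2 n3 n4 e
      · rw [Equiv.swap_comm u' y] at e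
        exact key _ _ _ _ _ _ hxy huv rfl rfl n2 n1 n4 n3 e
      · rw [Equiv.swap_comm u x] at e
        exact key _ _ _ _ _ _ hxy huv.symm rfl rfl n3 n4 n1 n2 e
      · rw [Equiv.swap_comm u x, Equiv.swap_comm u' y] at e
        exact key _ _ _ _ _ _ hxy huv.symm rfl rfl n4 n3 n2 n1 e
    have g1 : swap p q ≠ swap u v := fun h => by
      rw [h, ← mul_assoc, Equiv.swap_mul_self, one_mul] at e
      exact hns _ _ huv' e
    have g2 : swap p q ≠ swap u' v' := fun h => by
      rw [h, ← mul_assoc, Equiv.swap_mul_self, one_mul] at e'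
      exact hns _ _ huv e'
    have E1 := fun a b => e3 p q a b hpq e
    have E2 := fun a b => hr.symm (e3 q p a b hpq.symm (by rw [e, Equiv.swap_comm]))
    rcases mem4 hp with hp | hp | hp | hp <;> rcases mem4 hq with hq | hq | hq | hq
    · exact absurd (hp.trans hq.symm) hpq
    · exact absurd (by rw [hp, hq]) g1
    · exact E1 (Or.inl hp) (Or.inl hq)
    · exact E1 (Or.inl hp) (Or.inr hq)
    · exact absurd (by rw [hp, hq, Equiv.swap_comm]) g1
    · exact absurd (hp.trans hq.symm) hpq
    · exact E1 (Or.inr hp) (Or.inl hq)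
    · exact E1 (Or.inr hp) (Or.inr hq)
    · exact E2 (Or.inl hq) (Or.inl hp)
    · exact E2 (Or.inr hq) (Or.inl hp)
    · exact absurd (hp.trans hq.symm) hpq
    · exact absurd (by rw [hp, hq]) g2
    · exact E2 (Or.inl hq) (Or.inr hp)
    · exact E2 (Or.inr hq) (Or.inr hp)
    · exact absurd (by rw [hp, hq, Equiv.swap_comm]) g2
    · exact absurd (hp.trans hq.symm) hpq
  · exfalso
    rw [e1, e2] at hp hq e
    have f1 : g = swap p q * (swap y z * swap y x) := by
      rw [e, Equiv.swap_comm x y, cyc1 hxy.symm hyz hxz]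
    have f2 : g = swap p q * (swap x z * swap y z) := by
      rw [e, Equiv.swap_comm x y, cyc2 hxy.symm hyz hxz]
    have g1 : swap p q ≠ swap x y := fun h => by
      rw [h, ← mul_assoc, Equiv.swap_mul_self, one_mul] at e
      exact hns _ _ hxz e
    have g2 : swap p q ≠ swap y z := fun h => by
      rw [h, ← mul_assoc, Equiv.swap_mul_self, one_mul] at f1
      exact hns _ _ hxy.symm f1
    have g3 : swap p q ≠ swap x z := fun h => by
      rw [h, ← mul_assoc, Equiv.swap_mul_self, one_mul] at f2
      exact hns _ _ hyz f2
    rcases mem3 hp with hp | hp | hp <;> rcases mem3 hq with hq | hq | hq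
    · exact absurd (hp.trans hq.symm) hpq
    · exact g1 (by rw [hp, hq])
    · exact g3 (by rw [hp, hq])
    · exact g1 (by rw [hp, hq, Equiv.swap_comm])
    · exact absurd (hp.trans hq.symm) hpq
    · exact g2 (by rw [hp, hq])
    · exact g3 (by rw [hp, hq, Equiv.swap_comm])
    · exact g2 (by rw [hp, hq, Equiv.swap_comm])
    · exact absurd (hp.trans hq.symm) hpq

theorem cstar_core {μ κ l w s x y : Perm (Fin M)} {r : Fin M → Fin M → Prop} (hμ : NC μ) (hr : Equivalence r)
    (hd : ∀ i j, i ≠ j → r i j → Un μ i j) (ek : κ = μ * w) (el : l = μ * s)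
    (hw : ∀ i, r (w i) i) (hs : ∀ i, r (s i) i) (hnb : ¬ Nbp κ l) (hws : Equiv.Perm.sign w = 1)
    (h1 : Nbp κ x) (h2 : Nbp x y) (h3 : Nbp y l) : L μ < L x ∧ (y ≠ μ → L μ < L y) := by
  obtain ⟨p, q, hpq, ex⟩ := h1
  obtain ⟨u, v, huv, ey⟩ := h2
  obtain ⟨u', v', huv', e⟩ := h3
  have hwi : ∀ i, r (w⁻¹ i) i := by
    intro i
    have := hw (w⁻¹ i)
    rw [← Equiv.Perm.mul_apply, mul_inv_cancel, Equiv.Perm.one_apply] at this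
    exact hr.symm this
  have hsi : ∀ i, r (s⁻¹ i) i := by
    intro i
    have := hs (s⁻¹ i)
    rw [← Equiv.Perm.mul_apply, mul_inv_cancel, Equiv.Perm.one_apply] at this
    exact hr.symm this
  have eg : w⁻¹ * s = swap p q * (swap u v * swap u' v') := by
    rw [ey, ex, ek, el] at e
    simp only [mul_assoc] at e
    rw [mul_left_cancel e]
    group
  have eg' : s⁻¹ * w = swap u' v' * (swap u v * swap p q) := by
    have := congrArg (·⁻¹) eg
    simpa [mul_inv_rev, mul_assoc] using this
  have hns : ∀ p q, p ≠ q → w⁻¹ * s ≠ swap p q := by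
    intro p q hpq h
    apply hnb
    refine ⟨p, q, hpq, ?_⟩
    rw [← h, ek, el]; group
  have hns' : ∀ p q, p ≠ q → s⁻¹ * w ≠ swap p q := by
    intro p q hpq h
    apply hns p q hpq
    have := congrArg (·⁻¹) h
    simpa [mul_inv_rev, mul_assoc] using this
  have T1 := claimT hr (fun i => hr.trans (hwi (s i)) (hs i)) hns hpq huv huv' eg
  have T3 := claimT hr (fun i => hr.trans (hsi (w i)) (hw i)) hns' huv' huv hpq eg'
  constructor
  · rw [ex, ek, mul_assoc]
    refine bruhat hμ r hr hd _ (w * swap p q) le_rfl (fun i => ?_) ?_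
    · exact hr.trans (hw _) (T1 i)
    · intro h
      have := congrArg Equiv.Perm.sign h
      rw [Equiv.Perm.sign_mul, hws, Equiv.Perm.sign_swap hpq, Equiv.Perm.sign_one] at this
      exact absurd this (by decide)
  · intro hy
    have ey' : y = μ * (s * swap u' v') := by
      rw [← mul_assoc, ← el, e, swap_swap]
    rw [ey']
    refine bruhat hμ r hr hd _ (s * swap u' v') le_rfl (fun i => ?_) ?_
    · exact hr.trans (hs _) (T3 i)
    · intro h; rw [h, mul_one] at ey'; exact hy ey'

def colR (col : Fin M → ℕ) (i j : Fin M) : Prop := i = j ∨ (col i = col j ∧ col i ≠ 0)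

theorem colR_eq (col : Fin M → ℕ) : Equivalence (colR col) where
  refl i := Or.inl rfl
  symm := by
    rintro i j (rfl | ⟨h, h'⟩)
    · exact Or.inl rfl
    · exact Or.inr ⟨h.symm, h ▸ h'⟩
  trans := by
    rintro i j k (rfl | ⟨h, h'⟩) (rfl | ⟨h2, h2'⟩)
    · exact Or.inl rfl
    · exact Or.inr ⟨h2, h2'⟩
    · exact Or.inr ⟨h, h'⟩
    · exact Or.inr ⟨h.trans h2, h'⟩

structure ColData (μ w : Perm (Fin M)) (col : Fin M → ℕ) : Prop where
  fix : ∀ i, col i = 0 → w i = i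
  pres : ∀ i, col (w i) = col i
  un : ∀ i j, i ≠ j → col i = col j → col i ≠ 0 → Un μ i j
  orb : ∀ Φ : Fin M → Prop, (∀ i, col i ≠ 0 → (Φ i ↔ Φ (w i))) → ∀ i j, col i = col j → col i ≠ 0 → Φ i → Φ j
  lt3 : ∀ i, col i < 3

theorem ColData.caseA {μ w : Perm (Fin M)} {col : Fin M → ℕ} (h : ColData μ w col) {c d : Fin M}
    (hc : col c = 0) (hd : col d = 0) (hu : Un μ c d) :
    ∃ r : Fin M → Fin M → Prop, Equivalence r ∧ (∀ i j, i ≠ j → r i j → Un μ i j) ∧ (∀ i, r (w i) i) ∧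
      (∀ i, r (swap c d i) i) := by
  refine ⟨colR (fun i => if i = c ∨ i = d then 3 else col i), colR_eq _, ?_, ?_, ?_⟩
  · rintro i j hij (e | ⟨h1, h2⟩)
    · exact absurd e hij
    · have l1 := h.lt3 i
      have l2 := h.lt3 j
      dsimp only at h1 h2
      by_cases hi : i = c ∨ i = d <;> by_cases hj : j = c ∨ j = d
      · rcases hi with rfl | rfl <;> rcases hj with rfl | rfl
        · exact absurd rfl hij
        · exact hu
        · exact hu.symm
        · exact absurd rfl hij
      · rw [if_pos hi, if_neg hj] at h1; omega
      · rw [if_neg hi, if_pos hj] at h1; omega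
      · rw [if_neg hi, if_neg hj] at h1
        rw [if_neg hi] at h2
        exact h.un i j hij h1 h2
  · intro i
    by_cases h0 : col i = 0
    · rw [h.fix i h0]; exact Or.inl rfl
    · right
      have h1 : ¬ (i = c ∨ i = d) := by rintro (rfl | rfl) <;> contradiction
      have h2 : ¬ (w i = c ∨ w i = d) := by
        rintro (e | e)
        · exact h0 (by rw [← h.pres i, e, hc])
        · exact h0 (by rw [← h.pres i, e, hd])
      simp only [if_neg h1, if_neg h2, h.pres i]
      exact ⟨trivial, h0⟩
  · intro i
    by_cases h1 : i = c
    · subst h1; rw [Equiv.swap_apply_left]; right; simp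
    by_cases h2 : i = d
    · subst h2; rw [Equiv.swap_apply_right]; right; simp
    · rw [Equiv.swap_apply_of_ne_of_ne h1 h2]; exact Or.inl rfl

theorem ColData.caseB {μ w : Perm (Fin M)} {col : Fin M → ℕ} (h : ColData μ w col) {c d : Fin M}
    (hμ : NC μ) (hκ : NC (μ * w)) (hl : NC (μ * swap c d))
    (hc : col c ≠ 0) (hd : col d = 0) (hu : Un μ c d) :
    ∃ r : Fin M → Fin M → Prop, Equivalence r ∧ (∀ i j, i ≠ j → r i j → Un μ i j) ∧ (∀ i, r (w i) i) ∧
      (∀ i, r (swap c d i) i) := by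
  have hcd : c ≠ d := by rintro rfl; exact hc hd
  have J : ∀ i, i ≠ d → col i = col c → Un μ i d := by
    intro i hi hic
    by_cases hic' : i = c
    · subst hic'; exact hu
    constructor
    · intro h1
      have := (star_ins hμ hl (f := i) (i := c) (Equiv.swap_apply_of_ne_of_ne hic' hi) (Ne.symm hic')).mpr
        (by rwa [Equiv.swap_apply_left])
      exact (h.un i c hic' hic (hic ▸ hc)).1 this
    · have := h.orb (fun i => ¬ Ins μ d i) (fun i hi => by
        rw [star_ins hμ hκ (h.fix d hd) (i := i) (fun e => hi (e ▸ hd))]) c i hic.symm hc hu.2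
      exact this
  refine ⟨colR (fun i => if i = d then col c else col i), colR_eq _, ?_, ?_, ?_⟩
  · rintro i j hij (e | ⟨h1, h2⟩)
    · exact absurd e hij
    · dsimp only at h1 h2
      by_cases hi : i = d <;> by_cases hj : j = d
      · exact absurd (hi.trans hj.symm) hij
      · subst hi
        rw [if_pos rfl, if_neg hj] at h1
        exact (J j hj h1.symm).symm
      · subst hj
        rw [if_pos rfl, if_neg hi] at h1
        exact J i hi h1
      · rw [if_neg hi, if_neg hj] at h1
        rw [if_neg hi] at h2
        exact h.un i j hij h1 h2
  · intro i
    by_cases h0 : col i = 0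
    · rw [h.fix i h0]; exact Or.inl rfl
    · right
      have h1 : i ≠ d := by rintro rfl; contradiction
      have h2 : w i ≠ d := by
        intro e
        exact h0 (by rw [← h.pres i, e, hd])
      simp only [if_neg h1, if_neg h2, h.pres i]
      exact ⟨trivial, h0⟩
  · intro i
    by_cases h1 : i = c
    · subst h1; rw [Equiv.swap_apply_left]; right; simp [hc]
    by_cases h2 : i = d
    · subst h2; rw [Equiv.swap_apply_right]; right; simp [hc]
    · rw [Equiv.swap_apply_of_ne_of_ne h1 h2]; exact Or.inl rfl
end Kh

namespace Kh
variable {M : ℕ}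
open Equiv (swap Perm)

theorem C2b.swab {μ κ : Perm (Fin M)} {a b e f : Fin M} (h : C2b μ κ a b e f) : C2b μ κ b a e f :=
  ⟨h.ab.symm, h.ef, h.be, h.bf, h.ae, h.af, by rw [h.k, Equiv.swap_comm a b], h.uab.symm, h.uef,
    by rw [Equiv.swap_comm]; exact h.nab, by
      have := h.alt; tauto⟩

theorem C2b.swef {μ κ : Perm (Fin M)} {a b e f : Fin M} (h : C2b μ κ a b e f) : C2b μ κ a b f e :=
  ⟨h.ab, h.ef.symm, h.af, h.ae, h.bf, h.be, by rw [h.k, Equiv.swap_comm e f], h.uab, h.uef.symm,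
    h.nab, by
      have := h.alt; rw [Equiv.swap_comm f e]; tauto⟩

theorem C2a.cold {μ κ : Perm (Fin M)} {a b e : Fin M} (h : C2a μ κ a b e) :
    ColData μ (swap a b * swap b e) (fun i => if i = a ∨ i = b ∨ i = e then 1 else 0) := by
  have ka : (swap a b * swap b e) a = b := cyc_a h.ae h.ab
  have kb : (swap a b * swap b e) b = e := cyc_b h.ae h.be
  have ke : (swap a b * swap b e) e = a := cyc_e
  have ko : ∀ i, ¬ (i = a ∨ i = b ∨ i = e) → (swap a b * swap b e) i = i := by
    intro i hi; push Not at hi; exact cyc_o hi.1 hi.2.1 hi.2.2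
  have mem : ∀ i, (if i = a ∨ i = b ∨ i = e then 1 else 0) ≠ 0 ↔ i = a ∨ i = b ∨ i = e := by
    intro i; split_ifs with h <;> simp [h]
  constructor
  · intro i hi
    apply ko; rw [← mem]; simpa using hi
  · intro i
    by_cases hi : i = a ∨ i = b ∨ i = e
    · rcases hi with rfl | rfl | rfl
      · rw [ka]; simp
      · rw [kb]; simp
      · rw [ke]; simp
    · rw [ko i hi]
  · intro i j hij h1 h2
    have h3 := (mem i).mp h2
    rw [h1] at h2
    have h4 := (mem j).mp h2
    rcases h3 with rfl | rfl | rfl <;> rcases h4 with rfl | rfl | rfl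
    exacts [absurd rfl hij, h.uab, h.uae, h.uab.symm, absurd rfl hij, h.ube, h.uae.symm, h.ube.symm, absurd rfl hij]
  · intro Φ hΦ i j h1 h2
    have h3 := (mem i).mp h2
    rw [h1] at h2
    have h4 := (mem j).mp h2
    have q1 := hΦ a (by simp)
    have q2 := hΦ b (by simp)
    rw [ka] at q1
    rw [kb] at q2
    rcases h3 with rfl | rfl | rfl <;> rcases h4 with rfl | rfl | rfl <;> tauto
  · intro i; split_ifs <;> omega

theorem C2b.cold {μ κ : Perm (Fin M)} {a b e f : Fin M} (h : C2b μ κ a b e f) :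
    ColData μ (swap a b * swap e f)
      (fun i => if i = a ∨ i = b then 1 else if i = e ∨ i = f then 2 else 0) := by
  have ka : (swap a b * swap e f) a = b := by simp [Equiv.swap_apply_of_ne_of_ne h.ae h.af]
  have kb : (swap a b * swap e f) b = a := by simp [Equiv.swap_apply_of_ne_of_ne h.be h.bf]
  have ke : (swap a b * swap e f) e = f := by simp [Equiv.swap_apply_of_ne_of_ne h.af.symm h.bf.symm]
  have kf : (swap a b * swap e f) f = e := by simp [Equiv.swap_apply_of_ne_of_ne h.ae.symm h.be.symm]
  have ko : ∀ i, ¬ (i = a ∨ i = b) → ¬ (i = e ∨ i = f) → (swap a b * swap e f) i = i := by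
    intro i hi hi'; push Not at hi hi'
    simp [Equiv.swap_apply_of_ne_of_ne hi'.1 hi'.2, Equiv.swap_apply_of_ne_of_ne hi.1 hi.2]
  have q1 : ∀ i, (if i = a ∨ i = b then 1 else if i = e ∨ i = f then 2 else 0) = 1 → i = a ∨ i = b := by
    intro i; split_ifs with h1 h2 <;> simp [h1]
  have q2 : ∀ i, (if i = a ∨ i = b then 1 else if i = e ∨ i = f then 2 else 0) = 2 → i = e ∨ i = f := by
    intro i; split_ifs with h1 h2
    · simp
    · simp [h2]
    · simp
  have q0 : ∀ i, (if i = a ∨ i = b then 1 else if i = e ∨ i = f then 2 else 0) = 0 →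
      ¬ (i = a ∨ i = b) ∧ ¬ (i = e ∨ i = f) := by
    intro i; split_ifs with h1 h2
    · simp
    · simp
    · intro _; exact ⟨h1, h2⟩
  have lt : ∀ i, (if i = a ∨ i = b then 1 else if i = e ∨ i = f then 2 else 0) < 3 := by
    intro i; split_ifs <;> omega
  have two : ∀ i j, (if i = a ∨ i = b then 1 else if i = e ∨ i = f then 2 else 0) =
      (if j = a ∨ j = b then 1 else if j = e ∨ j = f then 2 else 0) →
      (if i = a ∨ i = b then 1 else if i = e ∨ i = f then 2 else 0) ≠ 0 →
      ((i = a ∨ i = b) ∧ (j = a ∨ j = b)) ∨ ((i = e ∨ i = f) ∧ (j = e ∨ j = f)) := by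
    intro i j h1 h2
    have := lt i
    have h5 : (if i = a ∨ i = b then 1 else if i = e ∨ i = f then 2 else 0) = 1 ∨
      (if i = a ∨ i = b then 1 else if i = e ∨ i = f then 2 else 0) = 2 := by omega
    rcases h5 with h5 | h5
    · exact Or.inl ⟨q1 i h5, q1 j (h1 ▸ h5)⟩
    · exact Or.inr ⟨q2 i h5, q2 j (h1 ▸ h5)⟩
  constructor
  · intro i hi
    exact ko i (q0 i hi).1 (q0 i hi).2
  · intro i
    by_cases hi : i = a ∨ i = b
    · rcases hi with rfl | rfl
      · rw [ka]; simp
      · rw [kb]; simp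
    by_cases hi' : i = e ∨ i = f
    · rcases hi' with rfl | rfl
      · rw [ke]; simp [h.af.symm, h.bf.symm, h.ae.symm, h.be.symm]
      · rw [kf]; simp [h.af.symm, h.bf.symm, h.ae.symm, h.be.symm]
    · rw [ko i hi hi']
  · intro i j hij h1 h2
    rcases two i j h1 h2 with ⟨h3, h4⟩ | ⟨h3, h4⟩
    · rcases h3 with rfl | rfl <;> rcases h4 with rfl | rfl
      exacts [absurd rfl hij, h.uab, h.uab.symm, absurd rfl hij]
    · rcases h3 with rfl | rfl <;> rcases h4 with rfl | rfl
      exacts [absurd rfl hij, h.uef, h.uef.symm, absurd rfl hij]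
  · intro Φ hΦ i j h1 h2
    have r1 := hΦ a (by simp)
    have r2 := hΦ e (by simp [h.ae.symm, h.be.symm])
    rw [ka] at r1
    rw [ke] at r2
    rcases two i j h1 h2 with ⟨h3, h4⟩ | ⟨h3, h4⟩
    · rcases h3 with rfl | rfl <;> rcases h4 with rfl | rfl <;> tauto
    · rcases h3 with rfl | rfl <;> rcases h4 with rfl | rfl <;> tauto
  · exact lt

theorem C2b.caseD {μ κ : Perm (Fin M)} {a b e f : Fin M} (h : C2b μ κ a b e f) (hμ : NC μ)
    (hl : NC (μ * swap a e)) (hu : Un μ a e) :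
    ∃ r : Fin M → Fin M → Prop, Equivalence r ∧ (∀ i j, i ≠ j → r i j → Un μ i j) ∧
      (∀ i, r ((swap a b * swap e f) i) i) ∧ (∀ i, r (swap a e i) i) := by
  have s1 : ∀ i, i ≠ a → i ≠ e → (Ins μ i a ↔ Ins μ i e) := by
    intro i h1 h2
    have := star_ins hμ hl (Equiv.swap_apply_of_ne_of_ne h1 h2) (i := a) h1.symm
    rwa [Equiv.swap_apply_left] at this
  have s2 : ∀ i, i ≠ a → i ≠ b → (Ins μ i a ↔ Ins μ i b) := by
    intro i h1 h2
    have := star_ins hμ h.nab (Equiv.swap_apply_of_ne_of_ne h1 h2) (i := a) h1.symm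
    rwa [Equiv.swap_apply_left] at this
  have be : ¬ Ins μ b e := fun hh => h.uab.2 ((s1 b h.ab.symm h.be).mpr hh)
  have fa : ¬ Ins μ f a := fun hh => h.uef.2 ((s1 f h.af.symm h.ef.symm).mp hh)
  have fb : ¬ Ins μ f b := fun hh => fa ((s2 f h.af.symm h.bf.symm).mpr hh)
  have eb : ¬ Ins μ e b := fun hh => hu.2 ((s2 e h.ae.symm h.be.symm).mpr hh)
  have af : ¬ Ins μ a f ∧ ¬ Ins μ b f := by
    rcases h.alt with nef | ⟨h1, _⟩ | ⟨_, h1, _⟩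
    · have s3 : ∀ i, i ≠ e → i ≠ f → (Ins μ i e ↔ Ins μ i f) := by
        intro i h1 h2
        have := star_ins hμ nef (Equiv.swap_apply_of_ne_of_ne h1 h2) (i := e) h1.symm
        rwa [Equiv.swap_apply_left] at this
      exact ⟨fun hh => hu.1 ((s3 a h.ae h.af).mpr hh), fun hh => be ((s3 b h.be h.bf).mpr hh)⟩
    · exact absurd h1 hu.1
    · exact absurd h1 be
  have uaf : Un μ a f := ⟨af.1, fa⟩
  have ube : Un μ b e := ⟨be, eb⟩
  have ubf : Un μ b f := ⟨af.2, fb⟩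
  have ka : (swap a b * swap e f) a = b := by simp [Equiv.swap_apply_of_ne_of_ne h.ae h.af]
  have kb : (swap a b * swap e f) b = a := by simp [Equiv.swap_apply_of_ne_of_ne h.be h.bf]
  have ke : (swap a b * swap e f) e = f := by simp [Equiv.swap_apply_of_ne_of_ne h.af.symm h.bf.symm]
  have kf : (swap a b * swap e f) f = e := by simp [Equiv.swap_apply_of_ne_of_ne h.ae.symm h.be.symm]
  have mem : ∀ i, (if i = a ∨ i = b ∨ i = e ∨ i = f then 1 else 0) ≠ 0 ↔ i = a ∨ i = b ∨ i = e ∨ i = f := by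
    intro i; split_ifs with h <;> simp [h]
  refine ⟨colR (fun i => if i = a ∨ i = b ∨ i = e ∨ i = f then 1 else 0), colR_eq _, ?_, ?_, ?_⟩
  · rintro i j hij (e | ⟨h1, h2⟩)
    · exact absurd e hij
    · dsimp only at h1 h2
      have h3 := (mem i).mp h2
      rw [h1] at h2
      have h4 := (mem j).mp h2
      rcases h3 with rfl | rfl | rfl | rfl <;> rcases h4 with rfl | rfl | rfl | rfl
      exacts [absurd rfl hij, h.uab, hu, uaf, h.uab.symm, absurd rfl hij, ube, ubf, hu.symm, ube.symm,
        absurd rfl hij, h.uef, uaf.symm, ubf.symm, h.uef.symm, absurd rfl hij]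
  · intro i
    by_cases hi : i = a ∨ i = b ∨ i = e ∨ i = f
    · right
      rcases hi with rfl | rfl | rfl | rfl
      · rw [ka]; simp
      · rw [kb]; simp
      · rw [ke]; simp
      · rw [kf]; simp
    · push Not at hi
      left
      simp [Equiv.swap_apply_of_ne_of_ne hi.2.2.1 hi.2.2.2, Equiv.swap_apply_of_ne_of_ne hi.1 hi.2.1]
  · intro i
    by_cases h1 : i = a
    · subst h1; rw [Equiv.swap_apply_left]; right; simp
    by_cases h2 : i = e
    · subst h2; rw [Equiv.swap_apply_right]; right; simp
    · rw [Equiv.swap_apply_of_ne_of_ne h1 h2]; exact Or.inl rfl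

theorem C2a.nb {μ κ : Perm (Fin M)} {a b e : Fin M} (h : C2a μ κ a b e) :
    Nbp κ (μ * swap a b) ∧ Nbp κ (μ * swap a e) ∧ Nbp κ (μ * swap b e) := by
  refine ⟨?_, ?_, ?_⟩
  · rw [h.k, ← mul_assoc]; exact nbp_swap' _ h.be
  · rw [h.k, cyc1 h.ab h.ae h.be, ← mul_assoc]; exact nbp_swap' _ h.ab
  · rw [h.k, cyc2 h.ab h.ae h.be, ← mul_assoc]; exact nbp_swap' _ h.ae

theorem cstarp {κ μ l r1 : Perm (Fin M)} (hκ : NC κ) (hμ : NC μ) (hl : NC l) (hne : κ ≠ μ)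
    (R : ∀ r, NC r → Nbp κ r → Nbp r μ → L μ < L r) (n1 : NC r1) (k1 : Nbp κ r1) (k2 : Nbp r1 μ)
    (hml : Nbp μ l) (hL : L μ < L l) (hnb : ¬ Nbp κ l) {x y : Perm (Fin M)}
    (h1 : Nbp κ x) (h2 : Nbp x y) (h3 : Nbp y l) : L μ < L x ∧ (y ≠ μ → L μ < L y) := by
  obtain ⟨c, d, hcd, el⟩ := hml
  have hu := un_of_L' hcd hμ el hl hL
  have sg : ∀ {a b e f : Fin M}, a ≠ b → e ≠ f → Equiv.Perm.sign (swap a b * swap e f) = 1 := by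
    intro a b e f h1 h2
    rw [Equiv.Perm.sign_mul, Equiv.Perm.sign_swap h1, Equiv.Perm.sign_swap h2]; decide
  have fin : ∀ w : Perm (Fin M), κ = μ * w → Equiv.Perm.sign w = 1 →
      (∃ r : Fin M → Fin M → Prop, Equivalence r ∧ (∀ i j, i ≠ j → r i j → Un μ i j) ∧
      (∀ i, r (w i) i) ∧ (∀ i, r (swap c d i) i)) → L μ < L x ∧ (y ≠ μ → L μ < L y) := by
    rintro w ek hs ⟨r, r1, r2, r3, r4⟩
    exact cstar_core hμ r1 r2 ek el r3 r4 hnb hs h1 h2 h3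
  have gen : ∀ (w : Perm (Fin M)) (col : Fin M → ℕ), κ = μ * w → ColData μ w col →
      (¬ (col c ≠ 0 ∧ col d ≠ 0)) →
      (∃ r : Fin M → Fin M → Prop, Equivalence r ∧ (∀ i j, i ≠ j → r i j → Un μ i j) ∧
      (∀ i, r (w i) i) ∧ (∀ i, r (swap c d i) i)) := by
    intro w col ek hcol hh
    by_cases hc : col c = 0
    · by_cases hd : col d = 0
      · exact hcol.caseA hc hd hu
      · rw [Equiv.swap_comm]
        exact hcol.caseB hμ (ek ▸ hκ) (by rw [Equiv.swap_comm, ← el]; exact hl) hd hc hu.symm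
    · exact hcol.caseB hμ (ek ▸ hκ) (by rw [← el]; exact hl) hc (by tauto) hu
  rcases claim2 hμ hκ hne R n1 k1 k2 with ⟨a, b, e, h, -⟩ | ⟨a, b, e, f, h, -⟩
  · apply fin _ h.k (sg h.ab h.be)
    apply gen _ _ h.k h.cold
    have mem : ∀ i, (if i = a ∨ i = b ∨ i = e then 1 else 0) ≠ 0 → i = a ∨ i = b ∨ i = e := by
      intro i; split_ifs with h <;> simp [h]
    rintro ⟨m1, m2⟩
    apply hnb
    obtain ⟨z1, z2, z3⟩ := h.nb
    rcases mem c m1 with rfl | rfl | rfl <;> rcases mem d m2 with rfl | rfl | rfl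
    · exact absurd rfl hcd
    · rw [el]; exact z1
    · rw [el]; exact z2
    · rw [el, Equiv.swap_comm]; exact z1
    · exact absurd rfl hcd
    · rw [el]; exact z3
    · rw [el, Equiv.swap_comm]; exact z2
    · rw [el, Equiv.swap_comm]; exact z3
    · exact absurd rfl hcd
  · apply fin _ h.k (sg h.ab h.ef)
    have er1 : Nbp κ (μ * swap a b) := by rw [h.k, ← mul_assoc]; exact nbp_swap' _ h.ef
    have er2 : Nbp κ (μ * swap e f) := by
      rw [h.k, swap_disj_comm h.ae h.af h.be h.bf, ← mul_assoc]; exact nbp_swap' _ h.ab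
    have D : ∀ c d, NC (μ * swap c d) → Un μ c d → (c = a ∨ c = b) → (d = e ∨ d = f) →
        (∃ r : Fin M → Fin M → Prop, Equivalence r ∧ (∀ i j, i ≠ j → r i j → Un μ i j) ∧
        (∀ i, r ((swap a b * swap e f) i) i) ∧ (∀ i, r (swap c d i) i)) := by
      rintro c d hl hu (rfl | rfl) (rfl | rfl)
      · exact h.caseD hμ hl hu
      · have := h.swef.caseD hμ hl hu
        rwa [Equiv.swap_comm d e] at this
      · have := h.swab.caseD hμ hl hu
        rwa [Equiv.swap_comm c a] at this
      · have := h.swab.swef.caseD hμ hl hu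
        rwa [Equiv.swap_comm c a, Equiv.swap_comm d e] at this
    by_cases hmem : (if c = a ∨ c = b then 1 else if c = e ∨ c = f then 2 else 0) ≠ 0 ∧
        (if d = a ∨ d = b then 1 else if d = e ∨ d = f then 2 else 0) ≠ 0
    swap
    · exact gen _ _ h.k h.cold hmem
    have mem : ∀ i, (if i = a ∨ i = b then 1 else if i = e ∨ i = f then 2 else 0) ≠ 0 →
        (i = a ∨ i = b) ∨ (i = e ∨ i = f) := by
      intro i; split_ifs with h h2 <;> simp [h, h2]
    rcases mem c hmem.1 with m1 | m1 <;> rcases mem d hmem.2 with m2 | m2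
    · exfalso; apply hnb
      rcases m1 with rfl | rfl <;> rcases m2 with rfl | rfl
      · exact absurd rfl hcd
      · rw [el]; exact er1
      · rw [el, Equiv.swap_comm]; exact er1
      · exact absurd rfl hcd
    · exact D c d (el ▸ hl) hu m1 m2
    · rw [Equiv.swap_comm c d]
      exact D d c (by rw [Equiv.swap_comm, ← el]; exact hl) hu.symm m2 m1
    · exfalso; apply hnb
      rcases m1 with rfl | rfl <;> rcases m2 with rfl | rfl
      · exact absurd rfl hcd
      · rw [el]; exact er2
      · rw [el, Equiv.swap_comm]; exact er2
      · exact absurd rfl hcd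
end Kh

namespace Kh
variable {M : ℕ}
open Equiv (swap Perm)

/-- Vertices of the ambient combinatorial system: non-crossing permutations. -/
abbrev PV (M : ℕ) : Type := {π : Perm (Fin M) // NC π}


theorem L_le (π : Perm (Fin M)) : L π ≤ 2 * M * M := by
  unfold L LL
  have : ∀ a ∈ (Finset.univ : Finset (Fin M)), Nat.dist (id (px a)) (id (py (π a))) ≤ 2 * M := by
    intro a _
    have h1 := a.isLt
    have h2 := (π a).isLt
    simp only [id, Nat.dist, px, py]; omega
  refine (Finset.sum_le_sum this).trans ?_
  simp; nlinarith

noncomputable def pht (u : PV M) : ℕ := 2 * M * M - L u.1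

theorem pht_lt {u v : PV M} : pht u < pht v ↔ L v.1 < L u.1 := by
  have := L_le u.1; have := L_le v.1
  unfold pht; omega

theorem pht_eq {u v : PV M} : pht u = pht v ↔ L u.1 = L v.1 := by
  have := L_le u.1; have := L_le v.1
  unfold pht; omega

theorem has_up {l m r : Perm (Fin M)} (hl : NC l) {p c : Fin M} (h : UpB l m p c) :
    has' r (upArc' l m) ↔ r c = l c := by
  rw [upArc_eq hl h, has_mk]

set_option maxHeartbeats 2000000 in
noncomputable def PS (M : ℕ) : Sys (PV M) (ℕ × ℕ) where
  Nb u v := Nbp u.1 v.1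
  ht := pht
  has u C := has' u.1 C
  upArc u v := upArc' u.1 v.1
  eta u v := eta' u.1 v.1
  symm h := h.symm
  hne := by
    rintro ⟨u, hu⟩ ⟨v, hv⟩ ⟨a, b, hab, h⟩
    dsimp only at h
    rw [Ne, pht_eq]; dsimp only; subst h
    exact nb_ne hab hu hv
  ua1 := by
    rintro ⟨u, hu⟩ ⟨v, hv⟩ h hL
    rw [pht_lt] at hL
    obtain ⟨p, c, h1⟩ := upB_of hu hv h hL
    dsimp only
    rw [has_up hu h1]
  ua2 := by
    rintro ⟨u, hu⟩ ⟨v, hv⟩ h hL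
    rw [pht_lt] at hL
    obtain ⟨p, c, h1⟩ := upB_of hu hv h hL
    dsimp only
    rw [has_up hu h1, h1.mc]
    exact fun e => h1.1 (u.injective e)
  ua3 := by
    rintro ⟨l, hl⟩ ⟨m, hm⟩ ⟨r, hr⟩ h hL h2 h3 h4
    rw [pht_lt] at hL ⊢
    obtain ⟨p, c, h1⟩ := upB_of hl hm h hL
    dsimp only at h3
    rw [has_up hl h1] at h3
    exact ua3p hl hm hr h1 h2 h3 (fun e => h4 (Subtype.ext e))
  lemK := by
    rintro ⟨k, hk⟩ ⟨v, hv⟩ ⟨r, hr⟩ C h1 h2 h3 h4 h5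
    exact lemKp h1 h2 (fun e => h3 (Subtype.ext e)) h4 h5
  top1 := by
    rintro ⟨k, hk⟩ ⟨l, hl⟩ ⟨m, hm⟩ ⟨w, hw⟩ h1 h2 h3 h4 h5 h6 h7 h8
    rw [pht_lt] at h3 h4 ⊢
    exact top1p hm hk hl hw h1.symm h2.symm h3 h4 (fun e => h5 (Subtype.ext e)) h6 h7
      (fun e => h8 (Subtype.ext e))
  top2 := by
    rintro ⟨k, hk⟩ ⟨l, hl⟩ ⟨m, hm⟩ ⟨w, hw⟩ ⟨w', hw'⟩ h1 h2 h3 h4 h5 h6 h7 h8 h9 h10 h11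
    rw [pht_lt] at h3 h4
    exact Subtype.ext (top2p hm hk hl hw hw' h1.symm h2.symm h3 h4 (fun e => h5 (Subtype.ext e)) h6 h7
      (fun e => h8 (Subtype.ext e)) h9 h10 (fun e => h11 (Subtype.ext e)))
  eqht := by
    rintro ⟨k, hk⟩ ⟨m, hm⟩ ⟨v, hv⟩ h1 h2 h3 h4 h5
    rw [pht_eq] at h2
    rw [pht_lt] at h5
    obtain ⟨t, t1, t2, t3, t4⟩ := eqhtp hk hm hv (fun e => h1 (Subtype.ext e)) h2 h3 h4 h5
    exact ⟨⟨t, t1⟩, t2, t3, pht_lt.mpr t4⟩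
  cstar := by
    rintro ⟨k, hk⟩ ⟨m, hm⟩ ⟨l, hl⟩ h1 R ⟨⟨r1, n1⟩, k1, k2⟩ h3 h4 h5 ⟨x, hx⟩ ⟨y, hy⟩ h6 h7 h8
    rw [pht_lt] at h1 h4 ⊢
    have := cstarp hk hm hl (by rintro rfl; exact lt_irrefl _ h1)
      (fun r hr a b => pht_lt.mp (R ⟨r, hr⟩ a b)) n1 k1 k2 h3 h4 h5 h6 h7 h8
    exact ⟨this.1, fun h => pht_lt.mpr (this.2 (fun e => h (Subtype.ext e)))⟩
  case1 := by
    rintro ⟨k, hk⟩ ⟨m, hm⟩ ⟨l, hl⟩ h1 R h2 h3 h4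
    have h5 := pht_lt.mp (R ⟨l, hl⟩ h2 h3)
    rw [pht_lt] at h1
    obtain ⟨p, c, hu⟩ := upB_of hl hm h3 h5
    dsimp only at h4
    rw [has_up hl hu] at h4
    obtain ⟨t, p', ht, hu', h6⟩ := case1p hk hm hl h1 (fun r hr a b => pht_lt.mp (R ⟨r, hr⟩ a b)) h2 h3 hu h4
    refine ⟨⟨t, ht⟩, hu'.nbp, pht_lt.mpr ?_, ?_, pht_lt.mpr h6⟩
    · exact hu'.Llt hk ht
    · dsimp only
      rw [upArc_eq hl hu, upArc_eq hk hu', h4]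
  case3 := by
    rintro ⟨k, hk⟩ ⟨m, hm⟩ ⟨l, hl⟩ hne h1 R h2 h3 h4
    have h5 := pht_lt.mp (R ⟨l, hl⟩ h2 h3)
    have hne' : k ≠ m := fun e => hne (Subtype.ext e)
    rw [pht_lt] at h1
    obtain ⟨p, c, hu⟩ := upB_of hl hm h3 h5
    dsimp only at h4
    rw [has_up hl hu] at h4
    obtain ⟨q, c1, c2, c3, c4, c5⟩ :=
      case3p hk hm hl hne' (fun r hr a b => pht_lt.mp (R ⟨r, hr⟩ a b)) h2 h3 hu h4
    have n1 : NC (m * swap q p) := c1.nbe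
    have n2 : NC (m * swap c q) := c1.nab
    have e1 : k = l * swap c q := c3.2.1
    have e2 : l = k * swap c q := by rw [e1, swap_swap]
    refine ⟨pht_lt.mpr (c3.Llt hl hk), ?_, ⟨_, n1⟩, ⟨_, n2⟩, c4.nbp, pht_lt.mpr (c4.Llt hk n1),
      pht_lt.mpr (L_un c1.be hm n1 c1.ube), c5.nbp, pht_lt.mpr (c5.Llt hk n2),
      pht_lt.mpr (L_un c1.ab hm n2 c1.uab), ?_, ?_, ?_, ?_, ?_⟩
    · dsimp only
      rw [has_up hl c3, c2]
      simp [Equiv.swap_apply_of_ne_of_ne c1.ab.symm c1.be]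
    · dsimp only; rw [has_up hk c4]; exact fun e => h4 e.symm
    · dsimp only; rw [has_up hk c5, e1]
      simp [c1.ab.symm]
    · rintro ⟨v, hv⟩ g1 g2 g3
      dsimp only at g1 g2 g3
      rw [has_up hk c4] at g2
      rw [has_up hk c5] at g3
      exact Subtype.ext ((two_moved g1 c1.ab g2 g3).trans e2.symm)
    · rintro ⟨v, hv⟩ g1 g2 g3
      dsimp only at g1 g2 g3
      rw [has_up hl hu] at g2
      rw [has_up hl c3] at g3
      exact Subtype.ext ((two_moved g1 c1.ab g2 g3).trans e1.symm)
    · rintro ⟨v, hv⟩ ⟨r, hr⟩ g1 g2 g3 g4 g5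
      dsimp only at g1 g2 g3 ⊢
      have g4' : v ≠ l := fun e => g4 (Subtype.ext e)
      have g5' : r ≠ k := fun e => g5 (Subtype.ext e)
      rw [has_up hk c4, has_up hk c5, has_up hl hu, has_up hl c3]
      constructor
      · rintro ⟨a, b⟩
        exact sq1 c1.ab e2 g1 g2 g3 g5' a b
      · rintro ⟨a, b⟩
        exact sq1 c1.ab e1 g3.symm g2.symm g1.symm g4' a b
  sgn := by
    rintro ⟨k, hk⟩ ⟨m, hm⟩ h1 h2 R inst
    have R' := fun r (hr : NC r) a b => pht_lt.mp (R ⟨r, hr⟩ a b)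
    have h2' : k ≠ m := fun e => h2 (Subtype.ext e)
    simp only [pht_lt] at *
    rcases sgnp hk hm h2' R' with h | ⟨v1, v2, hv, ⟨n1, a1, b1, d1⟩, ⟨n2, a2, b2, d2⟩, h3, h4⟩
    · apply Finset.sum_eq_zero
      rintro ⟨v, hv⟩ _
      split_ifs with hh
      · exact h v hv hh.1 hh.2.1 hh.2.2
      · rfl
    · rw [Finset.sum_eq_add (⟨v1, n1⟩ : PV M) ⟨v2, n2⟩]
      · rw [if_pos ⟨a1, b1, d1⟩, if_pos ⟨a2, b2, d2⟩]; exact h4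
      · exact fun e => hv (congrArg Subtype.val e)
      · rintro ⟨v, nv⟩ _ ⟨q1, q2⟩
        rw [if_neg]
        rintro ⟨z1, z2, z3⟩
        rcases h3 v nv z1 z2 z3 with rfl | rfl
        · exact q1 rfl
        · exact q2 rfl
      · intro hh; exact absurd (Finset.mem_univ _) hh
      · intro hh; exact absurd (Finset.mem_univ _) hh
  sg0 := by
    rintro ⟨k, hk⟩ ⟨v, hv⟩ ⟨m, hm⟩ h1 h2 h3 h4
    rw [pht_lt] at h3 h4
    exact sg0p hk hv h1 h3 h4

end Kh

namespace Kh
variable {M : ℕ}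
open Equiv (swap Perm)

/-- `x < y` are the two endpoints of an arc of `π`. -/
def Ar (π : Perm (Fin M)) (x y : ℕ) : Prop :=
  x < y ∧ ∃ a, (x = px a ∧ y = py (π a)) ∨ (y = px a ∧ x = py (π a))

variable {π : Perm (Fin M)}

theorem ar_of (π : Perm (Fin M)) (a : Fin M) : Ar π (px a) (py (π a)) ∨ Ar π (py (π a)) (px a) := by
  rcases lt_or_gt_of_ne (px_ne_py a (π a)) with h | h
  · exact Or.inl ⟨h, a, Or.inl ⟨rfl, rfl⟩⟩
  · exact Or.inr ⟨h, a, Or.inr ⟨rfl, rfl⟩⟩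

theorem ar_ex (π : Perm (Fin M)) {z : ℕ} (hz : z < 2 * M) : (∃ y, Ar π z y) ∨ (∃ x, Ar π x z) := by
  rcases Nat.even_or_odd' z with ⟨k, rfl | rfl⟩
  · have hk : k < M := by omega
    rcases ar_of π ⟨k, hk⟩ with h | h
    · exact Or.inl ⟨_, h⟩
    · exact Or.inr ⟨_, h⟩
  · have hk : k < M := by omega
    have h := ar_of π (π.symm ⟨k, hk⟩)
    rw [Equiv.apply_symm_apply] at h
    rcases h with h | h
    · exact Or.inr ⟨_, h⟩
    · exact Or.inl ⟨_, h⟩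

theorem px_lt (a : Fin M) : px a < 2 * M := by have := a.isLt; unfold px; omega
theorem py_lt (a : Fin M) : py a < 2 * M := by have := a.isLt; unfold py; omega

theorem Ar.lt {x y : ℕ} (h : Ar π x y) : y < 2 * M := by
  obtain ⟨_, a, ⟨rfl, rfl⟩ | ⟨rfl, rfl⟩⟩ := h
  · exact py_lt _
  · exact px_lt _

theorem Ar.uR {x y y' : ℕ} (h : Ar π x y) (h' : Ar π x y') : y = y' := by
  obtain ⟨_, a, ⟨h1, h2⟩ | ⟨h1, h2⟩⟩ := h <;> obtain ⟨_, b, ⟨k1, k2⟩ | ⟨k1, k2⟩⟩ := h'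
  · rw [h1, px_inj] at k1; subst k1; rw [h2, k2]
  · exact absurd (h1.symm.trans k2) (px_ne_py _ _)
  · exact absurd (k1.symm.trans h2) (px_ne_py _ _)
  · rw [h2, py_inj] at k2; rw [h1, k1, π.injective k2]

theorem Ar.uL {x x' y : ℕ} (h : Ar π x y) (h' : Ar π x' y) : x = x' := by
  obtain ⟨_, a, ⟨h1, h2⟩ | ⟨h1, h2⟩⟩ := h <;> obtain ⟨_, b, ⟨k1, k2⟩ | ⟨k1, k2⟩⟩ := h'
  · rw [h2, py_inj] at k2; rw [h1, k1, π.injective k2]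
  · exact absurd (k1.symm.trans h2) (px_ne_py _ _)
  · exact absurd (h1.symm.trans k2) (px_ne_py _ _)
  · rw [h1, px_inj] at k1; subst k1; rw [h2, k2]

theorem Ar.no {x y z : ℕ} (h : Ar π x y) (h' : Ar π y z) : False := by
  obtain ⟨g, a, ⟨h1, h2⟩ | ⟨h1, h2⟩⟩ := h <;> obtain ⟨g', b, ⟨k1, k2⟩ | ⟨k1, k2⟩⟩ := h'
  · exact absurd (k1.symm.trans h2) (px_ne_py _ _)
  · rw [h2, py_inj] at k2; rw [k1, ← π.injective k2] at g'; omega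
  · rw [h1, px_inj] at k1; subst k1; omega
  · exact absurd (h1.symm.trans k2) (px_ne_py _ _)

/-- an index of an arc -/
theorem Ar.idx {x y : ℕ} (h : Ar π x y) : ∃ a, x = min (px a) (py (π a)) ∧ y = max (px a) (py (π a)) := by
  obtain ⟨g, a, ⟨h1, h2⟩ | ⟨h1, h2⟩⟩ := h <;> refine ⟨a, ?_, ?_⟩ <;> omega

theorem ar_mm (π : Perm (Fin M)) (a : Fin M) : Ar π (min (px a) (py (π a))) (max (px a) (py (π a))) := by
  have := px_ne_py a (π a)
  refine ⟨by omega, a, ?_⟩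
  omega

theorem NC.nc {x y x' y' : ℕ} (hn : NC π) (h : Ar π x y) (h' : Ar π x' y') (h1 : x < x') (h2 : x' < y) : y' < y := by
  obtain ⟨a, ha, ha'⟩ := h.idx
  obtain ⟨b, hb, hb'⟩ := h'.idx
  have hab : a ≠ b := by rintro rfl; omega
  have h3 := hn a b hab
  have k1 : px a ≠ px b := fun e => hab (px_inj.mp e)
  have k2 : py (π a) ≠ py (π b) := fun e => hab (π.injective (py_inj.mp e))
  have k3 := px_ne_py a (π b)
  have k4 := px_ne_py b (π a)
  have k5 := px_ne_py a (π a)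
  have k6 := px_ne_py b (π b)
  unfold sS at h3
  rcases Bool.eq_false_or_eq_true (SS (px a) (py (π a)) (px b)) with h4 | h4
  · rw [h4] at h3
    have h3 := h3.symm
    rw [SS_true] at h4 h3
    omega
  · rw [h4] at h3
    have h3 := h3.symm
    rw [SS_false] at h4 h3
    omega

theorem NC.nc' {x y x' y' : ℕ} (hn : NC π) (h : Ar π x y) (h' : Ar π x' y') (h1 : x < y') (h2 : y' < y) : x < x' := by
  have g := h'.1
  rcases lt_trichotomy x x' with h3 | h3 | h3
  · exact h3
  · subst h3; have := h.uR h'; omega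
  · have := hn.nc h' h h3 h1; omega

/-- arcs nested iff `Ins` -/
theorem ins_iff (hn : NC π) {a b : Fin M} (hab : a ≠ b) : Ins π a b ↔
    min (px a) (py (π a)) < min (px b) (py (π b)) ∧ max (px b) (py (π b)) < max (px a) (py (π a)) := by
  constructor
  · intro h
    have := ins_bd hn hab h
    omega
  · intro h
    unfold Ins sS
    rw [SS_true]
    have k1 : px a ≠ px b := fun e => hab (px_inj.mp e)
    omega

/-- the word determines the matching -/
theorem nc_unique {π ρ : Perm (Fin M)} (hπ : NC π) (hρ : NC ρ)
    (hw : ∀ x, x < 2 * M → ((∃ y, Ar π x y) ↔ (∃ y, Ar ρ x y))) : π = ρ := by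
  have key : ∀ k x y, y - x = k → Ar π x y → Ar ρ x y := by
    intro k
    induction k using Nat.strong_induction_on with
    | _ k ih =>
      intro x y hk h
      have hlt := h.lt
      obtain ⟨y', h'⟩ := (hw x (by have := h.1; omega)).mp ⟨y, h⟩
      have hxy := h.1
      have hxy' := h'.1
      rcases lt_trichotomy y' y with c | c | c
      · -- y' inside
        rcases ar_ex π (z := y') (by omega) with ⟨z, hz⟩ | ⟨z, hz⟩
        · obtain ⟨z', hz'⟩ := (hw y' (by omega)).mp ⟨z, hz⟩
          exact (h'.no hz').elim
        · have h3 := hπ.nc' h hz hxy' c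
          have h4 := hz.1
          have h5 := ih (y' - z) (by omega) z y' rfl hz
          have := h5.uL h'
          omega
      · subst c; exact h'
      · rcases ar_ex ρ (z := y) (by omega) with ⟨z, hz⟩ | ⟨z, hz⟩
        · obtain ⟨z', hz'⟩ := (hw y (by omega)).mpr ⟨z, hz⟩
          exact (h.no hz').elim
        · have h3 := hρ.nc' h' hz hxy c
          have h4 := hz.1
          obtain ⟨w, hw'⟩ := (hw z (by omega)).mpr ⟨y, hz⟩
          have h5 := hπ.nc h hw' h3 h4
          have h6 := hw'.1
          have := (ih (w - z) (by omega) z w rfl hw').uR hz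
          omega
  ext a
  have h1 := key _ _ _ rfl (ar_mm π a)
  obtain ⟨b, hb, hb'⟩ := h1.idx
  have k1 := px_ne_py a (ρ b)
  have k2 := px_ne_py b (π a)
  have k3 : px a = px b := by omega
  have k4 : py (π a) = py (ρ b) := by omega
  rw [px_inj] at k3
  subst k3
  rw [py_inj.mp k4]

end Kh

namespace Kh
variable {M : ℕ}
open Equiv (swap Perm)

/-- `t` is a left endpoint -/
def Lf (π : Perm (Fin M)) (t : ℕ) : Prop := ∃ y, Ar π t y

theorem Lf_px {π : Perm (Fin M)} {a : Fin M} : Lf π (px a) ↔ px a < py (π a) := by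
  constructor
  · rintro ⟨y, hy⟩
    rcases ar_of π a with h | h
    · exact h.1
    · exact (h.no hy).elim
  · intro h; exact ⟨_, h, a, Or.inl ⟨rfl, rfl⟩⟩

theorem Lf_py {π : Perm (Fin M)} {a : Fin M} : Lf π (py (π a)) ↔ py (π a) < px a := by
  constructor
  · rintro ⟨y, hy⟩
    rcases ar_of π a with h | h
    · exact (h.no hy).elim
    · exact h.1
  · intro h; exact ⟨_, h, a, Or.inr ⟨rfl, rfl⟩⟩

theorem Lf_py' {π : Perm (Fin M)} {a b : Fin M} (h : π a = b) : Lf π (py b) ↔ py b < px a := by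
  subst h; exact Lf_py

theorem Lf.lt {π : Perm (Fin M)} {t : ℕ} (h : Lf π t) : t < 2 * M := by
  obtain ⟨y, hy⟩ := h
  have := hy.1; have := hy.lt; omega

theorem pos_cases (π : Perm (Fin M)) {t : ℕ} (ht : t < 2 * M) : ∃ a, t = px a ∨ t = py (π a) := by
  rcases ar_ex π ht with ⟨y, _, a, h | h⟩ | ⟨y, _, a, h | h⟩
  · exact ⟨a, Or.inl h.1⟩
  · exact ⟨a, Or.inr h.2⟩
  · exact ⟨a, Or.inr h.2⟩
  · exact ⟨a, Or.inl h.1⟩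

theorem up_word {l m : Perm (Fin M)} (hl : NC l) (hm : NC m) {p c : Fin M} (h : UpB l m p c) (t : ℕ) :
    Lf m t ↔ (if t = min (px c) (py (l c)) then False else if t = max (px c) (py (l c)) then True
      else Lf l t) := by
  have hmc := h.mc
  have hmp := h.mp
  obtain ⟨hpc, e, hi⟩ := h
  have hm' := hm
  rw [e] at hm'
  have ho := ins_order hpc hl hm' hi
  have mo : ∀ a, a ≠ p → a ≠ c → m a = l a := by
    intro a h1 h2; rw [e, Equiv.Perm.mul_apply, Equiv.swap_apply_of_ne_of_ne h1 h2]
  by_cases ht : t < 2 * M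
  swap
  · have h1 : ¬ Lf m t := fun h => ht h.lt
    have h2 : ¬ Lf l t := fun h => ht h.lt
    have := px_lt c
    have := py_lt (l c)
    rw [if_neg (by omega), if_neg (by omega)]
    tauto
  obtain ⟨a, rfl | rfl⟩ := pos_cases l ht
  · rw [Lf_px, Lf_px]
    by_cases h1 : a = p
    · subst h1
      have k1 : px a ≠ px c := fun e => hpc (px_inj.mp e)
      rw [hmp, if_neg (by omega), if_neg (by omega)]
      omega
    by_cases h2 : a = c
    · subst h2
      rw [hmc]
      rcases ho with ho | ho
      · rw [if_neg (by omega), if_pos (by omega)]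
        exact iff_of_true (by omega) trivial
      · rw [if_pos (by omega)]
        exact iff_of_false (by omega) id
    · have k1 : px a ≠ px c := fun e => h2 (px_inj.mp e)
      have k2 := px_ne_py a (l c)
      rw [mo a h1 h2, if_neg (by omega), if_neg (by omega)]
  · rw [Lf_py]
    by_cases h1 : a = p
    · subst h1
      have k1 : py (l a) ≠ py (l c) := fun e => hpc (l.injective (py_inj.mp e))
      rw [Lf_py' hmc, if_neg (by omega), if_neg (by omega)]
      omega
    by_cases h2 : a = c
    · subst h2
      rw [Lf_py' hmp]
      rcases ho with ho | ho
      · rw [if_pos (by omega)]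
        exact iff_of_false (by omega) id
      · rw [if_neg (by omega), if_pos (by omega)]
        exact iff_of_true (by omega) trivial
    · have k1 : py (l a) ≠ py (l c) := fun e => h2 (l.injective (py_inj.mp e))
      have k2 := px_ne_py c (l a)
      rw [Lf_py' (mo a h1 h2), if_neg (by omega), if_neg (by omega)]

/-- the matching `π` realizes the padded word of `l`. -/
structure Rz {N : ℕ} (n : ℕ) (l : Wt N) (π : Perm (Fin N)) : Prop where
  nc : NC π
  left : ∀ x, x < n → Lf π x
  right : ∀ x, n + N ≤ x → ¬ Lf π x
  wd : ∀ i : Fin N, l i = true ↔ Lf π (n + i.val)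

variable {N n : ℕ}

theorem Rz.uniq {l : Wt N} {π ρ : Perm (Fin N)} (h : Rz n l π) (h' : Rz n l ρ) : π = ρ := by
  apply nc_unique h.nc h'.nc
  intro x _
  change Lf π x ↔ Lf ρ x
  by_cases h1 : x < n
  · exact iff_of_true (h.left x h1) (h'.left x h1)
  by_cases h2 : n + N ≤ x
  · exact iff_of_false (h.right x h2) (h'.right x h2)
  obtain ⟨i, rfl⟩ : ∃ i : Fin N, x = n + i.val := ⟨⟨x - n, by omega⟩, by simp; omega⟩
  rw [← h.wd, ← h'.wd]

theorem Rz.inj {l l' : Wt N} {π : Perm (Fin N)} (h : Rz n l π) (h' : Rz n l' π) : l = l' := by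
  funext i
  rw [Bool.eq_iff_iff, h.wd, h'.wd]

theorem Rz.false_iff {l : Wt N} {π : Perm (Fin N)} (h : Rz n l π) (i : Fin N) :
    l i = false ↔ ¬ Lf π (n + i.val) := by
  rw [← h.wd]; simp

/-- a position in the middle that is not left is right -/
theorem Rz.rt {l : Wt N} {π : Perm (Fin N)} (hn : n ≤ N) (h : Rz n l π) {i : Fin N} (hi : l i = false) :
    ∃ x, Ar π x (n + i.val) := by
  have := i.isLt
  rcases ar_ex π (z := n + i.val) (by omega) with h1 | h1
  · exact absurd h1 ((h.false_iff i).mp hi)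
  · exact h1

/-- inside an arc, rights inject into lefts -/
theorem Rz.cnt_le {l : Wt N} {π : Perm (Fin N)} (hn : n ≤ N) (h : Rz n l π) {i k : Fin N} {y : ℕ}
    (ha : Ar π (n + i.val) y) (hk : n + k.val < y) : cnt l false i k ≤ cnt l true i k := by
  unfold cnt
  have hex : ∀ t ∈ {t : Fin N | i < t ∧ t ≤ k ∧ l t = false}, ∃ s : Fin N, Ar π (n + s.val) (n + t.val) ∧ i < s ∧ s < t := by
    rintro t ⟨h1, h2, h3⟩
    obtain ⟨x, hx⟩ := h.rt hn h3
    have h1' : i.val < t.val := h1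
    have h2' : t.val ≤ k.val := h2
    have h4 := h.nc.nc' ha hx (by omega) (by omega)
    have h5 := hx.1
    have := t.isLt
    obtain ⟨s, rfl⟩ : ∃ s : Fin N, x = n + s.val := ⟨⟨x - n, by omega⟩, by simp; omega⟩
    refine ⟨s, hx, ?_, ?_⟩
    · show i.val < s.val; omega
    · show s.val < t.val; omega
  choose! f hf using hex
  apply Set.ncard_le_ncard_of_injOn f
  · intro t ht
    have := hf t ht
    exact ⟨this.2.1, this.2.2.le.trans ht.2.1, (h.wd _).mpr ⟨_, this.1⟩⟩
  · intro t ht s hs e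
    have h1 := (hf t ht).1
    have h2 := (hf s hs).1
    rw [e] at h1
    have := h1.uR h2
    ext; omega

theorem cnt_last {l : Wt N} {i j : Fin N} (hij : i < j) (b : Bool) :
    cnt l b i j = {t : Fin N | i < t ∧ t < j ∧ l t = b}.ncard + if l j = b then 1 else 0 := by
  unfold cnt
  split_ifs with h
  · rw [← Set.ncard_insert_of_notMem (a := j)]
    · congr 1
      ext t
      simp only [Set.mem_insert_iff, Set.mem_setOf_eq]
      constructor
      · rintro ⟨h1, h2, h3⟩
        rcases h2.lt_or_eq with h4 | h4
        · exact Or.inr ⟨h1, h4, h3⟩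
        · exact Or.inl h4
      · rintro (rfl | ⟨h1, h2, h3⟩)
        · exact ⟨hij, le_rfl, h⟩
        · exact ⟨h1, h2.le, h3⟩
    · simp
  · congr 1
    ext t
    simp only [Set.mem_setOf_eq]
    constructor
    · rintro ⟨h1, h2, h3⟩
      rcases h2.lt_or_eq with h4 | h4
      · exact ⟨h1, h4, h3⟩
      · subst h4; exact absurd h3 h
    · rintro ⟨h1, h2, h3⟩
      exact ⟨h1, h2.le, h3⟩

theorem Rz.circ_of {l : Wt N} {π : Perm (Fin N)} (hn : n ≤ N) (h : Rz n l π) {i j : Fin N}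
    (ha : Ar π (n + i.val) (n + j.val)) : IsCircle l i j := by
  have hij : i < j := by have := ha.1; show i.val < j.val; omega
  have hj : l j = false := by
    rw [h.false_iff]; rintro ⟨y, hy⟩; exact ha.no hy
  refine ⟨hij, (h.wd i).mpr ⟨_, ha⟩, hj, ?_, ?_⟩
  · rw [cnt_last hij, cnt_last hij, if_neg (by simp [hj]), if_pos hj]
    congr 1
    rw [add_zero]
    apply le_antisymm
    · have hex : ∀ t ∈ {t : Fin N | i < t ∧ t < j ∧ l t = true}, ∃ s : Fin N, Ar π (n + t.val) (n + s.val) ∧ t < s ∧ s < j := by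
        rintro t ⟨h1, h2, h3⟩
        obtain ⟨x, hx⟩ := (h.wd t).mp h3
        have h1' : i.val < t.val := h1
        have h2' : t.val < j.val := h2
        have h4 := h.nc.nc ha hx (by omega) (by omega)
        have h5 := hx.1
        have := j.isLt
        obtain ⟨s, rfl⟩ : ∃ s : Fin N, x = n + s.val := ⟨⟨x - n, by omega⟩, by simp; omega⟩
        refine ⟨s, hx, ?_, ?_⟩
        · show t.val < s.val; omega
        · show s.val < j.val; omega
      choose! f hf using hex
      apply Set.ncard_le_ncard_of_injOn f
      · intro t ht
        have := hf t ht
        refine ⟨ht.1.trans this.2.1, this.2.2, ?_⟩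
        rw [h.false_iff]; rintro ⟨y, hy⟩; exact this.1.no hy
      · intro t ht s hs e
        have h1 := (hf t ht).1
        have h2 := (hf s hs).1
        rw [e] at h1
        have := h1.uL h2
        ext; omega
    · have hex : ∀ t ∈ {t : Fin N | i < t ∧ t < j ∧ l t = false}, ∃ s : Fin N, Ar π (n + s.val) (n + t.val) ∧ i < s ∧ s < t := by
        rintro t ⟨h1, h2, h3⟩
        obtain ⟨x, hx⟩ := h.rt hn h3
        have h1' : i.val < t.val := h1
        have h2' : t.val < j.val := h2
        have h4 := h.nc.nc' ha hx (by omega) (by omega)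
        have h5 := hx.1
        have := t.isLt
        obtain ⟨s, rfl⟩ : ∃ s : Fin N, x = n + s.val := ⟨⟨x - n, by omega⟩, by simp; omega⟩
        refine ⟨s, hx, ?_, ?_⟩
        · show i.val < s.val; omega
        · show s.val < t.val; omega
      choose! f hf using hex
      apply Set.ncard_le_ncard_of_injOn f
      · intro t ht
        have := hf t ht
        exact ⟨this.2.1, this.2.2.trans ht.2.1, (h.wd _).mpr ⟨_, this.1⟩⟩
      · intro t ht s hs e
        have h1 := (hf t ht).1
        have h2 := (hf s hs).1
        rw [e] at h1
        have := h1.uR h2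
        ext; omega
  · intro k h1 h2
    have h2' : k.val < j.val := h2
    exact h.cnt_le hn ha (by omega)

theorem Rz.ar_of {l : Wt N} {π : Perm (Fin N)} (hn : n ≤ N) (h : Rz n l π) {i j : Fin N}
    (hc : IsCircle l i j) : Ar π (n + i.val) (n + j.val) := by
  obtain ⟨hij, h1, h2, h3, h4⟩ := hc
  obtain ⟨y, hy⟩ := (h.wd i).mp h1
  rcases lt_trichotomy y (n + j.val) with c | c | c
  · have h5 := hy.1
    have := j.isLt
    obtain ⟨s, rfl⟩ : ∃ s : Fin N, y = n + s.val := ⟨⟨y - n, by omega⟩, by simp; omega⟩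
    have h6 := (h.circ_of hn hy).2.2.2.1
    have h7 := h4 s (by show i.val < s.val; omega) (by show s.val < j.val; omega)
    omega
  · rw [← c]; exact hy
  · have := h.cnt_le hn hy c
    omega

theorem Rz.circ_iff {l : Wt N} {π : Perm (Fin N)} (hn : n ≤ N) (h : Rz n l π) {i j : Fin N} :
    IsCircle l i j ↔ Ar π (n + i.val) (n + j.val) := ⟨h.ar_of hn, h.circ_of hn⟩

end Kh

namespace Kh
open Equiv (swap Perm)
variable {N m n : ℕ}

theorem swapC_eq (l : Wt N) (i j : Fin N) : swapC l i j = l ∘ swap i j := by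
  funext t
  unfold swapC
  simp only [Function.comp_apply, Equiv.swap_apply_def]
  split_ifs <;> rfl

theorem ncard_comp (l : Wt N) (e : Perm (Fin N)) (b : Bool) :
    {i : Fin N | (l ∘ e) i = b}.ncard = {i : Fin N | l i = b}.ncard := by
  apply Set.ncard_congr (fun a _ => e a)
  · intro a ha; exact ha
  · intro a b _ _ h; exact e.injective h
  · intro a ha; exact ⟨e.symm a, by simpa using ha, by simp⟩

theorem swapC_weight {l : Wt N} (i j : Fin N) : IsWeight m n (swapC l i j) ↔ IsWeight m n l := by
  unfold IsWeight
  rw [swapC_eq, ncard_comp, ncard_comp]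

theorem swapC_swapC (l : Wt N) (i j : Fin N) : swapC (swapC l i j) i j = l := by
  rw [swapC_eq, swapC_eq]
  funext t; simp

theorem step_weight {l l' : Wt N} (h : GammaStep l l') : IsWeight m n l' ↔ IsWeight m n l := by
  obtain ⟨i, j, _, rfl⟩ := h
  exact swapC_weight i j

theorem adj_weight {l l' : Wt N} (h : GammaAdj l l') : IsWeight m n l' ↔ IsWeight m n l := by
  rcases h with h | h
  · exact step_weight h
  · exact (step_weight h).symm

theorem swapC_wd {l : Wt N} {i j : Fin N} (h1 : l i = true) (h2 : l j = false) (t : Fin N) :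
    swapC l i j t = true ↔ (if t = i then False else if t = j then True else l t = true) := by
  unfold swapC
  split_ifs <;> simp_all

theorem Rz.encl {l : Wt N} {π : Perm (Fin N)} (hn : n ≤ N) (h : Rz n l π) (hw : IsWeight m n l)
    {c : Fin N} {i j : Fin N} (h1 : n + i.val = min (px c) (py (π c)))
    (h2 : n + j.val = max (px c) (py (π c))) : ∃ p, p ≠ c ∧ Ins π p c := by
  by_contra hno
  push Not at hno
  have hc := ar_mm π c
  rw [← h1, ← h2] at hc
  have hex : ∀ x : Fin n, ∃ t : Fin N, Ar π x.val (n + t.val) ∧ t ≠ j := by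
    intro x
    obtain ⟨y, hy⟩ := h.left x x.isLt
    have hx := x.isLt
    have hyc : y < n + i.val := by
      by_contra hlt
      have h3 : y ≠ n + i.val := by rintro rfl; exact hy.no hc
      have h4 : y ≠ n + j.val := by
        rintro rfl
        have := hy.uL hc; omega
      rcases lt_or_gt_of_ne h4 with h5 | h5
      · have := h.nc.nc' hc hy (by omega) h5
        omega
      · obtain ⟨a, ha, hb⟩ := hy.idx
        have hac : a ≠ c := by rintro rfl; omega
        exact hno a hac ((ins_iff h.nc hac).mpr ⟨by omega, by omega⟩)
    have hyn : n ≤ y := by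
      by_contra hlt
      obtain ⟨z, hz⟩ := h.left y (by omega)
      exact hy.no hz
    have := i.isLt
    obtain ⟨s, rfl⟩ : ∃ s : Fin N, y = n + s.val := ⟨⟨y - n, by omega⟩, by simp; omega⟩
    refine ⟨s, hy, ?_⟩
    rintro rfl
    have := hc.1; omega
  choose f hf using hex
  have hinj : Function.Injective f := by
    intro x y e
    have h3 := (hf x).1
    rw [e] at h3
    exact Fin.ext (h3.uL (hf y).1)
  have hsub : Set.range f ⊆ {i : Fin N | l i = false} \ {j} := by
    rintro _ ⟨x, rfl⟩
    refine ⟨?_, (hf x).2⟩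
    rw [Set.mem_setOf_eq, h.false_iff]
    rintro ⟨z, hz⟩
    exact (hf x).1.no hz
  have h3 := Set.ncard_le_ncard hsub
  rw [← Set.image_univ, Set.ncard_image_of_injective _ hinj, Set.ncard_univ, Nat.card_fin] at h3
  have hj : j ∈ {i : Fin N | l i = false} := by
    rw [Set.mem_setOf_eq, h.false_iff]
    rintro ⟨z, hz⟩
    exact hc.no hz
  have h4 := Set.ncard_diff_singleton_add_one hj
  rw [hw.2] at h4
  omega

theorem Rz.step_rz {l : Wt N} {π m' : Perm (Fin N)} (hn : n ≤ N) (h : Rz n l π) (hm : NC m') {p c i j : Fin N}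
    (hu : UpB π m' p c) (h1 : n + i.val = min (px c) (py (π c)))
    (h2 : n + j.val = max (px c) (py (π c))) : Rz n (swapC l i j) m' := by
  have hc := ar_mm π c
  rw [← h1, ← h2] at hc
  have hw := up_word h.nc hm hu
  rw [← h1, ← h2] at hw
  have hi : l i = true := (h.wd i).mpr ⟨_, hc⟩
  have hj : l j = false := by
    rw [h.false_iff]
    rintro ⟨z, hz⟩
    exact hc.no hz
  refine ⟨hm, ?_, ?_, ?_⟩
  · intro x hx
    rw [hw, if_neg (by omega), if_neg (by omega)]
    exact h.left x hx
  · intro x hx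
    have := i.isLt
    have := j.isLt
    rw [hw, if_neg (by omega), if_neg (by omega)]
    exact h.right x hx
  · intro t
    rw [swapC_wd hi hj, hw, h.wd]
    simp only [Nat.add_left_cancel_iff, Fin.ext_iff]

theorem Rz.up {l : Wt N} {π : Perm (Fin N)} (hn : n ≤ N) (h : Rz n l π) (hw : IsWeight m n l)
    {i j : Fin N} (hc : IsCircle l i j) :
    ∃ p c m', UpB π m' p c ∧ n + i.val = min (px c) (py (π c)) ∧ n + j.val = max (px c) (py (π c)) ∧
      Rz n (swapC l i j) m' := by
  obtain ⟨c, h1, h2⟩ := (h.ar_of hn hc).idx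
  obtain ⟨p, hp, hi, hm⟩ := lemS' h.nc (h.encl hn hw h1 h2)
  exact ⟨p, c, _, ⟨hp, rfl, hi⟩, h1, h2, h.step_rz hn hm ⟨hp, rfl, hi⟩ h1 h2⟩

theorem Rz.dn {l : Wt N} {π v : Perm (Fin N)} (hn : n ≤ N) (h : Rz n l π) (hv : NC v)
    {p c : Fin N} (hu : UpB v π p c) :
    ∃ k i j, Rz n k v ∧ IsCircle k i j ∧ l = swapC k i j ∧ n + i.val = min (px c) (py (v c)) ∧
      n + j.val = max (px c) (py (v c)) := by
  have hw := up_word hv h.nc hu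
  have hc := ar_mm v c
  have hlt := hc.1
  have h1 : n ≤ min (px c) (py (v c)) := by
    by_contra hlt
    have := (hw _).mp (h.left (min (px c) (py (v c))) (by omega))
    rw [if_pos rfl] at this
    exact this
  have h2 : max (px c) (py (v c)) < n + N := by
    by_contra hlt'
    apply h.right (max (px c) (py (v c))) (by omega)
    rw [hw, if_neg (by omega), if_pos rfl]
    trivial
  obtain ⟨i, hi⟩ : ∃ i : Fin N, n + i.val = min (px c) (py (v c)) := ⟨⟨min (px c) (py (v c)) - n, by omega⟩, by simp; omega⟩
  obtain ⟨j, hj⟩ : ∃ j : Fin N, n + j.val = max (px c) (py (v c)) := ⟨⟨max (px c) (py (v c)) - n, by omega⟩, by simp; omega⟩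
  rw [← hi, ← hj] at hw hc
  have hr : Rz n (fun t : Fin N => decide (Lf v (n + t.val))) v := by
    refine ⟨hv, ?_, ?_, ?_⟩
    · intro x hx
      have := (hw x).mp (h.left x hx)
      rwa [if_neg (by omega), if_neg (by omega)] at this
    · intro x hx h3
      have := i.isLt
      have := j.isLt
      apply h.right x hx
      rw [hw, if_neg (by omega), if_neg (by omega)]
      exact h3
    · intro t; simp
  refine ⟨_, i, j, hr, hr.circ_of hn hc, ?_, hi, hj⟩
  exact h.inj (hr.step_rz hn h.nc hu hi hj)

/-! heights -/

theorem cnt_pairs {α : Type*} [LinearOrder α] (S : Finset α) :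
    2 * ∑ i ∈ S, (S.filter (· < i)).card + S.card = S.card * S.card := by
  have h1 : ∑ i ∈ S, (S.filter (· < i)).card = ∑ i ∈ S, (S.filter (fun j => i < j)).card := by
    simp only [Finset.card_filter]
    rw [Finset.sum_comm]
  have h2 : ∀ i ∈ S, (S.filter (· < i)).card + (S.filter (fun j => i < j)).card + 1 = S.card := by
    intro i hi
    rw [← Finset.card_filter_add_card_filter_not (s := S) (fun j => j < i), add_assoc]
    congr 1
    rw [← Finset.card_erase_add_one (s := S.filter (fun j => ¬ j < i)) (a := i) (by simp [hi])]
    congr 2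
    ext j
    simp only [Finset.mem_filter, Finset.mem_erase, not_lt]
    constructor
    · rintro ⟨a, b⟩; exact ⟨b.ne', a, b.le⟩
    · rintro ⟨a, b, c⟩; exact ⟨b, lt_of_le_of_ne c (Ne.symm a)⟩
  have h3 := Finset.sum_congr rfl h2
  rw [Finset.sum_add_distrib, Finset.sum_add_distrib, ← h1] at h3
  simp at h3
  omega

theorem height_pos {l : Wt N} (hw : IsWeight m n l) :
    2 * height l + m * m = 2 * ∑ i : Fin N, (if l i = true then i.val else 0) + m := by
  set S : Finset (Fin N) := Finset.univ.filter (fun i => l i = true) with hS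
  have hc : S.card = m := by
    rw [← hw.1, hS, ← Set.ncard_coe_finset]; congr 1; ext; simp
  have h1 := cnt_pairs S
  rw [hc] at h1
  have h2 : height l = ∑ i ∈ S, {j : Fin N | j < i ∧ l j = false}.ncard := by
    rw [hS, Finset.sum_filter]; rfl
  have h3 : ∑ i : Fin N, (if l i = true then i.val else 0) = ∑ i ∈ S, i.val := by
    rw [hS, Finset.sum_filter]
  have h4 : ∀ i ∈ S, {j : Fin N | j < i ∧ l j = false}.ncard + (S.filter (· < i)).card = i.val := by
    intro i _
    have e1 : {j : Fin N | j < i ∧ l j = false} = ((Finset.univ.filter (fun j : Fin N => j < i)).filter (fun j => ¬ l j = true) : Finset (Fin N)) := by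
      ext; simp
    have e2 : S.filter (· < i) = (Finset.univ.filter (fun j : Fin N => j < i)).filter (fun j => l j = true) := by
      ext; simp [hS, and_comm]
    rw [e1, e2, Set.ncard_coe_finset, add_comm, Finset.card_filter_add_card_filter_not]
    have : Finset.univ.filter (fun j : Fin N => j < i) = Finset.Iio i := by ext; simp
    rw [this, Fin.card_Iio]
  have h5 := Finset.sum_congr rfl h4
  rw [Finset.sum_add_distrib] at h5
  rw [h2, h3, ← h5]
  omega

theorem height_swap {l : Wt N} (hw : IsWeight m n l) {i j : Fin N} (hij : i < j) (hi : l i = true) (hj : l j = false) :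
    height (swapC l i j) = height l + (j.val - i.val) := by
  have h1 := height_pos hw
  have h2 := height_pos ((swapC_weight i j).mpr hw)
  have h3 : ∑ t : Fin N, (if swapC l i j t = true then t.val else 0) + i.val = ∑ t : Fin N, (if l t = true then t.val else 0) + j.val := by
    have e1 : ∀ t : Fin N, (if swapC l i j t = true then t.val else 0) + (if t = i then i.val else 0) =
        (if l t = true then t.val else 0) + (if t = j then j.val else 0) := by
      intro t
      by_cases a : t = i
      · subst a
        rw [if_neg (by rw [swapC_wd hi hj, if_pos rfl]; exact id), if_pos rfl, if_pos hi, if_neg hij.ne]; omega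
      by_cases b : t = j
      · subst b
        rw [if_pos (by rw [swapC_wd hi hj, if_neg a, if_pos rfl]; trivial), if_neg a, if_pos rfl, if_neg (by simp [hj])]; omega
      · rw [if_neg a, if_neg b]
        congr 1
        have := swapC_wd hi hj t
        rw [if_neg a, if_neg b] at this
        simp only [this]
    have e2 := Finset.sum_congr (rfl : (Finset.univ : Finset (Fin N)) = _) (fun t _ => e1 t)
    rw [Finset.sum_add_distrib, Finset.sum_add_distrib] at e2
    simpa using e2
  have : i.val < j.val := hij
  omega

theorem circ_adj {l : Wt N} {i j : Fin N} (hij : i.val + 1 = j.val) (hi : l i = true) (hj : l j = false) : IsCircle l i j := by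
  have h0 : i < j := by show i.val < j.val; omega
  refine ⟨h0, hi, hj, ?_, ?_⟩
  · rw [cnt_last h0, cnt_last h0, if_neg (by simp [hj]), if_pos hj]
    have : ∀ b, {t : Fin N | i < t ∧ t < j ∧ l t = b} = ∅ := by
      intro b; ext t
      simp only [Set.mem_setOf_eq, Set.mem_empty_iff_false, iff_false]
      rintro ⟨h1, h2, _⟩
      have : i.val < t.val := h1
      have : t.val < j.val := h2
      omega
    rw [this, this]
  · intro k h1 h2
    have : i.val < k.val := h1
    have : k.val < j.val := h2
    omega

/-- either sorted or there is an adjacent up-down pair -/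
theorem sorted_or {l : Wt N} (hw : IsWeight m n l) :
    (∀ i : Fin N, l i = true ↔ i.val < m) ∨
    ∃ i j : Fin N, i.val + 1 = j.val ∧ l i = false ∧ l j = true := by
  by_contra hcon
  push Not at hcon
  obtain ⟨h1, h2⟩ := hcon
  have mono : ∀ d, ∀ i j : Fin N, i.val + d = j.val → l j = true → l i = true := by
    intro d
    induction d with
    | zero => intro i j e h; rw [show i = j from Fin.ext (by omega)]; exact h
    | succ d ih =>
      intro i j e h
      have := j.isLt
      have h3 := ih ⟨i.val + 1, by omega⟩ j (by simp; omega) h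
      by_contra hf
      exact h2 i ⟨i.val + 1, by omega⟩ rfl (by simpa using hf) h3
  obtain ⟨i, hi⟩ := h1
  by_cases ht : l i = true
  · have : m ≤ i.val := by
      by_contra hlt
      rcases hi with hi | hi
      · omega
      · exact hi.1 ht
    have hsub : (Finset.Iic i : Set (Fin N)) ⊆ {t | l t = true} := by
      intro t htt
      have : t.val ≤ i.val := by simpa using htt
      exact mono (i.val - t.val) t i (by omega) ht
    have := Set.ncard_le_ncard hsub
    rw [hw.1, Set.ncard_coe_finset, Fin.card_Iic] at this
    omega
  · have : i.val < m := by
      rcases hi with hi | hi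
      · exact absurd hi.1 ht
      · exact hi.2
    have hsub : {t | l t = true} ⊆ (Finset.Iio i : Set (Fin N)) := by
      intro t htt
      simp only [Finset.coe_Iio, Set.mem_Iio]
      by_contra hlt
      have : i.val ≤ t.val := by simpa using hlt
      exact ht (mono (t.val - i.val) i t (by omega) htt)
    have := Set.ncard_le_ncard hsub
    rw [hw.1, Set.ncard_coe_finset, Fin.card_Iio] at this
    omega

theorem nc_rev : NC (Fin.revPerm : Perm (Fin N)) := by
  intro a b hab
  unfold sS
  rw [Bool.eq_iff_iff, SS_true, SS_true]
  have hab' : a.val ≠ b.val := fun e => hab (Fin.ext e)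
  simp only [px, py, Fin.revPerm_apply, Fin.val_rev]
  have := a.isLt
  have := b.isLt
  omega

theorem Lf_rev (t : ℕ) : Lf (Fin.revPerm : Perm (Fin N)) t ↔ t < N := by
  by_cases ht : t < 2 * N
  · obtain ⟨a, rfl | rfl⟩ := pos_cases Fin.revPerm ht
    · rw [Lf_px]
      have := a.isLt
      simp only [px, py, Fin.revPerm_apply, Fin.val_rev]; omega
    · rw [Lf_py]
      have := a.isLt
      simp only [px, py, Fin.revPerm_apply, Fin.val_rev]; omega
  · exact iff_of_false (fun h => ht h.lt) (by omega)

theorem Rz.ex (hN : N = m + n) : ∀ (h : ℕ) (l : Wt N), IsWeight m n l → height l = h → ∃ π, Rz n l π := by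
  intro h
  induction h using Nat.strong_induction_on with
  | _ h ih =>
    intro l hw hh
    rcases sorted_or hw with hs | ⟨i, j, hij, hi, hj⟩
    · refine ⟨Fin.revPerm, nc_rev, ?_, ?_, ?_⟩
      · intro x hx; rw [Lf_rev]; omega
      · intro x hx; rw [Lf_rev]; omega
      · intro t; rw [Lf_rev, hs]; omega
    · have hlt : i < j := by show i.val < j.val; omega
      have hw' := (swapC_weight i j).mpr hw
      have hi' : swapC l i j i = true := by simp [swapC, hj]
      have hj' : swapC l i j j = false := by simp [swapC, hi, hlt.ne']
      have e := height_swap hw' hlt hi' hj'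
      rw [swapC_swapC] at e
      obtain ⟨π, hπ⟩ := ih (height (swapC l i j)) (by omega) _ hw' rfl
      obtain ⟨_, _, m', _, _, _, hr⟩ := hπ.up (by omega) hw' (circ_adj hij hi' hj')
      rw [swapC_swapC] at hr
      exact ⟨m', hr⟩

end Kh

namespace Kh
open Equiv (swap Perm)
variable {N m n : ℕ}

noncomputable instance instFintypeV : Fintype (V m n N) :=
  inferInstanceAs (Fintype {l : Wt N // IsWeight m n l})

/-- the matching attached to a weight -/
noncomputable def psi (v : V m n N) : Perm (Fin N) :=
  if h : ∃ π, Rz n v.1 π then h.choose else 1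

theorem psi_rz (hN : N = m + n) (v : V m n N) : Rz n v.1 (psi v) := by
  have h := Rz.ex hN _ v.1 v.2 rfl
  unfold psi
  rw [dif_pos h]
  exact h.choose_spec

theorem psi_nc (hN : N = m + n) (v : V m n N) : NC (psi v) := (psi_rz hN v).nc

theorem psi_inj (hN : N = m + n) : Function.Injective (psi : V m n N → _) := by
  intro u v h
  have h1 := psi_rz hN u
  rw [h] at h1
  exact Subtype.ext (h1.inj (psi_rz hN v))

theorem psi_eq (hN : N = m + n) {v : V m n N} {π : Perm (Fin N)} (h : Rz n v.1 π) : psi v = π :=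
  (psi_rz hN v).uniq h

/-- index of a circle -/
def CI (v : V m n N) (i j c : Fin N) : Prop :=
  n + i.val = min (px c) (py (psi v c)) ∧ n + j.val = max (px c) (py (psi v c))

theorem ci_ex (hN : N = m + n) {v : V m n N} {i j : Fin N} (h : IsCircle v.1 i j) : ∃ c, CI v i j c := by
  obtain ⟨c, h1, h2⟩ := ((psi_rz hN v).ar_of (by omega) h).idx
  exact ⟨c, h1, h2⟩

theorem CI.circ (hN : N = m + n) {v : V m n N} {i j c : Fin N} (h : CI v i j c) : IsCircle v.1 i j := by
  apply (psi_rz hN v).circ_of (by omega)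
  rw [h.1, h.2]; exact ar_mm _ _

theorem mm_inj {π : Perm (Fin N)} {c c' : Fin N} (h : min (px c) (py (π c)) = min (px c') (py (π c')))
    (h' : max (px c) (py (π c)) = max (px c') (py (π c'))) : c = c' := by
  have h1 := px_ne_py c (π c)
  have h2 := px_ne_py c' (π c')
  have h3 := px_ne_py c (π c')
  have h4 := px_ne_py c' (π c)
  exact px_inj.mp (by omega)

theorem CI.uniq {v : V m n N} {i j c c' : Fin N} (h : CI v i j c) (h' : CI v i j c') : c = c' :=
  mm_inj (h.1.symm.trans h'.1) (h.2.symm.trans h'.2)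

theorem CI.uniq' {v : V m n N} {i j i' j' c : Fin N} (h : CI v i j c) (h' : CI v i' j' c) : i = i' ∧ j = j' := by
  have := h.1; have := h.2; have := h'.1; have := h'.2
  constructor <;> (ext; omega)

theorem CI.encl (hN : N = m + n) {v : V m n N} {i j c i' j' c' : Fin N} (h : CI v i j c) (h' : CI v i' j' c') (hc : c ≠ c') :
    Encloses i j i' j' ↔ Ins (psi v) c c' := by
  rw [ins_iff (psi_nc hN v) hc, ← h.1, ← h.2, ← h'.1, ← h'.2]
  unfold Encloses
  rw [Fin.lt_def, Fin.lt_def]; omega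

/-- arcs inside a circle are circles -/
theorem CI.inside (hN : N = m + n) {v : V m n N} {i j c c' : Fin N} (h : CI v i j c) (hc : c ≠ c') (hi : Ins (psi v) c c') :
    ∃ i' j', CI v i' j' c' := by
  rw [ins_iff (psi_nc hN v) hc, ← h.1, ← h.2] at hi
  have h1 := (ar_mm (psi v) c').1
  have := j.isLt
  exact ⟨⟨min (px c') (py (psi v c')) - n, by omega⟩, ⟨max (px c') (py (psi v c')) - n, by omega⟩,
    by simp; omega, by simp; omega⟩

/-- vertex obtained by swapping -/
noncomputable def sw (v : V m n N) (i j : Fin N) : V m n N := ⟨swapC v.1 i j, (swapC_weight i j).mpr v.2⟩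

theorem CI.sw_eq (hN : N = m + n) {v : V m n N} {i j c p : Fin N} {μ : Perm (Fin N)} (h : CI v i j c) (hμ : NC μ)
    (hu : UpB (psi v) μ p c) : psi (sw v i j) = μ :=
  psi_eq hN ((psi_rz hN v).step_rz (by omega) hμ hu h.1 h.2)

theorem CI.up (hN : N = m + n) {v : V m n N} {i j c : Fin N} (h : CI v i j c) :
    ∃ p, UpB (psi v) (psi (sw v i j)) p c := by
  obtain ⟨p, hp, hi, hm⟩ := lemS' (psi_nc hN v) ((psi_rz hN v).encl (by omega) v.2 h.1 h.2)
  refine ⟨p, ?_⟩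
  rw [h.sw_eq hN hm ⟨hp, rfl, hi⟩]
  exact ⟨hp, rfl, hi⟩

theorem low_mem (hN : N = m + n) {u : V m n N} {v : Perm (Fin N)} (hv : NC v) {p c : Fin N} (hu : UpB v (psi u) p c) :
    ∃ k : V m n N, psi k = v ∧ ∃ i j, CI k i j c ∧ u = sw k i j := by
  obtain ⟨k, i, j, h1, h2, h3, h4, h5⟩ := (psi_rz hN u).dn (by omega) hv hu
  have hk : IsWeight m n k := by
    have := u.2; rw [h3, swapC_weight] at this; exact this
  have e : psi (⟨k, hk⟩ : V m n N) = v := psi_eq hN h1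
  refine ⟨⟨k, hk⟩, e, i, j, ⟨by rw [e]; exact h4, by rw [e]; exact h5⟩, Subtype.ext h3⟩

theorem step_iff (hN : N = m + n) {u v : V m n N} : GammaStep u.1 v.1 ↔ ∃ p c, UpB (psi u) (psi v) p c := by
  constructor
  · rintro ⟨i, j, h1, h2⟩
    obtain ⟨c, hc⟩ := ci_ex hN h1
    obtain ⟨p, hp⟩ := hc.up hN
    have : v = sw u i j := Subtype.ext h2
    subst this
    exact ⟨p, c, hp⟩
  · rintro ⟨p, c, hu⟩
    obtain ⟨k, hk, i, j, hc, rfl⟩ := low_mem hN (psi_nc hN u) hu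
    have := psi_inj hN hk
    subst this
    exact ⟨i, j, hc.circ hN, rfl⟩

theorem step_iff' (hN : N = m + n) {u v : V m n N} :
    GammaStep u.1 v.1 ↔ Nbp (psi u) (psi v) ∧ L (psi v) < L (psi u) := by
  rw [step_iff hN]
  constructor
  · rintro ⟨p, c, h⟩; exact ⟨h.nbp, h.Llt (psi_nc hN u) (psi_nc hN v)⟩
  · rintro ⟨h1, h2⟩; exact upB_of (psi_nc hN u) (psi_nc hN v) h1 h2

theorem nbp_ne {π ρ : Perm (Fin N)} (h1 : NC π) (h2 : NC ρ) (h : Nbp π ρ) : L π ≠ L ρ := by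
  obtain ⟨a, b, hab, rfl⟩ := h
  exact nb_ne hab h1 h2

theorem adj_iff (hN : N = m + n) {u v : V m n N} : GammaAdj u.1 v.1 ↔ Nbp (psi u) (psi v) := by
  unfold GammaAdj
  rw [step_iff' hN, step_iff' hN]
  constructor
  · rintro (h | h)
    · exact h.1
    · exact h.1.symm
  · intro h
    have : L (psi u) ≠ L (psi v) := nbp_ne (psi_nc hN u) (psi_nc hN v) h
    rcases lt_or_gt_of_ne this with h1 | h1
    · exact Or.inr ⟨h.symm, h1⟩
    · exact Or.inl ⟨h, h1⟩

/-- neighbours outside are above -/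
theorem out_above (hN : N = m + n) {u : V m n N} {v : Perm (Fin N)} (hv : NC v) (h : Nbp (psi u) v)
    (hr : ∀ k : V m n N, psi k ≠ v) : L v < L (psi u) := by
  by_contra hlt
  have h1 := nbp_ne (psi_nc hN u) hv h
  obtain ⟨p, c, hu⟩ := upB_of hv (psi_nc hN u) h.symm (by omega)
  obtain ⟨k, hk, _⟩ := low_mem hN hv hu
  exact hr k hk

/-- (CA) -/
theorem commonA (hN : N = m + n) {s u : V m n N} (hne : s ≠ u)
    (h2 : 2 ≤ {nu : Wt N | GammaAdj s.1 nu ∧ GammaAdj nu u.1}.ncard) {v : Perm (Fin N)} (hv : NC v)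
    (h3 : Nbp (psi s) v) (h4 : Nbp v (psi u)) : ∃ k : V m n N, psi k = v := by
  by_contra hno
  push Not at hno
  have l1 := out_above hN hv h3 hno
  have l2 := out_above hN hv h4.symm hno
  obtain ⟨a, b, ha, hb, hab⟩ := (Set.one_lt_ncard_iff (Set.toFinite _)).mp (lt_of_lt_of_le one_lt_two h2)
  have wa : IsWeight m n a := (adj_weight ha.1).mpr s.2
  have wb : IsWeight m n b := (adj_weight hb.1).mpr s.2
  have a1 := (adj_iff hN (u := s) (v := ⟨a, wa⟩)).mp ha.1
  have a2 := (adj_iff hN (v := u) (u := ⟨a, wa⟩)).mp ha.2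
  have b1 := (adj_iff hN (u := s) (v := ⟨b, wb⟩)).mp hb.1
  have b2 := (adj_iff hN (v := u) (u := ⟨b, wb⟩)).mp hb.2
  have := top2p hv (psi_nc hN s) (psi_nc hN u) (psi_nc hN ⟨a, wa⟩) (psi_nc hN ⟨b, wb⟩) h3.symm h4 l1 l2
    (fun e => hne (psi_inj hN e)) a1 a2 (hno _) b1 b2 (hno _)
  exact hab (congrArg Subtype.val (psi_inj hN this))

/-- (CD) -/
theorem lackD (hN : N = m + n) {s : V m n N} {i j c : Fin N} (hc : CI s i j c) {v : Perm (Fin N)} (hv : NC v)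
    (h : Nbp (psi s) v) (h2 : v c ≠ psi s c) : ∃ k : V m n N, psi k = v := by
  by_contra hno
  push Not at hno
  have l1 := out_above hN hv h hno
  obtain ⟨p, c', hu⟩ := upB_of (psi_nc hN s) hv h l1
  have key : ∃ i' j', CI s i' j' c' := by
    by_cases h3 : c = c'
    · subst h3; exact ⟨i, j, hc⟩
    · have h4 : c = p := by
        by_contra h4
        apply h2
        rw [hu.2.1, Equiv.Perm.mul_apply, Equiv.swap_apply_of_ne_of_ne h4 h3]
      subst h4
      exact hc.inside hN h3 hu.2.2
  obtain ⟨i', j', h3⟩ := key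
  exact hno _ (h3.sw_eq hN hv hu)

end Kh

namespace Kh
open Equiv (swap Perm)
variable {N m n : ℕ}

theorem UpB.ins_o {l m' : Perm (Fin N)} {p c q z : Fin N} (h : UpB l m' p c) (h1 : q ≠ p) (h2 : q ≠ c) :
    Ins m' q z ↔ Ins l q z := by
  rw [h.2.1]; unfold Ins
  rw [swap_mul_of_ne _ (Equiv.swap_apply_of_ne_of_ne h1 h2)]

theorem UpB.mo {l m' : Perm (Fin N)} {p c q : Fin N} (h : UpB l m' p c) (h1 : q ≠ p) (h2 : q ≠ c) :
    m' q = l q := by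
  rw [h.2.1, Equiv.Perm.mul_apply, Equiv.swap_apply_of_ne_of_ne h1 h2]

theorem UpB.un {l m' : Perm (Fin N)} (hl : NC l) (hm : NC m') {p c : Fin N} (h : UpB l m' p c) : Un m' p c := by
  obtain ⟨h1, rfl, h2⟩ := h
  exact un_after h1 hl hm h2

/-- perm-level (CB) -/
theorem permB {π ν μ v : Perm (Fin N)} (hπ : NC π) (hν : NC ν) (_hμ : NC μ) (hv : NC v) {p c q c' : Fin N}
    (hcc : c ≠ c') (h1 : Ins π c c') (h2 : NC (π * swap c c')) (u1 : UpB π ν p c) (u2 : UpB ν μ q c')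
    (n1 : Nbp π v) (n2 : Nbp v μ) : v = ν := by
  by_contra hne
  have hpc' : p ≠ c' := by
    rintro rfl
    exact ins_anti hπ u1.1 u1.2.2 h1
  have hpi : Ins π p c' := ins_trans hπ u1.1 u1.2.2 h1
  have hx := sxor (π := π) p c (px c')
  have hun := u1.un hπ hν
  have hq : q ≠ p ∧ q ≠ c := by
    have e := u1.2.1
    rw [← e] at hx
    have a1 : sS π p (px c') = true := hpi
    have a2 : sS π c (px c') = true := h1
    rw [a1, a2] at hx
    have key : sS ν p (px c') = false ∧ sS ν c (px c') = false := by
      cases b1 : sS ν p (px c') with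
      | true =>
        have := un_disj hν u1.1 hun b1
        rw [b1, this] at hx; simp at hx
      | false => rw [b1] at hx; simpa using hx
    have a3 : sS ν q (px c') = true := u2.2.2
    constructor
    · rintro rfl; rw [key.1] at a3; cases a3
    · rintro rfl; rw [key.2] at a3; cases a3
  have hdis : swap p c ≠ swap q c' := by
    intro e
    have := congrArg (fun f => f c') e
    simp only [Equiv.swap_apply_right, Equiv.swap_apply_of_ne_of_ne hpc'.symm hcc.symm] at this
    exact u2.1 this.symm
  have eπ : π = ν * swap p c := by rw [u1.2.1, swap_swap]
  have hπμ : π ≠ μ := by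
    intro e
    rw [u2.2.1] at e
    rw [eπ] at e
    exact hdis (mul_left_cancel e)
  have hfin : v = π * swap q c' := by
    rcases topcases (μ := ν) (κ := π) (l := μ) (w := v) ⟨p, c, u1.1, eπ⟩ u2.nbp hπμ n1 n2 hne with
      ⟨a, b, e, f, hab, hef, _, _, _, _, k1, k2, k3⟩ | ⟨a, b, d, hab, had, hbd, k1, k2, _⟩
    · rw [k3, ← k1]
      congr 1
      rw [u2.2.1] at k2
      exact (mul_left_cancel k2).symm
    · exfalso
      have e1 : swap p c = swap a b := mul_left_cancel (eπ.symm.trans k1)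
      have e2 : swap q c' = swap a d := mul_left_cancel (u2.2.1.symm.trans k2)
      have f1 : swap p c a ≠ a := by rw [e1]; simpa using hab.symm
      have f2 : swap q c' a ≠ a := by rw [e2]; simpa using had.symm
      have g1 : a = p ∨ a = c := by
        by_contra hh; push Not at hh; exact f1 (Equiv.swap_apply_of_ne_of_ne hh.1 hh.2)
      have g2 : a = q ∨ a = c' := by
        by_contra hh; push Not at hh; exact f2 (Equiv.swap_apply_of_ne_of_ne hh.1 hh.2)
      rcases g1 with rfl | rfl <;> rcases g2 with rfl | rfl
      · exact hq.1 rfl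
      · exact hpc' rfl
      · exact hq.2 rfl
      · exact hcc rfl
  have h3 : Ins π q c' := (u1.ins_o hq.1 hq.2).mp u2.2.2
  rw [hfin] at hv
  exact hq.2 (F1 hπ u2.1 hcc hv h2 h3 h1)

/-- perm-level (CC) -/
theorem permC {κ ν l w : Perm (Fin N)} (hκ : NC κ) (hν : NC ν) (hl : NC l) (hw : NC w) {p c q d : Fin N}
    (u1 : UpB κ ν p c) (u2 : UpB l ν q d) (hne : κ ≠ l) (n1 : Nbp κ w) (n2 : Nbp w l) (hwν : w ≠ ν)
    {x y x' y' : ℕ} (hx : x = min (px c) (py (κ c))) (hy : y = max (px c) (py (κ c)))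
    (hx' : x' = min (px d) (py (l d))) (hy' : y' = max (px d) (py (l d))) (h1 : x < x') (h2 : x' < y) (h3 : y < y') : False := by
  have eκ : κ = ν * swap p c := by rw [u1.2.1, swap_swap]
  have el : l = ν * swap q d := by rw [u2.2.1, swap_swap]
  rcases topcases (μ := ν) (κ := κ) (l := l) (w := w) u1.nbp.symm u2.nbp.symm hne n1 n2 hwν with
      ⟨a, b, e, f, hab, hef, hae, haf, hbe, hbf, k1, k2, k3⟩ | ⟨a, b, z, hab, had, hbd, k1, k2, _⟩
  · have e1 : swap p c = swap a b := mul_left_cancel (eκ.symm.trans k1)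
    have e2 : swap q d = swap e f := mul_left_cancel (el.symm.trans k2)
    have mv : ∀ {a b c d : Fin N}, a ≠ b → swap a b = swap c d → (a = c ∨ a = d) ∧ (b = c ∨ b = d) := by
      intro a b c d hab he
      constructor
      · by_contra hh; push Not at hh
        have := Equiv.swap_apply_of_ne_of_ne hh.1 hh.2
        rw [← he, Equiv.swap_apply_left] at this; exact hab this.symm
      · by_contra hh; push Not at hh
        have := Equiv.swap_apply_of_ne_of_ne hh.1 hh.2
        rw [← he, Equiv.swap_apply_right] at this; exact hab this
    have m1 := mv u1.1 e1
    have m2 := mv u2.1 e2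
    have wc : w c = κ c := by
      rw [k3, ← k1, Equiv.Perm.mul_apply, Equiv.swap_apply_of_ne_of_ne]
      · rcases m1.2 with h | h <;> rw [h] <;> assumption
      · rcases m1.2 with h | h <;> rw [h] <;> assumption
    have wd : w d = l d := by
      have hcm : swap a b * swap e f = swap e f * swap a b := by
        apply Equiv.Perm.Disjoint.commute
        rw [Equiv.Perm.disjoint_iff_disjoint_support, Equiv.Perm.support_swap hab, Equiv.Perm.support_swap hef]
        simp [hae.symm, hbe.symm, haf.symm, hbf.symm, hae, haf, hbe, hbf]
      rw [k3, mul_assoc, hcm, ← mul_assoc, ← k2, Equiv.Perm.mul_apply, Equiv.swap_apply_of_ne_of_ne]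
      · rcases m2.2 with h | h <;> rw [h] <;> exact Ne.symm ‹_›
      · rcases m2.2 with h | h <;> rw [h] <;> exact Ne.symm ‹_›
    have a1 := ar_mm w c
    have a2 := ar_mm w d
    rw [wc, ← hx, ← hy] at a1
    rw [wd, ← hx', ← hy'] at a2
    have := hw.nc a1 a2 h1 h2
    omega
  · exfalso
    have e1 : swap p c = swap a b := mul_left_cancel (eκ.symm.trans k1)
    have e2 : swap q d = swap a z := mul_left_cancel (el.symm.trans k2)
    have f1 : swap p c a ≠ a := by rw [e1]; simpa using hab.symm
    have f2 : swap q d a ≠ a := by rw [e2]; simpa using had.symm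
    have g1 : a = p ∨ a = c := by
      by_contra hh; push Not at hh; exact f1 (Equiv.swap_apply_of_ne_of_ne hh.1 hh.2)
    have g2 : a = q ∨ a = d := by
      by_contra hh; push Not at hh; exact f2 (Equiv.swap_apply_of_ne_of_ne hh.1 hh.2)
    have o1 := ins_order u1.1 hκ (by rw [← u1.2.1]; exact hν) u1.2.2
    have o2 := ins_order u2.1 hl (by rw [← u2.2.1]; exact hν) u2.2.2
    have i1 := u1.mc
    have i2 := u1.mp
    have i3 := u2.mc
    have i4 := u2.mp
    rw [← i1, ← i2] at o1
    rw [← i3, ← i4] at o2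
    rw [← i2] at hx hy
    rw [← i4] at hx' hy'
    rcases g1 with rfl | rfl <;> rcases g2 with rfl | rfl <;> rcases o1 with o1 | o1 <;> rcases o2 with o2 | o2 <;> omega

end Kh

namespace Kh
open Equiv (swap Perm)
variable {N m n : ℕ}

theorem ci_keep {s t : V m n N} {i j c : Fin N} (h : CI s i j c) (e : psi t c = psi s c) : CI t i j c := by
  unfold CI; rw [e]; exact h

/-- genB data -/
theorem dataB (hN : N = m + n) {s : V m n N} {i j i' j' : Fin N} (hC : IsCircle s.1 i j) (hC' : IsCircle s.1 i' j')
    (henc : Encloses i j i' j')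
    (hno : ¬ ∃ a b : Fin N, IsCircle s.1 a b ∧ Encloses a b i' j' ∧ Encloses i j a b) :
    ∃ p c q c', c ≠ c' ∧ Ins (psi s) c c' ∧ NC (psi s * swap c c') ∧ UpB (psi s) (psi (sw s i j)) p c ∧
      UpB (psi (sw s i j)) (psi (sw (sw s i j) i' j')) q c' := by
  obtain ⟨c, hc⟩ := ci_ex hN hC
  obtain ⟨c', hc'⟩ := ci_ex hN hC'
  have hcc : c ≠ c' := by
    rintro rfl
    have := (hc.uniq' hc').1
    have h2 := henc.1
    rw [this] at h2; exact lt_irrefl _ h2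
  have hi := (hc.encl hN hc' hcc).mp henc
  have hn : NC (psi s * swap c c') := by
    apply lemS (psi_nc hN s) hcc hi
    intro q h1 h2 h3 h4
    obtain ⟨a, b, hab⟩ := hc.inside hN h2.symm h4
    exact hno ⟨a, b, hab.circ hN, (hab.encl hN hc' h1).mpr h3, (hc.encl hN hab h2.symm).mpr h4⟩
  obtain ⟨p, hp⟩ := hc.up hN
  have hpc' : p ≠ c' := by
    rintro rfl
    exact ins_anti (psi_nc hN s) hp.1 hp.2.2 hi
  have hc2 : CI (sw s i j) i' j' c' := ci_keep hc' (hp.mo hpc'.symm hcc.symm)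
  obtain ⟨q, hq⟩ := hc2.up hN
  exact ⟨p, c, q, c', hcc, hi, hn, hp, hq⟩

theorem commonC (hN : N = m + n) {s u : V m n N} (hne : s ≠ u) {c1 c2 d1 d2 : Fin N} (hC : IsCircle s.1 c1 c2)
    (hD : IsCircle u.1 d1 d2) (hsw : swapC s.1 c1 c2 = swapC u.1 d1 d2)
    (hcross : (c1 < d1 ∧ d1 < c2 ∧ c2 < d2) ∨ (d1 < c1 ∧ c1 < d2 ∧ d2 < c2)) {v : Perm (Fin N)} (hv : NC v)
    (h1 : Nbp (psi s) v) (h2 : Nbp v (psi u)) : v = psi (sw s c1 c2) := by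
  by_contra hvn
  obtain ⟨c, hc⟩ := ci_ex hN hC
  obtain ⟨d, hd⟩ := ci_ex hN hD
  obtain ⟨p, hp⟩ := hc.up hN
  obtain ⟨q, hq⟩ := hd.up hN
  have e : sw u d1 d2 = sw s c1 c2 := Subtype.ext hsw.symm
  rw [e] at hq
  have hne' : psi s ≠ psi u := fun h => hne (psi_inj hN h)
  have hs := psi_nc hN s
  have hu := psi_nc hN u
  have hν := psi_nc hN (sw s c1 c2)
  simp only [Fin.lt_def] at hcross
  rcases hcross with h | h
  · exact permC hs hν hu hv hp hq hne' h1 h2 hvn hc.1 hc.2 hd.1 hd.2 (by omega) (by omega) (by omega)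
  · exact permC hu hν hs hv hq hp hne'.symm h2.symm h1.symm hvn hd.1 hd.2 hc.1 hc.2 (by omega) (by omega) (by omega)

noncomputable def AA (κ : Perm (Fin N)) (d c : Fin N) : Finset (Fin N) :=
  Finset.univ.filter (fun a => a ≠ c ∧ a ≠ d ∧ Ins κ a d ∧ Ins κ c a)

noncomputable def ccf (κ l : Perm (Fin N)) (d c : Fin N) : ℤ :=
  if κ c = l c then (if c ≠ d ∧ Ins κ c d then (-1) ^ (AA κ d c).card * 2 else 0) else 1

noncomputable def Ch (l : Perm (Fin N)) (c : Fin N) : Finset (Fin N) :=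
  Finset.univ.filter (fun c' => c ≠ c' ∧ Ins l c c' ∧ NC (l * swap c c'))

theorem mem_Ch {l : Perm (Fin N)} (hl : NC l) {c c' : Fin N} :
    c' ∈ Ch l c ↔ c ≠ c' ∧ Ins l c c' ∧ ∀ q, q ≠ c' → q ≠ c → Ins l q c' → ¬ Ins l c q := by
  unfold Ch
  simp only [Finset.mem_filter, Finset.mem_univ, true_and]
  constructor
  · rintro ⟨h1, h2, h3⟩
    refine ⟨h1, h2, fun q a1 a2 a3 a4 => ?_⟩
    have := star_ins hl h3 (f := q) (i := c') (Equiv.swap_apply_of_ne_of_ne a2 a1) a1.symm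
    rw [Equiv.swap_apply_right] at this
    exact ins_anti hl a2 (this.mp a3) a4
  · rintro ⟨h1, h2, h3⟩
    exact ⟨h1, h2, lemS hl h1 h2 h3⟩

theorem coef {κ l : Perm (Fin N)} (hκ : NC κ) (hl : NC l) {p d : Fin N} (hu : UpB κ l p d) (c : Fin N) :
    ccf κ l d c + ∑ c' ∈ Ch l c, ccf κ l d c' = if l c ≠ κ c then 1 else 0 := by
  have lp : l p ≠ κ p := by
    rw [hu.mp]; exact fun h => hu.1 (κ.injective h).symm
  have ld : l d ≠ κ d := by
    rw [hu.mc]; exact fun h => hu.1 (κ.injective h)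
  have lo : ∀ {q}, q ≠ p → q ≠ d → l q = κ q := fun h1 h2 => hu.mo h1 h2
  have io : ∀ {q z}, q ≠ p → q ≠ d → (Ins l q z ↔ Ins κ q z) := fun h1 h2 => hu.ins_o h1 h2
  have ipd : ∀ {q}, q ≠ p → q ≠ d → (Ins κ q p ↔ Ins κ q d) := by
    intro q h1 h2
    have := star_ins hκ (u := swap p d) (by rw [← hu.2.1]; exact hl) (f := q) (i := p) (Equiv.swap_apply_of_ne_of_ne h1 h2) h1.symm
    rwa [Equiv.swap_apply_left] at this
  have hun := hu.un hκ hl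
  have cmp : ∀ {a b : Fin N}, a ≠ b → Ins κ a d → Ins κ b d → ¬ Ins κ a b → ¬ Ins κ b a → False := by
    intro a b hab h1 h2 h3 h4
    have := un_disj hκ hab ⟨h3, h4⟩ h1
    rw [h2] at this; cases this
  -- children distinct from p, d have zero coefficient unless they contain d
  have zo : ∀ {q}, q ≠ p → q ≠ d → ¬ Ins κ q d → ccf κ l d q = 0 := by
    intro q h1 h2 h3
    unfold ccf; rw [if_pos (lo h1 h2).symm, if_neg (fun h => h3 h.2)]
  have one : ∀ {q}, l q ≠ κ q → ccf κ l d q = 1 := by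
    intro q h; unfold ccf; rw [if_neg (Ne.symm h)]
  by_cases hpd : c = p ∨ c = d
  · have hlc : l c ≠ κ c := by rcases hpd with rfl | rfl <;> assumption
    rw [if_pos hlc, one hlc, Finset.sum_eq_zero, add_zero]
    intro c' hc'
    rw [mem_Ch hl] at hc'
    obtain ⟨h1, h2, _⟩ := hc'
    have hp' : c' ≠ p := by
      rintro rfl
      rcases hpd with rfl | rfl
      · exact h1 rfl
      · exact hun.2 h2
    have hd' : c' ≠ d := by
      rintro rfl
      rcases hpd with rfl | rfl
      · exact hun.1 h2
      · exact h1 rfl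
    apply zo hp' hd'
    intro h3
    have h4 := (ipd hp' hd').mpr h3
    have h5 : Ins l c' c := by rcases hpd with rfl | rfl <;> rw [io hp' hd'] <;> assumption
    exact ins_anti hl h1 h2 h5
  · push Not at hpd
    obtain ⟨hcp, hcd⟩ := hpd
    rw [if_neg (by simpa using lo hcp hcd)]
    by_cases hin : Ins κ c d
    · have hinp : Ins κ c p := (ipd hcp hcd).mpr hin
      have ecc : ccf κ l d c = (-1) ^ (AA κ d c).card * 2 := by
        unfold ccf; rw [if_pos (lo hcp hcd).symm, if_pos ⟨hcd, hin⟩]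
      set A' := (AA κ d c).erase p with hA'
      have memA : ∀ {a}, a ∈ A' ↔ a ≠ p ∧ a ≠ c ∧ a ≠ d ∧ Ins κ a d ∧ Ins κ c a := by
        intro a; rw [hA']; unfold AA; simp
      have hpA : p ∈ AA κ d c := by
        unfold AA; simp only [Finset.mem_filter, Finset.mem_univ, true_and]
        exact ⟨hcp.symm, hu.1, hu.2.2, hinp⟩
      rcases A'.eq_empty_or_nonempty with hem | hne
      · have hcard : (AA κ d c).card = 1 := by
          rw [← Finset.insert_erase hpA, ← hA', hem]; simp
        have key : ∀ x, x = p ∨ x = d → ∀ q, q ≠ x → q ≠ c → Ins l q x → ¬ Ins l c q := by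
          intro x hx q h1 h2 h3 h4
          have hqp : q ≠ p := by
            rintro rfl
            rcases hx with rfl | rfl
            · exact h1 rfl
            · exact hun.1 h3
          have hqd : q ≠ d := by
            rintro rfl
            rcases hx with rfl | rfl
            · exact hun.2 h3
            · exact h1 rfl
          rw [io hqp hqd] at h3
          rw [io hcp hcd] at h4
          have h5 : Ins κ q d := by
            rcases hx with rfl | rfl
            · exact (ipd hqp hqd).mp h3
            · exact h3
          have : q ∈ A' := memA.mpr ⟨hqp, h2, hqd, h5, h4⟩
          rw [hem] at this; simp at this
        have mp : p ∈ Ch l c := (mem_Ch hl).mpr ⟨hcp, (io hcp hcd).mpr hinp, key p (Or.inl rfl)⟩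
        have md : d ∈ Ch l c := (mem_Ch hl).mpr ⟨hcd, (io hcp hcd).mpr hin, key d (Or.inr rfl)⟩
        have hsub : ({p, d} : Finset (Fin N)) ⊆ Ch l c := by
          intro x hx
          simp only [Finset.mem_insert, Finset.mem_singleton] at hx
          rcases hx with rfl | rfl <;> assumption
        rw [← Finset.sum_subset hsub, Finset.sum_pair hu.1, one lp, one ld, ecc, hcard]
        · norm_num
        · intro x hx hx'
          simp only [Finset.mem_insert, Finset.mem_singleton, not_or] at hx'
          apply zo hx'.1 hx'.2
          intro h3
          have h4 := (mem_Ch hl).mp hx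
          have : x ∈ A' := memA.mpr ⟨hx'.1, h4.1.symm, hx'.2, h3, (io hcp hcd).mp h4.2.1⟩
          rw [hem] at this; simp at this
      · obtain ⟨b, hb, hmax⟩ := Finset.exists_max_image A' (len κ) hne
        have hb' := memA.mp hb
        obtain ⟨hbp, hbc, hbd, hbi, hcb⟩ := hb'
        have hmx : ∀ a, a ∈ A' → a ≠ b → ¬ Ins κ a b := by
          intro a ha hab h
          have := len_lt hκ hab h
          have := hmax a ha
          omega
        have mb : b ∈ Ch l c := by
          rw [mem_Ch hl]
          refine ⟨hbc.symm, (io hcp hcd).mpr hcb, ?_⟩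
          intro q h1 h2 h3 h4
          by_cases hqp : q = p
          · subst hqp
            exact ins_anti hl h1 h3 ((io hbp hbd).mpr ((ipd hbp hbd).mpr hbi))
          by_cases hqd : q = d
          · subst hqd
            exact ins_anti hl h1 h3 ((io hbp hbd).mpr hbi)
          rw [io hqp hqd] at h3
          rw [io hcp hcd] at h4
          exact hmx q (memA.mpr ⟨hqp, h2, hqd, ins_trans hκ h1 h3 hbi, h4⟩) h1 h3
        have hcard : (AA κ d c).card = (AA κ d b).card + 1 := by
          have : AA κ d c = insert b (AA κ d b) := by
            ext a
            unfold AA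
            simp only [Finset.mem_filter, Finset.mem_univ, true_and, Finset.mem_insert]
            constructor
            · rintro ⟨h1, h2, h3, h4⟩
              by_cases hab : a = b
              · exact Or.inl hab
              refine Or.inr ⟨hab, h2, h3, ?_⟩
              by_cases hap : a = p
              · subst hap; exact (ipd hbp hbd).mpr hbi
              by_contra h5
              exact cmp hab h3 hbi (hmx a (memA.mpr ⟨hap, h1, h2, h3, h4⟩) hab) h5
            · rintro (rfl | ⟨h1, h2, h3, h4⟩)
              · exact ⟨hbc, hbd, hbi, hcb⟩
              · refine ⟨?_, h2, h3, ins_trans hκ hbc.symm hcb h4⟩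
                rintro rfl
                exact ins_anti hκ h1 hcb h4
          rw [this, Finset.card_insert_of_notMem]
          unfold AA; simp
        rw [Finset.sum_eq_single_of_mem b mb, ecc, hcard]
        · unfold ccf
          rw [if_pos (lo hbp hbd).symm, if_pos ⟨hbd, hbi⟩]
          ring
        · intro x hx hxb
          have h4 := (mem_Ch hl).mp hx
          have hxp : x ≠ p := by
            rintro rfl
            exact h4.2.2 b hbp hbc ((io hbp hbd).mpr ((ipd hbp hbd).mpr hbi)) ((io hcp hcd).mpr hcb)
          have hxd : x ≠ d := by
            rintro rfl
            exact h4.2.2 b hbd hbc ((io hbp hbd).mpr hbi) ((io hcp hcd).mpr hcb)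
          apply zo hxp hxd
          intro h3
          refine cmp hxb h3 hbi (hmx x (memA.mpr ⟨hxp, h4.1.symm, hxd, h3, (io hcp hcd).mp h4.2.1⟩) hxb) ?_
          intro h5
          exact h4.2.2 b hxb.symm hbc ((io hbp hbd).mpr h5) ((io hcp hcd).mpr hcb)
    · rw [zo hcp hcd hin, zero_add]
      apply Finset.sum_eq_zero
      intro x hx
      have h4 := (mem_Ch hl).mp hx
      have h5 := (io hcp hcd).mp h4.2.1
      have hxd : x ≠ d := by rintro rfl; exact hin h5
      have hxp : x ≠ p := by rintro rfl; exact hin ((ipd hcp hcd).mp h5)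
      apply zo hxp hxd
      intro h3
      have := ins_trans hl h4.1 h4.2.1 ((io hxp hxd).mpr h3)
      exact hin ((io hcp hcd).mp this)

theorem ccf_eq (hN : N = m + n) {k s : V m n N} {d1 d2 d i j c p : Fin N} (hd : CI k d1 d2 d)
    (hu : UpB (psi k) (psi s) p d) (hc : CI s i j c) : cCoef k.1 d1 d2 i j = ccf (psi k) (psi s) d c := by
  have hcirc : IsCircle k.1 i j ↔ psi k c = psi s c := by
    constructor
    · intro h
      obtain ⟨c0, h0⟩ := ci_ex hN h
      have a1 := h0.1; have a2 := h0.2; have a3 := hc.1; have a4 := hc.2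
      unfold px py at *
      have e1 : c0 = c := by ext; omega
      subst e1
      ext; omega
    · intro h
      exact (ci_keep hc h).circ hN
  unfold cCoef ccf
  by_cases h : psi k c = psi s c
  · rw [if_pos (hcirc.mpr h), if_pos h]
    have hck : CI k i j c := ci_keep hc h
    have hcd : c ≠ d := by
      rintro rfl
      have := hu.mc
      rw [← h] at this
      exact hu.1 ((psi k).injective this).symm
    have he := hck.encl hN hd hcd
    by_cases h2 : Ins (psi k) c d
    · rw [if_pos (he.mpr h2), if_pos ⟨hcd, h2⟩]
      congr 2
      rw [← Set.ncard_coe_finset]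
      have hex : ∀ q : Fin N × Fin N, q ∈ {p : Fin N × Fin N |
        IsCircle k.1 p.1 p.2 ∧ Encloses p.1 p.2 d1 d2 ∧ Encloses i j p.1 p.2} → ∃ a, CI k q.1 q.2 a :=
        fun q hq => ci_ex hN hq.1
      apply Set.ncard_congr (fun q hq => (hex q hq).choose)
      · intro q hq
        have hs := (hex q hq).choose_spec
        set a := (hex q hq).choose
        obtain ⟨b1, b2, b3⟩ := hq
        have n1 : a ≠ c := by
          intro e
          rw [e] at hs
          have := (hs.uniq' hck).1
          have h4 := b3.1
          rw [this] at h4; exact lt_irrefl _ h4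
        have n2 : a ≠ d := by
          intro e
          rw [e] at hs
          have := (hs.uniq' hd).1
          have h4 := b2.1
          rw [this] at h4; exact lt_irrefl _ h4
        unfold AA
        simp only [Finset.coe_filter, Finset.mem_univ, true_and, Set.mem_setOf_eq]
        exact ⟨n1, n2, (hs.encl hN hd n2).mp b2, (hck.encl hN hs n1.symm).mp b3⟩
      · intro q q' hq hq' e
        have h1 := (hex q hq).choose_spec
        have h3 := (hex q' hq').choose_spec
        rw [e] at h1
        have := h1.uniq' h3
        exact Prod.ext this.1 this.2
      · intro a ha
        unfold AA at ha
        simp only [Finset.coe_filter, Finset.mem_univ, true_and, Set.mem_setOf_eq] at ha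
        obtain ⟨n1, n2, b1, b2⟩ := ha
        obtain ⟨x, y, hxy⟩ := hck.inside hN n1.symm b2
        have hm : (x, y) ∈ {p : Fin N × Fin N |
          IsCircle k.1 p.1 p.2 ∧ Encloses p.1 p.2 d1 d2 ∧ Encloses i j p.1 p.2} :=
          ⟨hxy.circ hN, (hxy.encl hN hd n2).mpr b1, (hck.encl hN hxy n1.symm).mpr b2⟩
        exact ⟨(x, y), hm, ((hex _ hm).choose_spec).uniq hxy⟩
    · rw [if_neg (fun h => h2 (he.mp h)), if_neg (fun h => h2 h.2)]
  · rw [if_neg (fun hh => h (hcirc.mp hh)), if_neg h]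

end Kh

namespace Kh
open Equiv (swap Perm)
variable {N m n : ℕ}

noncomputable def cK (s k : V m n N) (c : Fin N) : ℤ :=
  if h : ∃ d p, UpB (psi k) (psi s) p d then ccf (psi k) (psi s) h.choose c else 0

theorem cK_of (hN : N = m + n) {s k : V m n N} {c d p : Fin N} (h : UpB (psi k) (psi s) p d) :
    cK s k c = ccf (psi k) (psi s) d c := by
  have h' : ∃ d p, UpB (psi k) (psi s) p d := ⟨d, p, h⟩
  unfold cK
  rw [dif_pos h']
  obtain ⟨q, hq⟩ := h'.choose_spec
  rw [(hq.uniq (psi_nc hN k) h).1]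

theorem sw_iff (hN : N = m + n) {s t : V m n N} {i j c : Fin N} (hc : CI s i j c) :
    (∃ p, UpB (psi s) (psi t) p c) ↔ t = sw s i j := by
  constructor
  · rintro ⟨p, hp⟩
    exact psi_inj hN (hc.sw_eq hN (psi_nc hN t) hp).symm
  · rintro rfl; exact hc.up hN

theorem lackSplit (hN : N = m + n) {A : Type*} [AddCommGroup A] {s : V m n N} {X : V m n N → A}
    (hX : ∀ t, ¬ Nbp (psi s) (psi t) → X t = 0) (c : Fin N) (t : V m n N) :
    (if psi t c ≠ psi s c then X t else 0) = (if ∃ p, UpB (psi s) (psi t) p c then X t else 0) +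
      ∑ c' ∈ Ch (psi s) c, (if ∃ p, UpB (psi s) (psi t) p c' then X t else 0) +
      (if (∃ d p, UpB (psi t) (psi s) p d) ∧ psi s c ≠ psi t c then X t else 0) := by
  have hs := psi_nc hN s
  have ht := psi_nc hN t
  by_cases hn : Nbp (psi s) (psi t)
  · rcases lt_or_gt_of_ne (nbp_ne hs ht hn) with hL | hL
    · have hno : ∀ c, ¬ ∃ p, UpB (psi s) (psi t) p c := by
        rintro c ⟨p, h⟩
        have := h.Llt hs ht
        omega
      obtain ⟨p, d, h⟩ := upB_of ht hs hn.symm hL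
      have : ∃ d p, UpB (psi t) (psi s) p d := ⟨d, p, h⟩
      simp only [hno, this, if_false, Finset.sum_const_zero, true_and, zero_add, ne_comm]
    · have hno : ¬ ∃ d p, UpB (psi t) (psi s) p d := by
        rintro ⟨d, p, h⟩
        have := h.Llt ht hs
        omega
      obtain ⟨p0, c0, h⟩ := upB_of hs ht hn hL
      have hiff : ∀ c', (∃ p, UpB (psi s) (psi t) p c') ↔ c0 = c' := by
        intro c'
        constructor
        · rintro ⟨p, hp⟩; exact (h.uniq hs hp).1
        · rintro rfl; exact ⟨p0, h⟩
      simp only [hiff, hno, false_and, if_false, add_zero, Finset.sum_ite_eq]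
      by_cases h1 : c0 = c
      · subst h1
        have e1 : psi t c0 ≠ psi s c0 := by
          rw [h.mc]; exact fun e => h.1 ((psi s).injective e)
        have e2 : c0 ∉ Ch (psi s) c0 := by unfold Ch; simp
        rw [if_pos e1, if_pos rfl, if_neg e2, add_zero]
      · rw [if_neg h1, zero_add]
        have : psi t c ≠ psi s c ↔ c0 ∈ Ch (psi s) c := by
          unfold Ch
          simp only [Finset.mem_filter, Finset.mem_univ, true_and]
          constructor
          · intro h2
            have : c = p0 := by
              by_contra h3
              exact h2 (h.mo h3 (Ne.symm h1))
            subst this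
            exact ⟨h.1, h.2.2, by rw [← h.2.1]; exact ht⟩
          · rintro ⟨a1, a2, a3⟩
            have : p0 = c := F1 hs h.1 a1 (by rw [← h.2.1]; exact ht) a3 h.2.2 a2
            subst this
            rw [h.mp]; exact fun e => h.1 ((psi s).injective e).symm
        simp only [this]
  · have := hX t hn
    simp [this]

theorem genD_sum (hN : N = m + n) {A : Type*} [AddCommGroup A] {s : V m n N} {X : V m n N → A}
    (hX : ∀ t, ¬ Nbp (psi s) (psi t) → X t = 0)
    (h2 : ∀ i j c, CI s i j c → ∑ t, (if psi t c ≠ psi s c then X t else 0) = 0) :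
    ∀ i j c, CI s i j c → X (sw s i j) + ∑ k, cK s k c • X k = 0 := by
  have hs := psi_nc hN s
  have key : ∀ (L : ℕ) (c : Fin N), len (psi s) c = L → (∃ i j, CI s i j c) →
      ∑ t, (if ∃ p, UpB (psi s) (psi t) p c then X t else 0) + ∑ k, cK s k c • X k = 0 := by
    intro L
    induction L using Nat.strong_induction_on with
    | _ L ih =>
    rintro c hlen ⟨i, j, hc⟩
    have e := h2 i j c hc
    simp only [lackSplit hN hX] at e
    rw [Finset.sum_add_distrib, Finset.sum_add_distrib, Finset.sum_comm] at e
    have e2 : ∑ c' ∈ Ch (psi s) c, ∑ t, (if ∃ p, UpB (psi s) (psi t) p c' then X t else 0) =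
        ∑ c' ∈ Ch (psi s) c, - ∑ k, cK s k c' • X k := by
      apply Finset.sum_congr rfl
      intro c' hc'
      rw [mem_Ch hs] at hc'
      exact eq_neg_of_add_eq_zero_left (ih _ (by rw [← hlen]; exact len_lt hs hc'.1 hc'.2.1) c' rfl (hc.inside hN hc'.1 hc'.2.1))
    rw [e2, Finset.sum_neg_distrib, Finset.sum_comm] at e
    refine Eq.trans ?_ e
    rw [add_assoc]
    congr 1
    rw [← Finset.sum_neg_distrib, ← Finset.sum_add_distrib]
    apply Finset.sum_congr rfl
    intro k _
    by_cases hk : ∃ d p, UpB (psi k) (psi s) p d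
    · obtain ⟨d, p, hd⟩ := id hk
      simp only [cK_of hN hd, hk, true_and]
      have := coef (psi_nc hN k) hs hd c
      rw [← Finset.sum_smul]
      rw [← eq_sub_iff_add_eq] at this
      rw [this]
      rw [sub_smul, sub_eq_add_neg, add_comm]
      congr 1
      split_ifs <;> simp
    · have : ∀ c, cK s k c = 0 := by intro c; unfold cK; rw [dif_neg hk]
      simp [this, hk]
  intro i j c hc
  have := key _ c rfl ⟨i, j, hc⟩
  simp only [sw_iff hN hc, Finset.sum_ite_eq', Finset.mem_univ, if_true] at this
  exact this

/-- the sum over `κ` in the generator (D) -/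
theorem genD_conv (hN : N = m + n) {A : Type*} [AddCommGroup A] {s k : V m n N} {i j c : Fin N} (hc : CI s i j c) (x : A) :
    (∑ᶠ d1 : Fin N, ∑ᶠ d2 : Fin N, if IsCircle k.1 d1 d2 ∧ s.1 = swapC k.1 d1 d2 then cCoef k.1 d1 d2 i j • x else 0) =
      cK s k c • x := by
  by_cases hk : ∃ d p, UpB (psi k) (psi s) p d
  · obtain ⟨d, p, hd⟩ := id hk
    obtain ⟨k', e, d1, d2, h1, h2⟩ := low_mem hN (psi_nc hN k) hd
    have : k' = k := psi_inj hN e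
    subst this
    have hq : ∀ a b, IsCircle k'.1 a b ∧ s.1 = swapC k'.1 a b → a = d1 ∧ b = d2 := by
      rintro a b ⟨h3, h4⟩
      obtain ⟨d', hd'⟩ := ci_ex hN h3
      obtain ⟨q, hq⟩ := hd'.up hN
      have : sw k' a b = s := Subtype.ext h4.symm
      rw [this] at hq
      have := (hq.uniq (psi_nc hN k') hd).1
      subst this
      exact hd'.uniq' h1
    rw [finsum_eq_single _ d1, finsum_eq_single _ d2, if_pos ⟨h1.circ hN, congrArg Subtype.val h2⟩,
      ccf_eq hN h1 hd hc, cK_of hN hd]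
    · intro b hb
      rw [if_neg (fun h => hb (hq _ _ h).2)]
    · intro a ha
      have : ∀ d2, ¬ (IsCircle k'.1 a d2 ∧ s.1 = swapC k'.1 a d2) := fun d2 h => ha (hq _ _ h).1
      simp [this]
  · have h0 : cK s k c = 0 := by unfold cK; rw [dif_neg hk]
    have : ∀ d1 d2, ¬ (IsCircle k.1 d1 d2 ∧ s.1 = swapC k.1 d1 d2) := by
      rintro d1 d2 ⟨h3, h4⟩
      obtain ⟨p, c, h⟩ := (step_iff hN (u := k) (v := s)).mp ⟨d1, d2, h3, h4⟩
      exact hk ⟨c, p, h⟩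
    simp [this, h0]

theorem sumWt {A : Type*} [AddCommMonoid A] (f : Wt N → A) (h : ∀ l, ¬ IsWeight m n l → f l = 0) :
    ∑ᶠ l, f l = ∑ v : V m n N, f v.1 := by
  rw [finsum_eq_sum_of_fintype]
  symm
  apply Fintype.sum_of_injective (fun v : V m n N => v.1) Subtype.val_injective
  · intro l hl
    apply h
    intro hw
    exact hl ⟨⟨l, hw⟩, rfl⟩
  · intro v; rfl

end Kh

namespace Kh
open Equiv (swap Perm)
variable {N m n : ℕ}

structure RepD (F : Type*) [Field F] {X : Type*} [AddCommGroup X] [Module F X] (Md : V m n N → Submodule F X)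
    (B : ∀ s t : V m n N, Md t →ₗ[F] Md s) : Prop where
  nadj : ∀ s t, ¬ Nbp (psi s) (psi t) → B s t = 0
  r1 : ∀ s u, s ≠ u → (∀ v, NC v → Nbp (psi s) v → Nbp v (psi u) → ∃ k : V m n N, psi k = v) →
    ∑ t, B s t ∘ₗ B t u = 0
  r2 : ∀ s i j c, CI s i j c → ∑ t, (if psi t c ≠ psi s c then B s t ∘ₗ B t s else 0) = 0

section
variable {F : Type*} [Field F] {X : Type*} [AddCommGroup X] [Module F X] {Md : V m n N → Submodule F X}
    {B : ∀ s t : V m n N, Md t →ₗ[F] Md s}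

theorem RepD.r1u (D : RepD F Md B) (hN : N = m + n) {s u w : V m n N} (h : s ≠ u)
    (h2 : ∀ v, NC v → Nbp (psi s) v → Nbp v (psi u) → v = psi w) : B s w ∘ₗ B w u = 0 := by
  have := D.r1 s u h (fun v a b c => ⟨w, (h2 v a b c).symm⟩)
  rwa [Finset.sum_eq_single w] at this
  · intro t _ ht
    by_cases h3 : Nbp (psi s) (psi t)
    · by_cases h4 : Nbp (psi t) (psi u)
      · exact absurd (psi_inj hN (h2 _ (psi_nc hN t) h3 h4)) ht
      · rw [D.nadj _ _ h4, LinearMap.comp_zero]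
    · rw [D.nadj _ _ h3, LinearMap.zero_comp]
  · intro hh; exact absurd (Finset.mem_univ _) hh

variable (B) in
noncomputable def TT (s t : V m n N) : Module.End F (∀ v, Md v) :=
  LinearMap.single F (fun v => Md v) s ∘ₗ B s t ∘ₗ LinearMap.proj t

variable (Md) in
noncomputable def PP (v : V m n N) : Module.End F (∀ v, Md v) :=
  LinearMap.single F (fun v => Md v) v ∘ₗ LinearMap.proj v

theorem TT_mul (s t u : V m n N) : TT B s t * TT B t u =
    LinearMap.single F (fun v => Md v) s ∘ₗ (B s t ∘ₗ B t u) ∘ₗ LinearMap.proj u := by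
  ext x v
  simp [TT, Module.End.mul_apply]

theorem csum (s u : V m n N) (f : V m n N → (Md u →ₗ[F] Md s)) :
    ∑ t, LinearMap.single F (fun v => Md v) s ∘ₗ f t ∘ₗ LinearMap.proj (φ := fun v => Md v) u =
      LinearMap.single F (fun v => Md v) s ∘ₗ (∑ t, f t) ∘ₗ LinearMap.proj (φ := fun v => Md v) u := by
  refine LinearMap.ext fun x => ?_
  simp only [LinearMap.sum_apply, LinearMap.comp_apply, map_sum]

theorem TT_sum0 {s u : V m n N} (h : ∑ t, B s t ∘ₗ B t u = 0) : ∑ t, TT B s t * TT B t u = 0 := by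
  simp only [TT_mul]
  rw [csum, h]; simp

theorem TT_zero {s t u : V m n N} (h : B s t ∘ₗ B t u = 0) : TT B s t * TT B t u = 0 := by
  rw [TT_mul, h]; simp

variable (B) in
noncomputable def preRep : FA F m n N →ₐ[F] Module.End F (∀ v, Md v) :=
  FreeAlgebra.lift F (Sum.elim (PP Md) (fun a => TT B a.1.1 a.1.2))

theorem preRep_e (v : V m n N) : preRep B (eV F m n N v) = PP Md v := by
  unfold preRep eV; simp

theorem preRep_ar (a : E m n N) : preRep B (arE F m n N a) = TT B a.1.1 a.1.2 := by
  unfold preRep arE; simp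

theorem preRep_arW (D : RepD F Md B) (hN : N = m + n) (s t : V m n N) : preRep B (arW F m n N s.1 t.1) = TT B s t := by
  unfold arW
  split_ifs with h
  · exact preRep_ar _
  · have : ¬ Nbp (psi s) (psi t) := by
      intro h2
      exact h ⟨s.2, t.2, (adj_iff hN).mpr h2⟩
    rw [map_zero]; unfold TT; rw [D.nadj _ _ this]; simp

theorem arW_zero {F : Type*} [Field F] {l l' : Wt N} (h : ¬ IsWeight m n l ∨ ¬ IsWeight m n l') : arW F m n N l l' = 0 := by
  unfold arW; rw [dif_neg]; tauto

theorem dataB_ne (hN : N = m + n) {s : V m n N} {a b : V m n N} {p c q c' : Fin N} (h1 : UpB (psi s) (psi a) p c)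
    (h2 : UpB (psi a) (psi b) q c') : s ≠ b := by
  rintro rfl
  have := h1.Llt (psi_nc hN s) (psi_nc hN a)
  have := h2.Llt (psi_nc hN a) (psi_nc hN s)
  omega

theorem preRep_rel (D : RepD F Md B) (hN : N = m + n) {x y : FA F m n N} (h : KbarRel F m n N x y) :
    preRep B x = preRep B y := by
  cases h with
  | pa h =>
    cases h with
    | idem v =>
      rw [map_mul, preRep_e]
      ext x w; simp [PP, Module.End.mul_apply]
    | orth v w h =>
      rw [map_mul, preRep_e, preRep_e, map_zero]
      ext x u; simp [PP, Module.End.mul_apply, h]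
    | src a =>
      rw [map_mul, preRep_e, preRep_ar]
      ext x u; simp [PP, TT, Module.End.mul_apply]
    | tgt a =>
      rw [map_mul, preRep_e, preRep_ar]
      ext x u; simp [PP, TT, Module.End.mul_apply]
    | srcZero v a h =>
      rw [map_mul, preRep_e, preRep_ar, map_zero]
      ext x u; simp [PP, TT, Module.End.mul_apply, h]
    | tgtZero a v h =>
      rw [map_mul, preRep_e, preRep_ar, map_zero]
      ext x u; simp [PP, TT, Module.End.mul_apply, Ne.symm h]
    | unit =>
      rw [finsum_eq_sum_of_fintype, map_sum, map_one]
      simp only [preRep_e]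
      refine LinearMap.ext fun x => ?_
      funext u
      simp only [PP, LinearMap.sum_apply, Finset.sum_apply, LinearMap.comp_apply, LinearMap.proj_apply, LinearMap.single_apply, Module.End.one_apply]
      rw [Finset.sum_eq_single u]
      · simp
      · intro v _ hv
        simp [Pi.single_eq_of_ne hv.symm]
      · simp
  | genA la mu h1 h2 hne htwo =>
    obtain ⟨s, rfl⟩ : ∃ s : V m n N, s.1 = la := ⟨⟨la, h1⟩, rfl⟩
    obtain ⟨u, rfl⟩ : ∃ s : V m n N, s.1 = mu := ⟨⟨mu, h2⟩, rfl⟩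
    have hne' : s ≠ u := fun h => hne (congrArg Subtype.val h)
    unfold GenA
    rw [sumWt (m := m) (n := n) _ (fun l hl => by rw [arW_zero (Or.inr hl), zero_mul]), map_sum, map_zero]
    have e := D.r1 s u hne' (fun v hv a b => commonA hN hne' htwo hv a b)
    simp only [map_mul, preRep_arW D hN]
    exact TT_sum0 e
  | genB1 la h i j i' j' hC hC' henc hno =>
    obtain ⟨s, rfl⟩ : ∃ s : V m n N, s.1 = la := ⟨⟨la, h⟩, rfl⟩
    obtain ⟨p, c, q, c', k1, k2, k3, k4, k5⟩ := dataB hN hC hC' henc hno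
    have e := D.r1u hN (dataB_ne hN k4 k5) (fun v hv a b => permB (psi_nc hN _) (psi_nc hN _) (psi_nc hN _) hv k1 k2 k3 k4 k5 a b)
    have a1 := preRep_arW D hN s (sw s i j)
    have a2 := preRep_arW D hN (sw s i j) (sw (sw s i j) i' j')
    rw [map_mul, map_zero]
    exact (congrArg₂ (· * ·) a1 a2).trans (TT_zero e)
  | genB2 la h i j i' j' hC hC' henc hno =>
    obtain ⟨s, rfl⟩ : ∃ s : V m n N, s.1 = la := ⟨⟨la, h⟩, rfl⟩
    obtain ⟨p, c, q, c', k1, k2, k3, k4, k5⟩ := dataB hN hC hC' henc hno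
    have e := D.r1u hN (dataB_ne hN k4 k5).symm (fun v hv a b => permB (psi_nc hN _) (psi_nc hN _) (psi_nc hN _) hv k1 k2 k3 k4 k5 b.symm a.symm)
    have a1 := preRep_arW D hN (sw s i j) s
    have a2 := preRep_arW D hN (sw (sw s i j) i' j') (sw s i j)
    rw [map_mul, map_zero]
    exact (congrArg₂ (· * ·) a2 a1).trans (TT_zero e)
  | genC la mu h1 h2 hne c1 c2 d1 d2 hC hC'' hsw hcross =>
    obtain ⟨s, rfl⟩ : ∃ s : V m n N, s.1 = la := ⟨⟨la, h1⟩, rfl⟩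
    obtain ⟨u, rfl⟩ : ∃ s : V m n N, s.1 = mu := ⟨⟨mu, h2⟩, rfl⟩
    have hne' : s ≠ u := fun h => hne (congrArg Subtype.val h)
    have e := D.r1u hN hne' (fun v hv a b => commonC hN hne' hC hC'' hsw hcross hv a b)
    have a1 := preRep_arW D hN s (sw s c1 c2)
    have a2 := preRep_arW D hN (sw s c1 c2) u
    rw [map_mul, map_zero]
    exact (congrArg₂ (· * ·) a1 a2).trans (TT_zero e)
  | genD la h i j hC =>
    obtain ⟨s, rfl⟩ : ∃ s : V m n N, s.1 = la := ⟨⟨la, h⟩, rfl⟩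
    obtain ⟨c, hc⟩ := ci_ex hN hC
    have e := genD_sum hN (s := s) (X := fun t => TT B s t * TT B t s)
      (fun t ht => TT_zero (by rw [D.nadj _ _ ht]; simp))
      (fun i j c hc => by
        have := D.r2 s i j c hc
        have e2 : ∀ t, (if psi t c ≠ psi s c then TT B s t * TT B t s else 0) =
          LinearMap.single F (fun v => Md v) s ∘ₗ (if psi t c ≠ psi s c then B s t ∘ₗ B t s else 0) ∘ₗ
            LinearMap.proj (φ := fun v => Md v) s := by
          intro t
          rw [TT_mul]; split_ifs <;> simp
        simp only [e2]
        rw [csum, this]; simp) i j c hc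
    unfold GenD
    rw [map_zero, map_add]
    rw [sumWt (m := m) (n := n) _ (fun l hl => by simp [arW_zero (F := F) (m := m) (n := n) (l' := l) (l := s.1) (Or.inr hl)])]
    have e3 : ∀ k : V m n N, (∑ᶠ d1 : Fin N, ∑ᶠ d2 : Fin N, if IsCircle k.1 d1 d2 ∧ s.1 = swapC k.1 d1 d2 then
      cCoef k.1 d1 d2 i j • (arW F m n N s.1 k.1 * arW F m n N k.1 s.1) else 0) =
      cK s k c • (arW F m n N s.1 k.1 * arW F m n N k.1 s.1) := fun k => genD_conv hN hc _
    simp only [e3]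
    rw [map_sum]
    refine Eq.trans ?_ e
    congr 1
    · rw [map_mul]
      exact congrArg₂ (· * ·) (preRep_arW D hN s (sw s i j)) (preRep_arW D hN (sw s i j) s)
    · apply Finset.sum_congr rfl
      intro k _
      rw [map_zsmul, map_mul]
      congr 1
      exact congrArg₂ (· * ·) (preRep_arW D hN s k) (preRep_arW D hN k s)

theorem rep_ex (D : RepD F Md B) (hN : N = m + n) : ∃ φ : Kbar F m n N →ₐ[F] Module.End F (∀ v, Md v),
    (∀ v : V m n N, φ (toKbar F m n N (eW F m n N v.1)) = PP Md v) ∧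
    (∀ s t : V m n N, φ (toKbar F m n N (arW F m n N s.1 t.1)) = TT B s t) := by
  refine ⟨RingQuot.liftAlgHom F ⟨preRep B, fun x y h => preRep_rel D hN h⟩, ?_, ?_⟩
  · intro v
    unfold toKbar
    rw [RingQuot.liftAlgHom_mkAlgHom_apply]
    unfold eW; rw [dif_pos v.2]; exact preRep_e v
  · intro s t
    unfold toKbar
    rw [RingQuot.liftAlgHom_mkAlgHom_apply]
    exact preRep_arW D hN s t
end
end Kh

namespace Kh
open Equiv (swap Perm)
variable {N m n : ℕ}

noncomputable def pv (hN : N = m + n) (v : V m n N) : PV N := ⟨psi v, psi_nc hN v⟩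

theorem pv_inj (hN : N = m + n) : Function.Injective (pv hN (N := N)) := by
  intro u v h
  exact psi_inj hN (congrArg Subtype.val h)

theorem pht_bd (u : PV N) : (PS N).ht u < 2 * N * N + 1 := by
  show pht u < _
  unfold pht; omega

section
variable {F : Type*} [Field F] {b : PV N}
  {M : PV N → Submodule F (List (PV N) → F)} {a : PV N → PV N → Module.End F (List (PV N) → F)}

noncomputable def BB (hN : N = m + n) (G : (PS N).Good b (2 * N * N + 1) M a) (s t : V m n N) :
    M (pv hN t) →ₗ[F] M (pv hN s) :=
  if h : Nbp (psi s) (psi t) then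
    (a (pv hN s) (pv hN t)).restrict (G.g1 _ _ h (pht_bd _) (pht_bd _)) else 0

theorem BB_app (hN : N = m + n) (G : (PS N).Good b (2 * N * N + 1) M a) {s t : V m n N}
    (h : Nbp (psi s) (psi t)) (x : M (pv hN t)) : (BB hN G s t x : List (PV N) → F) = a (pv hN s) (pv hN t) x := by
  unfold BB; rw [dif_pos h]; rfl

theorem BB_comp (hN : N = m + n) (G : (PS N).Good b (2 * N * N + 1) M a) (s t u : V m n N)
    (x : M (pv hN u)) : ((BB hN G s t ∘ₗ BB hN G t u) x : List (PV N) → F) =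
      (if (PS N).Nb (pv hN s) (pv hN t) ∧ (PS N).Nb (pv hN t) (pv hN u) then
        a (pv hN s) (pv hN t) * a (pv hN t) (pv hN u) else 0) x := by
  split_ifs with h
  · rw [LinearMap.comp_apply, BB_app hN G h.1, BB_app hN G h.2]; rfl
  · by_cases h1 : Nbp (psi s) (psi t)
    · have h2 : ¬ Nbp (psi t) (psi u) := fun h2 => h ⟨h1, h2⟩
      have : BB hN G t u = 0 := by unfold BB; rw [dif_neg h2]
      simp [this]
    · have : BB hN G s t = 0 := by unfold BB; rw [dif_neg h1]
      simp [this]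

theorem good_repD (hN : N = m + n) (G : (PS N).Good b (2 * N * N + 1) M a) :
    RepD F (fun v => M (pv hN v)) (BB hN G) where
  nadj s t h := by unfold BB; rw [dif_neg h]
  r1 s u hne hr := by
    refine LinearMap.ext fun x => Subtype.ext ?_
    have := G.g2 (pv hN s) (pv hN u) (fun e => hne (pv_inj hN e)) (pht_bd _) (pht_bd _)
      (fun v _ _ => pht_bd _) x x.2
    refine Eq.trans ?_ this
    rw [LinearMap.sum_apply, LinearMap.sum_apply]
    rw [AddSubmonoidClass.coe_finset_sum]
    refine Fintype.sum_of_injective (pv hN) (pv_inj hN) _ _ ?_ ?_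
    · intro v hv
      rw [if_neg]; rfl
      rintro ⟨h1, h2⟩
      obtain ⟨k, hk⟩ := hr v.1 v.2 h1 h2
      exact hv ⟨k, Subtype.ext hk⟩
    · intro t
      exact BB_comp hN G s t u x
  r2 s i j c hc := by
    refine LinearMap.ext fun x => Subtype.ext ?_
    obtain ⟨p, hp⟩ := hc.up hN
    have := G.g3 (pv hN s) (pv hN (sw s i j)) hp.nbp
      (pht_lt.mpr (hp.Llt (psi_nc hN _) (psi_nc hN _))) (pht_bd _) x x.2
    refine Eq.trans ?_ this
    rw [LinearMap.sum_apply, LinearMap.sum_apply]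
    rw [AddSubmonoidClass.coe_finset_sum]
    have hh : ∀ v : PV N, (PS N).has v ((PS N).upArc (pv hN s) (pv hN (sw s i j))) ↔ v.1 c = psi s c :=
      fun v => has_up (psi_nc hN s) hp
    simp only [hh]
    refine Fintype.sum_of_injective (pv hN) (pv_inj hN) _ _ ?_ ?_
    · intro v hv
      rw [if_neg]; rfl
      rintro ⟨h1, h2⟩
      obtain ⟨k, hk⟩ := lackD hN hc v.2 h1 h2
      exact hv ⟨k, Subtype.ext hk⟩
    · intro t
      by_cases h : psi t c = psi s c
      · rw [if_neg (by simp [h]), if_neg (by rintro ⟨_, h2⟩; exact h2 h)]; rfl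
      · rw [if_pos h, BB_comp hN G s t s x]
        have e : ((PS N).Nb (pv hN s) (pv hN t) ∧ ¬ (pv hN t).1 c = psi s c) ↔
          ((PS N).Nb (pv hN s) (pv hN t) ∧ (PS N).Nb (pv hN t) (pv hN s)) :=
          ⟨fun h => ⟨h.1, (PS N).symm h.1⟩, fun h' => ⟨h'.1, h⟩⟩
        simp only [e]
end
end Kh

namespace Kh
open Equiv (swap Perm)
variable {N m n : ℕ}

/-- elements represented by paths -/
inductive Pth {R : Type*} [Ring R] (A : V m n N → V m n N → R) (e : V m n N → R) :
    ℕ → V m n N → V m n N → R → Prop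
  | nil (v) : Pth A e 0 v v (e v)
  | cons {i s u t x} : Nbp (psi s) (psi u) → Pth A e i u t x → Pth A e (i + 1) s t (A s u * x)

/-- path algebra like relations -/
structure PR {R : Type*} [Ring R] (A : V m n N → V m n N → R) (e : V m n N → R) : Prop where
  idem : ∀ v, e v * e v = e v
  src : ∀ s t, e s * A s t = A s t
  tgt : ∀ s t, A s t * e t = A s t

section
variable {R : Type*} [Ring R] {A : V m n N → V m n N → R} {e : V m n N → R}

theorem Pth.eleft (H : PR A e) {i s t x} (h : Pth A e i s t x) : e s * x = x := by
  cases h with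
  | nil => exact H.idem _
  | cons h1 h2 => rw [← mul_assoc, H.src]

theorem Pth.app (H : PR A e) {i j s u t x y} (h : Pth A e i s u x) (h' : Pth A e j u t y) :
    Pth A e (i + j) s t (x * y) := by
  induction h with
  | nil v => rw [h'.eleft H, Nat.zero_add]; exact h'
  | cons h1 h2 ih =>
    rw [mul_assoc, Nat.add_right_comm]
    exact Pth.cons h1 (ih h')

theorem Pth.one (H : PR A e) {s t : V m n N} (h : Nbp (psi s) (psi t)) : Pth A e 1 s t (A s t) := by
  have := Pth.cons (A := A) (e := e) h (Pth.nil t)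
  rwa [H.tgt] at this

theorem Pth.op (H : PR A e) {i s t x} (h : Pth A e i s t x) :
    Pth (fun s t => MulOpposite.op (A t s)) (fun s => MulOpposite.op (e s)) i t s (MulOpposite.op x) := by
  have H' : PR (fun s t => MulOpposite.op (A t s)) (fun s => MulOpposite.op (e s)) :=
    ⟨fun v => by rw [← MulOpposite.op_mul, H.idem], fun s t => by rw [← MulOpposite.op_mul, H.tgt],
      fun s t => by rw [← MulOpposite.op_mul, H.src]⟩
  induction h with
  | nil v => exact Pth.nil (A := fun s t => MulOpposite.op (A t s)) (e := fun s => MulOpposite.op (e s)) v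
  | cons h1 h2 ih =>
    rw [MulOpposite.op_mul]
    exact ih.app H' (Pth.one H' h1.symm)
end

theorem sw_sw (v : V m n N) (i j : Fin N) : sw (sw v i j) i j = v :=
  Subtype.ext (swapC_swapC _ _ _)

theorem ustep (hN : N = m + n) {v : V m n N} {i j : Fin N} (hij : i.val + 1 = j.val) (hi : v.1 i = true)
    (hj : v.1 j = false) : ∃ p c, UpB (psi v) (psi (sw v i j)) p c ∧ len (psi v) c = 1 := by
  obtain ⟨c, hc⟩ := ci_ex hN (circ_adj hij hi hj)
  obtain ⟨p, hp⟩ := hc.up hN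
  refine ⟨p, c, hp, ?_⟩
  have h1 := hc.1; have h2 := hc.2
  unfold len Nat.dist; omega

theorem sw_height {v : V m n N} {i j : Fin N} (hij : i < j) (hi : v.1 i = true)
    (hj : v.1 j = false) : height (sw v i j).1 = height v.1 + (j.val - i.val) :=
  height_swap v.2 hij hi hj

/-- sorted weight -/
def Bot (v : V m n N) : Prop := ∀ i : Fin N, v.1 i = true ↔ i.val < m

theorem Bot.uniq {u v : V m n N} (h : Bot u) (h' : Bot v) : u = v := by
  apply Subtype.ext; funext i
  rw [Bool.eq_iff_iff, h i, h' i]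

theorem Bot.height {v : V m n N} (h : Bot v) : height v.1 = 0 := by
  unfold Kh.height
  apply Finset.sum_eq_zero
  intro i _
  split_ifs with hi
  · rw [Set.ncard_eq_zero]
    ext j
    simp only [Set.mem_setOf_eq, Set.mem_empty_iff_false, iff_false]
    rintro ⟨h1, h2⟩
    have := (h i).mp hi
    have h3 := (h j).mpr (by have : j.val < i.val := h1; omega)
    rw [h3] at h2; exact absurd h2 (by simp)
  · rfl

/-- one step down of length one -/
theorem dstep (v : V m n N) : Bot v ∨ ∃ (u : V m n N) (i j : Fin N), i.val + 1 = j.val ∧ u.1 i = true ∧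
    u.1 j = false ∧ v = sw u i j ∧ height v.1 = height u.1 + 1 := by
  rcases sorted_or v.2 with h | ⟨i, j, h1, h2, h3⟩
  · exact Or.inl h
  · right
    have hne : j ≠ i := by intro h; rw [h] at h1; omega
    have e1 : (sw v i j).1 i = true := by simp [sw, swapC, h3]
    have e2 : (sw v i j).1 j = false := by simp [sw, swapC, h2, hne]
    refine ⟨sw v i j, i, j, h1, e1, e2, (sw_sw _ _ _).symm, ?_⟩
    have := sw_height (v := sw v i j) (i := i) (j := j) (by show i.val < j.val; omega) e1 e2
    rw [sw_sw] at this; omega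

theorem bot_ex (v : V m n N) : ∃ b : V m n N, Bot b := by
  induction h : height v.1 using Nat.strong_induction_on generalizing v with
  | _ k ih =>
    rcases dstep v with h1 | ⟨u, i, j, _, _, _, _, h2⟩
    · exact ⟨v, h1⟩
    · exact ih _ (by omega) u rfl

section
variable (F : Type*) [Field F]

noncomputable def AK (s t : V m n N) : Kbar F m n N := toKbar F m n N (arW F m n N s.1 t.1)
noncomputable def EK (s : V m n N) : Kbar F m n N := toKbar F m n N (eW F m n N s.1)

variable {F}
theorem krel {x y : FA F m n N} (h : KbarRel F m n N x y) : toKbar F m n N x = toKbar F m n N y :=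
  RingQuot.mkAlgHom_rel F h

theorem eW_V (s : V m n N) : eW F m n N s.1 = eV F m n N s := by
  unfold eW; rw [dif_pos s.2]; rfl

theorem arW_V {s t : V m n N} (h : GammaAdj s.1 t.1) : arW F m n N s.1 t.1 = arE F m n N ⟨(s, t), h⟩ := by
  unfold arW; rw [dif_pos ⟨s.2, t.2, h⟩]; rfl

theorem arW_nV {s t : V m n N} (h : ¬ GammaAdj s.1 t.1) : arW F m n N s.1 t.1 = 0 := by
  unfold arW; rw [dif_neg]; exact fun hh => h hh.2.2

theorem AK_nadj (hN : N = m + n) {s t : V m n N} (h : ¬ Nbp (psi s) (psi t)) : AK F s t = 0 := by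
  unfold AK; rw [arW_nV, map_zero]; rwa [adj_iff hN]

theorem prK : PR (AK F (m := m) (n := n) (N := N)) (EK F) where
  idem v := by
    unfold EK; rw [← map_mul, eW_V]; exact krel (.pa (.idem v))
  src s t := by
    unfold EK AK
    by_cases h : GammaAdj s.1 t.1
    · rw [arW_V h, ← map_mul, eW_V]; exact krel (.pa (.src ⟨(s, t), h⟩))
    · rw [arW_nV h, map_zero, mul_zero]
  tgt s t := by
    unfold EK AK
    by_cases h : GammaAdj s.1 t.1
    · rw [arW_V h, ← map_mul, eW_V]; exact krel (.pa (.tgt ⟨(s, t), h⟩))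
    · rw [arW_nV h, map_zero, zero_mul]

theorem EK_orth {s t : V m n N} (h : s ≠ t) : EK F s * EK F t = 0 := by
  unfold EK; rw [← map_mul, eW_V, eW_V]
  exact (krel (.pa (.orth s t h))).trans (map_zero _)

theorem eta_unit {ν μ : Perm (Fin N)} (hn : NC ν) (hm : NC μ) {p c : Fin N} (h : UpB ν μ p c) (h1 : len ν c = 1) :
    ((eta' ν μ : ℤ) : F) ≠ 0 := by
  rw [eta_eq hn hm h, if_pos h1]
  push_cast
  exact pow_ne_zero _ (neg_ne_zero.mpr one_ne_zero)

variable (F) in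
set_option maxHeartbeats 2000000 in
theorem nonvan (hN : N = m + n) (s t : V m n N) :
    ∃ x, x ≠ 0 ∧ Pth (AK F) (EK F) (height s.1 + height t.1) s t x := by
  obtain ⟨b, hb⟩ := bot_ex s
  obtain ⟨M, a, G⟩ := (PS N).good_exists (F := F) (pv hN b) (2 * N * N + 1)
  obtain ⟨φ, f1, f2⟩ := rep_ex (good_repD hN G) hN
  set W : ∀ v : V m n N, M (pv hN v) := fun v => ⟨(PS N).wv F (pv hN b) (pv hN v), G.g6 _ (pht_bd _)⟩ with hW
  have N1 : ∀ k, ∀ v : V m n N, height v.1 = k → ∃ x, Pth (AK F) (EK F) k b v x ∧ ∃ ε : F, ε ≠ 0 ∧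
      φ x (Pi.single v (W v)) = ε • Pi.single b (W b) := by
    intro k
    induction k with
    | zero =>
      intro v hv
      rcases dstep v with h1 | ⟨u, i, j, _, _, _, _, h2⟩
      · obtain rfl := h1.uniq hb
        refine ⟨_, Pth.nil v, 1, one_ne_zero, ?_⟩
        unfold EK; rw [f1]
        simp [PP]
      · omega
    | succ k ih =>
      intro v hv
      rcases dstep v with h1 | ⟨u, i, j, q1, q2, q3, q4, h2⟩
      · have := h1.height; omega
      · obtain ⟨x, hx, ε, hε, h3⟩ := ih u (by omega)
        obtain ⟨p, c, hp, hl⟩ := ustep hN q1 q2 q3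
        rw [← q4] at hp
        have hlt : pht (pv hN u) < pht (pv hN v) := pht_lt.mpr (hp.Llt (psi_nc hN _) (psi_nc hN _))
        refine ⟨_, hx.app prK (Pth.one prK hp.nbp), ε * eta' (psi u) (psi v),
          mul_ne_zero hε (eta_unit (psi_nc hN _) (psi_nc hN _) hp hl), ?_⟩
        have e1 : φ (AK F u v) (Pi.single v (W v)) = ((eta' (psi u) (psi v) : ℤ) : F) • Pi.single u (W u) := by
          unfold AK; rw [f2]
          unfold TT
          rw [LinearMap.comp_apply, LinearMap.comp_apply, LinearMap.proj_apply, Pi.single_eq_same]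
          have : BB hN G u v (W v) = ((eta' (psi u) (psi v) : ℤ) : F) • W u := by
            apply Subtype.ext
            rw [BB_app hN G hp.nbp]
            rw [G.g4 (pv hN u) (pv hN v) hp.nbp hlt (pht_bd _)]
            exact (PS N).Dop_wv hp.nbp hlt
          rw [this, map_smul]; rfl
        rw [map_mul, Module.End.mul_apply, e1, map_smul, h3, smul_smul, mul_comm]
  have N2 : ∀ k, ∀ v : V m n N, height v.1 = k → ∃ x, Pth (AK F) (EK F) k v b x ∧ ∃ ε : F, ε ≠ 0 ∧
      ∀ z : M (pv hN b), (φ x (Pi.single b z) v : List (PV N) → F) [] = ε * (z : List (PV N) → F) [] := by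
    intro k
    induction k with
    | zero =>
      intro v hv
      rcases dstep v with h1 | ⟨u, i, j, _, _, _, _, h2⟩
      · obtain rfl := h1.uniq hb
        refine ⟨_, Pth.nil v, 1, one_ne_zero, fun z => ?_⟩
        unfold EK; rw [f1]
        simp [PP]
      · omega
    | succ k ih =>
      intro v hv
      rcases dstep v with h1 | ⟨u, i, j, q1, q2, q3, q4, h2⟩
      · have := h1.height; omega
      · obtain ⟨x, hx, ε, hε, h3⟩ := ih u (by omega)
        obtain ⟨p, c, hp, hl⟩ := ustep hN q1 q2 q3
        rw [← q4] at hp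
        have hlt : pht (pv hN u) < pht (pv hN v) := pht_lt.mpr (hp.Llt (psi_nc hN _) (psi_nc hN _))
        refine ⟨_, Pth.cons hp.nbp.symm hx, eta' (psi u) (psi v) * ε,
          mul_ne_zero (eta_unit (psi_nc hN _) (psi_nc hN _) hp hl) hε, fun z => ?_⟩
        rw [map_mul, Module.End.mul_apply]
        unfold AK; rw [f2]
        unfold TT
        rw [LinearMap.comp_apply, LinearMap.comp_apply, LinearMap.proj_apply, LinearMap.single_apply, Pi.single_eq_same]
        rw [BB_app hN G hp.nbp.symm, G.g5 (pv hN v) (pv hN u) hp.nbp.symm hlt (pht_bd _), h3, mul_assoc]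
        rfl
  obtain ⟨x, hx, ε, hε, h3⟩ := N1 _ t rfl
  obtain ⟨y, hy, δ, hδ, h4⟩ := N2 _ s rfl
  refine ⟨_, ?_, hy.app prK hx⟩
  intro h0
  have h5 := h4 (W b)
  have h6 : φ (y * x) (Pi.single t (W t)) = 0 := by rw [h0, map_zero]; rfl
  rw [map_mul, Module.End.mul_apply, h3, map_smul, smul_eq_zero] at h6
  rcases h6 with h6 | h6
  · exact hε h6
  · rw [h6] at h5
    have : (W b : List (PV N) → F) [] = 1 := by
      simp only [hW]
      simp [Sys.wv]
    rw [this, mul_one] at h5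
    exact hδ h5.symm
end
end Kh

namespace Kh
open Equiv (swap Perm)
variable {N m n : ℕ}

@[reducible] def H7P {P : Type} (s : P → P → P → Bool) (x1 y1 x2 y2 x3 y3 : P) : Prop :=
  hNC s x1 y1 x2 y2 x3 y3 → hNC s x1 y2 x2 y1 x3 y3 → hNC s x1 y3 x2 y2 x3 y1 →
  hUn s x1 y1 x2 y2 → hUn s x1 y1 x3 y3 → hUn s x2 y2 x3 y3 →
  hNC s x1 y2 x2 y3 x3 y1 ∨ hNC s x1 y3 x2 y1 x3 y2

set_option synthInstance.maxSize 2000 in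
set_option synthInstance.maxHeartbeats 400000 in
theorem H7f {a b c a' b' c' : Fin N} (h : a ≠ b) (h2 : a ≠ c) (h3 : b ≠ c)
    (h' : a' ≠ b') (h2' : a' ≠ c') (h3' : b' ≠ c') : H7P SS (px a) (py a') (px b) (py b') (px c) (py c') :=
  rankd 6 (fun lt => H7P (Sb lt) 0 1 2 3 4 5) (by decide +kernel) _ (inj6 h h2 h3 h' h2' h3')

theorem peak_shared {μ : Perm (Fin N)} {x y z : Fin N} (hμ : NC μ) (xy : x ≠ y) (xz : x ≠ z) (yz : y ≠ z)
    (hκ : NC (μ * swap x y)) (hl : NC (μ * swap x z)) (u1 : Un μ x y) (u2 : Un μ x z) :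
    ∃ w, NC w ∧ w ≠ μ ∧ Nbp (μ * swap x y) w ∧ Nbp w (μ * swap x z) := by
  have u3 := un_third hμ xy xz yz hκ hl u1 u2
  have hst : ∀ i, i ≠ x → i ≠ y → i ≠ z → sS μ i (px x) = sS μ i (px y) ∧ sS μ i (px y) = sS μ i (px z) := by
    intro i h1 h2 h3
    have s1 := star hμ hκ (f := i) (i := x) (Equiv.swap_apply_of_ne_of_ne h1 h2) h1.symm
    have s2 := star hμ hl (f := i) (i := x) (Equiv.swap_apply_of_ne_of_ne h1 h3) h1.symm
    rw [Equiv.swap_apply_left] at s1 s2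
    exact ⟨s1, s1.symm.trans s2⟩
  have k1 := hκ.hNC xy xz yz
  have k2 := hl.hNC xy xz yz
  simp only [Equiv.Perm.mul_apply, Equiv.swap_apply_left, Equiv.swap_apply_right,
    Equiv.swap_apply_of_ne_of_ne xz.symm yz.symm, Equiv.swap_apply_of_ne_of_ne xy.symm yz] at k1 k2
  rcases H7f xy xz yz (fun e => xy (μ.injective e)) (fun e => xz (μ.injective e)) (fun e => yz (μ.injective e))
    (hμ.hNC xy xz yz) k1 k2 (hUn_iff.mpr u1) (hUn_iff.mpr u2) (hUn_iff.mpr u3) with h | h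
  · have hw : NC (μ * (swap x y * swap y z)) := by
      apply Loc3' xy xz yz hμ hst (fun i h1 h2 h3 => cyc_o h1 h2 h3)
      rw [cyc_a xz xy, cyc_b xz yz, cyc_e]; exact h
    refine ⟨_, hw, ?_, ?_, ?_⟩
    · intro e
      have h5 : μ ((swap x y * swap y z) x) = μ x := congrArg (fun π : Perm (Fin N) => π x) e
      rw [cyc_a xz xy] at h5
      exact xy (μ.injective h5.symm)
    · rw [← mul_assoc]; exact nbp_swap _ yz
    · rw [cyc1 xy xz yz, ← mul_assoc]; exact nbp_swap' _ xy
  · have hw : NC (μ * (swap x z * swap z y)) := by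
      apply Loc3' xy xz yz hμ hst (fun i h1 h2 h3 => cyc_o h1 h3 h2)
      rw [cyc_a xy xz, cyc_b xy yz.symm, cyc_e]; exact h
    refine ⟨_, hw, ?_, ?_, ?_⟩
    · intro e
      have h5 : μ ((swap x z * swap z y) x) = μ x := congrArg (fun π : Perm (Fin N) => π x) e
      rw [cyc_a xy xz] at h5
      exact xz (μ.injective h5.symm)
    · rw [cyc1 xz xy yz.symm, ← mul_assoc]; exact nbp_swap _ xz
    · rw [← mul_assoc]; exact nbp_swap' _ yz.symm

def Crs (i j i' j' : ℕ) : Prop := (i < i' ∧ i' < j ∧ j < j') ∨ (i' < i ∧ i < j' ∧ j' < j)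

theorem UpB.order {l m : Perm (Fin N)} (hl : NC l) (hm : NC m) {p c : Fin N} (h : UpB l m p c) :
    (px p < py (m p) ∧ py (m p) < px c ∧ px c < py (m c)) ∨
    (py (m c) < px c ∧ px c < py (m p) ∧ py (m p) < px p) := by
  have := ins_order h.1 hl (by rw [← h.2.1]; exact hm) h.2.2
  rwa [← h.mc, ← h.mp] at this

theorem UpB.eqd {l m : Perm (Fin N)} {p c : Fin N} (h : UpB l m p c) : l = m * swap p c := by
  rw [h.2.1, swap_swap]

/-- the disjoint case -/
theorem peak_disj {μ κ l : Perm (Fin N)} (hμ : NC μ) (hκ : NC κ) (hl : NC l) {p c q d : Fin N}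
    (h1 : UpB κ μ p c) (h2 : UpB l μ q d) (pq : p ≠ q) (pd : p ≠ d) (cq : c ≠ q) (cd : c ≠ d)
    (hs : sS κ p (px q) ≠ sS κ p (px d)) :
    Crs (min (px c) (py (κ c))) (max (px c) (py (κ c))) (min (px d) (py (l d))) (max (px d) (py (l d))) := by
  have o1 := h1.order hκ hμ
  have o2 := h2.order hl hμ
  have e1 := h1.eqd
  have e2 := h2.eqd
  rw [← h1.mp, ← h2.mp]
  have hk' : NC (μ * swap p c) := e1 ▸ hκ
  have hl' : NC (μ * swap q d) := e2 ▸ hl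
  have sA : ∀ f, f ≠ p → f ≠ c → (Ins μ f p ↔ Ins μ f c) := by
    intro f fp fc
    have := star_ins hμ hk' (f := f) (i := p) (Equiv.swap_apply_of_ne_of_ne fp fc) fp.symm
    rwa [Equiv.swap_apply_left] at this
  have sB : ∀ f, f ≠ q → f ≠ d → (Ins μ f q ↔ Ins μ f d) := by
    intro f fp fc
    have := star_ins hμ hl' (f := f) (i := q) (Equiv.swap_apply_of_ne_of_ne fp fc) fp.symm
    rwa [Equiv.swap_apply_left] at this
  have hs' : SS (px p) (py (μ c)) (px q) ≠ SS (px p) (py (μ c)) (px d) := by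
    have : ∀ z, sS κ p z = SS (px p) (py (μ c)) z := by intro z; unfold sS; rw [h1.mc]
    rwa [this, this] at hs
  have T : ∀ x y z : ℕ, SS x y z = true ↔ (x < z ∧ z ≤ y) ∨ (y < z ∧ z ≤ x) := fun _ _ _ => SS_true
  have hs2 : ¬ (((px p < px q ∧ px q ≤ py (μ c)) ∨ (py (μ c) < px q ∧ px q ≤ px p)) ↔
      ((px p < px d ∧ px d ≤ py (μ c)) ∨ (py (μ c) < px d ∧ px d ≤ px p))) := by
    rw [← T, ← T, ← Bool.eq_iff_iff]; exact hs'
  unfold Crs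
  have nqp : ¬ Ins μ q p := by
    intro h
    have b1 := ins_bd hμ pq.symm h
    have b2 := ins_bd hμ cq.symm ((sA q pq.symm cq.symm).mp h)
    apply hs2
    omega
  have ndp : ¬ Ins μ d p := by
    intro h
    have b1 := ins_bd hμ pd.symm h
    have b2 := ins_bd hμ cd.symm ((sA d pd.symm cd.symm).mp h)
    apply hs2
    omega
  have npq : ¬ Ins μ p q := by
    intro h
    have b1 := ins_bd hμ pq h
    have b2 := ins_bd hμ pd ((sB p pq pd).mp h)
    apply hs2
    omega
  have ncq : ¬ Ins μ c q := by
    intro h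
    have b1 := ins_bd hμ cq h
    have b2 := ins_bd hμ cd ((sB c cq cd).mp h)
    apply hs2
    omega
  have u1 := un_sep hμ pq ⟨npq, nqp⟩
  have u2 := un_sep hμ pd ⟨fun h => npq ((sB p pq pd).mpr h), ndp⟩
  have u3 := un_sep hμ cq ⟨ncq, fun h => nqp ((sA q pq.symm cq.symm).mpr h)⟩
  have u4 := un_sep hμ cd ⟨fun h => ncq ((sB c cq cd).mpr h), fun h => ndp ((sA d pd.symm cd.symm).mpr h)⟩
  omega

theorem peak {μ κ l : Perm (Fin N)} (hμ : NC μ) (hκ : NC κ) (hl : NC l) {p c q d : Fin N}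
    (h1 : UpB κ μ p c) (h2 : UpB l μ q d) (hne : κ ≠ l) :
    Crs (min (px c) (py (κ c))) (max (px c) (py (κ c))) (min (px d) (py (l d))) (max (px d) (py (l d))) ∨
    ∃ w, NC w ∧ w ≠ μ ∧ Nbp κ w ∧ Nbp w l := by
  have e1 := h1.eqd
  have e2 := h2.eqd
  have hk' : NC (μ * swap p c) := e1 ▸ hκ
  have hl' : NC (μ * swap q d) := e2 ▸ hl
  rcases shareCases h1.1 h2.1 (fun e => hne (by rw [e1, e2, e])) with ⟨pq, pd, cq, cd⟩ | ⟨x, y, z, xy, xz, yz, s1, s2⟩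
  · by_cases hs : sS κ p (px q) = sS κ p (px d)
    · right
      rw [e1] at hs
      have := Comm h1.1 h2.1 pq pd cq cd hμ hk' hl' hs
      refine ⟨_, this, ?_, ?_, ?_⟩
      · rw [mul_assoc]
        intro e
        exact ne1_4 h1.1 pq pd (mul_left_cancel (e.trans (mul_one μ).symm))
      · rw [e1]; exact nbp_swap _ h2.1
      · have : swap p c * swap q d = swap q d * swap p c := by
          refine (Equiv.Perm.disjoint_iff_disjoint_support.mpr ?_).commute
          rw [Equiv.Perm.support_swap h1.1, Equiv.Perm.support_swap h2.1]
          simp [pq.symm, pd.symm, cq.symm, cd.symm]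
        rw [e2, mul_assoc, this, ← mul_assoc]; exact nbp_swap' _ h1.1
    · exact Or.inl (peak_disj hμ hκ hl h1 h2 pq pd cq cd hs)
  · right
    have a1 := h1.Llt hκ hμ
    have a2 := h2.Llt hl hμ
    rw [e1, s1] at a1
    rw [e2, s2] at a2
    rw [s1] at hk'
    rw [s2] at hl'
    rw [e1, e2, s1, s2]
    exact peak_shared hμ xy xz yz hk' hl' (un_of_L xy hμ hk' a1) (un_of_L xz hμ hl' a2)
end Kh

namespace Kh
open Equiv (swap Perm)
variable {N m n : ℕ}

section
variable {F : Type*} [Field F]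

theorem AK_genA (hN : N = m + n) {s r w1 w2 : V m n N} (hne : s ≠ r) (hw : w1 ≠ w2)
    (h1 : Nbp (psi s) (psi w1)) (h2 : Nbp (psi w1) (psi r)) (h3 : Nbp (psi s) (psi w2)) (h4 : Nbp (psi w2) (psi r)) :
    ∑ w, AK F s w * AK F w r = 0 := by
  have h := krel (KbarRel.genA (F := F) s.1 r.1 s.2 r.2 (fun e => hne (Subtype.ext e)) (by
    have : ({w1.1, w2.1} : Set (Wt N)).ncard = 2 := Set.ncard_pair (fun e => hw (Subtype.ext e))
    rw [← this]
    apply Set.ncard_le_ncard _ (Set.toFinite _)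
    rintro x (rfl | rfl)
    · exact ⟨(adj_iff hN).mpr h1, (adj_iff hN).mpr h2⟩
    · exact ⟨(adj_iff hN).mpr h3, (adj_iff hN).mpr h4⟩))
  rw [map_zero] at h
  refine Eq.trans ?_ h
  unfold GenA
  rw [sumWt (m := m) (n := n) _ (fun l hl => by rw [arW_zero (Or.inr hl), zero_mul]), map_sum]
  simp only [map_mul]
  rfl

theorem AK_genD (hN : N = m + n) {s : V m n N} {i j c : Fin N} (hc : CI s i j c) :
    AK F s (sw s i j) * AK F (sw s i j) s = - ∑ k, ((cK s k c : ℤ) : F) • (AK F s k * AK F k s) := by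
  rw [eq_neg_iff_add_eq_zero]
  have h := krel (KbarRel.genD (F := F) s.1 s.2 i j (hc.circ hN))
  rw [map_zero] at h
  refine Eq.trans ?_ h
  unfold GenD
  rw [sumWt (m := m) (n := n) _ (fun l hl => by
    rw [arW_zero (Or.inr hl), zero_mul]; simp)]
  simp only [genD_conv hN hc]
  rw [map_add, map_sum, map_mul]
  congr 1
  refine Finset.sum_congr rfl fun k _ => ?_
  rw [map_zsmul, map_mul, ← Int.cast_smul_eq_zsmul F]; rfl

variable (F) in
theorem ud (hN : N = m + n) {s v u : V m n N} (h1 : Nbp (psi s) (psi u)) (h2 : Nbp (psi u) (psi v))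
    (l1 : L (psi u) < L (psi s)) (l2 : L (psi u) < L (psi v)) :
    AK F s u * AK F u v ∈ Submodule.span F {x | ∃ w : V m n N, Nbp (psi s) (psi w) ∧ Nbp (psi w) (psi v) ∧
      L (psi u) < L (psi w) ∧ x = AK F s w * AK F w v} := by
  by_cases hsv : s = v
  · subst hsv
    obtain ⟨i, j, hC, e⟩ := (step_iff' hN).mpr ⟨h1, l1⟩
    obtain rfl : u = sw s i j := Subtype.ext e
    obtain ⟨c, hc⟩ := ci_ex hN hC
    rw [AK_genD hN hc]
    refine Submodule.neg_mem _ (Submodule.sum_mem _ fun k _ => ?_)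
    by_cases hk : ∃ d p, UpB (psi k) (psi s) p d
    · obtain ⟨d, p, hd⟩ := hk
      refine Submodule.smul_mem _ _ (Submodule.subset_span ⟨k, hd.nbp.symm, hd.nbp, ?_, rfl⟩)
      have := hd.Llt (psi_nc hN k) (psi_nc hN s)
      omega
    · unfold cK; rw [dif_neg hk, Int.cast_zero, zero_smul]; exact zero_mem _
  · have nu := psi_nc hN u
    have ns := psi_nc hN s
    have nv := psi_nc hN v
    obtain ⟨p, c, hp⟩ := upB_of ns nu h1 l1
    obtain ⟨q, d, hq⟩ := upB_of nv nu h2.symm l2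
    have hpv : psi s ≠ psi v := fun e => hsv (psi_inj hN e)
    obtain ⟨k1, e1, i, j, c1, s1⟩ := low_mem hN ns hp
    obtain rfl := psi_inj hN e1
    obtain ⟨k2, e2, i', j', c2, s2⟩ := low_mem hN nv hq
    obtain rfl := psi_inj hN e2
    rcases peak nu ns nv hp hq hpv with h | ⟨w, nw, wu, w1, w2⟩
    · have h := krel (KbarRel.genC (F := F) k1.1 k2.1 k1.2 k2.2 (fun e => hsv (Subtype.ext e)) i j i' j' (c1.circ hN)
        (c2.circ hN) (by
          have := congrArg Subtype.val (s1.symm.trans s2)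
          exact this) (by
          have a1 := c1.1; have a2 := c1.2; have a3 := c2.1; have a4 := c2.2
          unfold Crs at h
          simp only [Fin.lt_def]
          omega))
      have e : swapC k1.1 i j = u.1 := (congrArg Subtype.val s1).symm
      rw [e, map_mul, map_zero] at h
      have h' : AK F k1 u * AK F u k2 = 0 := h
      rw [h']; exact zero_mem _
    · have hk : ∃ k : V m n N, psi k = w := by
        by_contra hno
        push Not at hno
        have b1 := out_above hN nw w1 hno
        have b2 := out_above hN nw w2.symm hno
        have t1 := top1p nu ns nv nw h1.symm h2 l1 l2 hpv w1 w2 wu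
        have t2 := top1p nw ns nv nu w1.symm w2 b1 b2 hpv h1 h2 wu.symm
        omega
      obtain ⟨k, rfl⟩ := hk
      have huk : u ≠ k := fun e => wu (e ▸ rfl)
      have g := AK_genA (F := F) hN hsv huk h1 h2 w1 w2
      rw [← Finset.add_sum_erase _ _ (Finset.mem_univ u)] at g
      rw [eq_neg_of_add_eq_zero_left g]
      refine Submodule.neg_mem _ (Submodule.sum_mem _ fun w hw => ?_)
      have hw := Finset.ne_of_mem_erase hw
      by_cases a1 : Nbp (psi k1) (psi w)
      · by_cases a2 : Nbp (psi w) (psi k2)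
        · exact Submodule.subset_span ⟨w, a1, a2, top1p nu ns nv (psi_nc hN w) h1.symm h2 l1 l2 hpv a1 a2
            (fun e => hw (psi_inj hN e)), rfl⟩
        · rw [AK_nadj hN a2, mul_zero]; exact zero_mem _
      · rw [AK_nadj hN a1, zero_mul]; exact zero_mem _
end
end Kh

namespace Kh
open Equiv (swap Perm)
variable {N m n : ℕ}

theorem up_ht (hN : N = m + n) {s u : V m n N} (h : Nbp (psi s) (psi u)) (hL : L (psi u) < L (psi s)) :
    ∃ i j : Fin N, i < j ∧ s.1 i = true ∧ s.1 j = false ∧ u = sw s i j ∧ height u.1 = height s.1 + (j.val - i.val) := by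
  obtain ⟨i, j, hC, e⟩ := (step_iff' hN).mpr ⟨h, hL⟩
  obtain rfl : u = sw s i j := Subtype.ext e
  exact ⟨i, j, hC.1, hC.2.1, hC.2.2.1, rfl, sw_height hC.1 hC.2.1 hC.2.2.1⟩

theorem up_lt (hN : N = m + n) {s u : V m n N} (h : Nbp (psi s) (psi u)) (hL : L (psi u) < L (psi s)) :
    height s.1 < height u.1 := by
  obtain ⟨i, j, h1, _, _, _, h2⟩ := up_ht hN h hL
  have : i.val < j.val := h1
  omega

theorem dn_L (hN : N = m + n) {s u : V m n N} (h : Nbp (psi s) (psi u)) (hh : height u.1 ≤ height s.1) :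
    L (psi s) < L (psi u) := by
  have h1 := nbp_ne (psi_nc hN s) (psi_nc hN u) h
  by_contra hc
  have := up_lt hN h (by omega)
  omega

theorem unit_dn (hN : N = m + n) {s u : V m n N} (h : Nbp (psi s) (psi u)) (hh : height s.1 = height u.1 + 1) :
    ∃ i j : Fin N, i.val + 1 = j.val ∧ s.1 i = false ∧ s.1 j = true ∧ u = sw s i j := by
  obtain ⟨i, j, h1, h2, h3, rfl, h4⟩ := up_ht hN h.symm (dn_L hN h (by omega))
  have : i.val < j.val := h1
  refine ⟨i, j, by omega, ?_, ?_, (sw_sw u i j).symm⟩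
  · show swapC u.1 i j i = false
    unfold swapC; rw [if_pos rfl]; exact h3
  · show swapC u.1 i j j = true
    unfold swapC; rw [if_neg (by rintro rfl; omega), if_pos rfl]; exact h2

theorem dn_unit (hN : N = m + n) {s : V m n N} {i j : Fin N} (hij : i.val + 1 = j.val) (hi : s.1 i = false)
    (hj : s.1 j = true) : Nbp (psi s) (psi (sw s i j)) ∧ height s.1 = height (sw s i j).1 + 1 := by
  have h1 : (sw s i j).1 i = true := by
    show swapC s.1 i j i = true
    unfold swapC; rw [if_pos rfl]; exact hj
  have h2 : (sw s i j).1 j = false := by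
    show swapC s.1 i j j = false
    unfold swapC; rw [if_neg (by rintro rfl; omega), if_pos rfl]; exact hi
  obtain ⟨p, c, hu, _⟩ := ustep hN hij h1 h2
  have h3 := sw_height (v := sw s i j) (show i.val < j.val by omega) h1 h2
  rw [sw_sw] at hu h3
  exact ⟨hu.nbp.symm, by omega⟩

/-- the relations needed for the upper bound -/
structure UB (F : Type*) [Field F] {R : Type*} [Ring R] [Algebra F R] (A : V m n N → V m n N → R) (e : V m n N → R) :
    Prop where
  pr : PR A e
  nadj : ∀ s t, ¬ Nbp (psi s) (psi t) → A s t = 0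
  ud : ∀ s u v, Nbp (psi s) (psi u) → Nbp (psi u) (psi v) → L (psi u) < L (psi s) → L (psi u) < L (psi v) →
    A s u * A u v ∈ Submodule.span F {x | ∃ w : V m n N, Nbp (psi s) (psi w) ∧ Nbp (psi w) (psi v) ∧
      L (psi u) < L (psi w) ∧ x = A s w * A w v}
  ga : ∀ s r w1 w2 : V m n N, s ≠ r → w1 ≠ w2 → Nbp (psi s) (psi w1) → Nbp (psi w1) (psi r) → Nbp (psi s) (psi w2) →
    Nbp (psi w2) (psi r) → ∑ w, A s w * A w r = 0

section
variable {F : Type*} [Field F] {R : Type*} [Ring R] [Algebra F R] {A : V m n N → V m n N → R} {e : V m n N → R}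

theorem UB.op (H : UB F A e) : UB F (fun s t => MulOpposite.op (A t s)) (fun s => MulOpposite.op (e s)) where
  pr := ⟨fun v => by rw [← MulOpposite.op_mul, H.pr.idem], fun s t => by rw [← MulOpposite.op_mul, H.pr.tgt],
      fun s t => by rw [← MulOpposite.op_mul, H.pr.src]⟩
  nadj s t h := by rw [H.nadj t s (fun h' => h h'.symm), MulOpposite.op_zero]
  ud s u v h1 h2 l1 l2 := by
    have := H.ud v u s h2.symm h1.symm l2 l1
    rw [← MulOpposite.op_mul]
    have h3 := Submodule.mem_map_of_mem (f := (MulOpposite.opLinearEquiv F : R ≃ₗ[F] Rᵐᵒᵖ).toLinearMap) this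
    rw [Submodule.map_span] at h3
    refine Submodule.span_mono ?_ h3
    rintro _ ⟨_, ⟨w, a, b, c, rfl⟩, rfl⟩
    exact ⟨w, b.symm, a.symm, c, by rw [← MulOpposite.op_mul]; rfl⟩
  ga s r w1 w2 h0 h h1 h2 h3 h4 := by
    have := H.ga r s w1 w2 h0.symm h h2.symm h1.symm h4.symm h3.symm
    have := congrArg MulOpposite.op this
    rw [MulOpposite.op_zero] at this
    refine Eq.trans ?_ this
    rw [Finset.op_sum]
    rfl

variable (A e) in
/-- ascending paths -/
inductive Up : ℕ → V m n N → V m n N → R → Prop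
  | nil (v) : Up 0 v v (e v)
  | cons {i s u t x} : Nbp (psi s) (psi u) → L (psi u) < L (psi s) → Up i u t x → Up (i + 1) s t (A s u * x)

variable (A e) in
/-- descending-then-ascending paths -/
inductive Val : ℕ → V m n N → V m n N → R → Prop
  | up {i s t x} : Up A e i s t x → Val i s t x
  | down {i s u t x} : Nbp (psi s) (psi u) → L (psi s) < L (psi u) → Val i u t x → Val (i + 1) s t (A s u * x)

theorem Up.pth {i s t x} (h : Up A e i s t x) : Pth A e i s t x := by
  induction h with
  | nil v => exact Pth.nil v
  | cons h1 _ _ ih => exact Pth.cons h1 ih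

theorem Val.pth {i s t x} (h : Val A e i s t x) : Pth A e i s t x := by
  induction h with
  | up h => exact h.pth
  | down h1 _ _ ih => exact Pth.cons h1 ih

theorem span_mulL {S : Set R} {M : Submodule F R} (a : R) (h : ∀ x ∈ S, a * x ∈ M) {x : R} (hx : x ∈ Submodule.span F S) :
    a * x ∈ M := by
  have : Submodule.span F S ≤ M.comap (LinearMap.mulLeft F a) := Submodule.span_le.mpr h
  exact this hx

theorem span_mulR {S : Set R} {M : Submodule F R} (a : R) (h : ∀ x ∈ S, x * a ∈ M) {x : R} (hx : x ∈ Submodule.span F S) :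
    x * a ∈ M := by
  have : Submodule.span F S ≤ M.comap (LinearMap.mulRight F a) := Submodule.span_le.mpr h
  exact this hx

theorem UB.t1 (H : UB F A e) (hN : N = m + n) : ∀ u : V m n N, ∀ s i t x, Nbp (psi s) (psi u) →
    Val A e i u t x → A s u * x ∈ Submodule.span F {y | Val A e (i + 1) s t y} := by
  classical
  have wf : WellFounded (fun a b : V m n N => L (psi b) < L (psi a)) :=
    @Finite.wellFounded_of_trans_of_irrefl _ _ _ ⟨fun a b c h1 h2 => lt_trans h2 h1⟩ ⟨fun a h => lt_irrefl _ h⟩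
  intro u
  induction u using wf.induction with
  | _ u ih =>
  intro s i t x hsu hx
  by_cases hL : L (psi s) < L (psi u)
  · exact Submodule.subset_span (Val.down hsu hL hx)
  · have hL' : L (psi u) < L (psi s) := by
      have := nbp_ne (psi_nc hN s) (psi_nc hN u) hsu
      omega
    cases hx with
    | up h => exact Submodule.subset_span (Val.up (Up.cons hsu hL' h))
    | @down j _ v _ y h1 h2 h3 =>
      rw [← mul_assoc]
      refine span_mulR y ?_ (H.ud s u v hsu h1 hL' h2)
      rintro _ ⟨w, a1, a2, a3, rfl⟩
      rw [mul_assoc]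
      refine span_mulL (A s w) ?_ (ih v h2 w j t y a2 h3)
      intro z hz
      exact ih w a3 s _ t z a1 hz

theorem UB.t1' (H : UB F A e) (hN : N = m + n) {i s t x} (h : Pth A e i s t x) :
    x ∈ Submodule.span F {y | Val A e i s t y} := by
  induction h with
  | nil v => exact Submodule.subset_span (Val.up (Up.nil v))
  | @cons i s u t x h1 _ ih => exact span_mulL _ (fun z hz => H.t1 hN u s i t z h1 hz) ih

theorem Up.le (hN : N = m + n) {i s t x} (h : Up A e i s t x) : i + height s.1 ≤ height t.1 := by
  induction h with
  | nil v => omega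
  | cons h1 h2 _ ih => have := up_lt hN h1 h2; omega

theorem Val.le (hN : N = m + n) {i s t x} (h : Val A e i s t x) : i ≤ height s.1 + height t.1 := by
  induction h with
  | up h => have := h.le hN; omega
  | down h1 h2 _ ih => have := up_lt hN h1.symm h2; omega

theorem Val.dec (H : PR A e) (hN : N = m + n) {i s t x} (h : Val A e i s t x) : ∃ j k v y z, j + k = i ∧ Pth A e j s v y ∧
    Pth A e k v t z ∧ x = y * z ∧ j + height v.1 ≤ height s.1 ∧ k + height v.1 ≤ height t.1 := by
  induction h with
  | @up i s t x h => exact ⟨0, i, s, e s, x, by omega, Pth.nil s, h.pth, (h.pth.eleft H).symm, by omega, h.le hN⟩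
  | @down i s u t x h1 h2 _ ih =>
    obtain ⟨j, k, v, y, z, a1, a2, a3, a4, a5, a6⟩ := ih
    have := up_lt hN h1.symm h2
    exact ⟨j + 1, k, v, A s u * y, z, by omega, Pth.cons h1 a2, a3, by rw [a4, mul_assoc], by omega, a6⟩

theorem UB.t2 (H : UB F A e) (hN : N = m + n) {i s t x} (h : Pth A e i s t x) (hi : height s.1 + height t.1 < i) : x = 0 := by
  have := H.t1' hN h
  have he : {y | Val A e i s t y} = ∅ := by
    ext y; simp only [Set.mem_setOf_eq, Set.mem_empty_iff_false, iff_false]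
    intro hv; have := hv.le hN; omega
  rw [he, Submodule.span_empty] at this
  exact (Submodule.mem_bot F).mp this

variable (F A e) in
/-- `z` spans the paths of maximal length from `s` down to the bottom -/
def Gen (b s : V m n N) (z : R) : Prop := Pth A e (height s.1) s b z ∧ ∀ x, Pth A e (height s.1) s b x → x ∈ Submodule.span F {z}

/-- position argument -/
theorem third (hN : N = m + n) {s : V m n N} {i j i' j' : Fin N} (hij : i.val + 1 = j.val) (hij' : i'.val + 1 = j'.val)
    (h1 : s.1 i = false) (h2 : s.1 j = true) (h1' : s.1 i' = false) (h2' : s.1 j' = true) (hne : i ≠ i') {w : V m n N}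
    (hw : Nbp (psi s) (psi w)) (hh : height s.1 = height w.1 + 1) (hr : Nbp (psi w) (psi (sw (sw s i j) i' j')))
    (hh' : height w.1 = height (sw (sw s i j) i' j').1 + 1) : w = sw s i j ∨ w = sw s i' j' := by
  obtain ⟨p, q, pq, p1, p2, rfl⟩ := unit_dn hN hw hh
  obtain ⟨p', q', pq', p1', p2', er⟩ := unit_dn hN hr hh'
  have nb : ∀ {a b : Fin N}, s.1 a = false → s.1 b = true → a.val ≠ b.val := by
    intro a b ha hb e
    rw [Fin.ext e, hb] at ha; cases ha
  have n1 := nb h1 h2'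
  have n2 := nb h1' h2
  have n3 := nb h1 p2
  have n4 := nb h1' p2
  have n5 := nb p1 h2
  have n6 := nb p1 h2'
  have hne' : i.val ≠ i'.val := fun e => hne (Fin.ext e)
  by_cases c1 : p = i
  · left; subst c1; rw [show q = j from Fin.ext (by omega)]
  by_cases c2 : p = i'
  · right; subst c2; rw [show q = j' from Fin.ext (by omega)]
  exfalso
  have c1' : p.val ≠ i.val := fun e => c1 (Fin.ext e)
  have c2' : p.val ≠ i'.val := fun e => c2 (Fin.ext e)
  have key : ∀ t : Fin N, (sw (sw s i j) i' j').1 t ≠ (sw s p q).1 t → t.val = p'.val ∨ t.val = q'.val := by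
    intro t ht
    by_contra hc
    push Not at hc
    apply ht
    rw [er]
    show swapC (sw s p q).1 p' q' t = _
    unfold swapC
    rw [if_neg (fun e => hc.1 (congrArg Fin.val e)), if_neg (fun e => hc.2 (congrArg Fin.val e))]
  have ev : ∀ (v : V m n N) (a b t : Fin N), (sw v a b).1 t = if t = a then v.1 b else if t = b then v.1 a else v.1 t :=
    fun v a b t => rfl
  have k1 := key i (by
    simp only [ev, Fin.ext_iff]
    repeat' split_ifs
    all_goals first | (simp_all; done) | (exfalso; omega))
  have k2 := key j (by
    simp only [ev, Fin.ext_iff]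
    repeat' split_ifs
    all_goals first | (simp_all; done) | (exfalso; omega))
  have k3 := key i' (by
    simp only [ev, Fin.ext_iff]
    repeat' split_ifs
    all_goals first | (simp_all; done) | (exfalso; omega))
  omega

theorem UB.t3 (H : UB F A e) (hN : N = m + n) {b : V m n N} (hb : Bot b) : ∀ k, ∀ s : V m n N, height s.1 = k →
    (∃ z, Gen F A e b s z) ∧ ∀ u z, Nbp (psi s) (psi u) → height s.1 = height u.1 + 1 → Gen F A e b u z →
      Gen F A e b s (A s u * z) := by
  intro k
  induction k using Nat.strong_induction_on with
  | _ k ih =>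
  intro s hk
  have claim : ∀ u z, Nbp (psi s) (psi u) → height s.1 = height u.1 + 1 → Gen F A e b u z → Gen F A e b s (A s u * z) := by
    intro u z hu hsu gz
    refine ⟨?_, ?_⟩
    · rw [hsu]; exact Pth.cons hu gz.1
    intro x hx
    have hx := H.t1' hN hx
    refine (Submodule.span_le.mpr ?_ : Submodule.span F _ ≤ _) hx
    intro y hy
    have hy : Val A e (height s.1) s b y := hy
    have hb0 := hb.height
    generalize hj : height s.1 = j at hy
    cases hy with
    | up h => have := h.le hN; omega
    | @down j _ v _ y h1 h2 h3 =>
      have a1 := h3.le hN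
      have a2 := up_lt hN h1.symm h2
      have hv : height v.1 = j := by omega
      have hp : Pth A e (height v.1) v b y := by rw [hv]; exact h3.pth
      show A s v * y ∈ _
      by_cases huv : v = u
      · subst huv
        refine span_mulL _ ?_ (gz.2 y hp)
        rintro _ rfl
        exact Submodule.subset_span rfl
      · obtain ⟨i, jj, p1, p2, p3, rfl⟩ := unit_dn hN hu hsu
        obtain ⟨i', j', q1, q2, q3, rfl⟩ := unit_dn hN h1 (by omega)
        have hii : i ≠ i' := by
          rintro rfl
          exact huv (by rw [show jj = j' from Fin.ext (by omega)])
        have hii' : i.val ≠ i'.val := fun e => hii (Fin.ext e)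
        have nb : ∀ {a b : Fin N}, s.1 a = false → s.1 b = true → a.val ≠ b.val := by
          intro a b ha hb e
          rw [Fin.ext e, hb] at ha; cases ha
        have n1 := nb p2 q3
        have n2 := nb q2 p3
        have ev : ∀ (v : V m n N) (a b t : Fin N), (sw v a b).1 t = if t = a then v.1 b else if t = b then v.1 a else v.1 t :=
          fun v a b t => rfl
        have E : sw (sw s i' j') i jj = sw (sw s i jj) i' j' := by
          apply Subtype.ext; funext t
          simp only [ev, Fin.ext_iff]
          repeat' split_ifs
          all_goals first | rfl | (exfalso; omega)
        obtain ⟨r1, r2⟩ := dn_unit hN (s := sw s i jj) q1 (by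
          rw [ev]; simp only [Fin.ext_iff]; rw [if_neg (by omega), if_neg (by omega)]; exact q2) (by
          rw [ev]; simp only [Fin.ext_iff]; rw [if_neg (by omega), if_neg (by omega)]; exact q3)
        obtain ⟨r3, r4⟩ := dn_unit hN (s := sw s i' j') p1 (by
          rw [ev]; simp only [Fin.ext_iff]; rw [if_neg (by omega), if_neg (by omega)]; exact p2) (by
          rw [ev]; simp only [Fin.ext_iff]; rw [if_neg (by omega), if_neg (by omega)]; exact p3)
        rw [E] at r3 r4
        set r := sw (sw s i jj) i' j' with hr
        set u := sw s i jj with hu'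
        set v := sw s i' j' with hv'
        obtain ⟨⟨zr, gr⟩, _⟩ := ih (height r.1) (by omega) r rfl
        have gv := (ih (height v.1) (by omega) v rfl).2 r zr r3 r4 gr
        have hsr : s ≠ r := by
          intro e; rw [← e] at r2; omega
        have ga := H.ga s r u v hsr (fun e => huv e.symm) hu r1 h1 r3
        have oth : ∀ w, w ≠ u → w ≠ v → A s w * A w r * zr = 0 := by
          intro w wu wv
          by_cases b1 : Nbp (psi s) (psi w)
          swap
          · rw [H.nadj _ _ b1]; simp
          by_cases b2 : Nbp (psi w) (psi r)
          swap
          · rw [H.nadj _ _ b2]; simp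
          rw [mul_assoc]
          have hh : height w.1 < height u.1 := by
            by_contra hge
            rcases Nat.lt_or_ge (height s.1) (height w.1) with g | g
            · have z1 := dn_L hN b1.symm (by omega)
              have z2 := dn_L hN b2 (by omega)
              have := top2p (psi_nc hN w) (psi_nc hN s) (psi_nc hN r) (psi_nc hN u) (psi_nc hN v) b1.symm b2 z1 z2
                (fun e => hsr (psi_inj hN e)) hu r1 (fun e => wu (psi_inj hN e).symm) h1 r3
                (fun e => wv (psi_inj hN e).symm)
              exact huv (psi_inj hN this).symm
            · have z1 := up_lt hN b1.symm (dn_L hN b1 g)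
              rcases third hN p1 q1 p2 p3 q2 q3 hii b1 (by omega) b2 (show height w.1 = height r.1 + 1 by omega) with h | h
              · exact wu h
              · exact wv h
          rw [H.t2 hN (Pth.cons b2 gr.1) (by omega), mul_zero]
        have ga' : (∑ w, A s w * A w r) * zr = 0 := by rw [ga, zero_mul]
        rw [Finset.sum_mul, Finset.sum_eq_add u v (fun e => huv e.symm) (fun w _ hw => oth w hw.1 hw.2)
          (fun h => absurd (Finset.mem_univ _) h) (fun h => absurd (Finset.mem_univ _) h)] at ga'
        have gu : A u r * zr ∈ Submodule.span F {z} := gz.2 _ (by rw [r2]; exact Pth.cons r1 gr.1)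
        refine span_mulL _ ?_ (gv.2 y hp)
        rintro _ rfl
        rw [← mul_assoc, eq_neg_of_add_eq_zero_right ga', mul_assoc]
        refine Submodule.neg_mem _ (span_mulL _ ?_ gu)
        rintro _ rfl
        exact Submodule.subset_span rfl
  refine ⟨?_, claim⟩
  rcases dstep s with h | ⟨u, i, j, h1, h2, h3, rfl, h4⟩
  · obtain rfl := h.uniq hb
    refine ⟨e s, ?_, ?_⟩
    · rw [h.height]; exact Pth.nil s
    · rw [h.height]
      intro x hx
      cases hx
      exact Submodule.subset_span rfl
  · obtain ⟨⟨z, gz⟩, _⟩ := ih (height u.1) (by omega) u rfl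
    obtain ⟨p, c, hu, _⟩ := ustep hN h1 h2 h3
    exact ⟨_, claim u z hu.nbp.symm h4 gz⟩

theorem ht0 {v : V m n N} (h : height v.1 = 0) : Bot v := by
  rcases dstep v with h1 | ⟨u, i, j, _, _, _, _, h4⟩
  · exact h1
  · omega

theorem UB.t4 (H : UB F A e) (hN : N = m + n) (s t : V m n N) :
    ∃ g, ∀ x, Pth A e (height s.1 + height t.1) s t x → x ∈ Submodule.span F {g} := by
  obtain ⟨b, hb⟩ := bot_ex s
  obtain ⟨⟨z, gz⟩, _⟩ := H.t3 hN hb _ s rfl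
  obtain ⟨⟨z', gz'⟩, _⟩ := H.op.t3 hN hb _ t rfl
  refine ⟨z * z'.unop, fun x hx => ?_⟩
  refine (Submodule.span_le.mpr ?_ : Submodule.span F _ ≤ _) (H.t1' hN hx)
  intro x hx
  obtain ⟨j, k, v, y, y', a1, a2, a3, rfl, a5, a6⟩ := Val.dec H.pr hN hx
  obtain rfl := (ht0 (v := v) (by omega)).uniq hb
  obtain rfl : j = height s.1 := by omega
  obtain rfl : k = height t.1 := by omega
  have b1 := gz.2 y a2
  have b2 := gz'.2 _ (a3.op H.pr)
  obtain ⟨c, rfl⟩ := Submodule.mem_span_singleton.mp b1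
  obtain ⟨c', h⟩ := Submodule.mem_span_singleton.mp b2
  have : y' = c' • z'.unop := by
    have := congrArg MulOpposite.unop h
    simpa using this.symm
  rw [this]
  show (c • z) * (c' • z'.unop) ∈ Submodule.span F _
  rw [smul_mul_smul_comm]
  exact Submodule.smul_mem _ _ (Submodule.subset_span rfl)
end

theorem ubK (F : Type*) [Field F] (hN : N = m + n) : UB F (AK F (m := m) (n := n) (N := N)) (EK F) where
  pr := prK
  nadj _ _ h := AK_nadj hN h
  ud _ _ _ h1 h2 l1 l2 := ud F hN h1 h2 l1 l2
  ga _ _ _ _ h0 h h1 h2 h3 h4 := AK_genA hN h0 h h1 h2 h3 h4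
end Kh

namespace Kh
open Equiv (swap Perm)
variable {N m n : ℕ}

theorem Pth.eright {R : Type*} [Ring R] {A : V m n N → V m n N → R} {e : V m n N → R} (H : PR A e) {i s t x}
    (h : Pth A e i s t x) : x * e t = x := by
  induction h with
  | nil v => exact H.idem _
  | cons _ _ ih => rw [mul_assoc, ih]

theorem fr_one {F X : Type*} [Field F] [AddCommGroup X] [Module F X] {S : Set X} {g x : X} (hS : ∀ y ∈ S, y ∈ Submodule.span F {g})
    (hx : x ∈ S) (h0 : x ≠ 0) : Module.finrank F (Submodule.span F S) = 1 := by
  obtain ⟨c, rfl⟩ := Submodule.mem_span_singleton.mp (hS x hx)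
  have hc : c ≠ 0 := by rintro rfl; exact h0 (zero_smul _ _)
  have hg : g ≠ 0 := by rintro rfl; exact h0 (smul_zero _)
  have : Submodule.span F S = Submodule.span F {g} := by
    apply le_antisymm (Submodule.span_le.mpr hS)
    rw [Submodule.span_singleton_le_iff_mem]
    have := Submodule.smul_mem _ c⁻¹ (Submodule.subset_span (R := F) hx)
    rwa [smul_smul, inv_mul_cancel₀ hc, one_smul] at this
  rw [this]; exact finrank_span_singleton hg

section
variable (F : Type*) [Field F]

theorem list_pth (hN : N = m + n) : ∀ (r : List (Wt N)) (u : V m n N), (∀ v ∈ r, IsWeight m n v) → (u.1 :: r).IsChain GammaAdj →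
    ∃ t, Pth (AK F) (EK F) r.length u t (toKbar F m n N (pathEl F m n N (u.1 :: r))) := by
  intro r
  induction r with
  | nil => intro u _ _; exact ⟨u, Pth.nil u⟩
  | cons w r ih =>
    intro u hw hc
    rw [List.isChain_cons_cons] at hc
    obtain ⟨w', rfl⟩ : ∃ s : V m n N, s.1 = w := ⟨⟨w, hw w (by simp)⟩, rfl⟩
    obtain ⟨t, ht⟩ := ih w' (fun v hv => hw v (List.mem_cons_of_mem _ hv)) hc.2
    refine ⟨t, ?_⟩
    have := Pth.cons ((adj_iff hN).mp hc.1) ht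
    rw [show pathEl F m n N (u.1 :: w'.1 :: r) = arW F m n N u.1 w'.1 * pathEl F m n N (w'.1 :: r) from rfl, map_mul]
    exact this

theorem pth_list (hN : N = m + n) {i s t x} (h : Pth (AK F (m := m) (n := n) (N := N)) (EK F) i s t x) :
    ∃ r : List (Wt N), r.length = i ∧ (∀ v ∈ r, IsWeight m n v) ∧ (s.1 :: r).IsChain GammaAdj ∧
      x = toKbar F m n N (pathEl F m n N (s.1 :: r)) := by
  induction h with
  | nil v => exact ⟨[], rfl, by simp, by simp, rfl⟩
  | @cons i s u t x h1 _ ih =>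
    obtain ⟨r, a1, a2, a3, rfl⟩ := ih
    refine ⟨u.1 :: r, by simp [a1], ?_, ?_, ?_⟩
    · intro v hv
      rcases List.mem_cons.mp hv with rfl | hv
      · exact u.2
      · exact a2 v hv
    · rw [List.isChain_cons_cons]; exact ⟨(adj_iff hN).mpr h1, a3⟩
    · rw [show pathEl F m n N (s.1 :: u.1 :: r) = arW F m n N s.1 u.1 * pathEl F m n N (u.1 :: r) from rfl, map_mul]
      rfl

theorem deg_eq (hN : N = m + n) (i : ℕ) : degComp F m n N i =
    Submodule.span F {x | ∃ s t, Pth (AK F (m := m) (n := n) (N := N)) (EK F) i s t x} := by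
  unfold degComp
  congr 1
  ext x
  constructor
  · rintro ⟨p, h1, h2, h3, rfl⟩
    cases p with
    | nil => simp at h1
    | cons u r =>
      obtain ⟨t, ht⟩ := list_pth F hN r ⟨u, h2 u (by simp)⟩ (fun v hv => h2 v (List.mem_cons_of_mem _ hv)) h3
      have : r.length = i := by simpa using h1
      rw [this] at ht
      exact ⟨_, t, ht⟩
  · rintro ⟨s, t, h⟩
    obtain ⟨r, h1, h2, h3, rfl⟩ := pth_list F hN h
    refine ⟨s.1 :: r, by simp [h1], ?_, h3, rfl⟩
    intro v hv
    rcases List.mem_cons.mp hv with rfl | hv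
    · exact s.2
    · exact h2 v hv

theorem sand_eq (hN : N = m + n) (s t : V m n N) (i : ℕ) : Submodule.map (sandwich F m n N s.1 t.1) (degComp F m n N i) =
    Submodule.span F {x | Pth (AK F (m := m) (n := n) (N := N)) (EK F) i s t x} := by
  rw [deg_eq F hN, Submodule.map_span]
  have ev : ∀ x, sandwich F m n N s.1 t.1 x = EK F s * (x * EK F t) := fun x => rfl
  apply le_antisymm
  · rw [Submodule.span_le]
    rintro _ ⟨x, ⟨s', t', h⟩, rfl⟩
    rw [ev]
    by_cases h1 : s = s'
    · by_cases h2 : t = t'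
      · subst h1; subst h2
        rw [h.eright prK, h.eleft prK]; exact Submodule.subset_span h
      · rw [← h.eright prK, mul_assoc x, EK_orth (fun e => h2 e.symm), mul_zero, mul_zero]; exact zero_mem _
    · rw [← h.eleft prK, mul_assoc (EK F s'), ← mul_assoc, EK_orth h1, zero_mul]; exact zero_mem _
  · apply Submodule.span_mono
    intro x h
    exact ⟨x, ⟨s, t, h⟩, by rw [ev, h.eright prK, h.eleft prK]⟩
end

theorem card_tr (v : V m n N) : (Finset.univ.filter (fun i : Fin N => v.1 i = true)).card = m := by
  refine Eq.trans ?_ v.2.1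
  rw [← Set.ncard_coe_finset]; congr 1; ext; simp

theorem ht_le (v : V m n N) : height v.1 ≤ m * n := by
  unfold height
  rw [← Finset.sum_filter]
  have hc := card_tr v
  refine le_trans (Finset.sum_le_card_nsmul _ _ n ?_) (le_of_eq (by rw [hc, smul_eq_mul]))
  intro i _
  refine le_trans (Set.ncard_le_ncard ?_ (Set.toFinite _)) (le_of_eq v.2.2)
  rintro j ⟨_, h⟩; exact h

theorem ht_top {v : V m n N} (h : height v.1 = m * n) : ∀ i : Fin N, v.1 i = true → ∀ j, v.1 j = false → j < i := by
  intro i hi j hj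
  unfold height at h
  rw [← Finset.sum_filter] at h
  have hc := card_tr v
  have hle : ∀ i ∈ Finset.univ.filter (fun i : Fin N => v.1 i = true), {j : Fin N | j < i ∧ v.1 j = false}.ncard ≤ n := by
    intro i _
    refine le_trans (Set.ncard_le_ncard ?_ (Set.toFinite _)) (le_of_eq v.2.2)
    rintro j ⟨_, h⟩; exact h
  have h2 : ∑ i ∈ Finset.univ.filter (fun i : Fin N => v.1 i = true), {j : Fin N | j < i ∧ v.1 j = false}.ncard =
      ∑ i ∈ Finset.univ.filter (fun i : Fin N => v.1 i = true), n := by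
    rw [h, Finset.sum_const, hc, smul_eq_mul]
  have h3 := (Finset.sum_eq_sum_iff_of_le hle).mp h2 i (by simp [hi])
  have h4 : {j : Fin N | j < i ∧ v.1 j = false} = {j : Fin N | v.1 j = false} := by
    apply Set.eq_of_subset_of_ncard_le _ _ (Set.toFinite _)
    · rintro j ⟨_, h⟩; exact h
    · rw [h3]; exact le_of_eq v.2.2
  have : j ∈ {j : Fin N | j < i ∧ v.1 j = false} := by rw [h4]; exact hj
  exact this.1

theorem ncard_lt (k : ℕ) (hk : k ≤ N) : {i : Fin N | i.val < k}.ncard = k := by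
  have : {i : Fin N | i.val < k} = Set.range (Fin.castLE hk) := by
    ext i; constructor
    · intro h; exact ⟨⟨i.val, h⟩, rfl⟩
    · rintro ⟨j, rfl⟩; exact j.2
  rw [this, ← Nat.card_coe_set_eq, Nat.card_range_of_injective (Fin.castLE_injective hk), Nat.card_fin]

theorem top_iff (hN : N = m + n) {v : V m n N} (h : height v.1 = m * n) (i : Fin N) : v.1 i = true ↔ n ≤ i.val := by
  have H := ht_top h
  constructor
  · intro hi
    have : {j : Fin N | v.1 j = false} ⊆ {j : Fin N | j.val < i.val} := fun j hj => H i hi j hj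
    have := Set.ncard_le_ncard this (Set.toFinite _)
    rwa [v.2.2, ncard_lt _ i.2.le] at this
  · intro hn
    by_contra hi
    have hi : v.1 i = false := by simpa using hi
    have : {j : Fin N | j.val < i.val + 1} ⊆ {j : Fin N | v.1 j = false} := by
      intro j hj
      have hj : j.val < i.val + 1 := hj
      by_contra hc
      have hc : v.1 j = true := by simpa using hc
      have : i.val < j.val := H j hc i hi
      omega
    have := Set.ncard_le_ncard this (Set.toFinite _)
    rw [v.2.2, ncard_lt _ (by omega)] at this
    omega

theorem top_ex (hN : N = m + n) : ∃ v : V m n N, height v.1 = m * n := by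
  have c1 : {i : Fin N | i.val < n}.ncard = n := ncard_lt n (by omega)
  have c2 : {i : Fin N | n ≤ i.val}.ncard = m := by
    have h := Set.ncard_add_ncard_compl {i : Fin N | i.val < n}
    have e : {i : Fin N | i.val < n}ᶜ = {i : Fin N | n ≤ i.val} := by ext i; simp
    rw [e, c1, Nat.card_fin] at h
    omega
  have hw : IsWeight m n (fun i : Fin N => decide (n ≤ i.val)) := by
    constructor
    · simpa using c2
    · simpa using c1
  refine ⟨⟨_, hw⟩, ?_⟩
  show height (fun i : Fin N => decide (n ≤ i.val)) = _
  unfold height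
  rw [← Finset.sum_filter]
  have hc : (Finset.univ.filter (fun i : Fin N => decide (n ≤ i.val) = true)).card = m := by
    rw [← c2, ← Set.ncard_coe_finset]; congr 1; ext; simp
  rw [← hc, ← smul_eq_mul]
  apply Finset.sum_eq_card_nsmul
  intro i hi
  have hi : n ≤ i.val := by simpa using hi
  refine Eq.trans ?_ c1
  congr 1
  ext j
  simp only [Set.mem_setOf_eq, decide_eq_false_iff_not, Fin.lt_def]
  omega

theorem main14 (F : Type*) [Field F] (m n : ℕ) (N : ℕ) (hN : N = m + n) :
    (∀ la mu : Wt N, IsWeight m n la → IsWeight m n mu →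
      (∀ i : ℕ, height la + height mu < i → Submodule.map (sandwich F m n N la mu) (degComp F m n N i) = ⊥) ∧
      Module.finrank F (Submodule.map (sandwich F m n N la mu) (degComp F m n N (height la + height mu))) = 1) ∧
    (∀ i : ℕ, 2 * m * n < i → degComp F m n N i = ⊥) ∧
    Module.finrank F (degComp F m n N (2 * m * n)) = 1 := by
  have H := ubK (m := m) (n := n) F hN
  have e2 : 2 * m * n = m * n + m * n := by ring
  refine ⟨?_, ?_, ?_⟩
  · intro la mu h1 h2
    obtain ⟨s, rfl⟩ : ∃ s : V m n N, s.1 = la := ⟨⟨la, h1⟩, rfl⟩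
    obtain ⟨t, rfl⟩ : ∃ s : V m n N, s.1 = mu := ⟨⟨mu, h2⟩, rfl⟩
    refine ⟨fun i hi => ?_, ?_⟩
    · rw [sand_eq F hN, Submodule.span_eq_bot]
      intro x hx
      exact H.t2 hN hx hi
    · rw [sand_eq F hN]
      obtain ⟨g, hg⟩ := H.t4 hN s t
      obtain ⟨x, hx0, hx⟩ := nonvan F hN s t
      exact fr_one hg hx hx0
  · intro i hi
    rw [deg_eq F hN, Submodule.span_eq_bot]
    rintro x ⟨s, t, hx⟩
    have := ht_le s; have := ht_le t
    exact H.t2 hN hx (by omega)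
  · rw [deg_eq F hN]
    obtain ⟨v, hv⟩ := top_ex (m := m) (n := n) hN
    obtain ⟨g, hg⟩ := H.t4 hN v v
    obtain ⟨x, hx0, hx⟩ := nonvan F hN v v
    have e3 : height v.1 + height v.1 = 2 * m * n := by omega
    rw [e3] at hg hx
    refine fr_one (g := g) ?_ ⟨v, v, hx⟩ hx0
    rintro y ⟨s, t, hy⟩
    have uq : ∀ s : V m n N, height s.1 = m * n → s = v := by
      intro s hs
      apply Subtype.ext; funext i
      rw [Bool.eq_iff_iff, top_iff hN hs, top_iff hN hv]
    have a1 := ht_le s; have a2 := ht_le t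
    by_cases hh : height s.1 + height t.1 < 2 * m * n
    · rw [H.t2 hN hy hh]; exact zero_mem _
    · obtain rfl := uq s (by omega)
      obtain rfl := uq t (by omega)
      exact hg y hy
end Kh

namespace Kh
variable {N : ℕ}

/-- Grading `K̄_m^n` by path length: for weights `λ, μ` the space
`e_λ (K̄_m^n)_i e_μ` vanishes for `i > |λ|+|μ|` and is one-dimensional for
`i = |λ|+|μ|`; in particular `(K̄_m^n)_i = 0` for `i > 2mn` and `(K̄_m^n)_{2mn}` is
one-dimensional. -/
theorem statement14 (F : Type*) [Field F] (m n : ℕ) (hm : 1 ≤ m) (hn : 1 ≤ n)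
    (N : ℕ) (hN : N = m + n) :
    (∀ la mu : Wt N, IsWeight m n la → IsWeight m n mu →
      (∀ i : ℕ, height la + height mu < i →
        Submodule.map (sandwich F m n N la mu) (degComp F m n N i) = ⊥) ∧
      Module.finrank F
        ↥(Submodule.map (sandwich F m n N la mu)
          (degComp F m n N (height la + height mu))) = 1) ∧
    (∀ i : ℕ, 2 * m * n < i → degComp F m n N i = ⊥) ∧
    Module.finrank F ↥(degComp F m n N (2 * m * n)) = 1 := by
  exact main14 F m n N hN

end Kh
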